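/- Let G be a group in the class 𝒰 with spectrum π, and let ω be a set of primes. Let A be a ℤG-module whose underlying abelian group is a Černikov ω-group, and suppose that A has no infinite ℤG-submodule that is a ℤG-module quotient of some ℤG-module whose underlying abelian group is torsion-free of finite rank and π-spectral. Then the group cohomology H^n(G,A) is a Černikov ω-group for all n ≥ 0. -/

import Mathlib

/-!
Statement 1: Theorem B of "Torsion cohomology for solvable groups of finite rank".
-/

open CategoryTheory

noncomputable section




/-- The rational circle `ℚ/ℤ`. -/
abbrev RatCircle : Type := ℚ ⧸ AddSubgroup.zmultiples (1 : ℚ)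

/-- The quasicyclic (Prüfer) `p`-group, realized as the `p`-primary part of `ℚ/ℤ`. -/
def pruferSubgroup (p : ℕ) : AddSubgroup RatCircle where
  carrier := {x | ∃ n : ℕ, (p ^ n : ℕ) • x = 0}
  zero_mem' := ⟨0, smul_zero _⟩
  add_mem' := by
    rintro a b ⟨m, hm⟩ ⟨n, hn⟩
    refine ⟨m + n, ?_⟩
    have ha : (p ^ m * p ^ n) • a = 0 := by rw [mul_comm, mul_smul, hm, smul_zero]
    have hb : (p ^ m * p ^ n) • b = 0 := by rw [mul_smul, hn, smul_zero]
    rw [smul_add, pow_add, ha, hb, add_zero]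
  neg_mem' := by
    rintro a ⟨m, hm⟩
    exact ⟨m, by rw [smul_neg, hm, neg_zero]⟩

/-- A group has a quasicyclic `p`-section if some quotient of a subgroup is
isomorphic to the Prüfer `p`-group. -/
def HasQuasicyclicSection (G : Type*) [Group G] (p : ℕ) : Prop :=
  ∃ (H : Subgroup G) (K : Subgroup H) (_ : K.Normal),
    Nonempty ((H ⧸ K) ≃* Multiplicative (pruferSubgroup p))

/-- The spectrum of a group: the set of primes `p` such that the group has a
section isomorphic to the quasicyclic `p`-group. -/
def groupSpectrum (G : Type*) [Group G] : Set ℕ :=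
  {p | p.Prime ∧ HasQuasicyclicSection G p}

/-- The spectrum of an (additive) abelian group, via `Multiplicative`. -/
abbrev addSpectrum (A : Type*) [AddGroup A] : Set ℕ :=
  groupSpectrum (Multiplicative A)

/-- An abelian group has finite rank if its torsion-free rank and all of its
`p`-ranks are finite. -/
def FiniteRankAbelian (A : Type*) [AddCommGroup A] : Prop :=
  (∃ n : ℕ, ∀ k : ℕ, (∃ f : (Fin k →₀ ℤ) →+ A, Function.Injective f) → k ≤ n) ∧
  ∀ p : ℕ, p.Prime → {a : A | (p : ℕ) • a = 0}.Finite

/-- A group has finite rank (in the sense appropriate for abelian groups: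
finite torsion-free rank and finite `p`-ranks). -/
def FiniteRankGroup (G : Type*) [Group G] : Prop :=
  (∃ n : ℕ, ∀ k : ℕ,
    (∃ f : Multiplicative (Fin k →₀ ℤ) →* G, Function.Injective f) → k ≤ n) ∧
  ∀ p : ℕ, p.Prime → {g : G | g ^ p = 1}.Finite

/-- A solvable group of finite rank: a solvable group all of whose abelian
sections have finite rank. -/
def SolvableOfFiniteRank (G : Type*) [Group G] : Prop :=
  IsSolvable G ∧
    ∀ (H : Subgroup G) (K : Subgroup H) (_ : K.Normal),
      (∀ x y : H ⧸ K, x * y = y * x) → FiniteRankGroup (H ⧸ K)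

/-- A group is virtually abelian. -/
def VirtuallyAbelian (G : Type*) [Group G] : Prop :=
  ∃ H : Subgroup G, H.index ≠ 0 ∧ ∀ x y : H, x * y = y * x

/-- A `ℤG`-module (given as an object of `Rep ℤ G`) whose underlying abelian group
is torsion-free, of finite rank, and `π`-spectral. -/
def NiceRep {G : Type} [Group G] (π : Set ℕ) (M : Rep.{0} ℤ G) : Prop :=
  (∀ g : M, g ≠ 0 → ¬IsOfFinAddOrder g) ∧ FiniteRankAbelian M ∧ addSpectrum M ⊆ π

/-- The class `𝒰` of solvable groups of finite rank. -/
def MemClassU (G : Type) [Group G] : Prop :=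
  SolvableOfFiniteRank G ∧
  ∃ (N : Subgroup G) (_ : N.Normal),
    Group.IsNilpotent N ∧
    Group.FG (G ⧸ N) ∧ VirtuallyAbelian (G ⧸ N) ∧
    ∃ (r : ℕ) (T : Fin (r + 1) → Subgroup G),
      Monotone T ∧ T 0 = ⊥ ∧
      ((T (Fin.last r) : Set G) = {g : G | g ∈ N ∧ IsOfFinOrder g}) ∧
      (∀ (i : Fin (r + 1)) (g t : G), t ∈ T i → g * t * g⁻¹ ∈ T i) ∧
      (∀ (i : Fin r) (n t : G), n ∈ N → t ∈ T i.succ →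
        n * t * n⁻¹ * t⁻¹ ∈ T i.castSucc) ∧
      (∀ i : Fin r, (T i.castSucc).relIndex (T i.succ) = 0 →
        ∃ M : Rep ℤ (G ⧸ N), NiceRep (groupSpectrum G) M ∧
          ∃ φ : M → G,
            (∀ m : M, φ m ∈ T i.succ) ∧
            (∀ m m' : M, (φ (m + m'))⁻¹ * (φ m * φ m') ∈ T i.castSucc) ∧
            (∀ t : G, t ∈ T i.succ → ∃ m : M, (φ m)⁻¹ * t ∈ T i.castSucc) ∧
            (∀ (g : G) (m : M),
              (φ (M.ρ (QuotientGroup.mk g) m))⁻¹ * (g * φ m * g⁻¹) ∈ T i.castSucc))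

/-- A Černikov abelian group: it has a subgroup of finite index that is a direct
sum of finitely many quasicyclic groups. -/
def IsCernikov (A : Type*) [AddCommGroup A] : Prop :=
  ∃ (S : AddSubgroup A) (r : ℕ) (p : Fin r → ℕ),
    S.index ≠ 0 ∧ (∀ i, (p i).Prime) ∧
    Nonempty (S ≃+ ((i : Fin r) → pruferSubgroup (p i)))

/-- A torsion `ω`-group: every element has finite order divisible only by primes
in `ω`. -/
def IsOmegaTorsion (ω : Set ℕ) (A : Type*) [AddGroup A] : Prop :=
  ∀ a : A, IsOfFinAddOrder a ∧
    ∀ p : ℕ, p.Prime → (p : ℤ) ∣ (addOrderOf a : ℤ) → p ∈ ω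

/-- A Černikov `ω`-group. -/
def IsCernikovOmega (ω : Set ℕ) (A : Type*) [AddCommGroup A] : Prop :=
  IsCernikov A ∧ IsOmegaTorsion ω A

/-- The subgroup `S` of (the underlying abelian group of) the representation `A`
is a `ℤG`-module quotient of some `ℤG`-module whose underlying abelian group is
torsion-free, of finite rank and `π`-spectral. -/
def IsQuotientOfNiceRep {G : Type} [Group G] (π : Set ℕ) (A : Rep ℤ G)
    (S : AddSubgroup A) : Prop :=
  ∃ M : Rep ℤ G, NiceRep π M ∧
    ∃ ψ : (M : Type) →+ (A : Type),
      (∀ m : M, ψ m ∈ S) ∧ (∀ a ∈ S, ∃ m : M, ψ m = a) ∧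
      ∀ (g : G) (m : M), ψ (M.ρ g m) = A.ρ g (ψ m)

section
namespace TB

/-- An additive action of a group. -/
structure Act (Γ X : Type) [Group Γ] [AddCommGroup X] where
  f : Γ → X →+ X
  one' : ∀ x, f 1 x = x
  mul' : ∀ a b x, f (a * b) x = f a (f b x)

instance (Γ X : Type) [Group Γ] [AddCommGroup X] : CoeFun (Act Γ X) (fun _ => Γ → X →+ X) := ⟨Act.f⟩

namespace Act
variable {Γ Δ X : Type} [Group Γ] [Group Δ] [AddCommGroup X]
@[simp] lemma one (ρ : Act Γ X) (x) : ρ 1 x = x := ρ.one' x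
lemma mul (ρ : Act Γ X) (a b x) : ρ (a * b) x = ρ a (ρ b x) := ρ.mul' a b x
lemma one_eq (ρ : Act Γ X) : ρ 1 = AddMonoidHom.id X := by ext; simp
lemma mul_eq (ρ : Act Γ X) (a b) : ρ (a * b) = (ρ a).comp (ρ b) := by ext x; exact ρ.mul a b x
@[simp] lemma inv_self (ρ : Act Γ X) (a x) : ρ a⁻¹ (ρ a x) = x := by simp [← mul]
@[simp] lemma self_inv (ρ : Act Γ X) (a x) : ρ a (ρ a⁻¹ x) = x := by simp [← mul]
/-- restriction -/
def comp (ρ : Act Γ X) (f : Δ →* Γ) : Act Δ X :=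
  ⟨fun d => ρ (f d), fun x => by simp, fun a b x => by simp [mul]⟩
@[simp] lemma comp_apply (ρ : Act Γ X) (f : Δ →* Γ) (d) : ρ.comp f d = ρ (f d) := rfl
@[ext] lemma ext {ρ σ : Act Γ X} (h : ∀ g x, ρ g x = σ g x) : ρ = σ := by
  cases ρ; cases σ; congr; ext g x; exact h g x
end Act

section basic
variable {Γ X : Type} [Group Γ] [AddCommGroup X]

/-- The representation attached to an action. -/
def toRepr (ρ : Act Γ X) : Representation ℤ Γ X where
  toFun g := (ρ g).toIntLinearMap
  map_one' := by ext x; exact ρ.one x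
  map_mul' a b := by ext x; exact ρ.mul a b x

/-- Inhomogeneous differential. -/
def dd (ρ : Act Γ X) (n : ℕ) : ((Fin n → Γ) → X) →+ ((Fin (n+1) → Γ) → X) where
  toFun f g := ρ (g 0) (f fun i => g i.succ) + ∑ j : Fin (n+1),
    (-1 : ℤ) ^ ((j : ℕ) + 1) • f (Fin.contractNth j (· * ·) g)
  map_zero' := by ext; simp
  map_add' f g := by ext; simp [Finset.sum_add_distrib, add_add_add_comm]

lemma dd_apply (ρ : Act Γ X) (n : ℕ) (f) (g) : dd ρ n f g = ρ (g 0) (f fun i => g i.succ) +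
   ∑ j : Fin (n+1), (-1 : ℤ) ^ ((j : ℕ) + 1) • f (Fin.contractNth j (· * ·) g) := rfl

lemma dd_eq (ρ : Act Γ X) (n : ℕ) (f) :
    dd ρ n f = (inhomogeneousCochains.d (Rep.of (toRepr ρ)) n).hom f := by
  ext g
  rw [inhomogeneousCochains.d_hom_apply]
  rfl

lemma dd_dd (ρ : Act Γ X) (n : ℕ) (f) : dd ρ (n+1) (dd ρ n f) = 0 := by
  rw [dd_eq, dd_eq]
  have h : inhomogeneousCochains.d (Rep.of (toRepr ρ)) n ≫
      inhomogeneousCochains.d (Rep.of (toRepr ρ)) (n+1) = 0 := by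
    have := (groupCohomology.inhomogeneousCochains (Rep.of (toRepr ρ))).d_comp_d n (n+1) (n+2)
    rwa [groupCohomology.inhomogeneousCochains.d_def,
      groupCohomology.inhomogeneousCochains.d_def] at this
  exact congrArg (fun k => k.hom f) h

/-- cocycles -/
def Zn (ρ : Act Γ X) (n : ℕ) : AddSubgroup ((Fin n → Γ) → X) := (dd ρ n).ker
/-- coboundaries -/
def Bn (ρ : Act Γ X) : (n : ℕ) → AddSubgroup ((Fin n → Γ) → X)
  | 0 => ⊥
  | n+1 => (dd ρ n).range
/-- cohomology -/
def Hn (ρ : Act Γ X) (n : ℕ) : Type := Zn ρ n ⧸ (Bn ρ n).addSubgroupOf (Zn ρ n)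
instance (ρ : Act Γ X) (n : ℕ) : AddCommGroup (Hn ρ n) :=
  inferInstanceAs (AddCommGroup (Zn ρ n ⧸ (Bn ρ n).addSubgroupOf (Zn ρ n)))

/-- class of a cocycle -/
def mkH (ρ : Act Γ X) (n : ℕ) : Zn ρ n →+ Hn ρ n := QuotientAddGroup.mk' _

/-- class of a cocycle -/
def cl {ρ : Act Γ X} {n : ℕ} (z : (Fin n → Γ) → X) (hz : dd ρ n z = 0) : Hn ρ n :=
  mkH ρ n ⟨z, hz⟩

lemma cl_surj {ρ : Act Γ X} {n : ℕ} (x : Hn ρ n) : ∃ z hz, x = cl z hz := by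
  obtain ⟨⟨z, hz⟩, rfl⟩ := QuotientAddGroup.mk'_surjective _ x
  exact ⟨z, hz, rfl⟩

@[elab_as_elim]
lemma Hn_ind {ρ : Act Γ X} {n : ℕ} {P : Hn ρ n → Prop} (h : ∀ z hz, P (cl z hz)) (x) : P x := by
  obtain ⟨z, hz, rfl⟩ := cl_surj x
  exact h z hz

lemma cl_add {ρ : Act Γ X} {n : ℕ} {z w : (Fin n → Γ) → X} (hz : dd ρ n z = 0) (hw : dd ρ n w = 0) :
    cl z hz + cl w hw = cl (z+w) (by rw [map_add, hz, hw, add_zero]) := rfl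
lemma cl_sub {ρ : Act Γ X} {n : ℕ} {z w : (Fin n → Γ) → X} (hz : dd ρ n z = 0) (hw : dd ρ n w = 0) :
    cl z hz - cl w hw = cl (z-w) (by rw [map_sub, hz, hw, sub_zero]) := rfl
lemma cl_neg {ρ : Act Γ X} {n : ℕ} {z : (Fin n → Γ) → X} (hz : dd ρ n z = 0) :
    - cl z hz = cl (-z) (by rw [map_neg, hz, neg_zero]) := rfl
lemma cl_zsmul {ρ : Act Γ X} {n : ℕ} {z : (Fin n → Γ) → X} (hz : dd ρ n z = 0) (k : ℤ) :
    k • cl z hz = cl (k • z) (by rw [map_zsmul, hz, smul_zero]) := rfl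
lemma cl_nsmul {ρ : Act Γ X} {n : ℕ} {z : (Fin n → Γ) → X} (hz : dd ρ n z = 0) (k : ℕ) :
    k • cl z hz = cl (k • z) (by rw [map_nsmul, hz, smul_zero]) := rfl

lemma cl_eq_zero {ρ : Act Γ X} {n : ℕ} {z : (Fin n → Γ) → X} {hz : dd ρ n z = 0} :
    cl z hz = 0 ↔ z ∈ Bn ρ n := by
  unfold cl mkH
  exact (QuotientAddGroup.eq_zero_iff _).trans (by rw [AddSubgroup.mem_addSubgroupOf])

lemma cl_eq_zero_zero {ρ : Act Γ X} {z : (Fin 0 → Γ) → X} {hz : dd ρ 0 z = 0} :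
    cl z hz = 0 ↔ z = 0 := cl_eq_zero

lemma cl_eq_zero_succ {ρ : Act Γ X} {n : ℕ} {z : (Fin (n+1) → Γ) → X} {hz : dd ρ (n+1) z = 0} :
    cl z hz = 0 ↔ ∃ c, dd ρ n c = z := cl_eq_zero

lemma cl_eq_cl {ρ : Act Γ X} {n : ℕ} {z w : (Fin n → Γ) → X} {hz : dd ρ n z = 0}
    {hw : dd ρ n w = 0} : cl z hz = cl w hw ↔ z - w ∈ Bn ρ n := by
  rw [← sub_eq_zero, cl_sub, cl_eq_zero]

lemma cl_congr {ρ : Act Γ X} {n : ℕ} {z w : (Fin n → Γ) → X} {hz : dd ρ n z = 0}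
    {hw : dd ρ n w = 0} (h : z = w) : cl z hz = cl w hw := by subst h; rfl

lemma dd_zero_iff {ρ : Act Γ X} {z : (Fin 0 → Γ) → X} :
    dd ρ 0 z = 0 ↔ ∀ g, ρ g (z default) = z default := by
  constructor
  · intro h g
    have := congrFun h (fun _ => g)
    rw [dd_apply] at this
    simp only [Fin.sum_univ_succ, Fin.sum_univ_zero] at this
    rw [Subsingleton.elim (fun i : Fin 0 => g) default,
      Subsingleton.elim (Fin.contractNth _ _ _) default] at this
    simpa [← sub_eq_add_neg, sub_eq_zero] using this
  · intro h
    ext g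
    rw [dd_apply]
    simp only [Fin.sum_univ_succ, Fin.sum_univ_zero]
    rw [Subsingleton.elim (fun i : Fin 0 => g _) default,
      Subsingleton.elim (Fin.contractNth _ _ _) default, h]
    simp

/-- lift a hom on cocycles -/
def liftH {ρ : Act Γ X} {n : ℕ} {Y : Type} [AddCommGroup Y] (F : ((Fin n → Γ) → X) →+ Y)
    (h : ∀ z ∈ Bn ρ n, F z = 0) : Hn ρ n →+ Y :=
  QuotientAddGroup.lift _ (F.comp (Zn ρ n).subtype) (by
    intro z hz; exact h _ hz)

lemma Bn_zn (ρ : Act Γ X) {n : ℕ} {z : (Fin n → Γ) → X} (h : z ∈ Bn ρ n) : dd ρ n z = 0 := by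
  cases n with
  | zero => have : z = 0 := h
            rw [this, map_zero]
  | succ n => obtain ⟨c, rfl⟩ := h; exact dd_dd _ _ _

/-- H^0 element from an invariant -/
def cl0 {ρ : Act Γ X} (x : X) (h : ∀ g, ρ g x = x) : Hn ρ 0 :=
  cl (fun _ => x) (dd_zero_iff.2 h)

lemma cl0_surj {ρ : Act Γ X} (y : Hn ρ 0) : ∃ x h, y = cl0 (ρ := ρ) x h := by
  obtain ⟨z, hz, rfl⟩ := cl_surj y
  refine ⟨z default, dd_zero_iff.1 hz, cl_congr ?_⟩
  ext g; rw [Subsingleton.elim g default]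

lemma cl0_eq_zero {ρ : Act Γ X} {x : X} {h : ∀ g, ρ g x = x} : cl0 (ρ := ρ) x h = 0 ↔ x = 0 := by
  unfold cl0; rw [cl_eq_zero_zero]
  exact ⟨fun h => congrFun h default, fun h => by subst h; rfl⟩

lemma cl0_sub {ρ : Act Γ X} {x y : X} {h : ∀ g, ρ g x = x} {h'} :
    cl0 (ρ := ρ) x h - cl0 y h' = cl0 (x - y) (fun g => by rw [map_sub, h, h']) := rfl
lemma cl0_add {ρ : Act Γ X} {x y : X} {h : ∀ g, ρ g x = x} {h'} :
    cl0 (ρ := ρ) x h + cl0 y h' = cl0 (x + y) (fun g => by rw [map_add, h, h']) := rfl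
lemma cl0_inj {ρ : Act Γ X} {x y : X} {h : ∀ g, ρ g x = x} {h'} :
    cl0 (ρ := ρ) x h = cl0 y h' ↔ x = y := by
  rw [← sub_eq_zero, cl0_sub, cl0_eq_zero, sub_eq_zero]

end basic

section maps
variable {Γ Δ Ε X Y Z : Type} [Group Γ] [Group Δ] [Group Ε]
  [AddCommGroup X] [AddCommGroup Y] [AddCommGroup Z]

/-- compatible pair -/
def Compat (ρ : Act Γ X) (σ : Act Δ Y) (f : Δ →* Γ) (φ : X →+ Y) : Prop :=
  ∀ d x, φ (ρ (f d) x) = σ d (φ x)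

/-- the cochain map -/
def cmap (f : Δ →* Γ) (φ : X →+ Y) (n : ℕ) : ((Fin n → Γ) → X) →+ ((Fin n → Δ) → Y) where
  toFun c g := φ (c (f ∘ g))
  map_zero' := by ext; simp
  map_add' _ _ := by ext; simp

@[simp] lemma cmap_apply (f : Δ →* Γ) (φ : X →+ Y) (n : ℕ) (c) (g) :
    cmap f φ n c g = φ (c (f ∘ g)) := rfl

lemma dd_cmap {ρ : Act Γ X} {σ : Act Δ Y} {f : Δ →* Γ} {φ : X →+ Y} (h : Compat ρ σ f φ) (n : ℕ)
    (c) : dd σ n (cmap f φ n c) = cmap f φ (n+1) (dd ρ n c) := by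
  ext g
  simp only [dd_apply, cmap_apply, map_add, map_sum, map_zsmul]
  congr 1
  · rw [← h]; rfl
  · refine Finset.sum_congr rfl fun j _ => ?_
    congr 3
    rw [Fin.comp_contractNth _ _ (map_mul f)]

lemma cmap_Bn {ρ : Act Γ X} {σ : Act Δ Y} {f : Δ →* Γ} {φ : X →+ Y} (h : Compat ρ σ f φ) {n : ℕ}
    {c} (hc : c ∈ Bn ρ n) : cmap f φ n c ∈ Bn σ n := by
  cases n with
  | zero => have : c = 0 := hc
            subst this; rw [map_zero]; exact zero_mem _
  | succ n => obtain ⟨b, rfl⟩ := hc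
              exact ⟨cmap f φ n b, dd_cmap h n b⟩

/-- induced map -/
def Hmap {ρ : Act Γ X} {σ : Act Δ Y} (f : Δ →* Γ) (φ : X →+ Y) (h : Compat ρ σ f φ) (n : ℕ) :
    Hn ρ n →+ Hn σ n :=
  QuotientAddGroup.map _ _
    ((((cmap f φ n).comp (Zn ρ n).subtype)).codRestrict (Zn σ n) (by
      rintro ⟨z, hz⟩
      change dd σ n (cmap f φ n z) = 0
      rw [dd_cmap h, show dd ρ n z = 0 from hz, map_zero]))
    (by
      rintro ⟨z, hz⟩ hb
      exact cmap_Bn h (c := z) hb)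

lemma Hmap_cl {ρ : Act Γ X} {σ : Act Δ Y} (f : Δ →* Γ) (φ : X →+ Y) (h : Compat ρ σ f φ) (n : ℕ)
    (z) (hz) : Hmap f φ h n (cl z hz) = cl (cmap f φ n z) (by rw [dd_cmap h, hz, map_zero]) := rfl

lemma Hmap_cl0 {ρ : Act Γ X} {σ : Act Δ Y} (f : Δ →* Γ) (φ : X →+ Y) (h : Compat ρ σ f φ)
    (x) (hx) : Hmap f φ h 0 (cl0 x hx) = cl0 (φ x) (fun g => by rw [← h, hx]) := rfl

lemma Hmap_comp {ρ : Act Γ X} {σ : Act Δ Y} {τ : Act Ε Z} (f : Δ →* Γ) (φ : X →+ Y)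
    (h : Compat ρ σ f φ) (f' : Ε →* Δ) (φ' : Y →+ Z) (h' : Compat σ τ f' φ') (n : ℕ) (x) :
    Hmap f' φ' h' n (Hmap f φ h n x) = Hmap (f.comp f') (φ'.comp φ)
      (fun d x => by simp only [AddMonoidHom.comp_apply, MonoidHom.comp_apply]; rw [h, h']) n x := by
  induction x using Hn_ind with | h z hz => rfl

lemma Hmap_id {ρ : Act Γ X} (h : Compat ρ ρ (MonoidHom.id Γ) (AddMonoidHom.id X)) (n : ℕ) (x) :
    Hmap (MonoidHom.id Γ) (AddMonoidHom.id X) h n x = x := by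
  induction x using Hn_ind with | h z hz => rfl

lemma Hmap_congr {ρ : Act Γ X} {σ : Act Δ Y} {f f' : Δ →* Γ} {φ φ' : X →+ Y} (h : Compat ρ σ f φ)
    (h' : Compat ρ σ f' φ') (hf : f = f') (hφ : φ = φ') (n : ℕ) (x) :
    Hmap f φ h n x = Hmap f' φ' h' n x := by subst hf hφ; rfl

lemma Compat.add {ρ : Act Γ X} {σ : Act Δ Y} {f : Δ →* Γ} {φ φ' : X →+ Y} (h : Compat ρ σ f φ)
    (h' : Compat ρ σ f φ') : Compat ρ σ f (φ + φ') := fun d x => by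
  simp only [AddMonoidHom.add_apply, map_add, h d x, h' d x]
lemma Compat.sub {ρ : Act Γ X} {σ : Act Δ Y} {f : Δ →* Γ} {φ φ' : X →+ Y} (h : Compat ρ σ f φ)
    (h' : Compat ρ σ f φ') : Compat ρ σ f (φ - φ') := fun d x => by
  simp only [AddMonoidHom.sub_apply, map_sub, h d x, h' d x]
lemma Compat.zero {ρ : Act Γ X} {σ : Act Δ Y} {f : Δ →* Γ} : Compat ρ σ f (0 : X →+ Y) :=
  fun d x => by simp
lemma Compat.id {ρ : Act Γ X} : Compat ρ ρ (MonoidHom.id Γ) (AddMonoidHom.id X) :=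
  fun d x => rfl
lemma Compat.comp {ρ : Act Γ X} {σ : Act Δ Y} {τ : Act Ε Z} {f : Δ →* Γ} {φ : X →+ Y}
    (h : Compat ρ σ f φ) {f' : Ε →* Δ} {φ' : Y →+ Z} (h' : Compat σ τ f' φ') :
    Compat ρ τ (f.comp f') (φ'.comp φ) :=
  fun d x => by simp only [AddMonoidHom.comp_apply, MonoidHom.comp_apply]; rw [h, h']

lemma Hmap_add {ρ : Act Γ X} {σ : Act Δ Y} {f : Δ →* Γ} {φ φ' : X →+ Y} (h : Compat ρ σ f φ)
    (h' : Compat ρ σ f φ') (n : ℕ) (x) :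
    Hmap f (φ + φ') (h.add h') n x = Hmap f φ h n x + Hmap f φ' h' n x := by
  induction x using Hn_ind with | h z hz => rfl
lemma Hmap_sub {ρ : Act Γ X} {σ : Act Δ Y} {f : Δ →* Γ} {φ φ' : X →+ Y} (h : Compat ρ σ f φ)
    (h' : Compat ρ σ f φ') (n : ℕ) (x) :
    Hmap f (φ - φ') (h.sub h') n x = Hmap f φ h n x - Hmap f φ' h' n x := by
  induction x using Hn_ind with | h z hz => rfl
lemma Hmap_zero {ρ : Act Γ X} {σ : Act Δ Y} {f : Δ →* Γ} (h : Compat ρ σ f (0 : X →+ Y))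
    (n : ℕ) (x) : Hmap f (0 : X →+ Y) h n x = 0 := by
  induction x using Hn_ind with | h z hz =>
    rw [Hmap_cl, cl_eq_zero]; exact zero_mem _
lemma Compat.zsmul {ρ : Act Γ X} (k : ℤ) :
    Compat ρ ρ (MonoidHom.id Γ) (k • AddMonoidHom.id X) := fun d x => by simp
lemma Hmap_zsmul {ρ : Act Γ X} (k : ℤ) (h : Compat ρ ρ (MonoidHom.id Γ) (k • AddMonoidHom.id X))
    (n : ℕ) (x) : Hmap (MonoidHom.id Γ) (k • AddMonoidHom.id X) h n x = k • x := by
  induction x using Hn_ind with | h z hz => rfl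

end maps

section les
variable {Γ X Y Z : Type} [Group Γ] [AddCommGroup X] [AddCommGroup Y] [AddCommGroup Z]

/-- equivariant map -/
abbrev Equi (ρ : Act Γ X) (σ : Act Γ Y) (φ : X →+ Y) : Prop := Compat ρ σ (MonoidHom.id Γ) φ

/-- short exact sequence -/
structure SES (ρX : Act Γ X) (ρY : Act Γ Y) (ρZ : Act Γ Z) where
  i : X →+ Y
  q : Y →+ Z
  hi : Equi ρX ρY i
  hq : Equi ρY ρZ q
  inj : Function.Injective i
  surj : Function.Surjective q
  qi : ∀ x, q (i x) = 0
  ex : ∀ y, q y = 0 → ∃ x, i x = y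

namespace SES
variable {ρX : Act Γ X} {ρY : Act Γ Y} {ρZ : Act Γ Z} (S : SES ρX ρY ρZ)

/-- map -/
def Hi (n : ℕ) : Hn ρX n →+ Hn ρY n := Hmap _ S.i S.hi n
/-- map -/
def Hq (n : ℕ) : Hn ρY n →+ Hn ρZ n := Hmap _ S.q S.hq n

lemma dd_i (n) (c) : dd ρY n (fun g => S.i (c g)) = fun g => S.i (dd ρX n c g) := dd_cmap S.hi n c
lemma dd_q (n) (c) : dd ρZ n (fun g => S.q (c g)) = fun g => S.q (dd ρY n c g) := dd_cmap S.hq n c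

lemma zi {n} {z} (hz : dd ρX n z = 0) : dd ρY n (fun g => S.i (z g)) = 0 := by
  rw [dd_i, hz]; ext; simp
lemma zq {n} {z} (hz : dd ρY n z = 0) : dd ρZ n (fun g => S.q (z g)) = 0 := by
  rw [dd_q, hz]; ext; simp
lemma Hi_cl (n) (z) (hz) : S.Hi n (cl z hz) = cl (fun g => S.i (z g)) (S.zi hz) := rfl
lemma Hq_cl (n) (z) (hz) : S.Hq n (cl z hz) = cl (fun g => S.q (z g)) (S.zq hz) := rfl

lemma lift_q {I : Type} (z : I → Z) : ∃ c : I → Y, (fun g => S.q (c g)) = z := by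
  choose c hc using fun g => S.surj (z g)
  exact ⟨c, funext hc⟩
lemma lift_i {I : Type} (z : I → Y) (h : ∀ g, S.q (z g) = 0) :
    ∃ c : I → X, (fun g => S.i (c g)) = z := by
  choose c hc using fun g => S.ex _ (h g)
  exact ⟨c, funext hc⟩
lemma i_inj {I : Type} {z w : I → X} (h : (fun g => S.i (z g)) = fun g => S.i (w g)) : z = w :=
  funext fun g => S.inj (congrFun h g)

lemma qi_H (n) (x) : S.Hq n (S.Hi n x) = 0 := by
  induction x using Hn_ind with | h z hz =>
    rw [Hi_cl, Hq_cl, cl_eq_zero]; simp only [S.qi]; exact zero_mem _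

/-- exactness in the middle -/
lemma ex_mid (n) (y : Hn ρY n) (h : S.Hq n y = 0) : ∃ x, S.Hi n x = y := by
  induction y using Hn_ind with | h z hz =>
  rw [Hq_cl, cl_eq_zero] at h
  obtain ⟨w, hw, hwz⟩ : ∃ w, w ∈ Bn ρY n ∧ ∀ g, S.q (w g) = S.q (z g) := by
    cases n with
    | zero => exact ⟨0, zero_mem _, fun g => by simpa using (congrFun (show _ = _ from h) g).symm⟩
    | succ n =>
      obtain ⟨b, hb⟩ := h
      obtain ⟨c, rfl⟩ := S.lift_q b
      refine ⟨dd ρY n c, ⟨c, rfl⟩, fun g => ?_⟩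
      rw [dd_q] at hb
      exact congrFun hb g
  obtain ⟨c, hc⟩ := S.lift_i (z - w) (fun g => by simp [hwz])
  refine ⟨cl c ?_, ?_⟩
  · apply S.i_inj
    rw [← dd_i, hc, map_sub, hz, Bn_zn _ hw]
    ext; simp
  · rw [Hi_cl, cl_eq_cl, hc]
    simpa using hw

/-- The snake relation. -/
def Rel (n) (x : Hn ρZ n) (y : Hn ρX (n+1)) : Prop :=
  ∃ (c : (Fin n → Γ) → Y) (a : (Fin (n+1) → Γ) → X) (h : dd ρY n c = fun g => S.i (a g))
    (hz : dd ρZ n (fun g => S.q (c g)) = 0) (ha : dd ρX (n+1) a = 0), x = cl _ hz ∧ y = cl a ha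

lemma rel_total (n) (x) : ∃ y, S.Rel n x y := by
  induction x using Hn_ind with | h z hz =>
  obtain ⟨c, rfl⟩ := S.lift_q z
  obtain ⟨a, ha⟩ := S.lift_i (dd ρY n c) (fun g => by
    have := hz; rw [dd_q] at this; exact congrFun this g)
  refine ⟨cl a ?_, c, a, ha.symm, hz, ?_, rfl, rfl⟩
  all_goals
    apply S.i_inj
    rw [← dd_i, ha, dd_dd]; ext; simp

lemma rel_add {n} {x x' y y'} (h : S.Rel n x y) (h' : S.Rel n x' y') : S.Rel n (x+x') (y+y') := by
  obtain ⟨c, a, h, hz, ha, rfl, rfl⟩ := h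
  obtain ⟨c', a', h', hz', ha', rfl, rfl⟩ := h'
  refine ⟨c+c', a+a', ?_, ?_, ?_, ?_, ?_⟩
  · rw [map_add, h, h']; ext; simp
  · rw [dd_q, map_add, h, h']; ext; simp [S.qi]
  · rw [map_add, ha, ha', add_zero]
  · rw [cl_add]; apply cl_congr; ext; simp
  · rw [cl_add]

lemma rel_neg {n} {x y} (h : S.Rel n x y) : S.Rel n (-x) (-y) := by
  obtain ⟨c, a, h, hz, ha, rfl, rfl⟩ := h
  refine ⟨-c, -a, ?_, ?_, ?_, ?_, ?_⟩
  · rw [map_neg, h]; ext; simp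
  · rw [dd_q, map_neg, h]; ext; simp [S.qi]
  · rw [map_neg, ha, neg_zero]
  · rw [cl_neg]; apply cl_congr; ext; simp
  · rw [cl_neg]

lemma rel_zero {n} {y} (h : S.Rel n 0 y) : y = 0 := by
  obtain ⟨c, a, h, hz, ha, h0, rfl⟩ := h
  have h0 := h0.symm
  rw [cl_eq_zero] at h0
  rw [cl_eq_zero_succ]
  obtain ⟨w, hw, hwz⟩ : ∃ w, dd ρY n w = 0 ∧ ∀ g, S.q (w g) = S.q (c g) := by
    cases n with
    | zero => exact ⟨0, by simp, fun g => by simpa using (congrFun (show _ = _ from h0) g).symm⟩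
    | succ n =>
      obtain ⟨b, hb⟩ := h0
      obtain ⟨e, rfl⟩ := S.lift_q b
      refine ⟨dd ρY n e, dd_dd _ _ _, fun g => ?_⟩
      rw [dd_q] at hb
      exact congrFun hb g
  obtain ⟨e, he⟩ := S.lift_i (c - w) (fun g => by simp [hwz])
  refine ⟨e, S.i_inj ?_⟩
  rw [← dd_i, he, map_sub, hw, h, sub_zero]

/-- connecting hom -/
def δ (n : ℕ) : Hn ρZ n →+ Hn ρX (n+1) where
  toFun x := (S.rel_total n x).choose
  map_zero' := S.rel_zero (S.rel_total n 0).choose_spec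
  map_add' x y := by
    have h1 := (S.rel_total n x).choose_spec
    have h2 := (S.rel_total n y).choose_spec
    have h3 := (S.rel_total n (x+y)).choose_spec
    have := S.rel_add h3 (S.rel_neg (S.rel_add h1 h2))
    rw [add_neg_cancel] at this
    have := S.rel_zero this
    rwa [← sub_eq_add_neg, sub_eq_zero] at this

lemma rel_δ (n) (x) : S.Rel n x (S.δ n x) := (S.rel_total n x).choose_spec

lemma δ_eq {n} {x y} (h : S.Rel n x y) : S.δ n x = y := by
  have := S.rel_add (S.rel_δ n x) (S.rel_neg h)
  rw [add_neg_cancel] at this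
  have := S.rel_zero this
  rwa [← sub_eq_add_neg, sub_eq_zero] at this

lemma δ_q (n) (y) : S.δ n (S.Hq n y) = 0 := by
  induction y using Hn_ind with | h z hz =>
  apply S.δ_eq
  refine ⟨z, 0, ?_, ?_, map_zero _, rfl, ?_⟩
  · rw [hz]; ext; simp
  · rw [dd_q, hz]; ext; simp
  · symm; rw [cl_eq_zero]; exact zero_mem _

lemma ex_δ (n) (z) (h : S.δ n z = 0) : ∃ y, S.Hq n y = z := by
  have := S.rel_δ n z
  rw [h] at this
  obtain ⟨c, a, h, hz, ha, rfl, h0⟩ := this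
  obtain ⟨b, rfl⟩ := cl_eq_zero_succ.1 h0.symm
  refine ⟨cl (c - fun g => S.i (b g)) ?_, ?_⟩
  · rw [map_sub, h, dd_i, sub_self]
  · rw [Hq_cl]; apply cl_congr; ext; simp [S.qi]

lemma ex_i (n) (x) (h : S.Hi (n+1) x = 0) : ∃ z, S.δ n z = x := by
  induction x using Hn_ind with | h z hz =>
  rw [Hi_cl, cl_eq_zero_succ] at h
  obtain ⟨c, hc⟩ := h
  have h0 : dd ρZ n (fun g => S.q (c g)) = 0 := by rw [dd_q, hc]; ext; simp [S.qi]
  exact ⟨cl _ h0, S.δ_eq ⟨c, z, hc, h0, hz, rfl, rfl⟩⟩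

lemma i_δ (n) (z) : S.Hi (n+1) (S.δ n z) = 0 := by
  obtain ⟨c, a, h, hz, ha, h1, h2⟩ := S.rel_δ n z
  rw [h2, Hi_cl, cl_eq_zero_succ]
  exact ⟨c, h⟩

lemma Hi_inj0 (x) (h : S.Hi 0 x = 0) : x = 0 := by
  induction x using Hn_ind with | h z hz =>
  rw [Hi_cl, cl_eq_zero_zero] at h
  rw [cl_eq_zero_zero]
  exact S.i_inj (h.trans (by ext; simp))

end SES

section nat
variable {Δ X' Y' Z' : Type} [Group Δ] [AddCommGroup X'] [AddCommGroup Y'] [AddCommGroup Z']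
variable {ρX : Act Γ X} {ρY : Act Γ Y} {ρZ : Act Γ Z}
variable {ρX' : Act Δ X'} {ρY' : Act Δ Y'} {ρZ' : Act Δ Z'}

lemma δ_nat (S : SES ρX ρY ρZ) (S' : SES ρX' ρY' ρZ') (f : Δ →* Γ) (a : X →+ X') (b : Y →+ Y')
    (c : Z →+ Z') (ha : Compat ρX ρX' f a) (hb : Compat ρY ρY' f b) (hc : Compat ρZ ρZ' f c)
    (h1 : ∀ x, b (S.i x) = S'.i (a x)) (h2 : ∀ y, c (S.q y) = S'.q (b y)) (n : ℕ) (z) :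
    S'.δ n (Hmap f c hc n z) = Hmap f a ha (n+1) (S.δ n z) := by
  apply S'.δ_eq
  obtain ⟨e, d, h, hz, hd, h3, h4⟩ := S.rel_δ n z
  rw [h4]
  nth_rewrite 1 [h3]
  have key : dd ρY' n (cmap f b n e) = fun g => S'.i (cmap f a (n+1) d g) := by
    rw [dd_cmap hb, h]; ext g; exact h1 _
  refine ⟨cmap f b n e, cmap f a (n+1) d, key, ?_, ?_, ?_, ?_⟩
  · rw [S'.dd_q, key]; ext; simp [S'.qi]
  · rw [dd_cmap ha, hd, map_zero]
  · rw [Hmap_cl]; apply cl_congr; ext g; exact h2 _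
  · rw [Hmap_cl]

end nat
end les

/-- Serre class -/
structure Serre where
  P : ∀ (A : Type) [AddCommGroup A], Prop
  zero : ∀ (A : Type) [AddCommGroup A], (∀ a : A, a = 0) → P A
  exact : ∀ (A B C : Type) [AddCommGroup A] [AddCommGroup B] [AddCommGroup C] (f : A →+ B)
    (g : B →+ C), (∀ b, g b = 0 → ∃ a, f a = b) → P A → P C → P B

namespace Serre
variable (P : Serre) {A B C : Type} [AddCommGroup A] [AddCommGroup B] [AddCommGroup C]
lemma of_inj (g : B →+ C) (h : ∀ b, g b = 0 → b = 0) (hC : P.P C) : P.P B :=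
  P.exact PUnit B C 0 g (fun b hb => ⟨0, by simp [h b hb]⟩) (P.zero _ (fun _ => rfl)) hC
lemma of_surj (f : A →+ B) (h : ∀ b, ∃ a, f a = b) (hA : P.P A) : P.P B :=
  P.exact A B PUnit f 0 (fun b _ => h b) hA (P.zero _ (fun _ => rfl))
end Serre

end TB
end

section
namespace TB

section fin
variable {Γ : Type} [Group Γ]
lemma contract_cons_zero {n : ℕ} (a : Γ) (g : Fin (n+1) → Γ) :
    Fin.contractNth 0 (· * ·) (Fin.cons a g : Fin (n+2) → Γ) = Fin.cons (a * g 0) (fun i => g i.succ) := by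
  ext k
  refine Fin.cases ?_ (fun k => ?_) k
  · simp [Fin.contractNth]
  · simp [Fin.contractNth]

lemma contract_cons_succ {n : ℕ} (a : Γ) (g : Fin (n+1) → Γ) (j : Fin (n+1)) :
    Fin.contractNth j.succ (· * ·) (Fin.cons a g : Fin (n+2) → Γ)
      = Fin.cons a (Fin.contractNth j (· * ·) g) := by
  ext k
  refine Fin.cases ?_ (fun k => ?_) k
  · simp [Fin.contractNth]
  · simp only [Fin.contractNth, Fin.val_succ, Fin.cons_succ, Fin.castSucc_succ]
    simp
end fin

/-- acyclic action -/
def Acyc {Γ Y : Type} [Group Γ] [AddCommGroup Y] (σ : Act Γ Y) : Prop :=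
  ∀ n (x : Hn σ (n+1)), x = 0

section acyc
variable {Γ X Y Ω : Type} [Group Γ] [AddCommGroup X] [AddCommGroup Y]

lemma acyc_of (σ : Act Γ Y) (e : Y ≃+ (Ω → X)) (r : Ω → Γ → Ω) (κ : Ω → Γ)
    (hr : ∀ w a b, r (r w a) b = r w (a * b)) (hr1 : ∀ w, r w 1 = w)
    (he : ∀ g y w, e (σ g y) w = e y (r w g)) (hκ : ∀ w g, κ (r w g) = κ w * g) : Acyc σ := by
  intro n x
  induction x using Hn_ind with | h f hf =>
  rw [cl_eq_zero_succ]
  let h : (Fin n → Γ) → Y := fun g => e.symm fun w => e (f (Fin.cons (κ w) g)) (r w (κ w)⁻¹)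
  have hh : ∀ g w, e (h g) w = e (f (Fin.cons (κ w) g)) (r w (κ w)⁻¹) := fun g w => by
    simp [h]
  refine ⟨h, ?_⟩
  ext g
  apply e.injective
  ext w
  have key := congrFun hf (Fin.cons (κ w) g)
  have key2 := congrFun (congrArg e key) (r w (κ w)⁻¹)
  rw [dd_apply, map_add, Pi.add_apply, he, hr, Fin.cons_zero, inv_mul_cancel, hr1,
    Fin.sum_univ_succ, map_add, Pi.add_apply, contract_cons_zero, map_sum, Finset.sum_apply] at key2
  simp only [contract_cons_succ, Fin.cons_succ] at key2
  rw [dd_apply, map_add, Pi.add_apply, he, map_sum, Finset.sum_apply]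
  simp only [map_zsmul, Pi.smul_apply, hh] at key2 ⊢
  rw [hκ, hr, mul_inv_rev, mul_inv_cancel_left]
  simp only [Pi.zero_apply, map_zero] at key2
  have e1 : ∀ j : Fin (n+1), (-1:ℤ)^((j.succ : ℕ)+1) = - (-1)^((j:ℕ)+1) := fun j => by
    rw [Fin.val_succ, pow_succ]; ring
  simp only [e1, neg_smul, Finset.sum_neg_distrib] at key2
  simp only [Fin.val_zero, zero_add, pow_one, neg_smul, one_smul] at key2
  rw [← sub_eq_zero, ← neg_eq_zero, ← key2]
  abel

end acyc

section constr
variable {Γ Δ X Y Z : Type} [Group Γ] [Group Δ] [AddCommGroup X] [AddCommGroup Y] [AddCommGroup Z]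

/-- functions -/
def coAct (Γ X : Type) [Group Γ] [AddCommGroup X] : Act Γ (Γ → X) where
  f g := { toFun := fun φ x => φ (x * g), map_zero' := rfl, map_add' := fun _ _ => rfl }
  one' x := by ext; simp
  mul' a b x := by ext; simp [mul_assoc]

lemma coAct_apply (g : Γ) (φ : Γ → X) (x : Γ) : coAct Γ X g φ x = φ (x * g) := rfl

/-- quotient action -/
def qAct (ρ : Act Γ X) (S : AddSubgroup X) (h : ∀ g, ∀ x ∈ S, ρ g x ∈ S) : Act Γ (X ⧸ S) where
  f g := QuotientAddGroup.map S S (ρ g) (fun x hx => h g x hx)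
  one' x := by
    obtain ⟨x, rfl⟩ := QuotientAddGroup.mk'_surjective S x
    exact congrArg (QuotientAddGroup.mk' S) (ρ.one x)
  mul' a b x := by
    obtain ⟨x, rfl⟩ := QuotientAddGroup.mk'_surjective S x
    exact congrArg (QuotientAddGroup.mk' S) (ρ.mul a b x)

lemma qAct_mk (ρ : Act Γ X) (S : AddSubgroup X) (h) (g x) :
    qAct ρ S h g (QuotientAddGroup.mk' S x) = QuotientAddGroup.mk' S (ρ g x) := rfl

/-- sub action -/
def sAct (ρ : Act Γ X) (S : AddSubgroup X) (h : ∀ g, ∀ x ∈ S, ρ g x ∈ S) : Act Γ S where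
  f g := ((ρ g).comp S.subtype).codRestrict S (fun x => h g x x.2)
  one' x := Subtype.ext (ρ.one _)
  mul' a b x := Subtype.ext (ρ.mul a b _)

lemma sAct_coe (ρ : Act Γ X) (S : AddSubgroup X) (h) (g) (x : S) :
    (sAct ρ S h g x : X) = ρ g x := rfl

/-- restrict -/
def SES.res {ρX : Act Γ X} {ρY : Act Γ Y} {ρZ : Act Γ Z} (S : SES ρX ρY ρZ) (f : Δ →* Γ) :
    SES (ρX.comp f) (ρY.comp f) (ρZ.comp f) where
  i := S.i
  q := S.q
  hi d x := S.hi (f d) x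
  hq d x := S.hq (f d) x
  inj := S.inj
  surj := S.surj
  qi := S.qi
  ex := S.ex

/-- sub/quotient -/
def SES.sub (ρ : Act Γ X) (S : AddSubgroup X) (h : ∀ g, ∀ x ∈ S, ρ g x ∈ S) :
    SES (sAct ρ S h) ρ (qAct ρ S h) where
  i := S.subtype
  q := QuotientAddGroup.mk' S
  hi _ _ := rfl
  hq _ _ := rfl
  inj := S.subtype_injective
  surj := QuotientAddGroup.mk'_surjective S
  qi x := by simp
  ex y hy := ⟨⟨y, by simpa using hy⟩, rfl⟩

/-- from a surjection -/
def SES.ofSurj (ρ : Act Γ X) (σ : Act Γ Y) (q : X →+ Y) (hq : Equi ρ σ q)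
    (hs : Function.Surjective q) : SES (sAct ρ q.ker (fun g x hx => by
      have := hq g x
      rw [MonoidHom.id_apply] at this
      rw [AddMonoidHom.mem_ker] at hx ⊢; rw [this, hx, map_zero])) ρ σ where
  i := q.ker.subtype
  q := q
  hi _ _ := rfl
  hq := hq
  inj := q.ker.subtype_injective
  surj := hs
  qi x := x.2
  ex y hy := ⟨⟨y, hy⟩, rfl⟩

lemma range_inv (ρ : Act Γ X) (σ : Act Γ Y) (i : X →+ Y) (hi : Equi ρ σ i) :
  ∀ g, ∀ y ∈ i.range, σ g y ∈ i.range := by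
    rintro g _ ⟨x, rfl⟩
    exact ⟨ρ g x, hi g x⟩

/-- from an injection -/
def SES.ofInj (ρ : Act Γ X) (σ : Act Γ Y) (i : X →+ Y) (hi : Equi ρ σ i)
    (hs : Function.Injective i) : SES ρ σ (qAct σ i.range (range_inv ρ σ i hi)) where
  i := i
  q := QuotientAddGroup.mk' _
  hi := hi
  hq _ _ := rfl
  inj := hs
  surj := QuotientAddGroup.mk'_surjective _
  qi x := by simp
  ex y hy := by simpa using hy

/-- the embedding in functions -/
def iot (ρ : Act Γ X) : X →+ (Γ → X) where
  toFun x g := ρ g x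
  map_zero' := by ext; simp
  map_add' _ _ := by ext; simp

lemma iot_equi (ρ : Act Γ X) : Equi ρ (coAct Γ X) (iot ρ) := fun g x => by
  ext y; simp [iot, coAct_apply, ρ.mul]

lemma iot_inj (ρ : Act Γ X) : Function.Injective (iot ρ) := fun x y h => by
  have := congrFun h 1
  simpa [iot] using this

/-- X_1 -/
abbrev X1 (ρ : Act Γ X) : Type := (Γ → X) ⧸ (iot ρ).range
/-- X_1 -/
def act1 (ρ : Act Γ X) : Act Γ (X1 ρ) := qAct (coAct Γ X) _ (range_inv _ _ _ (iot_equi ρ))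
/-- the dimension shifting sequence -/
def shift (ρ : Act Γ X) : SES ρ (coAct Γ X) (act1 ρ) := SES.ofInj _ _ (iot ρ) (iot_equi ρ) (iot_inj ρ)

lemma coAct_acyc (f : Δ →* Γ) (hf : Function.Injective f) : Acyc ((coAct Γ X).comp f) := by
  let t : Γ → Γ := fun x => ((x : Γ ⧸ f.range)).out
  have ht : ∀ x, ∃ d, f d = (t x)⁻¹ * x := fun x => by
    have := QuotientGroup.mk_out_eq_mul f.range x
    obtain ⟨⟨_, d, rfl⟩, h⟩ := this
    refine ⟨d⁻¹, ?_⟩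
    simp only [t]; rw [h, map_inv]; group
  have ht2 : ∀ x d, t (x * f d) = t x := fun x d => by
    simp only [t]; congr 1
    rw [QuotientGroup.eq]; simp
  choose κ hκ using ht
  refine acyc_of (Ω := Γ) (X := X) _ (AddEquiv.refl _) (fun w d => w * f d) κ ?_ ?_ ?_ ?_
  · intro w a b; simp [mul_assoc]
  · intro w; simp
  · intro g y w; rfl
  · intro w g
    apply hf
    rw [hκ, ht2, map_mul, hκ, mul_assoc]

end constr

section shiftlem
variable {Γ X Y Z : Type} [Group Γ] [AddCommGroup X] [AddCommGroup Y] [AddCommGroup Z]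
variable {ρX : Act Γ X} {ρY : Act Γ Y} {ρZ : Act Γ Z}
lemma SES.δ_surj (S : SES ρX ρY ρZ) (h : Acyc ρY) (n) (x : Hn ρX (n+1)) : ∃ z, S.δ n z = x :=
  S.ex_i n x (h _ _)
lemma SES.δ_inj (S : SES ρX ρY ρZ) (h : Acyc ρY) (n) (x : Hn ρZ (n+1)) (hx : S.δ (n+1) x = 0) : x = 0 := by
  obtain ⟨y, rfl⟩ := S.ex_δ _ x hx
  rw [h _ y, map_zero]

lemma SES.P_mid (S : SES ρX ρY ρZ) (P : Serre) (n) (h1 : P.P (Hn ρX n)) (h2 : P.P (Hn ρZ n)) : P.P (Hn ρY n) :=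
  P.exact _ _ _ (S.Hi n) (S.Hq n) (S.ex_mid n) h1 h2
lemma SES.P_right (S : SES ρX ρY ρZ) (P : Serre) (n) (h1 : P.P (Hn ρY n)) (h2 : P.P (Hn ρX (n+1))) : P.P (Hn ρZ n) :=
  P.exact _ _ _ (S.Hq n) (S.δ n) (S.ex_δ n) h1 h2
lemma SES.P_left (S : SES ρX ρY ρZ) (P : Serre) (n) (h1 : P.P (Hn ρZ n)) (h2 : P.P (Hn ρY (n+1))) :
    P.P (Hn ρX (n+1)) :=
  P.exact _ _ _ (S.δ n) (S.Hi (n+1)) (S.ex_i n) h1 h2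

lemma Hmap_inj_of_bij {Δ : Type} [Group Δ] {ρ : Act Γ X} {σ : Act Δ Y} (f : Δ ≃* Γ) (φ : X →+ Y)
    (hφ : Function.Bijective φ) (h : Compat ρ σ f.toMonoidHom φ) (n : ℕ) (x : Hn ρ n)
    (hx : Hmap f.toMonoidHom φ h n x = 0) : x = 0 := by
  let e := AddEquiv.ofBijective φ hφ
  have h' : Compat σ ρ f.symm.toMonoidHom e.symm.toAddMonoidHom := by
    intro d y
    apply e.injective
    obtain ⟨x, rfl⟩ := e.surjective y
    obtain ⟨d, rfl⟩ := f.surjective d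
    have := h d x
    have h2 : e (ρ (f d) x) = σ d (e x) := this
    simpa using h2.symm
  have := congrArg (Hmap _ _ h' n) hx
  rw [Hmap_comp, map_zero] at this
  rw [← this]
  symm
  refine (Hmap_congr _ Compat.id ?_ ?_ n x).trans (Hmap_id _ n x)
  · ext; simp
  · ext y; exact e.symm_apply_apply y

lemma P_of_bij (P : Serre) {Δ : Type} [Group Δ] {ρ : Act Γ X} {σ : Act Δ Y} (f : Δ ≃* Γ) (φ : X →+ Y)
    (hφ : Function.Bijective φ) (h : Compat ρ σ f.toMonoidHom φ) (n : ℕ) (hP : P.P (Hn σ n)) :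
    P.P (Hn ρ n) :=
  P.of_inj (Hmap f.toMonoidHom φ h n) (Hmap_inj_of_bij f φ hφ h n) hP
end shiftlem

section conj
variable {Γ Γ' X : Type} [Group Γ] [Group Γ'] [AddCommGroup X]

lemma conj_id (ρ : Act Γ X) (g : Γ) (h : Compat ρ ρ (MulAut.conj g⁻¹).toMonoidHom (ρ g)) (n : ℕ)
    (x : Hn ρ n) : Hmap (MulAut.conj g⁻¹).toMonoidHom (ρ g) h n x = x := by
  induction n generalizing X with
  | zero =>
    obtain ⟨y, hy, rfl⟩ := cl0_surj x
    rw [Hmap_cl0, cl0_inj, hy]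
  | succ n ih =>
    obtain ⟨z, rfl⟩ := (shift ρ).δ_surj (coAct_acyc (MonoidHom.id Γ) (fun _ _ h => h)) n x
    have hh : ∀ {Y : Type} [AddCommGroup Y] (σ : Act Γ Y),
        Compat σ σ (MulAut.conj g⁻¹).toMonoidHom (σ g) := fun σ d x => by
      rw [← σ.mul, ← σ.mul]
      congr 2; simp; group
    rw [← δ_nat (shift ρ) (shift ρ) _ (ρ g) (coAct Γ X g) (act1 ρ g) h (hh _) (hh _), ih]
    · intro x; exact ((shift ρ).hi g x).symm
    · intro x; exact ((shift ρ).hq g x).symm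

/-- conjugation hom -/
def cj (K : Subgroup Γ) [K.Normal] (g : Γ) : K →* K := (MulAut.conjNormal g⁻¹ : K ≃* K).toMonoidHom

lemma cj_coe (K : Subgroup Γ) [K.Normal] (g : Γ) (k : K) : (cj K g k : Γ) = g⁻¹ * k * g := by
  simp [cj]

lemma cj_compat (ρ : Act Γ X) (K : Subgroup Γ) [K.Normal] (g : Γ) :
    Compat (ρ.comp K.subtype) (ρ.comp K.subtype) (cj K g) (ρ g) := fun k x => by
  simp only [Act.comp_apply, Subgroup.subtype_apply, cj_coe, ← ρ.mul]
  congr 2; group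

/-- action on cohomology of a normal subgroup -/
def conjAct (ρ : Act Γ X) (K : Subgroup Γ) [K.Normal] (n : ℕ) : Act Γ (Hn (ρ.comp K.subtype) n) where
  f g := Hmap (cj K g) (ρ g) (cj_compat ρ K g) n
  one' x := by
    refine (Hmap_congr _ Compat.id ?_ ?_ n x).trans (Hmap_id _ n x)
    · ext; simp [cj_coe]
    · exact ρ.one_eq
  mul' a b x := by
    refine Eq.trans ?_ (Hmap_comp _ _ _ _ _ _ n x).symm
    apply Hmap_congr
    · ext; simp [cj_coe, mul_assoc]
    · exact ρ.mul_eq a b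

lemma conjAct_apply (ρ : Act Γ X) (K : Subgroup Γ) [K.Normal] (n : ℕ) (g x) :
    conjAct ρ K n g x = Hmap (cj K g) (ρ g) (cj_compat ρ K g) n x := rfl

lemma conjAct_K (ρ : Act Γ X) (K : Subgroup Γ) [K.Normal] (n : ℕ) (k : K) (x) :
    conjAct ρ K n k x = x := by
  rw [conjAct_apply]
  have h2 : cj K (k:Γ) = (MulAut.conj k⁻¹).toMonoidHom := by ext y; simp [cj_coe]
  refine (Hmap_congr _ ?_ h2 rfl n x).trans (conj_id (ρ.comp K.subtype) k ?_ n x)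
  all_goals (intro d y; have := cj_compat ρ K k d y; rwa [h2] at this)

lemma conjAct_eq (ρ : Act Γ X) (f : Γ →* Γ') (n : ℕ) {a b : Γ} (h : f a = f b) :
    conjAct ρ f.ker n a = conjAct ρ f.ker n b := by
  have : b⁻¹ * a ∈ f.ker := by rw [MonoidHom.mem_ker, map_mul, map_inv, h, inv_mul_cancel]
  have h2 := conjAct_K ρ f.ker n ⟨_, this⟩
  ext x
  rw [← mul_inv_cancel_left b a, Act.mul]
  simp only at h2
  rw [h2]

/-- action of the quotient -/
def actQ (ρ : Act Γ X) (f : Γ →* Γ') (hf : Function.Surjective f) (n : ℕ) :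
    Act Γ' (Hn (ρ.comp f.ker.subtype) n) where
  f g := conjAct ρ f.ker n (Function.surjInv hf g)
  one' x := by
    rw [conjAct_eq ρ f n (b := 1), Act.one]
    rw [Function.surjInv_eq hf, map_one]
  mul' a b x := by
    rw [← Act.mul]
    congr 1
    apply conjAct_eq; rw [map_mul]; simp only [Function.surjInv_eq hf]

lemma actQ_f (ρ : Act Γ X) (f : Γ →* Γ') (hf : Function.Surjective f) (n : ℕ) (g : Γ) :
    actQ ρ f hf n (f g) = conjAct ρ f.ker n g := by
  apply conjAct_eq; rw [Function.surjInv_eq hf]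

lemma actQ_apply (ρ : Act Γ X) (f : Γ →* Γ') (hf : Function.Surjective f) (n : ℕ) (g : Γ) (x) :
    actQ ρ f hf n (f g) x = Hmap (cj f.ker g) (ρ g) (cj_compat ρ f.ker g) n x := by
  rw [actQ_f, conjAct_apply]

/-- An equivariant family is equivariant for the quotient. -/
lemma actQ_equi {X Y : Type} [AddCommGroup X] [AddCommGroup Y] {ρ : Act Γ X} {σ : Act Γ Y}
    (f : Γ →* Γ') (hf : Function.Surjective f) {n m : ℕ}
    (φ : Hn (ρ.comp f.ker.subtype) n →+ Hn (σ.comp f.ker.subtype) m)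
    (h : ∀ g x, φ (conjAct ρ f.ker n g x) = conjAct σ f.ker m g (φ x)) :
    Equi (actQ ρ f hf n) (actQ σ f hf m) φ := by
  intro g x
  obtain ⟨g, rfl⟩ := hf g
  rw [MonoidHom.id_apply, actQ_f, actQ_f, h]

lemma δ_conj {X Y Z : Type} [AddCommGroup X] [AddCommGroup Y] [AddCommGroup Z]
    {ρX : Act Γ X} {ρY : Act Γ Y} {ρZ : Act Γ Z} (S : SES ρX ρY ρZ) (K : Subgroup Γ) [K.Normal]
    (n : ℕ) (g) (x) : (S.res K.subtype).δ n (conjAct ρZ K n g x) =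
      conjAct ρX K (n+1) g ((S.res K.subtype).δ n x) := by
  rw [conjAct_apply, conjAct_apply]
  apply δ_nat (S.res K.subtype) (S.res K.subtype) (cj K g) (ρX g) (ρY g) (ρZ g) _ (cj_compat ρY K g)
  · intro x; exact (S.hi g x).symm
  · intro x; exact (S.hq g x).symm

lemma Hmap_conj {X Y : Type} [AddCommGroup X] [AddCommGroup Y]
    {ρX : Act Γ X} {ρY : Act Γ Y} (K : Subgroup Γ) [K.Normal] (φ : X →+ Y) (h : Equi ρX ρY φ)
    (h' : Equi (ρX.comp K.subtype) (ρY.comp K.subtype) φ)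
    (n : ℕ) (g) (x) : Hmap _ φ h' n (conjAct ρX K n g x) = conjAct ρY K n g (Hmap _ φ h' n x) := by
  rw [conjAct_apply, conjAct_apply, Hmap_comp, Hmap_comp]
  apply Hmap_congr
  · rfl
  · ext x; exact h g x

end conj

end TB
end

section
namespace TB

section lhs
variable {Γ Γ' X : Type} [Group Γ] [Group Γ'] [AddCommGroup X]

/-- H^0 to X -/
def val0 (ρ : Act Γ X) : Hn ρ 0 →+ X :=
  liftH (Pi.evalAddMonoidHom (fun _ : Fin 0 → Γ => X) default) (fun z hz => by
    have : z = 0 := hz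
    subst this; rfl)

@[simp] lemma val0_cl0 (ρ : Act Γ X) (x) (h) : val0 ρ (cl0 x h) = x := rfl
lemma val0_inj (ρ : Act Γ X) : Function.Injective (val0 ρ) := by
  intro a b h
  obtain ⟨a, ha, rfl⟩ := cl0_surj a
  obtain ⟨b, hb, rfl⟩ := cl0_surj b
  rw [val0_cl0, val0_cl0] at h
  rw [cl0_inj, h]
lemma val0_fix (ρ : Act Γ X) (x) (g) : ρ g (val0 ρ x) = val0 ρ x := by
  obtain ⟨a, ha, rfl⟩ := cl0_surj x
  exact ha g
lemma val0_Hmap {Δ Y : Type} [Group Δ] [AddCommGroup Y] {ρ : Act Γ X} {σ : Act Δ Y} (f : Δ →* Γ) (φ : X →+ Y)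
    (h : Compat ρ σ f φ) (x) : val0 σ (Hmap f φ h 0 x) = φ (val0 ρ x) := by
  obtain ⟨a, ha, rfl⟩ := cl0_surj x
  rfl

variable (ρ : Act Γ X) (f : Γ →* Γ') (hf : Function.Surjective f)

lemma val0_compat : Compat (actQ ρ f hf 0) ρ f (val0 _) := by
  intro g x
  rw [actQ_apply, val0_Hmap]

lemma Compat.res {Δ : Type} [Group Δ] {ρ : Act Γ X} {f : Δ →* Γ} :
    Compat ρ (ρ.comp f) f (AddMonoidHom.id X) := fun _ _ => rfl

/-- restriction to the kernel -/
def resK (n : ℕ) : Hn ρ n →+ Hn (ρ.comp f.ker.subtype) n :=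
  Hmap f.ker.subtype (AddMonoidHom.id X) Compat.res n

lemma resK_inv (n : ℕ) (x) (g) : actQ ρ f hf n g (resK ρ f n x) = resK ρ f n x := by
  obtain ⟨g, rfl⟩ := hf g
  have hh : Compat ρ ρ (MulAut.conj g⁻¹).toMonoidHom (ρ g) := fun d x => by
      rw [← ρ.mul, ← ρ.mul]
      congr 2; simp; group
  conv_rhs => rw [← conj_id ρ g hh n x]
  rw [actQ_apply, resK, Hmap_comp, Hmap_comp]
  apply Hmap_congr
  · ext k; simp [cj_coe]
  · rfl

/-- edge map -/
def edge (n : ℕ) : Hn ρ n →+ Hn (actQ ρ f hf n) 0 where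
  toFun x := cl0 (resK ρ f n x) (resK_inv ρ f hf n x)
  map_zero' := by rw [cl0_eq_zero, map_zero]
  map_add' a b := by rw [cl0_add, cl0_inj, map_add]

lemma edge_zero (n) (x) : edge ρ f hf n x = 0 ↔ resK ρ f n x = 0 :=
  cl0_eq_zero (h := resK_inv ρ f hf n x)

lemma dd_one {Γ X : Type} [Group Γ] [AddCommGroup X] (ρ : Act Γ X) (z : (Fin 1 → Γ) → X) :
    dd ρ 1 z = 0 ↔ ∀ a b, z (fun _ => a * b) = z (fun _ => a) + ρ a (z fun _ => b) := by
  constructor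
  · intro h a b
    have := congrFun h ![a, b]
    rw [dd_apply] at this
    simp only [Fin.sum_univ_succ, Fin.sum_univ_zero] at this
    have e1 : (Fin.contractNth 0 (· * ·) ![a,b]) = fun _ => a * b := by
      ext k; rw [Subsingleton.elim k 0]; simp [Fin.contractNth]
    have e2 : (Fin.contractNth (Fin.succ 0) (· * ·) ![a,b]) = fun _ => a := by
      ext k; rw [Subsingleton.elim k 0]; simp [Fin.contractNth]
    have e3 : (fun i : Fin 1 => ![a,b] i.succ) = fun _ => b := by
      ext k; rw [Subsingleton.elim k 0]; simp
    rw [e1, e2, e3] at this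
    simp at this
    rw [← sub_eq_zero, ← neg_eq_zero, ← this]; abel
  · intro h
    ext g
    rw [dd_apply]
    simp only [Fin.sum_univ_succ, Fin.sum_univ_zero]
    have e1 : (Fin.contractNth 0 (· * ·) g) = fun _ => g 0 * g 1 := by
      ext k; rw [Subsingleton.elim k 0]; simp [Fin.contractNth]
    have e2 : (Fin.contractNth (Fin.succ 0) (· * ·) g) = fun _ => g 0 := by
      ext k; rw [Subsingleton.elim k 0]; simp [Fin.contractNth]
    have e3 : (fun i : Fin 1 => g i.succ) = fun _ => g 1 := by
      ext k; rw [Subsingleton.elim k 0]; simp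
    rw [e1, e2, e3, h]
    simp

lemma dd_z {Γ X : Type} [Group Γ] [AddCommGroup X] (ρ : Act Γ X) (z : (Fin 0 → Γ) → X) (g) :
    dd ρ 0 z g = ρ (g 0) (z default) - z default := by
  rw [dd_apply]
  simp only [Fin.sum_univ_succ, Fin.sum_univ_zero]
  rw [Subsingleton.elim (fun i : Fin 0 => g _) default,
      Subsingleton.elim (Fin.contractNth _ _ _) default]
  simp [sub_eq_add_neg]

lemma infres (x : Hn ρ 1) (h : resK ρ f 1 x = 0) :
    ∃ y, Hmap f (val0 _) (val0_compat ρ f hf) 1 y = x := by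
  induction x using Hn_ind with | h z hz =>
  rw [resK, Hmap_cl, cl_eq_zero_succ] at h
  obtain ⟨c, hc⟩ := h
  let m := c default
  let z' : (Fin 1 → Γ) → X := z - dd ρ 0 (fun _ => m)
  have hz' : dd ρ 1 z' = 0 := by simp only [z']; rw [map_sub, hz, dd_dd, sub_zero]
  have hz2 := (dd_one ρ z').1 hz'
  have hk : ∀ k ∈ f.ker, z' (fun _ => k) = 0 := by
    intro k hk
    have := congrFun hc (fun _ => ⟨k, hk⟩)
    rw [dd_z] at this
    simp only [z', Pi.sub_apply, dd_z]
    simp only [Act.comp_apply, cmap_apply] at this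
    rw [sub_eq_zero]; exact this.symm
  have h1 : ∀ g k, k ∈ f.ker → z' (fun _ => g * k) = z' (fun _ => g) := fun g k hk' => by
    rw [hz2, hk k hk', map_zero, add_zero]
  have h2 : ∀ g k, k ∈ f.ker → ρ k (z' (fun _ => g)) = z' (fun _ => g) := fun g k hk' => by
    have e1 := hz2 k g
    rw [hk k hk', zero_add] at e1
    rw [← e1, ← h1 g (g⁻¹ * k * g)]
    · congr 1; ext; group
    · have : f.ker.Normal := inferInstance
      simpa using this.conj_mem k hk' g⁻¹
  let s := Function.surjInv hf
  have hs : ∀ g, f (s g) = g := Function.surjInv_eq hf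
  have h3 : ∀ g, z' (fun _ => s (f g)) = z' (fun _ => g) := fun g => by
    rw [← h1 g (g⁻¹ * s (f g))]
    · congr 1; ext; group
    · simp [MonoidHom.mem_ker, hs]
  let w : (Fin 1 → Γ') → Hn (ρ.comp f.ker.subtype) 0 := fun g =>
    cl0 (z' fun _ => s (g 0)) (fun k => h2 _ _ k.2)
  have hw : dd (actQ ρ f hf 0) 1 w = 0 := by
    rw [dd_one]
    intro a b
    apply val0_inj
    obtain ⟨a, rfl⟩ := hf a
    obtain ⟨b, rfl⟩ := hf b
    rw [map_add, val0_compat]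
    simp only [w, val0_cl0, ← map_mul, h3]
    exact hz2 a b
  refine ⟨cl w hw, ?_⟩
  rw [Hmap_cl, cl_eq_cl]
  refine ⟨fun _ => -m, ?_⟩
  ext g
  have : z' g = z g - dd ρ 0 (fun _ => m) g := rfl
  have e : cmap f (val0 (ρ.comp f.ker.subtype)) 1 w g = z' g := by
    simp only [cmap_apply, w, val0_cl0, Function.comp]
    rw [h3]; congr 1; ext k; rw [Subsingleton.elim k 0]
  rw [Pi.sub_apply, e, this, dd_z, dd_z, map_neg]; abel

lemma coKer_acyc : Acyc (actQ (coAct Γ X) f hf 0) := by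
  let s := Function.surjInv hf
  have hs : ∀ g, f (s g) = g := Function.surjInv_eq hf
  have h3 : ∀ (y : Hn ((coAct Γ X).comp f.ker.subtype) 0) (a b), f a = f b →
      val0 _ y a = val0 _ y b := by
    intro y a b hab
    have := congrFun (val0_fix _ y ⟨a⁻¹ * b, by simp [MonoidHom.mem_ker, hab]⟩) a
    simp only [Act.comp_apply, coAct_apply] at this
    rw [← this]; simp
  let e : Hn ((coAct Γ X).comp f.ker.subtype) 0 ≃+ (Γ' → X) :=
    { toFun := fun y w => val0 _ y (s w)
      invFun := fun φ => cl0 (fun g => φ (f g)) (fun k => by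
        ext x
        have : f k = 1 := MonoidHom.mem_ker.1 k.2
        simp [coAct_apply, this])
      left_inv := fun y => by
        apply val0_inj
        ext g
        rw [val0_cl0]
        exact h3 _ _ _ (hs _)
      right_inv := fun φ => by
        ext w
        exact congrArg φ (hs w)
      map_add' := fun a b => by ext; simp }
  refine acyc_of (Ω := Γ') (X := X) _ e (fun w g => w * g) id ?_ ?_ ?_ ?_
  · intro w a b; simp [mul_assoc]
  · intro w; simp
  · intro g y w
    obtain ⟨g, rfl⟩ := hf g
    simp only [e, AddEquiv.coe_mk, Equiv.coe_fn_mk]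
    rw [val0_compat]
    rw [coAct_apply]
    apply h3
    rw [map_mul, hs, hs]
  · intro w g; rfl

/-- Lyndon-Hochschild-Serre bound. -/
theorem lhs {Γ Γ' X : Type} [Group Γ] [Group Γ'] [AddCommGroup X]
    (ρ : Act Γ X) (f : Γ →* Γ') (hf : Function.Surjective f) (P : Serre) (n : ℕ) (h : ∀ a b, a + b = n → P.P (Hn (actQ ρ f hf b) a)) :
    P.P (Hn ρ n) := by
  match n, h with
  | 0, h =>
    refine P.of_inj (edge ρ f hf 0) ?_ (h 0 0 rfl)
    intro x hx
    rw [edge_zero] at hx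
    obtain ⟨y, hy, rfl⟩ := cl0_surj x
    rw [resK, Hmap_cl0, cl0_eq_zero] at hx
    rw [cl0_eq_zero]; exact hx
  | 1, h =>
    refine P.exact _ _ _ (Hmap f (val0 _) (val0_compat ρ f hf) 1) (edge ρ f hf 1) ?_ (h 1 0 rfl) (h 0 1 rfl)
    intro x hx
    rw [edge_zero] at hx
    exact infres ρ f hf x hx
  | m+2, h =>
    have acK : Acyc ((coAct Γ X).comp f.ker.subtype) := coAct_acyc _ f.ker.subtype_injective
    have ac : Acyc (coAct Γ X) := coAct_acyc (MonoidHom.id Γ) (fun _ _ h => h)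
    refine P.of_surj ((shift ρ).δ (m+1)) ((shift ρ).δ_surj ac (m+1)) ?_
    apply lhs (act1 ρ) f hf P (m+1)
    intro a b hab
    let S := (shift ρ).res f.ker.subtype
    have heq : ∀ b, Equi (actQ (act1 ρ) f hf b) (actQ ρ f hf (b+1)) (S.δ b) := fun b =>
      actQ_equi f hf _ (fun g x => δ_conj (shift ρ) f.ker b g x)
    cases b with
    | succ b =>
      refine P_of_bij P (MulEquiv.refl Γ') (S.δ (b+1)) ⟨?_, ?_⟩ (heq (b+1)) a (h a (b+2) (by omega))
      · rw [injective_iff_map_eq_zero]; exact S.δ_inj acK b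
      · exact S.δ_surj acK (b+1)
    | zero =>
      obtain rfl : a = m + 1 := hab
      let S1 := SES.ofSurj (actQ (act1 ρ) f hf 0) (actQ ρ f hf 1) (S.δ 0) (heq 0) (S.δ_surj acK 0)
      refine S1.P_mid P (m+1) ?_ (h (m+1) 1 rfl)
      let S2 : SES (actQ ρ f hf 0) (actQ (coAct Γ X) f hf 0) (sAct (actQ (act1 ρ) f hf 0) (S.δ 0).ker
          (fun g x hx => by
            rw [AddMonoidHom.mem_ker] at hx ⊢
            have := heq 0 g x
            rw [MonoidHom.id_apply] at this; rw [this, hx, map_zero])) :=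
        { i := S.Hi 0
          q := (S.Hq 0).codRestrict (S.δ 0).ker (fun y => S.δ_q 0 y)
          hi := actQ_equi f hf _ (fun g x => Hmap_conj f.ker _ (shift ρ).hi _ 0 g x)
          hq := fun g x => Subtype.ext (actQ_equi f hf (S.Hq 0) (fun g x => Hmap_conj f.ker _ (shift ρ).hq _ 0 g x) g x)
          inj := (injective_iff_map_eq_zero _).2 S.Hi_inj0
          surj := fun ⟨y, hy⟩ => by
            obtain ⟨x, hx⟩ := S.ex_δ 0 y hy
            exact ⟨x, Subtype.ext hx⟩
          qi := fun x => Subtype.ext (S.qi_H 0 x)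
          ex := fun y hy => S.ex_mid 0 y (congrArg Subtype.val hy) }
      refine S2.P_right P (m+1) ?_ (h (m+2) 0 rfl)
      exact P.zero _ (coKer_acyc f hf m)

end lhs
end TB
end

section
namespace TB

lemma SES.res_δ {Γ Δ X Y Z : Type} [Group Γ] [Group Δ] [AddCommGroup X] [AddCommGroup Y] [AddCommGroup Z]
    {ρX : Act Γ X} {ρY : Act Γ Y} {ρZ : Act Γ Z} (S : SES ρX ρY ρZ) (f : Δ →* Γ) (n) (z) :
    (S.res f).δ n (Hmap f (AddMonoidHom.id Z) Compat.res n z) =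
      Hmap f (AddMonoidHom.id X) Compat.res (n+1) (S.δ n z) :=
  δ_nat S (S.res f) f _ (AddMonoidHom.id Y) _ _ Compat.res _ (fun _ => rfl) (fun _ => rfl) n z

lemma coAct_acyc' {Γ X : Type} [Group Γ] [AddCommGroup X] : Acyc (coAct Γ X) :=
  coAct_acyc (MonoidHom.id Γ) (fun _ _ h => h)

section transfer
variable {Γ X : Type} [Group Γ] [AddCommGroup X]

lemma norm_ex (ρ : Act Γ X) (H : Subgroup Γ) (hH : H.index ≠ 0) (y : X) (hy : ∀ h ∈ H, ρ h y = y) :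
    ∃ (s : Finset Γ), s.card = H.index ∧ ∀ g, ρ g (∑ t ∈ s, ρ t y) = ∑ t ∈ s, ρ t y := by
  classical
  have : H.FiniteIndex := ⟨hH⟩
  let _ : Fintype (Γ ⧸ H) := Fintype.ofFinite _
  let F : Γ ⧸ H → X := fun t => ρ t.out y
  have hF : ∀ g : Γ, F (g : Γ ⧸ H) = ρ g y := fun g => by
    obtain ⟨h, hh⟩ := QuotientGroup.mk_out_eq_mul H g
    simp only [F]; rw [hh, ρ.mul, hy _ h.2]
  let s : Finset Γ := Finset.univ.image (fun t : Γ ⧸ H => t.out)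
  have hinj : Function.Injective (fun t : Γ ⧸ H => t.out) := Quotient.out_injective
  have hs : ∑ t ∈ s, ρ t y = ∑ t, F t := Finset.sum_image (fun _ _ _ _ h => hinj h)
  refine ⟨s, ?_, fun g => ?_⟩
  · rw [Finset.card_image_of_injective _ hinj, Finset.card_univ, Subgroup.index, Nat.card_eq_fintype_card]
  · rw [hs, map_sum]
    conv_rhs => rw [← Equiv.sum_comp (MulAction.toPerm g : Equiv.Perm (Γ ⧸ H))]
    refine Finset.sum_congr rfl fun t _ => ?_
    simp only [MulAction.toPerm_apply]
    induction t using QuotientGroup.induction_on with | H t =>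
    rw [hF, MulAction.Quotient.smul_coe, hF, smul_eq_mul, ρ.mul]

theorem transfer (ρ : Act Γ X) (H : Subgroup Γ) (n : ℕ) (x : Hn ρ n)
    (hx : Hmap H.subtype (AddMonoidHom.id X) Compat.res n x = 0) : H.index • x = 0 := by
  by_cases hH : H.index = 0
  · rw [hH, zero_smul]
  induction n using Nat.strong_induction_on generalizing X with
  | _ n ih =>
  match n with
  | 0 =>
    obtain ⟨y, hy, rfl⟩ := cl0_surj x
    rw [Hmap_cl0, cl0_eq_zero] at hx
    have : y = 0 := hx
    subst this
    rw [cl0_eq_zero.2 rfl, smul_zero]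
  | 1 =>
    obtain ⟨z, rfl⟩ := (shift ρ).δ_surj coAct_acyc' 0 x
    rw [← SES.res_δ] at hx
    obtain ⟨w, hw⟩ := SES.ex_δ _ _ _ hx
    obtain ⟨y, hy, rfl⟩ := cl0_surj w
    obtain ⟨v, hv, rfl⟩ := cl0_surj z
    obtain ⟨s, hs, hs2⟩ := norm_ex (coAct Γ X) H hH y (fun h hh => hy ⟨h, hh⟩)
    rw [← map_nsmul]
    have : H.index • cl0 v hv = (shift ρ).Hq 0 (cl0 _ hs2) := by
      apply val0_inj
      rw [map_nsmul, SES.Hq, val0_Hmap, val0_cl0, val0_cl0, map_sum]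
      have h1 : (shift ρ).q y = v := by
        have := congrArg (val0 _) hw
        rwa [SES.Hq, val0_Hmap, val0_cl0, val0_Hmap] at this
      have h2 : ∀ t, (shift ρ).q (coAct Γ X t y) = v := fun t => by
        have := (shift ρ).hq t y
        rw [MonoidHom.id_apply] at this
        rw [this, h1, hv]
      simp [h2, hs]
    rw [this, SES.δ_q]
  | n+2 =>
    obtain ⟨z, rfl⟩ := (shift ρ).δ_surj coAct_acyc' (n+1) x
    rw [← SES.res_δ] at hx
    have := SES.δ_inj _ (coAct_acyc _ H.subtype_injective) _ _ hx
    rw [← map_nsmul, ih (n+1) (by omega) _ z this, map_zero]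

end transfer

section shapiro
variable {Γ X Y : Type} [Group Γ] [AddCommGroup X] [AddCommGroup Y] (H : Subgroup Γ)

/-- coinduced group -/
def coindS (σ : Act H X) : AddSubgroup (Γ → X) where
  carrier := {φ | ∀ (h : H) g, φ (h * g) = σ h (φ g)}
  zero_mem' := by intro h g; simp
  add_mem' := by intro a b ha hb h g; simp [ha h g, hb h g]
  neg_mem' := by intro a ha h g; simp [ha h g]

lemma coindS_mem {σ : Act H X} (φ : coindS H σ) (h : H) (g : Γ) : φ.1 (h * g) = σ h (φ.1 g) := φ.2 h g

lemma coind_inv (σ : Act H X) : ∀ g, ∀ φ ∈ coindS H σ, coAct Γ X g φ ∈ coindS H σ := by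
  intro g φ hφ h x
  simp only [coAct_apply]
  rw [mul_assoc, hφ]

/-- coinduced action -/
def coind (σ : Act H X) : Act Γ (coindS H σ) := sAct (coAct Γ X) (coindS H σ) (coind_inv H σ)

lemma coind_apply (σ : Act H X) (g : Γ) (φ) (x) : (coind H σ g φ).1 x = φ.1 (x * g) := rfl

/-- evaluation at 1 -/
def ev1 (σ : Act H X) : coindS H σ →+ X := (Pi.evalAddMonoidHom (fun _ : Γ => X) 1).comp (coindS H σ).subtype

lemma ev1_apply (σ : Act H X) (φ) : ev1 H σ φ = φ.1 1 := rfl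

lemma ev1_compat (σ : Act H X) : Compat (coind H σ) σ H.subtype (ev1 H σ) := by
  intro h φ
  have := coindS_mem H φ h 1
  rw [mul_one] at this
  rw [ev1_apply, ev1_apply, ← this, coind_apply, one_mul]
  rfl

lemma coindMap_mem {σ : Act H X} {τ : Act H Y} (φ : X →+ Y) (hφ : Equi σ τ φ) (u : coindS H σ) :
    (fun g => φ (u.1 g)) ∈ coindS H τ := by
  intro h g
  change φ (u.1 (h * g)) = _
  rw [coindS_mem]; exact hφ h _

/-- functoriality -/
def coindMap {σ : Act H X} {τ : Act H Y} (φ : X →+ Y) (hφ : Equi σ τ φ) : coindS H σ →+ coindS H τ where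
  toFun u := ⟨fun g => φ (u.1 g), coindMap_mem H φ hφ u⟩
  map_zero' := by ext; simp
  map_add' _ _ := by ext; simp

lemma coindMap_equi {σ : Act H X} {τ : Act H Y} (φ : X →+ Y) (hφ : Equi σ τ φ) :
    Equi (coind H σ) (coind H τ) (coindMap H φ hφ) := fun _ _ => rfl

lemma coind_surj {σ : Act H X} {τ : Act H Y} (φ : X →+ Y) (hφ : Equi σ τ φ) (hs : Function.Surjective φ) :
    Function.Surjective (coindMap H φ hφ) := by
  intro u
  choose y hy using fun c : Γ ⧸ H => hs (u.1 (c.out⁻¹))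
  have h0 : ∀ g : Γ, ∃ h : H, (h:Γ) * (QuotientGroup.mk g⁻¹ : Γ ⧸ H).out⁻¹ = g := fun g => by
    obtain ⟨h, hh⟩ := QuotientGroup.mk_out_eq_mul H g⁻¹
    exact ⟨h, by rw [hh]; group⟩
  choose k hk using h0
  have hc : ∀ (h : H) (g : Γ), (QuotientGroup.mk (h*g)⁻¹ : Γ ⧸ H) = QuotientGroup.mk g⁻¹ := fun h g => by
    rw [QuotientGroup.eq]; simp
  have hk2 : ∀ (h : H) (g : Γ), k (h*g) = h * k g := fun h g => by
    have h1 := hk (h*g)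
    rw [hc] at h1
    apply Subtype.ext
    rw [Subgroup.coe_mul]
    have h2 := hk g
    rw [eq_comm, ← mul_inv_eq_iff_eq_mul] at h1 h2
    rw [← h1, ← h2]; group
  refine ⟨⟨fun g => σ (k g) (y (QuotientGroup.mk g⁻¹)), fun h g => ?_⟩, ?_⟩
  · change σ (k (h*g)) (y (QuotientGroup.mk (h*g)⁻¹)) = σ h (σ (k g) (y (QuotientGroup.mk g⁻¹)))
    rw [hk2, hc, σ.mul]
  · ext g
    change φ (σ (k g) (y (QuotientGroup.mk g⁻¹))) = u.1 g
    have := hφ (k g) (y (QuotientGroup.mk g⁻¹))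
    rw [MonoidHom.id_apply] at this
    rw [this, hy, ← coindS_mem, hk]

/-- exactness -/
def coindSES {Z : Type} [AddCommGroup Z] {ρX : Act H X} {ρY : Act H Y} {ρZ : Act H Z} (S : SES ρX ρY ρZ) :
    SES (coind H ρX) (coind H ρY) (coind H ρZ) where
  i := coindMap H S.i S.hi
  q := coindMap H S.q S.hq
  hi := coindMap_equi H S.i S.hi
  hq := coindMap_equi H S.q S.hq
  inj := by
    intro a b h
    ext g
    exact S.inj (congrFun (congrArg Subtype.val h) g)
  surj := coind_surj H S.q S.hq S.surj
  qi x := by ext g; exact S.qi _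
  ex := by
    intro u hu
    choose w hw using fun g => S.ex (u.1 g) (congrFun (congrArg Subtype.val hu) g)
    refine ⟨⟨w, fun h g => S.inj ?_⟩, ?_⟩
    · have := S.hi h (w g)
      rw [MonoidHom.id_apply] at this
      rw [this, hw, hw, coindS_mem]
    · ext g; exact hw g

lemma coind_coAct_acyc : Acyc (coind H (coAct H X)) := by
  let e : coindS H (coAct H X) ≃+ (Γ → X) :=
    { toFun := fun φ g => φ.1 g 1
      invFun := fun ψ => ⟨fun g h => ψ (h * g), fun h g => by
        ext k; simp [coAct_apply, mul_assoc]⟩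
      left_inv := fun φ => by
        ext g h
        change φ.1 (h * g) 1 = _
        rw [coindS_mem, coAct_apply, one_mul]
      right_inv := fun ψ => by ext g; simp
      map_add' := fun _ _ => rfl }
  refine acyc_of _ e (fun w d => w * d) (fun w => w) ?_ ?_ ?_ ?_
  · intro w a b; simp [mul_assoc]
  · intro w; simp
  · intro g y w; rfl
  · intro w g; rfl

lemma coind_inv_eq (σ : Act H X) (u v : coindS H σ) (hu : ∀ g, coind H σ g u = u) (hv : ∀ g, coind H σ g v = v)
    (h : u.1 1 = v.1 1) : u = v := by
  ext g
  have h1 := congrFun (congrArg Subtype.val (hu g)) 1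
  have h2 := congrFun (congrArg Subtype.val (hv g)) 1
  rw [coind_apply, one_mul] at h1 h2
  rw [h1, h2, h]

end shapiro

theorem shapiro {Γ : Type} [Group Γ] (H : Subgroup Γ) (b : ℕ) : ∀ {X : Type} [AddCommGroup X] (σ : Act H X)
    (x : Hn (coind H σ) b) (_ : Hmap H.subtype (ev1 H σ) (ev1_compat H σ) b x = 0), x = 0 := by
  induction b with
  | zero =>
    intro X _ σ x hx
    obtain ⟨y, hy, rfl⟩ := cl0_surj x
    rw [Hmap_cl0, cl0_eq_zero] at hx
    rw [cl0_eq_zero]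
    exact coind_inv_eq H σ _ _ hy (fun g => map_zero _) hx
  | succ n ih =>
    intro X _ σ x hx
    let S := coindSES H (shift σ)
    obtain ⟨z, rfl⟩ := S.δ_surj (coind_coAct_acyc H) n x
    have nat := δ_nat S (shift σ) H.subtype (ev1 H _) (ev1 H _) (ev1 H _) (ev1_compat H _) (ev1_compat H _)
      (ev1_compat H _) (fun _ => rfl) (fun _ => rfl) n z
    rw [hx] at nat
    match n with
    | 0 =>
      obtain ⟨w, hw⟩ := SES.ex_δ _ _ _ nat
      obtain ⟨y, hy, rfl⟩ := cl0_surj w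
      obtain ⟨v, hv, rfl⟩ := cl0_surj z
      have hw2 : (shift σ).q y = v.1 1 := by
        have := congrArg (val0 _) hw
        rwa [SES.Hq, val0_Hmap, val0_cl0, val0_Hmap] at this
      let c : coindS H (coAct H X) := ⟨fun _ => y, fun h g => (hy h).symm⟩
      have hc : ∀ g, coind H (coAct H X) g c = c := fun g => rfl
      have : cl0 v hv = S.Hq 0 (cl0 c hc) := by
        apply val0_inj
        rw [SES.Hq, val0_Hmap, val0_cl0, val0_cl0]
        refine coind_inv_eq H _ _ _ hv (fun g => ?_) hw2.symm
        have := S.hq g c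
        rw [MonoidHom.id_apply] at this
        rw [← this, hc]
      rw [this, SES.δ_q]
    | n+1 =>
      have := (shift σ).δ_inj coAct_acyc' _ _ nat
      rw [ih _ z this, map_zero]

section cyc
variable {Γ X : Type} [Group Γ] [AddCommGroup X]

/-- difference operator -/
def DD (ρ : Act Γ X) (t : Γ) : (Γ → X) →+ (Γ → X) where
  toFun φ g := φ (t * g) - ρ t (φ g)
  map_zero' := by ext; simp
  map_add' _ _ := by ext; simp; abel

lemma DD_equi (ρ : Act Γ X) (t : Γ) : Equi (coAct Γ X) (coAct Γ X) (DD ρ t) := by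
  intro g φ; ext x; simp [DD, coAct_apply, mul_assoc]

lemma DD_ker (ρ : Act Γ X) (t : Γ) (hz : ∀ g, ∃ k : ℤ, t ^ k = g) (φ) (h : DD ρ t φ = 0) : ∃ x, iot ρ x = φ := by
  refine ⟨φ 1, ?_⟩
  have h' : ∀ g, φ (t * g) = ρ t (φ g) := fun g => sub_eq_zero.1 (congrFun h g)
  ext g
  obtain ⟨k, rfl⟩ := hz g
  change ρ _ (φ 1) = _
  induction k using Int.induction_on with
  | zero => simp
  | succ i ih => rw [add_comm, zpow_add, zpow_one, h', ← ih, ρ.mul]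
  | pred i ih =>
    have h2 := h' (t ^ (-(i:ℤ) - 1))
    rw [← zpow_one_add] at h2
    have e : (1:ℤ) + (-(i:ℤ) - 1) = -i := by ring
    rw [e, ← ih] at h2
    have h3 := congrArg (ρ t⁻¹) h2
    rw [Act.inv_self, ← ρ.mul] at h3
    rw [← h3]
    congr 2
    rw [zpow_sub, zpow_one]
    exact ((Commute.refl t).inv_left.zpow_right _).eq.symm

lemma iot_DD (ρ : Act Γ X) (t : Γ) (x) : DD ρ t (iot ρ x) = 0 := by
  ext g; simp [DD, iot, ρ.mul]

lemma int_sum (v : ℤ → X) : ∃ F : ℤ → X, ∀ k, F (k+1) - F k = v k := by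
  refine ⟨fun k => match k with
    | .ofNat n => ∑ i ∈ Finset.range n, v i
    | .negSucc n => - ∑ i ∈ Finset.range (n+1), v (.negSucc i), fun k => ?_⟩
  match k with
  | .ofNat n =>
    change (∑ i ∈ Finset.range (n+1), v i) - ∑ i ∈ Finset.range n, v i = _
    rw [Finset.sum_range_succ]; simp
  | .negSucc 0 =>
    change (∑ i ∈ Finset.range 0, v i) - - ∑ i ∈ Finset.range (0+1), v (.negSucc i) = _
    simp
  | .negSucc (n+1) =>
    change (- ∑ i ∈ Finset.range (n+1), v (.negSucc i)) - - ∑ i ∈ Finset.range (n+1+1), v (.negSucc i) = _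
    rw [Finset.sum_range_succ _ (n+1)]; abel

lemma DD_surj (ρ : Act Γ X) (t : Γ) (hz : ∀ g, ∃ k : ℤ, t ^ k = g) (hi : ∀ k : ℤ, t ^ k = 1 → k = 0) (ψ) :
    ∃ φ, DD ρ t φ = ψ := by
  choose lg hlg using hz
  have hlg2 : ∀ k : ℤ, lg (t^k) = k := fun k => by
    have := hlg (t^k)
    rw [← mul_inv_eq_one, ← zpow_neg, ← zpow_add] at this
    have := hi _ this; omega
  obtain ⟨F, hF⟩ := int_sum (fun k => ρ (t^(-(k+1))) (ψ (t^k)))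
  refine ⟨fun g => ρ g (F (lg g)), ?_⟩
  ext g
  obtain ⟨k, rfl⟩ : ∃ k : ℤ, g = t ^ k := ⟨lg g, (hlg g).symm⟩
  simp only [DD, AddMonoidHom.coe_mk, ZeroHom.coe_mk]
  rw [← zpow_one_add, hlg2, hlg2, ← ρ.mul, ← zpow_one_add, ← map_sub, add_comm, hF, ← ρ.mul, ← zpow_add]
  simp

lemma infcyc (P : Serre) (ρ : Act Γ X) (t : Γ) (hz : ∀ g, ∃ k : ℤ, t ^ k = g) (hi : ∀ k : ℤ, t ^ k = 1 → k = 0)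
    (hX : P.P X) (n : ℕ) : P.P (Hn ρ n) := by
  let S : SES ρ (coAct Γ X) (coAct Γ X) :=
    { i := iot ρ
      q := DD ρ t
      hi := iot_equi ρ
      hq := DD_equi ρ t
      inj := iot_inj ρ
      surj := DD_surj ρ t hz hi
      qi := iot_DD ρ t
      ex := DD_ker ρ t hz }
  match n with
  | 0 => exact P.of_inj (val0 ρ) ((injective_iff_map_eq_zero _).1 (val0_inj ρ)) hX
  | 1 =>
    refine P.of_surj (S.δ 0) (S.δ_surj coAct_acyc' 0) ?_
    refine P.of_inj ((Pi.evalAddMonoidHom (fun _ : Γ => X) 1).comp (val0 (coAct Γ X))) ?_ hX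
    intro b hb
    apply val0_inj
    ext g
    have := congrFun (val0_fix _ b g) 1
    rw [coAct_apply, one_mul] at this
    rw [this]; simpa using hb
  | n+2 =>
    apply P.zero
    intro x
    obtain ⟨z, rfl⟩ := S.δ_surj coAct_acyc' (n+1) x
    rw [coAct_acyc' n z, map_zero]

lemma cyc_sum (t : Γ) (hz : ∀ g, ∃ k : ℤ, t ^ k = g) [Fintype Γ] (v : Γ → X) (hv : ∑ g, v g = 0) :
    ∃ χ : Γ → X, ∀ g, χ (t * g) - χ g = v g := by
  classical
  set n := orderOf t with hn
  have hn0 : 0 < n := orderOf_pos t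
  have hlg : ∀ g : Γ, ∃ k : ℕ, k < n ∧ t ^ k = g := fun g => by
    obtain ⟨k, rfl⟩ := hz g
    refine ⟨(k % n).toNat, ?_, ?_⟩
    · have := Int.emod_lt_of_pos k (b := n) (by exact_mod_cast hn0)
      have := Int.emod_nonneg k (b := n) (by omega)
      omega
    · rw [← zpow_natCast, Int.toNat_of_nonneg (Int.emod_nonneg k (by omega)), zpow_mod_orderOf]
  choose lg hl1 hl2 using hlg
  have hu : ∀ k, k < n → lg (t^k) = k := fun k hk =>
    pow_injOn_Iio_orderOf (hl1 _) hk (hl2 _)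
  have htot : ∑ i ∈ Finset.range n, v (t ^ i) = 0 := by
    rw [← hv]
    refine Finset.sum_bij (fun i _ => t ^ i) (fun _ _ => Finset.mem_univ _) ?_ ?_ (fun _ _ => rfl)
    · intro a ha b hb h
      exact pow_injOn_Iio_orderOf (Finset.mem_range.1 ha) (Finset.mem_range.1 hb) h
    · intro g _
      exact ⟨lg g, Finset.mem_range.2 (hl1 g), hl2 g⟩
  refine ⟨fun g => ∑ i ∈ Finset.range (lg g), v (t^i), fun g => ?_⟩
  have hg := hl2 g
  have h1 := hl1 g
  generalize lg g = k at hg h1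
  subst hg
  dsimp only
  rw [← pow_succ', hu k h1]
  by_cases h : k + 1 < n
  · rw [hu _ h, Finset.sum_range_succ]; abel
  · have e : k + 1 = n := by omega
    have h0 := hu 0 hn0
    rw [pow_zero] at h0
    have e2 : t ^ (k+1) = 1 := by rw [e, hn, pow_orderOf_eq_one]
    rw [← e, Finset.sum_range_succ] at htot
    rw [e2, h0, Finset.sum_range_zero, ← htot]; abel

/-- norm -/
def NN (ρ : Act Γ X) [Fintype Γ] : (Γ → X) →+ X where
  toFun φ := ∑ g, ρ g⁻¹ (φ g)
  map_zero' := by simp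
  map_add' _ _ := by simp [Finset.sum_add_distrib]

lemma NN_apply (ρ : Act Γ X) [Fintype Γ] (φ) : NN ρ φ = ∑ g, ρ g⁻¹ (φ g) := rfl

lemma NN_equi (ρ : Act Γ X) [Fintype Γ] : Equi (coAct Γ X) ρ (NN ρ) := by
  intro h φ
  rw [NN_apply, NN_apply, map_sum, MonoidHom.id_apply, ← Equiv.sum_comp (Equiv.mulRight h) (fun g => ρ h (ρ g⁻¹ (φ g)))]
  refine Finset.sum_congr rfl fun g _ => ?_
  rw [coAct_apply, ← ρ.mul]; simp

lemma NN_surj (ρ : Act Γ X) [Fintype Γ] : Function.Surjective (NN ρ) := by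
  classical
  intro x
  refine ⟨Pi.single 1 x, ?_⟩
  rw [NN_apply, Finset.sum_eq_single 1]
  · simp
  · intro b _ hb; rw [Pi.single_eq_of_ne hb, map_zero]
  · simp

lemma NN_DD (ρ : Act Γ X) [Fintype Γ] (t : Γ) (hc : ∀ g, t * g = g * t) (φ) : NN ρ (DD ρ t φ) = 0 := by
  rw [NN_apply]
  simp only [DD, AddMonoidHom.coe_mk, ZeroHom.coe_mk, map_sub, Finset.sum_sub_distrib]
  rw [sub_eq_zero, ← Equiv.sum_comp (Equiv.mulLeft t) (fun g => ρ g⁻¹ (ρ t (φ g)))]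
  refine Finset.sum_congr rfl fun g _ => ?_
  have e : (t * g)⁻¹ * t = g⁻¹ := by simp
  rw [Equiv.coe_mulLeft, ← ρ.mul, e]

lemma NN_ker (ρ : Act Γ X) [Fintype Γ] (t : Γ) (hz : ∀ g, ∃ k : ℤ, t ^ k = g) (hc : ∀ g, t * g = g * t) (ψ)
    (h : NN ρ ψ = 0) : ∃ φ, DD ρ t φ = ψ := by
  have hs : ∑ g, ρ (t*g)⁻¹ (ψ g) = 0 := by
    rw [NN_apply] at h
    have := congrArg (ρ t⁻¹) h
    rw [map_sum, map_zero] at this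
    rw [← this]
    refine Finset.sum_congr rfl fun g _ => ?_
    rw [← ρ.mul, hc, mul_inv_rev]
  obtain ⟨χ, hχ⟩ := cyc_sum t hz (fun g => ρ (t*g)⁻¹ (ψ g)) hs
  refine ⟨fun g => ρ g (χ g), ?_⟩
  ext g
  simp only [DD, AddMonoidHom.coe_mk, ZeroHom.coe_mk]
  rw [← ρ.mul, ← map_sub, hχ, ← ρ.mul]; simp

lemma card_inj {A B : Type} [AddCommGroup A] [AddCommGroup B] (k : ℕ) (f : A →+ B) (hf : ∀ a, f a = 0 → a = 0)
    (h : Finite B ∧ Nat.card B ≤ k) : Finite A ∧ Nat.card A ≤ k := by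
  have := h.1
  have hi := (injective_iff_map_eq_zero f).2 hf
  exact ⟨Finite.of_injective f hi, (Nat.card_le_card_of_injective f hi).trans h.2⟩

lemma card_surj {A B : Type} [AddCommGroup A] [AddCommGroup B] (k : ℕ) (f : A →+ B) (hf : Function.Surjective f)
    (h : Finite A ∧ Nat.card A ≤ k) : Finite B ∧ Nat.card B ≤ k := by
  have := h.1
  exact ⟨Finite.of_surjective f hf, (Nat.card_le_card_of_surjective f hf).trans h.2⟩

lemma fincyc [Finite Γ] (ρ : Act Γ X) (t : Γ) (hz : ∀ g, ∃ k : ℤ, t ^ k = g)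
    (k : ℕ) (hX : Finite X ∧ Nat.card X ≤ k) (n : ℕ) : Finite (Hn ρ n) ∧ Nat.card (Hn ρ n) ≤ k := by
  let _ := Fintype.ofFinite Γ
  have hc : ∀ g, t * g = g * t := fun g => by
    obtain ⟨k, rfl⟩ := hz g
    exact ((Commute.refl t).zpow_right k).eq
  let Y := (DD ρ t).range
  let σ : Act Γ Y := sAct (coAct Γ X) Y (range_inv _ _ _ (DD_equi ρ t))
  have hq : Equi (coAct Γ X) σ (DD ρ t).rangeRestrict := fun g φ => Subtype.ext (DD_equi ρ t g φ)
  let S : SES ρ (coAct Γ X) σ :=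
    { i := iot ρ
      q := (DD ρ t).rangeRestrict
      hi := iot_equi ρ
      hq := hq
      inj := iot_inj ρ
      surj := AddMonoidHom.rangeRestrict_surjective _
      qi := fun x => Subtype.ext (iot_DD ρ t x)
      ex := fun φ h => DD_ker ρ t hz φ (congrArg Subtype.val h) }
  let S' : SES σ (coAct Γ X) ρ :=
    { i := Y.subtype
      q := NN ρ
      hi := fun _ _ => rfl
      hq := NN_equi ρ
      inj := Y.subtype_injective
      surj := NN_surj ρ
      qi := by rintro ⟨_, φ, rfl⟩; exact NN_DD ρ t hc φ
      ex := fun ψ h => by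
        obtain ⟨φ, hφ⟩ := NN_ker ρ t hz hc ψ h
        exact ⟨⟨ψ, φ, hφ⟩, rfl⟩ }
  induction n using Nat.strong_induction_on with
  | _ n ih =>
  match n with
  | 0 => exact card_inj k (val0 ρ) ((injective_iff_map_eq_zero _).1 (val0_inj ρ)) hX
  | 1 =>
    refine card_surj k (S.δ 0) (S.δ_surj coAct_acyc' 0) ?_
    refine card_inj k (((Pi.evalAddMonoidHom (fun _ : Γ => X) 1).comp Y.subtype).comp (val0 σ)) ?_ hX
    intro b hb
    apply val0_inj
    ext g
    have := congrFun (congrArg Subtype.val (val0_fix _ b g)) 1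
    rw [sAct_coe, coAct_apply, one_mul] at this
    rw [this]; simpa using hb
  | n+2 =>
    refine card_surj k ((S.δ (n+1)).comp (S'.δ n)) ?_ (ih n (by omega))
    intro x
    obtain ⟨y, rfl⟩ := S.δ_surj coAct_acyc' (n+1) x
    obtain ⟨z, rfl⟩ := S'.δ_surj coAct_acyc' n y
    exact ⟨z, rfl⟩

end cyc
end TB
end

section
namespace TB

section serre

lemma fin_exact {A B C : Type} [AddCommGroup A] [AddCommGroup B] [AddCommGroup C] (f : A →+ B)
    (g : B →+ C) (h : ∀ b, g b = 0 → ∃ a, f a = b) (hA : Finite A) (hC : Finite C) : Finite B := by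
  rw [AddMonoidHom.finite_iff_finite_ker_range g]
  refine ⟨?_, inferInstance⟩
  have : Finite f.range := Finite.of_surjective f.rangeRestrict f.rangeRestrict_surjective
  exact Finite.of_injective (fun x : g.ker => (⟨x.1, h x.1 x.2⟩ : f.range)) (fun a b hab => by
    apply Subtype.ext; exact congrArg (fun x : f.range => x.1) hab)

/-- trivial groups -/
def sTriv : Serre where
  P A _ := ∀ a : A, a = 0
  zero A _ h := h
  exact A B C _ _ _ f g h hA hC := fun b => by
    obtain ⟨a, rfl⟩ := h b (hC _)
    rw [hA a, map_zero]

/-- finite groups -/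
def sFin : Serre where
  P A _ := Finite A
  zero A _ h := by
    have : Subsingleton A := ⟨fun a b => by rw [h a, h b]⟩
    infer_instance
  exact A B C _ _ _ f g h hA hC := fin_exact f g h hA hC

/-- bounded groups -/
def sBd : Serre where
  P A _ := ∃ m : ℕ, m ≠ 0 ∧ ∀ a : A, m • a = 0
  zero A _ h := ⟨1, one_ne_zero, fun a => by rw [h a, smul_zero]⟩
  exact A B C _ _ _ f g h := by
    rintro ⟨m, hm, h1⟩ ⟨k, hk, h2⟩
    refine ⟨m * k, mul_ne_zero hm hk, fun b => ?_⟩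
    obtain ⟨a, ha⟩ := h (k • b) (by rw [map_nsmul, h2])
    rw [mul_smul, ← ha, ← map_nsmul, h1, map_zero]

/-- torsion groups -/
def sTor : Serre where
  P A _ := ∀ a : A, ∃ m : ℕ, m ≠ 0 ∧ m • a = 0
  zero A _ h := fun a => ⟨1, one_ne_zero, by rw [h a, smul_zero]⟩
  exact A B C _ _ _ f g h := by
    intro h1 h2 b
    obtain ⟨k, hk, h2⟩ := h2 (g b)
    obtain ⟨a, ha⟩ := h (k • b) (by rw [map_nsmul, h2])
    obtain ⟨m, hm, h1⟩ := h1 a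
    refine ⟨m * k, mul_ne_zero hm hk, ?_⟩
    rw [mul_smul, ← ha, ← map_nsmul, h1, map_zero]

lemma Serre.add (P : Serre) {A B : Type} [AddCommGroup A] [AddCommGroup B] (hA : P.P A) (hB : P.P B) : P.P (A × B) :=
  P.exact A (A × B) B (AddMonoidHom.inl A B) (AddMonoidHom.snd A B) (fun b hb => ⟨b.1, by
    ext; simp; simpa using hb.symm⟩) hA hB

lemma Serre.pow (P : Serre) {A : Type} [AddCommGroup A] (hA : P.P A) : ∀ n, P.P (Fin n → A)
  | 0 => P.zero _ (fun a => Subsingleton.elim _ _)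
  | n+1 => by
    refine P.exact A _ (Fin n → A) (AddMonoidHom.single (fun _ => A) 0)
      { toFun := fun f i => f i.succ, map_zero' := rfl, map_add' := fun _ _ => rfl } ?_ hA (Serre.pow P hA n)
    intro b hb
    refine ⟨b 0, ?_⟩
    ext i
    refine Fin.cases ?_ (fun i => ?_) i
    · simp
    · simpa using (congrFun hb i).symm
end serre

section cer
variable {A B C : Type} [AddCommGroup A] [AddCommGroup B] [AddCommGroup C]

/-- m-torsion -/
abbrev tor (m : ℕ) (A : Type) [AddCommGroup A] : AddSubgroup A := (nsmulAddMonoidHom (α := A) m).ker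
/-- multiples -/
abbrev mul (m : ℕ) (A : Type) [AddCommGroup A] : AddSubgroup A := (nsmulAddMonoidHom (α := A) m).range

lemma mem_tor {m : ℕ} {a : A} : a ∈ tor m A ↔ m • a = 0 := Iff.rfl
lemma tor_smul {m : ℕ} (a : tor m A) : m • a.1 = 0 := a.2
lemma mem_mul {m : ℕ} {a : A} : a ∈ mul m A ↔ ∃ b, m • b = a := Iff.rfl

lemma fg_tor_fin [AddGroup.FG A] (h : ∀ a : A, ∃ m : ℕ, m ≠ 0 ∧ m • a = 0) : Finite A := by
  have : Module.Finite ℤ A := Module.Finite.iff_addGroup_fg.mpr inferInstance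
  apply Module.finite_of_fg_torsion
  intro a
  obtain ⟨m, hm, h⟩ := h a
  refine ⟨⟨(m:ℤ), by simpa using hm⟩, ?_⟩
  change (m:ℤ) • a = 0
  rw [natCast_zsmul, h]

lemma card_quot_mul [Finite A] (m : ℕ) : Nat.card (A ⧸ mul m A) = Nat.card (tor m A) := by
  have h1 := (mul m A).card_mul_index
  have h2 := (tor m A).card_mul_index
  rw [AddSubgroup.index_ker] at h2
  have h3 : 0 < Nat.card (mul m A) := Nat.card_pos
  have : Nat.card (mul m A) * (mul m A).index = Nat.card (mul m A) * Nat.card (tor m A) := by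
    rw [h1, ← h2, mul_comm]
  exact Nat.eq_of_mul_eq_mul_left h3 this

lemma fin_quot_mul (m : ℕ) (h : ∀ a : A, ∃ m : ℕ, m ≠ 0 ∧ m • a = 0) (hf : Finite (tor m A)) :
    Finite (A ⧸ mul m A) := by
  classical
  by_contra hinf
  have : Infinite (A ⧸ mul m A) := not_finite_iff_infinite.1 hinf
  obtain ⟨s, hs⟩ := Infinite.exists_subset_card_eq (A ⧸ mul m A) (Nat.card (tor m A) + 1)
  let W : AddSubgroup A := AddSubgroup.closure (s.image Quotient.out : Finset A)
  have hW : AddGroup.FG W := AddGroup.closure_finset_fg _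
  have hWf : Finite W := fg_tor_fin (fun a => by
    obtain ⟨m, hm, h⟩ := h a
    exact ⟨m, hm, Subtype.ext h⟩)
  let F : W ⧸ mul m W →+ A ⧸ mul m A := QuotientAddGroup.map _ _ W.subtype (by
    rintro _ ⟨x, rfl⟩
    exact ⟨x, rfl⟩)
  have h1 : (s : Set _) ⊆ Set.range F := by
    intro x hx
    refine ⟨QuotientAddGroup.mk' _ ⟨x.out, AddSubgroup.subset_closure (Finset.mem_coe.2 (Finset.mem_image_of_mem _ hx))⟩, ?_⟩
    exact Quotient.out_eq x
  have h2 : s.card ≤ Nat.card (W ⧸ mul m W) := by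
    have h3 : Nat.card (Set.range F) ≤ Nat.card (W ⧸ mul m W) := Finite.card_range_le F
    refine le_trans ?_ h3
    have h5 := Set.ncard_le_ncard h1 (Set.toFinite _)
    rwa [Set.ncard_coe_finset] at h5
  rw [card_quot_mul, hs] at h2
  have h4 : Nat.card (tor m W) ≤ Nat.card (tor m A) :=
    Nat.card_le_card_of_injective (fun x : tor m W => (⟨x.1.1, congrArg Subtype.val x.2⟩ : tor m A))
      (fun a b hab => by
        apply Subtype.ext; apply Subtype.ext; exact congrArg (fun x : tor m A => x.1) hab)
  omega

/-- Chernikov groups with primes dividing m -/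
def Cer (m : ℕ) (A : Type) [AddCommGroup A] : Prop := (∀ a : A, ∃ k : ℕ, m ^ k • a = 0) ∧ Finite (tor m A)

lemma Cer.tors {m : ℕ} (hm : m ≠ 0) (h : Cer m A) : ∀ a : A, ∃ k : ℕ, k ≠ 0 ∧ k • a = 0 := fun a => by
  obtain ⟨k, hk⟩ := h.1 a
  exact ⟨m^k, pow_ne_zero _ hm, hk⟩

lemma Cer.inj {m : ℕ} (f : A →+ B) (hf : Function.Injective f) (h : Cer m B) : Cer m A := by
  refine ⟨fun a => ?_, ?_⟩
  · obtain ⟨k, hk⟩ := h.1 (f a)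
    exact ⟨k, hf (by rw [map_nsmul, hk, map_zero])⟩
  · have := h.2
    exact Finite.of_injective (fun x : tor m A => (⟨f x.1, by rw [mem_tor, ← map_nsmul, tor_smul, map_zero]⟩ : tor m B))
      (fun a b hab => Subtype.ext (hf (congrArg (fun x : tor m B => x.1) hab)))

lemma Cer.surj {m : ℕ} (hm : m ≠ 0) (f : A →+ B) (hf : Function.Surjective f) (h : Cer m A) : Cer m B := by
  refine ⟨fun b => ?_, ?_⟩
  · obtain ⟨a, rfl⟩ := hf b
    obtain ⟨k, hk⟩ := h.1 a
    exact ⟨k, by rw [← map_nsmul, hk, map_zero]⟩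
  · have hU : Cer m f.ker := h.inj f.ker.subtype f.ker.subtype_injective
    have h1 := fin_quot_mul m (hU.tors hm) hU.2
    let V : AddSubgroup A := (f.ker).comap (nsmulAddMonoidHom m)
    let g : V →+ f.ker ⧸ mul m f.ker := (QuotientAddGroup.mk' _).comp
      { toFun := fun v => ⟨m • v.1, v.2⟩, map_zero' := by simp, map_add' := fun a b => by ext; simp }
    have hV : ∀ v : V, g v = 0 → ∃ a : tor m A, ∃ u : f.ker, v.1 = a.1 + u.1 := by
      intro v hv
      have : (⟨m • v.1, v.2⟩ : f.ker) ∈ mul m f.ker := (QuotientAddGroup.eq_zero_iff _).1 hv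
      obtain ⟨u, hu⟩ := this
      have hu' : m • u.1 = m • v.1 := congrArg Subtype.val hu
      exact ⟨⟨v.1 - u.1, by rw [mem_tor, smul_sub, hu', sub_self]⟩, u, by simp⟩
    have h2 : Finite g.range := inferInstance
    have hg : Finite (V ⧸ g.ker) := Finite.of_equiv _ (QuotientAddGroup.quotientKerEquivRange g).symm.toEquiv
    have h3 := h.2
    let Φ : tor m A × (V ⧸ g.ker) → B := fun x => f x.1.1 + f x.2.out.1
    refine Finite.Set.subset (s := Set.range Φ) (t := (tor m B : Set B)) ?_
    intro b hb
    obtain ⟨a, rfl⟩ := hf b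
    have ha : a ∈ V := by
      change f (m • a) = 0
      rw [map_nsmul]; exact hb
    let v : V := ⟨a, ha⟩
    obtain ⟨k, hk⟩ := QuotientAddGroup.mk_out_eq_mul g.ker v
    obtain ⟨x, u, hx⟩ := hV (-k.1) (by rw [map_neg, k.2.out, neg_zero])
    refine ⟨(x, QuotientAddGroup.mk v), ?_⟩
    change f x.1 + f (QuotientAddGroup.mk v : V ⧸ g.ker).out.1 = f a
    rw [hk]
    have e : f u.1 = 0 := u.2
    have hx' : -k.1.1 = x.1 + u.1 := hx
    have e3 : k.1.1 = -(x.1 + u.1) := by rw [← hx', neg_neg]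
    rw [AddSubgroup.coe_add, e3]
    simp [v, e]

/-- Serre class -/
def sCer (m : ℕ) (hm : m ≠ 0) : Serre where
  P A _ := Cer m A
  zero A _ h := by
    have : Subsingleton A := ⟨fun a b => by rw [h a, h b]⟩
    exact ⟨fun a => ⟨0, by rw [h a, smul_zero]⟩, inferInstance⟩
  exact A B C _ _ _ f g h := by
    intro h1 h2
    refine ⟨fun b => ?_, ?_⟩
    · obtain ⟨k, h2⟩ := h2.1 (g b)
      obtain ⟨a, ha⟩ := h (m^k • b) (by rw [map_nsmul, h2])
      obtain ⟨l, h1⟩ := h1.1 a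
      exact ⟨l + k, by rw [pow_add, mul_smul, ← ha, ← map_nsmul, h1, map_zero]⟩
    · have hr : Cer m f.range := h1.surj hm f.rangeRestrict f.rangeRestrict_surjective
      let i : tor m f.range →+ tor m B := (f.range.subtype.comp (tor m f.range).subtype).codRestrict _ (fun x => by
        have := congrArg Subtype.val x.2.out
        exact this)
      let q : tor m B →+ tor m C := (g.comp (tor m B).subtype).codRestrict _ (fun x => by
        rw [mem_tor, ← map_nsmul]
        have : m • x.1 = 0 := x.2.out
        change g (m • x.1) = 0
        rw [this, map_zero])
      refine fin_exact i q ?_ hr.2 h2.2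
      intro b hb
      obtain ⟨a, ha⟩ := h b.1 (congrArg Subtype.val hb)
      exact ⟨⟨⟨b.1, a, ha⟩, Subtype.ext b.2.out⟩, rfl⟩

lemma Cer.tor_pow {m : ℕ} (h : Cer m A) (k : ℕ) : Finite (tor (m^k) A) := by
  induction k with
  | zero =>
    have : ∀ a : tor (m^0) A, a = 0 := fun a => Subtype.ext (by
      have := tor_smul a
      generalize a.1 = b at this
      rw [pow_zero, one_smul] at this; exact this)
    exact sFin.zero _ this
  | succ k ih =>
    have h1 := h.2
    let q : tor (m^(k+1)) A →+ tor (m^k) A :=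
      ((nsmulAddMonoidHom m).comp (tor (m^(k+1)) A).subtype).codRestrict _ (fun x => by
        have : m^(k+1) • x.1 = 0 := x.2.out
        change m^k • (m • x.1) = 0
        rw [← mul_smul, ← pow_succ, this])
    let i : tor m A →+ tor (m^(k+1)) A := (tor m A).subtype.codRestrict _ (fun x => by
        have : m • x.1 = 0 := x.2.out
        change m^(k+1) • x.1 = 0
        rw [pow_succ, mul_smul, this, smul_zero])
    exact fin_exact i q (fun b hb => ⟨⟨b.1, congrArg Subtype.val hb⟩, rfl⟩) h1 ih

lemma Cer.div {m : ℕ} (hm : m ≠ 0) (h : Cer m A) : ∃ k : ℕ, Finite (A ⧸ mul (m^k) A) ∧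
    ∀ a ∈ mul (m^k) A, ∃ b ∈ mul (m^k) A, m • b = a := by
  have hanti : Antitone (fun k => (((tor m A : Set A) ∩ mul (m^k) A : Set A))) := by
    refine antitone_nat_of_succ_le fun k => ?_
    rintro x ⟨hx, y, rfl⟩
    refine ⟨hx, m • y, ?_⟩
    change m^k • m • y = m^(k+1) • y
    rw [← mul_smul, ← pow_succ]
  have hfin := h.2
  have : ∃ k, ∀ i, k ≤ i → ∀ a, m • a = 0 → a ∈ mul (m^k) A → a ∈ mul (m^i) A := by
    let c : ℕ → ℕ := fun k => Set.ncard ((tor m A : Set A) ∩ mul (m^k) A : Set A)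
    have hf : ∀ k, ((tor m A : Set A) ∩ mul (m^k) A : Set A).Finite := fun k =>
      Set.Finite.subset (Set.toFinite (tor m A : Set A)) Set.inter_subset_left
    obtain ⟨k, hk⟩ : ∃ k, ∀ i, c k ≤ c i := by
      obtain ⟨_, ⟨k, rfl⟩, hk⟩ := WellFounded.has_min (wellFounded_lt (α := ℕ)) (Set.range c) ⟨_, 0, rfl⟩
      exact ⟨k, fun i => not_lt.1 (hk _ ⟨i, rfl⟩)⟩
    refine ⟨k, fun i hi a ha hak => ?_⟩
    have := Set.eq_of_subset_of_ncard_le (hanti hi) (hk i) (hf k)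
    have h2 : a ∈ ((tor m A : Set A) ∩ mul (m^k) A : Set A) := ⟨ha, hak⟩
    simp only [] at this
    rw [← this] at h2
    exact h2.2
  obtain ⟨k, hk⟩ := this
  refine ⟨k, fin_quot_mul _ (h.tors hm) (h.tor_pow k), ?_⟩
  have key : ∀ j, ∀ a ∈ mul (m^k) A, m^j • a = 0 → ∀ i, a ∈ mul (m^i) A := by
    intro j
    induction j with
    | zero => intro a _ h0 i; rw [pow_zero, one_smul] at h0; rw [h0]; exact zero_mem _
    | succ j ih =>
      intro a ha h0 i
      have h1 : m^j • a ∈ mul (m^(j+i+k)) A := by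
        apply hk _ (by omega)
        · rw [← mul_smul, ← pow_succ', h0]
        · exact AddSubgroup.nsmul_mem _ ha _
      obtain ⟨b, hb⟩ := h1
      have hb' : m^(j+i+k) • b = m^j • a := hb
      have h2 := ih (a - m^(i+k) • b) (AddSubgroup.sub_mem _ ha ⟨m^i • b, by
        change m^k • m^i • b = _; rw [← mul_smul, ← pow_add, add_comm]⟩) (by
          rw [smul_sub, ← hb', ← mul_smul, ← pow_add, ← add_assoc, sub_self]) i
      have h3 : m^(i+k) • b ∈ mul (m^i) A := ⟨m^k • b, by
        change m^i • m^k • b = _; rw [← mul_smul, ← pow_add]⟩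
      have := AddSubgroup.add_mem _ h2 h3
      rwa [sub_add_cancel] at this
  intro a ha
  obtain ⟨j, hj⟩ := h.1 a
  obtain ⟨b, hb⟩ := key j a ha hj (k+1)
  refine ⟨m^k • b, ⟨b, rfl⟩, ?_⟩
  rw [← hb, ← mul_smul, ← pow_succ']; rfl

end cer
end TB
end

section
namespace TB

section dv
variable {A B C D X Y : Type} [AddCommGroup A] [AddCommGroup B] [AddCommGroup C] [AddCommGroup D]
  [AddCommGroup X] [AddCommGroup Y]

/-- divisible -/
def Dv (A : Type) [AddCommGroup A] : Prop := ∀ n : ℕ, n ≠ 0 → ∀ a : A, ∃ b, n • b = a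

lemma Dv.ext (hD : Dv D) (i : X →+ Y) (hi : Function.Injective i) (g : X →+ D) :
    ∃ h : Y →+ D, ∀ x, h (i x) = g x := by
  let _ : DivisibleBy D ℤ := divisibleByOfSMulRightSurj D ℤ (fun {n} hn a => by
    obtain ⟨b, hb⟩ := hD n.natAbs (Int.natAbs_ne_zero.2 hn) a
    rcases Int.natAbs_eq n with h | h
    · refine ⟨b, ?_⟩
      dsimp only
      rw [h, natCast_zsmul, hb]
    · refine ⟨-b, ?_⟩
      dsimp only
      rw [h, neg_smul, natCast_zsmul, smul_neg, neg_neg, hb])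
  have hI : Module.Injective ℤ D := (Module.Baer.of_divisible D).injective
  obtain ⟨h, hh⟩ := hI.out i.toIntLinearMap hi g.toIntLinearMap
  exact ⟨h.toAddMonoidHom, hh⟩

lemma Dv.surj (hD : Dv A) (f : A →+ B) (hf : Function.Surjective f) : Dv B := by
  intro n hn b
  obtain ⟨a, rfl⟩ := hf b
  obtain ⟨c, rfl⟩ := hD n hn a
  exact ⟨f c, by rw [map_nsmul]⟩

lemma cop_surj {n k : ℕ} (h : Nat.Coprime n k) (a : A) (ha : k • a = 0) : ∃ z : ℤ, n • (z • a) = a := by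
  refine ⟨Nat.gcdA n k, ?_⟩
  have := Nat.gcd_eq_gcd_ab n k
  rw [h.gcd_eq_one] at this
  rw [← natCast_zsmul, ← mul_smul]
  have e : (n:ℤ) * n.gcdA k = 1 - k * n.gcdB k := by push_cast at this; linarith
  rw [e, sub_smul, one_smul, mul_comm, mul_smul, natCast_zsmul, ha, smul_zero, sub_zero]

lemma dv_of {m : ℕ} (h : ∀ a : A, ∃ k : ℕ, m ^ k • a = 0) (hm : ∀ a : A, ∃ b, m • b = a) : Dv A := by
  intro n
  induction n using Nat.recOnPrimePow with
  | zero => intro h; exact absurd rfl h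
  | one => intro _ a; exact ⟨a, one_smul _ _⟩
  | prime_pow_mul n p k hp hpn hk ih =>
    intro hn a
    have hn' : n ≠ 0 := right_ne_zero_of_mul hn
    have hps : ∀ a : A, ∃ b, p • b = a := fun a => by
      by_cases hpm : p ∣ m
      · obtain ⟨c, rfl⟩ := hpm
        obtain ⟨b, hb⟩ := hm a
        exact ⟨c • b, by rw [← mul_smul, hb]⟩
      · obtain ⟨k, hk⟩ := h a
        obtain ⟨z, hz⟩ := cop_surj (((Nat.Prime.coprime_iff_not_dvd hp).2 hpm).pow_right k) a hk
        exact ⟨_, hz⟩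
    have hpk : ∀ k, ∀ a : A, ∃ b, p^k • b = a := by
      intro k
      induction k with
      | zero => intro a; exact ⟨a, by simp⟩
      | succ k ih =>
        intro a
        obtain ⟨b, rfl⟩ := ih a
        obtain ⟨c, rfl⟩ := hps b
        exact ⟨c, by rw [pow_succ, mul_smul]⟩
    obtain ⟨b, rfl⟩ := hpk k a
    obtain ⟨c, rfl⟩ := ih hn' b
    exact ⟨c, by rw [mul_smul]⟩

end dv

section prufer
variable {A D : Type} [AddCommGroup A] [AddCommGroup D]

lemma prufer_tors (p : ℕ) (x : pruferSubgroup p) : ∃ k : ℕ, p^k • x = 0 := by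
  obtain ⟨x, k, hk⟩ := x
  exact ⟨k, Subtype.ext hk⟩

lemma prufer_dv {p : ℕ} (hp : p.Prime) : Dv (pruferSubgroup p) := by
  refine dv_of (prufer_tors p) ?_
  rintro ⟨x, k, hk⟩
  obtain ⟨r, rfl⟩ := QuotientAddGroup.mk'_surjective _ x
  have e : p • (QuotientAddGroup.mk' (AddSubgroup.zmultiples (1:ℚ)) (r / p)) = QuotientAddGroup.mk' _ r := by
    rw [← map_nsmul, nsmul_eq_mul, mul_div_cancel₀]
    exact_mod_cast hp.ne_zero
  refine ⟨⟨QuotientAddGroup.mk' _ (r / p), k+1, ?_⟩, Subtype.ext e⟩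
  rw [pow_succ, mul_smul, e]; exact hk

lemma circle_mk_eq_zero (r : ℚ) : QuotientAddGroup.mk' (AddSubgroup.zmultiples (1:ℚ)) r = 0 ↔ ∃ k : ℤ, (k:ℚ) = r := by
  rw [QuotientAddGroup.mk'_apply, QuotientAddGroup.eq_zero_iff, AddSubgroup.mem_zmultiples_iff]
  simp

/-- generator of the socle -/
def pu (p : ℕ) (hp : p.Prime) : pruferSubgroup p := ⟨QuotientAddGroup.mk' _ (1 / p), 1, by
  rw [← map_nsmul, circle_mk_eq_zero]
  refine ⟨1, ?_⟩
  have : (p:ℚ) ≠ 0 := by exact_mod_cast hp.ne_zero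
  simp [this]⟩

lemma pu_smul (p : ℕ) (hp : p.Prime) : p • pu p hp = 0 := by
  have : (p:ℚ) ≠ 0 := by exact_mod_cast hp.ne_zero
  apply Subtype.ext
  change p • QuotientAddGroup.mk' _ (1 / (p:ℚ)) = 0
  rw [← map_nsmul, circle_mk_eq_zero]
  exact ⟨1, by simp [this]⟩

lemma pu_ne (p : ℕ) (hp : p.Prime) : pu p hp ≠ 0 := by
  intro h
  have h := congrArg Subtype.val h
  change QuotientAddGroup.mk' _ (1 / (p:ℚ)) = 0 at h
  rw [circle_mk_eq_zero] at h
  obtain ⟨k, hk⟩ := h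
  have : (p:ℚ) ≠ 0 := by exact_mod_cast hp.ne_zero
  rw [eq_div_iff this] at hk
  have hk : k * p = 1 := by exact_mod_cast hk
  have := Int.isUnit_iff.1 (IsUnit.of_mul_eq_one_right _ hk)
  have := hp.two_le
  omega

lemma pu_gen (p : ℕ) (hp : p.Prime) (x : pruferSubgroup p) (hx : p • x = 0) : ∃ k : ℤ, k • pu p hp = x := by
  obtain ⟨x, hx'⟩ := x
  obtain ⟨r, rfl⟩ := QuotientAddGroup.mk'_surjective _ x
  have h := congrArg Subtype.val hx
  change p • QuotientAddGroup.mk' _ r = 0 at h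
  rw [← map_nsmul, circle_mk_eq_zero] at h
  obtain ⟨k, hk⟩ := h
  refine ⟨k, Subtype.ext ?_⟩
  change k • QuotientAddGroup.mk' _ (1 / (p:ℚ)) = _
  have : (p:ℚ) ≠ 0 := by exact_mod_cast hp.ne_zero
  rw [← map_zsmul]
  congr 1
  rw [zsmul_eq_mul, hk, nsmul_eq_mul]; field_simp

lemma zmod_inj {p : ℕ} (hp : p.Prime) (f : ZMod p →+ A) (h : f 1 ≠ 0) : Function.Injective f := by
  have := Fact.mk hp
  rw [injective_iff_map_eq_zero]
  intro a ha
  by_contra h0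
  apply h
  have e : (1 : ZMod p) = (a⁻¹).val • a := by
    rw [nsmul_eq_mul, ZMod.natCast_val, ZMod.cast_id, inv_mul_cancel₀ h0]
  rw [e, map_nsmul, ha, smul_zero]

lemma prufer_inj {p : ℕ} (hp : p.Prime) (f : pruferSubgroup p →+ A) (h : f (pu p hp) ≠ 0) : Function.Injective f := by
  rw [injective_iff_map_eq_zero]
  intro a ha
  by_contra h0
  obtain ⟨k, hk⟩ := prufer_tors p a
  have : ∃ j, p^j • a ≠ 0 ∧ p^(j+1) • a = 0 := by
    by_contra hc
    push Not at hc
    have : ∀ j, p^j • a ≠ 0 := fun j => by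
      induction j with
      | zero => simpa using h0
      | succ j ih => exact hc j ih
    exact this k hk
  obtain ⟨j, hj, hj2⟩ := this
  obtain ⟨z, hz⟩ := pu_gen p hp (p^j • a) (by rw [← mul_smul, ← pow_succ', hj2])
  have hzp : ¬ (p:ℤ) ∣ z := by
    rintro ⟨w, rfl⟩
    rw [mul_comm, mul_smul, natCast_zsmul, pu_smul, smul_zero] at hz
    exact hj hz.symm
  have hco : IsCoprime (p:ℤ) z := (Int.isCoprime_iff_gcd_eq_one.2 (by
    rw [Int.gcd_comm]
    have := (Nat.Prime.coprime_iff_not_dvd hp).2 (fun hd => hzp (Int.natCast_dvd.2 hd))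
    rw [Nat.coprime_comm] at this
    exact this))
  obtain ⟨u, v, huv⟩ := hco
  apply h
  have e : pu p hp = v • (p^j • a) := by
    rw [← hz, ← mul_smul]
    have : v * z = 1 - u * p := by linarith
    rw [this, sub_smul, one_smul, mul_smul, natCast_zsmul, pu_smul, smul_zero, sub_zero]
  rw [e, map_zsmul, map_nsmul, ha, smul_zero, smul_zero]

lemma prufer_embed {p : ℕ} (hp : p.Prime) (hD : Dv D) (d : D) (hd : d ≠ 0) (hpd : p • d = 0) :
    ∃ f : pruferSubgroup p →+ D, Function.Injective f ∧ f (pu p hp) = d := by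
  have h1 : ∀ {E : Type} [AddCommGroup E] (e : E) (he : p • e = 0), ∃ f : ZMod p →+ E, f 1 = e := by
    intro E _ e he
    refine ⟨ZMod.lift p ⟨(zmultiplesHom E) e, by simpa using he⟩, ?_⟩
    have := ZMod.lift_coe p ⟨(zmultiplesHom E) e, by simpa using he⟩ 1
    rw [Int.cast_one] at this
    rw [this]; simp
  obtain ⟨i, hi⟩ := h1 (pu p hp) (pu_smul p hp)
  obtain ⟨g, hg⟩ := h1 d hpd
  obtain ⟨f, hf⟩ := hD.ext i (zmod_inj hp i (by rw [hi]; exact pu_ne p hp)) g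
  have hfd : f (pu p hp) = d := by rw [← hi, hf, hg]
  exact ⟨f, prufer_inj hp f (by rw [hfd]; exact hd), hfd⟩

/-- cons -/
def consEquiv (r : ℕ) (q : ℕ) (p : Fin r → ℕ) :
    (pruferSubgroup q × ((i : Fin r) → pruferSubgroup (p i))) ≃+
      ((i : Fin (r+1)) → pruferSubgroup ((Fin.cons q p : Fin (r+1) → ℕ) i)) where
  toFun x := Fin.cons (α := fun i => pruferSubgroup ((Fin.cons q p : Fin (r+1) → ℕ) i)) x.1 x.2
  invFun f := (f 0, fun i => f i.succ)
  left_inv x := rfl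
  right_inv f := by
    funext i
    refine Fin.cases ?_ (fun i => ?_) i <;> rfl
  map_add' x y := by
    funext i
    refine Fin.cases ?_ (fun i => ?_) i <;> rfl

lemma exists_prime_tor {m : ℕ} (hm : m ≠ 0) (h : ∀ a : A, ∃ k : ℕ, m ^ k • a = 0) (a : A) (ha : a ≠ 0) :
    ∃ q : ℕ, q.Prime ∧ q ∣ m ∧ ∃ d : A, d ≠ 0 ∧ q • d = 0 := by
  obtain ⟨k, hk⟩ := h a
  have h1 : addOrderOf a ≠ 1 := fun h => ha (AddMonoid.addOrderOf_eq_one_iff.1 h)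
  obtain ⟨q, hq, hd⟩ := Nat.exists_prime_and_dvd h1
  have h2 : addOrderOf a ∣ m^k := addOrderOf_dvd_of_nsmul_eq_zero hk
  refine ⟨q, hq, hq.dvd_of_dvd_pow (hd.trans h2), (addOrderOf a / q) • a, ?_, ?_⟩
  · intro h0
    have h3 := addOrderOf_dvd_of_nsmul_eq_zero h0
    have h4 : 0 < addOrderOf a := Nat.pos_of_ne_zero (fun h => by
      rw [h] at h2; exact pow_ne_zero k hm (Nat.eq_zero_of_zero_dvd h2))
    have := Nat.le_of_dvd (Nat.div_pos (Nat.le_of_dvd h4 hd) hq.pos) h3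
    have := Nat.div_lt_self h4 hq.one_lt
    omega
  · rw [← mul_smul, Nat.mul_div_cancel' hd, addOrderOf_nsmul_eq_zero]

lemma dv_struct (m : ℕ) (hm : m ≠ 0) : ∀ (c : ℕ) (D : Type) [AddCommGroup D], Dv D → Cer m D → Nat.card (tor m D) ≤ c →
    ∃ (r : ℕ) (p : Fin r → ℕ), (∀ i, (p i).Prime ∧ p i ∣ m) ∧ Nonempty (D ≃+ ((i : Fin r) → pruferSubgroup (p i))) := by
  intro c
  induction c with
  | zero =>
    intro D _ hD hC hc
    have := hC.2
    have := Nat.card_pos (α := tor m D)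
    omega
  | succ c ih =>
    intro D _ hD hC hc
    by_cases h0 : ∀ d : D, d = 0
    · refine ⟨0, Fin.elim0, fun i => i.elim0, ⟨?_⟩⟩
      have : Unique D := ⟨⟨0⟩, h0⟩
      exact { toFun := fun _ i => i.elim0, invFun := fun _ => 0, left_inv := fun d => (h0 d).symm,
              right_inv := fun f => Subsingleton.elim _ _, map_add' := fun _ _ => Subsingleton.elim _ _ }
    push Not at h0
    obtain ⟨a, ha⟩ := h0
    obtain ⟨q, hq, hqm, d, hd, hqd⟩ := exists_prime_tor hm hC.1 a ha
    obtain ⟨f, hf, hfd⟩ := prufer_embed hq hD d hd hqd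
    obtain ⟨g, hg⟩ := (prufer_dv hq).ext f hf (AddMonoidHom.id _)
    have hg' : ∀ x, g (f x) = x := hg
    let e : D ≃+ pruferSubgroup q × g.ker :=
      { toFun := fun x => (g x, ⟨x - f (g x), by rw [AddMonoidHom.mem_ker, map_sub, hg', sub_self]⟩)
        invFun := fun x => f x.1 + x.2.1
        left_inv := fun x => by simp
        right_inv := fun x => by
          have : g x.2.1 = 0 := x.2.2
          ext <;> simp [hg', this]
        map_add' := fun x y => by
          ext
          · simp
          · simp; abel }
    have hDk : Dv g.ker := hD.surj ((AddMonoidHom.snd _ _).comp e.toAddMonoidHom) (fun x => ⟨e.symm (0, x), by simp⟩)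
    have hCk : Cer m g.ker := hC.inj g.ker.subtype g.ker.subtype_injective
    have hlt : Nat.card (tor m g.ker) < Nat.card (tor m D) := by
      have := hC.2
      let F : tor m g.ker → tor m D := fun x => ⟨x.1.1, congrArg Subtype.val x.2⟩
      have hF : Function.Injective F := fun a b hab => by
        apply Subtype.ext; apply Subtype.ext; exact congrArg (fun x : tor m D => x.1) hab
      refine lt_of_le_of_ne (Nat.card_le_card_of_injective F hF) (fun heq => ?_)
      have hs := ((Nat.bijective_iff_injective_and_card F).2 ⟨hF, heq⟩).2
      obtain ⟨k, rfl⟩ := hqm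
      obtain ⟨y, hy⟩ := hs ⟨d, by rw [mem_tor, mul_comm, mul_smul, hqd, smul_zero]⟩
      have h1 : y.1.1 = d := congrArg (fun x : tor _ D => x.1) hy
      have h2 : g d = 0 := by rw [← h1]; exact y.1.2
      rw [← hfd, hg'] at h2
      exact pu_ne q hq h2
    obtain ⟨r, p, hp, ⟨E⟩⟩ := ih g.ker hDk hCk (by omega)
    refine ⟨r+1, Fin.cons q p, ?_, ⟨(e.trans ((AddEquiv.refl _).prodCongr E)).trans (consEquiv r q p)⟩⟩
    intro i
    refine Fin.cases ?_ (fun i => ?_) i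
    · exact ⟨hq, hqm⟩
    · exact hp i

end prufer

section conv
variable {A : Type} [AddCommGroup A]

lemma Cer.dvpart {m : ℕ} (hm : m ≠ 0) (h : Cer m A) : ∃ k : ℕ, Finite (A ⧸ mul (m^k) A) ∧ Dv (mul (m^k) A) := by
  obtain ⟨k, hk, h2⟩ := h.div hm
  refine ⟨k, hk, dv_of (m := m) (fun a => ?_) (fun a => ?_)⟩
  · obtain ⟨j, hj⟩ := h.1 a.1
    exact ⟨j, Subtype.ext hj⟩
  · obtain ⟨b, hb, hb2⟩ := h2 a.1 a.2
    exact ⟨⟨b, hb⟩, Subtype.ext hb2⟩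

theorem Cer.cernikov {m : ℕ} (hm : m ≠ 0) (h : Cer m A) : IsCernikov A := by
  obtain ⟨k, hk, hD⟩ := h.dvpart hm
  obtain ⟨r, p, hp, he⟩ := dv_struct m hm _ _ hD (h.inj _ (AddSubgroup.subtype_injective _)) le_rfl
  exact ⟨_, r, p, AddSubgroup.index_ne_zero_of_finite, fun i => (hp i).1, he⟩

theorem Cer.omega {m : ℕ} (ω : Set ℕ) (hm : m ≠ 0) (hω : ∀ p : ℕ, p.Prime → p ∣ m → p ∈ ω) (h : Cer m A) :
    IsCernikovOmega ω A := by
  refine ⟨h.cernikov hm, fun a => ?_⟩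
  obtain ⟨k, hk⟩ := h.1 a
  refine ⟨isOfFinAddOrder_iff_nsmul_eq_zero.2 ⟨m^k, Nat.pos_of_ne_zero (pow_ne_zero _ hm), hk⟩, fun p hp hd => ?_⟩
  have hd : p ∣ addOrderOf a := by exact_mod_cast hd
  exact hω p hp (hp.dvd_of_dvd_pow (hd.trans (addOrderOf_dvd_of_nsmul_eq_zero hk)))

lemma prufer_cer {m p : ℕ} (hm : m ≠ 0) (hp : p ∣ m) : Cer m (pruferSubgroup p) := by
  refine ⟨fun a => ?_, ?_⟩
  · obtain ⟨k, hk⟩ := prufer_tors p a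
    obtain ⟨c, rfl⟩ := hp
    exact ⟨k, by rw [mul_pow, mul_comm, mul_smul, hk, smul_zero]⟩
  · have h := AddCircle.finite_torsion (1:ℚ) (Nat.pos_of_ne_zero hm)
    have := h.to_subtype
    exact Finite.of_injective (fun x : tor m (pruferSubgroup p) =>
      (⟨x.1.1, congrArg Subtype.val x.2⟩ : {u : AddCircle (1:ℚ) | m • u = 0})) (fun a b hab => by
        apply Subtype.ext; apply Subtype.ext; exact congrArg (fun x : {u : AddCircle (1:ℚ) | m • u = 0} => x.1) hab)

lemma Serre.piPow (P : Serre) {r : ℕ} : ∀ (F : Fin r → Type) [∀ i, AddCommGroup (F i)], (∀ i, P.P (F i)) → P.P ((i : Fin r) → F i) := by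
  induction r with
  | zero => intro F _ h; exact P.zero _ (fun a => Subsingleton.elim _ _)
  | succ n ih =>
    intro F _ h
    refine P.exact (F 0) _ ((i : Fin n) → F i.succ) (AddMonoidHom.single F 0)
      { toFun := fun f i => f i.succ, map_zero' := rfl, map_add' := fun _ _ => rfl } ?_ (h 0) (ih _ (fun i => h i.succ))
    intro b hb
    refine ⟨b 0, ?_⟩
    ext i
    refine Fin.cases ?_ (fun i => ?_) i
    · simp
    · rw [AddMonoidHom.single_apply, Pi.single_eq_of_ne (Fin.succ_ne_zero i)]
      exact (congrFun hb i).symm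

theorem cer_of_omega (ω : Set ℕ) (h : IsCernikovOmega ω A) :
    ∃ m : ℕ, m ≠ 0 ∧ (∀ p : ℕ, p.Prime → p ∣ m → p ∈ ω) ∧ Cer m A := by
  classical
  obtain ⟨⟨S, r, p, hS, hp, ⟨e⟩⟩, ht⟩ := h
  set m0 : ℕ := S.index * ∏ i, p i with hm0
  have hm0' : m0 ≠ 0 := mul_ne_zero hS (Finset.prod_ne_zero_iff.2 fun i _ => (hp i).ne_zero)
  have hS0 : Cer m0 S := by
    have : Cer m0 ((i : Fin r) → pruferSubgroup (p i)) := (sCer m0 hm0').piPow _ (fun i =>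
      prufer_cer hm0' (dvd_mul_of_dvd_right (Finset.dvd_prod_of_mem p (Finset.mem_univ i)) _))
    exact this.inj e.toAddMonoidHom e.injective
  have hA0 : Cer m0 A := by
    refine (sCer m0 hm0').exact S A (A ⧸ S) S.subtype (QuotientAddGroup.mk' S) (fun b hb => ⟨⟨b, by simpa using hb⟩, rfl⟩) hS0 ⟨?_, ?_⟩
    · intro a
      refine ⟨1, ?_⟩
      rw [pow_one, hm0, mul_comm, mul_smul]
      have : S.index • a = 0 := by
        rw [AddSubgroup.index]; exact card_nsmul_eq_zero'
      rw [this, smul_zero]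
    · have : Finite (A ⧸ S) := by
        have : S.FiniteIndex := ⟨hS⟩
        infer_instance
      infer_instance
  let m : ℕ := ∏ q ∈ m0.primeFactors.filter (· ∈ ω), q
  have hdvd : m ∣ m0 := (Finset.prod_dvd_prod_of_subset _ _ _ (Finset.filter_subset _ _)).trans (Nat.prod_primeFactors_dvd m0)
  have hmne : m ≠ 0 := fun h => hm0' (by rw [h] at hdvd; exact Nat.eq_zero_of_zero_dvd hdvd)
  refine ⟨m, hmne, ?_, ?_, ?_⟩
  · intro q hq hd
    obtain ⟨x, hx, hd⟩ := (Prime.dvd_finset_prod_iff hq.prime _).1 hd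
    rw [Finset.mem_filter] at hx
    rw [(Nat.prime_dvd_prime_iff_eq hq (Nat.prime_of_mem_primeFactors hx.1)).1 hd]
    exact hx.2
  · intro a
    obtain ⟨k, hk⟩ := hA0.1 a
    have hn := addOrderOf_dvd_of_nsmul_eq_zero hk
    have hn0 : addOrderOf a ≠ 0 := fun h0 => by
      rw [h0] at hn; exact pow_ne_zero k hm0' (Nat.eq_zero_of_zero_dvd hn)
    have key : addOrderOf a ∣ m ^ (addOrderOf a) := by
      rw [Nat.dvd_iff_prime_pow_dvd_dvd]
      intro q j hq hd
      rcases Nat.eq_zero_or_pos j with rfl | hj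
      · simp
      have hqa : q ∣ addOrderOf a := (dvd_pow_self q hj.ne').trans hd
      have hqm : q ∣ m := by
        apply Finset.dvd_prod_of_mem (fun q => q)
        rw [Finset.mem_filter, Nat.mem_primeFactors]
        exact ⟨⟨hq, hq.dvd_of_dvd_pow (hqa.trans hn), hm0'⟩, (ht a).2 q hq (by exact_mod_cast hqa)⟩
      refine (pow_dvd_pow_of_dvd hqm j).trans (pow_dvd_pow _ ?_)
      have h1 := Nat.le_of_dvd (Nat.pos_of_ne_zero hn0) hd
      have h2 := Nat.lt_pow_self hq.one_lt (n := j)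
      omega
    exact ⟨_, addOrderOf_dvd_iff_nsmul_eq_zero.1 key⟩
  · have := hA0.2
    obtain ⟨c, hc⟩ := hdvd
    exact Finite.of_injective (fun x : tor m A => (⟨x.1, by
      rw [mem_tor, hc, mul_comm, mul_smul, tor_smul, smul_zero]⟩ : tor m0 A)) (fun a b hab => Subtype.ext (congrArg (fun x : tor m0 A => x.1) hab))

end conv
end TB
end

section
namespace TB

lemma Serre.piFin (P : Serre) {A I : Type} [AddCommGroup A] [Finite I] (hA : P.P A) : P.P (I → A) := by
  obtain ⟨k, ⟨e⟩⟩ := Finite.exists_equiv_fin I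
  refine P.of_inj (C := Fin k → A) { toFun := fun f i => f (e.symm i), map_zero' := rfl, map_add' := fun _ _ => rfl } ?_ (P.pow hA k)
  intro b hb
  ext i
  have := congrFun hb (e i)
  simpa using this

lemma fin_grp (P : Serre) {Γ X : Type} [Group Γ] [AddCommGroup X] [Finite Γ] (ρ : Act Γ X) (hX : P.P X) (n : ℕ) :
    P.P (Hn ρ n) := by
  refine P.of_surj (mkH ρ n) ?_ (P.of_inj (Zn ρ n).subtype (fun b hb => Subtype.ext hb) (P.piFin hX))
  intro b
  obtain ⟨z, hz, rfl⟩ := cl_surj b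
  exact ⟨⟨z, hz⟩, rfl⟩

lemma fg_comm_aux (P : Serre) (k : ℕ) : ∀ {Γ X : Type} [Group Γ] [AddCommGroup X] (_ : ∀ a b : Γ, a * b = b * a)
    (s : Fin k → Γ) (_ : Subgroup.closure (Set.range s) = ⊤) (ρ : Act Γ X) (_ : P.P X) (n : ℕ), P.P (Hn ρ n) := by
  induction k with
  | zero =>
    intro Γ X _ _ hc s hs ρ hX n
    have : Subsingleton Γ := by
      rw [Set.range_eq_empty, Subgroup.closure_empty] at hs
      exact ⟨fun a b => by
        have h1 : ∀ c : Γ, c = 1 := fun c => Subgroup.mem_bot.1 (hs ▸ Subgroup.mem_top c)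
        rw [h1 a, h1 b]⟩
    exact fin_grp P ρ hX n
  | succ k ih =>
    intro Γ X _ _ hc s hs ρ hX n
    let t := s 0
    have hN : (Subgroup.zpowers t).Normal := ⟨fun a ha g => by rw [hc g a, mul_assoc, mul_inv_cancel, mul_one]; exact ha⟩
    let f := QuotientGroup.mk' (Subgroup.zpowers t)
    have hf : Function.Surjective f := QuotientGroup.mk'_surjective _
    have hker : ∀ g, g ∈ f.ker ↔ ∃ j : ℤ, t ^ j = g := by
      intro g; rw [QuotientGroup.ker_mk', Subgroup.mem_zpowers_iff]
    apply lhs ρ f hf P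
    intro a b _
    refine ih (fun a b => ?_) (fun i => f (s i.succ)) ?_ _ ?_ a
    · obtain ⟨a, rfl⟩ := hf a
      obtain ⟨b, rfl⟩ := hf b
      rw [← map_mul, hc, map_mul]
    · have h1 : Subgroup.map f (Subgroup.closure (Set.range s)) = ⊤ := by
        rw [hs, ← MonoidHom.range_eq_map, MonoidHom.range_eq_top.2 hf]
      rw [MonoidHom.map_closure] at h1
      rw [eq_top_iff, ← h1, Subgroup.closure_le]
      rintro _ ⟨_, ⟨i, rfl⟩, rfl⟩
      refine Fin.cases ?_ (fun i => ?_) i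
      · have : f (s 0) = 1 := by
          rw [← MonoidHom.mem_ker, hker]; exact ⟨1, zpow_one _⟩
        rw [this]; exact one_mem _
      · exact Subgroup.subset_closure ⟨i, rfl⟩
    · let t' : f.ker := ⟨t, (hker t).2 ⟨1, zpow_one _⟩⟩
      have hz : ∀ g : f.ker, ∃ k : ℤ, t' ^ k = g := by
        rintro ⟨g, hg⟩
        obtain ⟨j, rfl⟩ := (hker g).1 hg
        exact ⟨j, Subtype.ext (by simp [t'])⟩
      by_cases hi : ∀ k : ℤ, t' ^ k = 1 → k = 0
      · exact infcyc P _ t' hz hi hX b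
      · push Not at hi
        obtain ⟨k, hk, hk0⟩ := hi
        have : IsOfFinOrder t' := isOfFinOrder_iff_zpow_eq_one.2 ⟨k, hk0, hk⟩
        have h1 : Finite (Subgroup.zpowers t') := finite_zpowers.2 this
        have : Finite f.ker := Finite.of_surjective (fun x : Subgroup.zpowers t' => x.1) (fun g => by
          obtain ⟨j, hj⟩ := hz g
          exact ⟨⟨g, ⟨j, hj⟩⟩, rfl⟩)
        exact fin_grp P _ hX b

lemma fg_comm (P : Serre) {Γ X : Type} [Group Γ] [AddCommGroup X] (hc : ∀ a b : Γ, a * b = b * a)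
    (hfg : Group.FG Γ) (ρ : Act Γ X) (hX : P.P X) (n : ℕ) : P.P (Hn ρ n) := by
  obtain ⟨S, hS⟩ := Group.fg_def.1 hfg
  exact fg_comm_aux P S.card hc (fun i => (S.equivFin.symm i).1) (by
    rw [← hS]; congr 1; ext x; constructor
    · rintro ⟨i, rfl⟩; exact (S.equivFin.symm i).2
    · intro hx; exact ⟨S.equivFin ⟨x, hx⟩, by simp⟩) ρ hX n

lemma triv_acyc {Γ X : Type} [Group Γ] [AddCommGroup X] [Subsingleton Γ] (ρ : Act Γ X) : Acyc ρ := by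
  refine acyc_of (Ω := Unit) (X := X) ρ (AddEquiv.mk' ⟨fun x _ => x, fun f => f (), fun _ => rfl, fun _ => rfl⟩ (fun _ _ => rfl)) (fun w _ => w) (fun _ => 1)
    (fun _ _ _ => rfl) (fun _ => rfl) ?_ (fun _ g => Subsingleton.elim _ _)
  intro g y w
  rw [Subsingleton.elim g 1, Act.one_eq]; rfl

lemma fin_kill {Γ X : Type} [Group Γ] [AddCommGroup X] (ρ : Act Γ X) (n : ℕ) (x : Hn ρ (n+1)) :
    Nat.card Γ • x = 0 := by
  have := transfer ρ ⊥ (n+1) x (triv_acyc _ _ _)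
  rwa [Subgroup.index_bot] at this

lemma ext_zero {Γ X : Type} [Group Γ] [AddCommGroup X] (ρ : Act Γ X) (H : Subgroup Γ) (n : ℕ)
    (z : (Fin (n+1) → Γ) → X) (hz : dd ρ (n+1) z = 0)
    (h : Hmap H.subtype (AddMonoidHom.id X) Compat.res (n+1) (cl z hz) = 0) :
    ∃ c : (Fin n → Γ) → X, ∀ g, (∀ i, g i ∈ H) → dd ρ n c g = z g := by
  classical
  rw [Hmap_cl, cl_eq_zero_succ] at h
  obtain ⟨c, hc⟩ := h
  let c0 : (Fin n → Γ) → X := fun g => if h : ∀ i, g i ∈ H then c (fun i => ⟨g i, h i⟩) else 0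
  have h0 : cmap H.subtype (AddMonoidHom.id X) n c0 = c := by
    ext g
    rw [cmap_apply]
    have : ∀ i, (g i : Γ) ∈ H := fun i => (g i).2
    simp [c0]
  refine ⟨c0, fun g hg => ?_⟩
  rw [← h0, dd_cmap Compat.res] at hc
  have := congrFun hc (fun i => ⟨g i, hg i⟩)
  exact this

lemma res_zero_of {Γ X : Type} [Group Γ] [AddCommGroup X] (ρ : Act Γ X) (x : Hn ρ 0) (H : Subgroup Γ)
    (h : Hmap H.subtype (AddMonoidHom.id X) Compat.res 0 x = 0) : x = 0 := by
  apply val0_inj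
  have := val0_Hmap H.subtype (AddMonoidHom.id X) (Compat.res (ρ := ρ)) x
  rw [h, map_zero] at this
  rw [map_zero, this]; rfl

lemma compact_fin {Γ X : Type} [Group Γ] [AddCommGroup X] [Finite X] (ρ : Act Γ X) (n : ℕ) (x : Hn ρ n)
    (h : ∀ s : Finset Γ, ∃ H : Subgroup Γ, (∀ g ∈ s, g ∈ H) ∧
      Hmap H.subtype (AddMonoidHom.id X) Compat.res n x = 0) : x = 0 := by
  classical
  cases n with
  | zero =>
    obtain ⟨H, -, hH⟩ := h ∅
    exact res_zero_of ρ x H hH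
  | succ n =>
    induction x using Hn_ind with
    | h z hz =>
      rw [cl_eq_zero_succ]
      letI : TopologicalSpace X := ⊥
      haveI : DiscreteTopology X := ⟨rfl⟩
      let C : Finset Γ → Set ((Fin n → Γ) → X) := fun s => {c | ∀ g, (∀ i, g i ∈ s) → dd ρ n c g = z g}
      have hne : (⋂ s, C s).Nonempty := by
        apply IsCompact.nonempty_iInter_of_directed_nonempty_isCompact_isClosed
        · intro s t
          refine ⟨s ∪ t, ?_, ?_⟩
          · intro c hc g hg; exact hc g (fun i => Finset.mem_union_left _ (hg i))
          · intro c hc g hg; exact hc g (fun i => Finset.mem_union_right _ (hg i))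
        · intro s
          obtain ⟨H, hs, hH⟩ := h s
          obtain ⟨c, hc⟩ := ext_zero ρ H n z hz hH
          exact ⟨c, fun g hg => hc g (fun i => hs _ (hg i))⟩
        · intro s
          apply IsClosed.isCompact
          simp only [C, Set.setOf_forall]
          refine isClosed_iInter fun g => isClosed_iInter fun _ => isClosed_eq ?_ continuous_const
          simp only [dd_apply]
          refine Continuous.add (continuous_of_discreteTopology.comp (continuous_apply _)) (continuous_finset_sum _ fun j _ => ?_)
          exact (continuous_of_discreteTopology (f := fun x : X => (-1:ℤ)^((j:ℕ)+1) • x)).comp (continuous_apply _)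
        · intro s
          simp only [C, Set.setOf_forall]
          refine isClosed_iInter fun g => isClosed_iInter fun _ => isClosed_eq ?_ continuous_const
          simp only [dd_apply]
          refine Continuous.add (continuous_of_discreteTopology.comp (continuous_apply _)) (continuous_finset_sum _ fun j _ => ?_)
          exact (continuous_of_discreteTopology (f := fun x : X => (-1:ℤ)^((j:ℕ)+1) • x)).comp (continuous_apply _)
      obtain ⟨c, hc⟩ := hne
      refine ⟨c, funext fun g => ?_⟩
      rw [Set.mem_iInter] at hc
      exact hc (Finset.univ.image g) g (fun i => Finset.mem_image_of_mem _ (Finset.mem_univ i))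

/-- the bar boundary -/
def bdry (Γ : Type) [Group Γ] (n : ℕ) : ((Fin (n+1) → Γ) →₀ ℤ) →+ ((Fin n → Γ) →₀ ℤ) :=
  Finsupp.liftAddHom (fun g => (AddMonoidHom.flip (AddMonoidHom.smul (R := ℤ) (M := (Fin n → Γ) →₀ ℤ)))
    (Finsupp.single (fun i => g i.succ) 1 + ∑ j : Fin (n+1), (-1 : ℤ) ^ ((j : ℕ) + 1) • Finsupp.single (Fin.contractNth j (· * ·) g) 1))

lemma bdry_single {Γ : Type} [Group Γ] (n : ℕ) (g) (k : ℤ) : bdry Γ n (Finsupp.single g k) =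
    k • (Finsupp.single (fun i => g i.succ) 1 + ∑ j : Fin (n+1), (-1 : ℤ) ^ ((j : ℕ) + 1) • Finsupp.single (Fin.contractNth j (· * ·) g) 1) := by
  rw [bdry, Finsupp.liftAddHom_apply_single]; rfl

/-- evaluation of formal sums -/
def evs {I X : Type} [AddCommGroup X] (c : I → X) : (I →₀ ℤ) →+ X :=
  Finsupp.liftAddHom (fun g => (AddMonoidHom.flip (AddMonoidHom.smul (R := ℤ) (M := X))) (c g))

lemma evs_single {I X : Type} [AddCommGroup X] (c : I → X) (g k) : evs c (Finsupp.single g k) = k • c g := by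
  simp [evs]

lemma evs_bdry {Γ X : Type} [Group Γ] [AddCommGroup X] (ρ : Act Γ X) (ht : ∀ g x, ρ g x = x) (n : ℕ) (c) (a) :
    evs c (bdry Γ n a) = evs (dd ρ n c) a := by
  induction a using Finsupp.induction_linear with
  | zero => simp
  | add f g hf hg => simp [hf, hg]
  | single g k =>
    rw [bdry_single, evs_single, map_zsmul, map_add, map_sum, evs_single, one_smul, dd_apply, ht]
    simp only [map_zsmul, evs_single, one_smul]

lemma evs_congr {I X : Type} [AddCommGroup X] (c d : I → X) (a : I →₀ ℤ) (h : ∀ i ∈ a.support, c i = d i) :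
    evs c a = evs d a := by
  simp only [evs, Finsupp.liftAddHom_apply, Finsupp.sum]
  exact Finset.sum_congr rfl (fun i hi => by simp [h i hi])

lemma compact_div {Γ X : Type} [Group Γ] [AddCommGroup X] (hD : Dv X) (ρ : Act Γ X) (ht : ∀ g x, ρ g x = x) (n : ℕ) (x : Hn ρ n)
    (h : ∀ s : Finset Γ, ∃ H : Subgroup Γ, (∀ g ∈ s, g ∈ H) ∧
      Hmap H.subtype (AddMonoidHom.id X) Compat.res n x = 0) : x = 0 := by
  classical
  cases n with
  | zero =>
    obtain ⟨H, -, hH⟩ := h ∅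
    exact res_zero_of ρ x H hH
  | succ n =>
    induction x using Hn_ind with
    | h z hz =>
      rw [cl_eq_zero_succ]
      have hk : ∀ a, bdry Γ n a = 0 → evs z a = 0 := by
        intro a ha
        obtain ⟨H, hs, hH⟩ := h (a.support.biUnion fun g => Finset.univ.image g)
        obtain ⟨c, hc⟩ := ext_zero ρ H n z hz hH
        rw [evs_congr z (dd ρ n c) a, ← evs_bdry ρ ht, ha, map_zero]
        intro g hg
        rw [hc]
        intro i
        exact hs _ (Finset.mem_biUnion.2 ⟨g, hg, Finset.mem_image_of_mem _ (Finset.mem_univ i)⟩)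
      obtain ⟨C, hC⟩ := hD.ext (QuotientAddGroup.kerLift (bdry Γ n)) (QuotientAddGroup.kerLift_injective _)
        (QuotientAddGroup.lift (bdry Γ n).ker (evs z) hk)
      refine ⟨fun g => C (Finsupp.single g 1), funext fun g => ?_⟩
      have h1 := hC (QuotientAddGroup.mk' _ (Finsupp.single g 1))
      have h2 : C (bdry Γ n (Finsupp.single g 1)) = evs z (Finsupp.single g 1) := h1
      rw [evs_single, one_smul, bdry_single, one_smul] at h2
      rw [← h2, dd_apply, ht, map_add, map_sum]
      simp only [map_zsmul]

end TB
end

section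
namespace TB

/-- cohomology with finite coefficients is finite -/
def FinCoh (Γ : Type) [Group Γ] : Prop :=
  ∀ (n : ℕ) (F : Type) [AddCommGroup F] (ρ : Act Γ F), Finite F → Finite (Hn ρ n)

lemma FinCoh.ext {Γ Γ' : Type} [Group Γ] [Group Γ'] (f : Γ →* Γ') (hf : Function.Surjective f)
    (h1 : FinCoh f.ker) (h2 : FinCoh Γ') : FinCoh Γ := fun n F _ ρ hF =>
  lhs ρ f hf sFin n (fun a b _ => h2 a _ _ (h1 b _ _ hF))

lemma FinCoh.iso {Γ Γ' : Type} [Group Γ] [Group Γ'] (f : Γ ≃* Γ') (h : FinCoh Γ) : FinCoh Γ' :=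
  fun n F _ ρ hF => P_of_bij sFin (σ := ρ.comp f.toMonoidHom) f (AddMonoidHom.id F) Function.bijective_id
    (fun d x => rfl) n (h n F _ hF)

lemma FinCoh.of_fin {Γ : Type} [Group Γ] [Finite Γ] : FinCoh Γ := fun n _ _ ρ hF => fin_grp sFin ρ hF n

/-- additive version -/
def FinCohA (A : Type) [AddCommGroup A] : Prop := FinCoh (Multiplicative A)

lemma FinCohA.ses {A B C : Type} [AddCommGroup A] [AddCommGroup B] [AddCommGroup C] (i : A →+ B) (q : B →+ C)
    (hi : Function.Injective i) (hq : Function.Surjective q) (hx : ∀ b, q b = 0 ↔ ∃ a, i a = b)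
    (hA : FinCohA A) (hC : FinCohA C) : FinCohA B := by
  refine FinCoh.ext (Γ := Multiplicative B) (Γ' := Multiplicative C) (AddMonoidHom.toMultiplicative q) hq ?_ hC
  let φ : Multiplicative A →* (AddMonoidHom.toMultiplicative q).ker :=
    (AddMonoidHom.toMultiplicative i).codRestrict _ (fun a => (hx _).2 ⟨a.toAdd, rfl⟩)
  have hφ : Function.Bijective φ := by
    constructor
    · intro a b hab
      exact hi (congrArg (fun x : (AddMonoidHom.toMultiplicative q).ker => x.1) hab)
    · rintro ⟨b, hb⟩
      obtain ⟨a, ha⟩ := (hx b).1 hb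
      exact ⟨Multiplicative.ofAdd a, Subtype.ext ha⟩
  exact FinCoh.iso (MulEquiv.ofBijective φ hφ) hA

lemma FinCohA.iso {A B : Type} [AddCommGroup A] [AddCommGroup B] (e : A ≃+ B) (h : FinCohA A) : FinCohA B :=
  FinCoh.iso (Γ := Multiplicative A) (Γ' := Multiplicative B) (AddEquiv.toMultiplicative e) h

lemma FinCohA.of_fin {A : Type} [AddCommGroup A] [Finite A] : FinCohA A :=
  FinCoh.of_fin (Γ := Multiplicative A)

lemma FinCohA.sub {A : Type} [AddCommGroup A] (S : AddSubgroup A) (h1 : FinCohA S) (h2 : FinCohA (A ⧸ S)) : FinCohA A :=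
  FinCohA.ses S.subtype (QuotientAddGroup.mk' S) S.subtype_injective (QuotientAddGroup.mk'_surjective S)
    (fun b => by
      rw [QuotientAddGroup.mk'_apply, QuotientAddGroup.eq_zero_iff]
      exact ⟨fun h => ⟨⟨b, h⟩, rfl⟩, by rintro ⟨a, rfl⟩; exact a.2⟩) h1 h2

lemma FinCohA.fg {A : Type} [AddCommGroup A] (h : AddGroup.FG A) : FinCohA A := fun n _ _ ρ hF =>
  fg_comm sFin (Γ := Multiplicative A) (fun a b => mul_comm a b) inferInstance ρ hF n

/-- locally cyclic torsion groups -/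
lemma FinCoh.locCyc {Γ : Type} [Group Γ] (h : ∀ s : Finset Γ, ∃ t : Γ, IsOfFinOrder t ∧ ∀ g ∈ s, g ∈ Subgroup.zpowers t) :
    FinCoh Γ := by
  classical
  intro n F _ ρ hF
  by_contra hinf
  have : Infinite (Hn ρ n) := not_finite_iff_infinite.1 hinf
  obtain ⟨S, hS⟩ := Infinite.exists_subset_card_eq (Hn ρ n) (Nat.card F + 1)
  have h1 : ∀ x : Hn ρ n, x ≠ 0 → ∃ s : Finset Γ, ∀ H : Subgroup Γ, (∀ g ∈ s, g ∈ H) →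
      Hmap H.subtype (AddMonoidHom.id F) Compat.res n x ≠ 0 := by
    intro x hx
    by_contra hcon
    push Not at hcon
    exact hx (compact_fin ρ n x hcon)
  choose! s hs using h1
  obtain ⟨t, ht, htS⟩ := h ((S ×ˢ S).biUnion fun x => s (x.1 - x.2))
  let H := Subgroup.zpowers t
  have hfin : Finite H := finite_zpowers.2 ht
  have hb := (fincyc (ρ.comp H.subtype) ⟨t, Subgroup.mem_zpowers t⟩ (fun g => by
    obtain ⟨g, k, rfl⟩ := g
    exact ⟨k, Subtype.ext (by simp)⟩) (Nat.card F) ⟨hF, le_rfl⟩ n)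
  have := hb.1
  have hinj : Set.InjOn (Hmap H.subtype (AddMonoidHom.id F) (Compat.res (ρ := ρ)) n) (S : Set (Hn ρ n)) := by
    intro x hx y hy hxy
    by_contra hne
    refine hs (x - y) (sub_ne_zero.2 hne) H ?_ (by rw [map_sub, hxy, sub_self])
    intro g hg
    exact htS g (Finset.mem_biUnion.2 ⟨(x, y), Finset.mem_product.2 ⟨hx, hy⟩, hg⟩)
  have h2 := Set.ncard_image_of_injOn hinj
  rw [Set.ncard_coe_finset, hS] at h2
  have h3 := Set.ncard_le_card (Hmap H.subtype (AddMonoidHom.id F) (Compat.res (ρ := ρ)) n '' (S : Set (Hn ρ n)))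
  omega

lemma circle_loc (p : ℕ) (x : RatCircle) (k : ℕ) (hp : p ≠ 0) (h : p ^ k • x = 0) :
    ∃ j : ℤ, x = j • (QuotientAddGroup.mk' (AddSubgroup.zmultiples (1:ℚ)) (1 / (p:ℚ)^k)) := by
  obtain ⟨r, rfl⟩ := QuotientAddGroup.mk'_surjective _ x
  rw [← map_nsmul, circle_mk_eq_zero] at h
  obtain ⟨j, hj⟩ := h
  refine ⟨j, ?_⟩
  rw [← map_zsmul]
  congr 1
  have : (p:ℚ)^k ≠ 0 := pow_ne_zero _ (by exact_mod_cast hp)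
  rw [zsmul_eq_mul, hj, nsmul_eq_mul]
  push_cast
  field_simp

lemma FinCohA.prufer (p : ℕ) (hp : p.Prime) : FinCohA (pruferSubgroup p) := by
  classical
  apply FinCoh.locCyc
  intro s
  choose! k hk using prufer_tors p
  let K := s.sup (fun x => k (Multiplicative.toAdd x))
  let u : RatCircle := QuotientAddGroup.mk' (AddSubgroup.zmultiples (1:ℚ)) (1 / (p:ℚ)^K)
  have hu0 : p ^ K • u = 0 := by
    rw [← map_nsmul, circle_mk_eq_zero]
    refine ⟨1, ?_⟩
    have : (p:ℚ)^K ≠ 0 := pow_ne_zero _ (by exact_mod_cast hp.ne_zero)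
    rw [nsmul_eq_mul]; push_cast; field_simp
  let v : pruferSubgroup p := ⟨u, K, hu0⟩
  refine ⟨Multiplicative.ofAdd v, ?_, ?_⟩
  · rw [isOfFinOrder_ofAdd_iff, isOfFinAddOrder_iff_nsmul_eq_zero]
    exact ⟨p^K, Nat.pow_pos hp.pos, Subtype.ext hu0⟩
  · intro g hg
    have h1 : p ^ K • (Multiplicative.toAdd g) = 0 := by
      have : k (Multiplicative.toAdd g) ≤ K := Finset.le_sup (f := fun x => k (Multiplicative.toAdd x)) hg
      obtain ⟨c, hc⟩ := Nat.exists_eq_add_of_le this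
      rw [hc, pow_add, mul_comm, mul_smul, hk, smul_zero]
    obtain ⟨j, hj⟩ := circle_loc p (Multiplicative.toAdd g).1 K hp.ne_zero (congrArg Subtype.val h1)
    exact ⟨j, Subtype.ext hj.symm⟩

lemma FinCohA.pi (r : ℕ) : ∀ (p : Fin r → ℕ), (∀ i, (p i).Prime) → FinCohA ((i : Fin r) → pruferSubgroup (p i)) := by
  induction r with
  | zero => intro p hp; exact FinCohA.of_fin
  | succ r ih =>
    intro p hp
    refine FinCohA.ses (A := pruferSubgroup (p 0)) (C := (i : Fin r) → pruferSubgroup (p i.succ))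
      (AddMonoidHom.single (fun i => pruferSubgroup (p i)) 0)
      { toFun := fun f i => f i.succ, map_zero' := rfl, map_add' := fun _ _ => rfl } ?_ ?_ ?_
      (FinCohA.prufer _ (hp 0)) (ih _ (fun i => hp _))
    · exact Pi.single_injective (M := fun i => pruferSubgroup (p i)) 0
    · intro f
      exact ⟨Fin.cons 0 f, rfl⟩
    · intro b
      constructor
      · intro hb
        refine ⟨b 0, ?_⟩
        ext i
        refine Fin.cases ?_ (fun i => ?_) i
        · simp
        · have := congrFun hb i
          simp only [AddMonoidHom.coe_mk, ZeroHom.coe_mk, Pi.zero_apply] at this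
          rw [AddMonoidHom.single_apply, Pi.single_eq_of_ne (Fin.succ_ne_zero i), this]
      · rintro ⟨a, rfl⟩
        funext i
        exact Pi.single_eq_of_ne (M := fun i => pruferSubgroup (p i)) (Fin.succ_ne_zero i) a

lemma FinCohA.cer {A : Type} [AddCommGroup A] {m : ℕ} (hm : m ≠ 0) (h : Cer m A) : FinCohA A := by
  obtain ⟨k, hf, hd⟩ := h.dvpart hm
  obtain ⟨r, p, hp, ⟨e⟩⟩ := dv_struct m hm _ _ hd (h.inj (mul (m^k) A).subtype (mul (m^k) A).subtype_injective) le_rfl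
  exact FinCohA.sub (mul (m^k) A) ((FinCohA.pi r p (fun i => (hp i).1)).iso e.symm) FinCohA.of_fin

/-- elements of order prime to m -/
def copr (m : ℕ) (A : Type) [AddCommGroup A] : AddSubgroup A where
  carrier := {a | ∃ n : ℕ, n.Coprime m ∧ n • a = 0}
  zero_mem' := ⟨1, Nat.coprime_one_left m, smul_zero _⟩
  add_mem' := by
    rintro a b ⟨n, hn, ha⟩ ⟨k, hk, hb⟩
    refine ⟨n * k, Nat.Coprime.mul_left hn hk, ?_⟩
    rw [smul_add, mul_smul _ _ b, hb, mul_comm, mul_smul _ _ a, ha, smul_zero, smul_zero, add_zero]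
  neg_mem' := by
    rintro a ⟨n, hn, ha⟩
    exact ⟨n, hn, by rw [smul_neg, ha, neg_zero]⟩

lemma tor_fin_mul {A : Type} [AddCommGroup A] (h : ∀ p : ℕ, p.Prime → Finite (tor p A)) (m : ℕ) (hm : m ≠ 0) : Finite (tor m A) := by
  induction m using Nat.recOnMul with
  | zero => exact absurd rfl hm
  | one =>
    have : Subsingleton (tor 1 A) := ⟨fun a b => Subtype.ext (by
      have ha := tor_smul a
      have hb := tor_smul b
      rw [one_smul] at ha hb
      rw [ha, hb])⟩
    infer_instance
  | prime p hp => exact h p hp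
  | mul a b ha hb =>
    have h1 := ha (left_ne_zero_of_mul hm)
    have h2 := hb (right_ne_zero_of_mul hm)
    refine fin_exact (A := tor a A) (C := tor b A)
      ((tor a A).subtype.codRestrict _ (fun x => by
        rw [mem_tor, mul_comm, mul_smul]; exact (congrArg _ (tor_smul x)).trans (smul_zero _)))
      (((nsmulAddMonoidHom a).comp (tor (a*b) A).subtype).codRestrict _ (fun x => by
        rw [mem_tor]
        change b • (a • x.1) = 0
        rw [← mul_smul, mul_comm b a]; exact tor_smul x)) ?_ h1 h2
    intro x hx
    exact ⟨⟨x.1, congrArg Subtype.val hx⟩, rfl⟩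

lemma copr_quot_cer {A : Type} [AddCommGroup A] (ht : ∀ a : A, ∃ n : ℕ, n ≠ 0 ∧ n • a = 0) (m : ℕ) (hm : m ≠ 0)
    (h : Finite (tor m A)) : Cer m (A ⧸ copr m A) := by
  constructor
  · intro x
    obtain ⟨a, rfl⟩ := QuotientAddGroup.mk'_surjective _ x
    obtain ⟨n, hn, ha⟩ := ht a
    obtain ⟨k, c, hkc, hc⟩ : ∃ (k c : ℕ), n ∣ m ^ k * c ∧ c.Coprime m := by
      clear ha
      induction n using Nat.recOnMul with
      | zero => exact absurd rfl hn
      | one => exact ⟨0, 1, one_dvd _, Nat.coprime_one_left _⟩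
      | prime p hp =>
        rcases Nat.coprime_or_dvd_of_prime hp m with h | h
        · exact ⟨0, p, by simp, h⟩
        · exact ⟨1, 1, by simpa using h, Nat.coprime_one_left _⟩
      | mul a b ha hb =>
        obtain ⟨k, c, h1, h2⟩ := ha (left_ne_zero_of_mul hn)
        obtain ⟨k', c', h1', h2'⟩ := hb (right_ne_zero_of_mul hn)
        exact ⟨k + k', c * c', by rw [pow_add, mul_mul_mul_comm]; exact mul_dvd_mul h1 h1', h2.mul_left h2'⟩
    refine ⟨k, ?_⟩
    rw [← map_nsmul, QuotientAddGroup.mk'_apply, QuotientAddGroup.eq_zero_iff]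
    refine ⟨c, hc, ?_⟩
    obtain ⟨d, hd⟩ := hkc
    rw [← mul_smul, mul_comm c, hd, mul_comm n, mul_smul, ha, smul_zero]
  · refine Finite.of_surjective (fun x : tor m A => (⟨QuotientAddGroup.mk' _ x.1, by
      rw [mem_tor, ← map_nsmul, tor_smul, map_zero]⟩ : tor m (A ⧸ copr m A))) ?_
    rintro ⟨x, hx⟩
    obtain ⟨a, rfl⟩ := QuotientAddGroup.mk'_surjective _ x
    rw [mem_tor, ← map_nsmul, QuotientAddGroup.mk'_apply, QuotientAddGroup.eq_zero_iff] at hx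
    obtain ⟨n, hn, hna⟩ := hx
    have hb := Nat.isCoprime_iff_coprime.2 hn
    obtain ⟨u, v, huv⟩ := hb
    refine ⟨⟨(u * n) • a, ?_⟩, ?_⟩
    · rw [mem_tor, smul_comm, mul_smul, natCast_zsmul, smul_comm n m a]
      have : n • (m • a) = 0 := hna
      rw [smul_comm m n a, this, smul_zero]
    · apply Subtype.ext
      change QuotientAddGroup.mk' _ ((u * n) • a) = QuotientAddGroup.mk' _ a
      rw [← sub_eq_zero, ← map_sub, QuotientAddGroup.mk'_apply, QuotientAddGroup.eq_zero_iff]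
      refine ⟨n, hn, ?_⟩
      have : (u * n) • a - a = -((v * m) • a) := by
        have : a = (u * n + v * m) • a := by rw [huv, one_smul]
        nth_rewrite 2 [this]; rw [add_smul]; abel
      rw [this, smul_neg, mul_smul, natCast_zsmul, smul_comm, hna, smul_zero, neg_zero]

lemma Hn_kill {Γ X : Type} [Group Γ] [AddCommGroup X] (ρ : Act Γ X) (m : ℕ) (h : ∀ x : X, m • x = 0) (n : ℕ) (y : Hn ρ n) :
    m • y = 0 := by
  induction y using Hn_ind with
  | h z hz =>
    rw [cl_nsmul, cl_eq_zero]
    have : m • z = 0 := funext fun g => h _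
    rw [this]; exact zero_mem _

lemma FinCohA.tor {A : Type} [AddCommGroup A] (ht : ∀ a : A, ∃ n : ℕ, n ≠ 0 ∧ n • a = 0)
    (h : ∀ p : ℕ, p.Prime → Finite (tor p A)) : FinCohA A := by
  intro n F _ ρ hF
  let m := Nat.card F
  have hm : m ≠ 0 := Nat.card_pos.ne'
  have hmF : ∀ x : F, m • x = 0 := fun x => card_nsmul_eq_zero'
  let q := QuotientAddGroup.mk' (copr m A)
  have hq : Function.Surjective q := QuotientAddGroup.mk'_surjective _
  refine lhs ρ (Γ' := Multiplicative (A ⧸ copr m A)) (AddMonoidHom.toMultiplicative q) hq sFin n (fun a b _ => ?_)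
  refine FinCohA.cer hm (copr_quot_cer ht m hm (tor_fin_mul h m hm)) a _ _ ?_
  have hk : ∀ x : (AddMonoidHom.toMultiplicative q).ker, ∃ n : ℕ, n.Coprime m ∧ x ^ n = 1 := by
    rintro ⟨x, hx⟩
    have : Multiplicative.toAdd x ∈ copr m A := (QuotientAddGroup.eq_zero_iff _).1 hx
    obtain ⟨n, hn, hx⟩ := this
    exact ⟨n, hn, Subtype.ext hx⟩
  cases b with
  | zero => exact Finite.of_injective _ (val0_inj _)
  | succ b =>
    have : ∀ x : Hn (ρ.comp (AddMonoidHom.toMultiplicative q).ker.subtype) (b+1), x = 0 := by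
      intro x
      apply compact_fin
      intro s
      let H := Subgroup.closure (s : Set (AddMonoidHom.toMultiplicative q).ker)
      refine ⟨H, fun g hg => Subgroup.subset_closure hg, ?_⟩
      letI : CommGroup H := { (inferInstance : Group H) with mul_comm := fun a b => Subtype.ext (Subtype.ext (mul_comm a.1.1 b.1.1)) }
      have hHfg : Group.FG H := Group.closure_finset_fg s
      have hH : Finite H := CommGroup.finite_of_fg_torsion H (by
        intro x
        obtain ⟨n, hn, hx⟩ := ht (Multiplicative.toAdd x.1.1)
        rw [isOfFinOrder_iff_pow_eq_one]
        exact ⟨n, Nat.pos_of_ne_zero hn, Subtype.ext (Subtype.ext hx)⟩)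
      have hcop : (Nat.card H).Coprime m := by
        rw [Nat.coprime_iff_gcd_eq_one]
        by_contra hne
        obtain ⟨p, hp, hpd⟩ := Nat.exists_prime_and_dvd hne
        haveI : Fact p.Prime := ⟨hp⟩
        obtain ⟨y, hy⟩ := exists_prime_orderOf_dvd_card' p (hpd.trans (Nat.gcd_dvd_left _ _))
        obtain ⟨n, hn, hyn⟩ := hk y.1
        have h1 : p ∣ n := by
          rw [← hy]; exact orderOf_dvd_of_pow_eq_one (Subtype.ext hyn)
        have := Nat.Coprime.eq_one_of_dvd (Nat.Coprime.coprime_dvd_left h1 hn) (hpd.trans (Nat.gcd_dvd_right _ _))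
        exact hp.one_lt.ne' this
      set y := Hmap H.subtype (AddMonoidHom.id F) Compat.res (b+1) x
      have h1 : Nat.card H • y = 0 := fin_kill _ _ _
      have h2 : m • y = 0 := Hn_kill _ m hmF _ _
      obtain ⟨u, v, huv⟩ := Nat.isCoprime_iff_coprime.2 hcop
      rw [← one_smul ℤ y, ← huv, add_smul, mul_smul, mul_smul, natCast_zsmul, natCast_zsmul, h1, h2, smul_zero, smul_zero, add_zero]
    exact Finite.of_injective (fun _ => ()) (fun x y _ => by rw [this x, this y])

end TB
end

section
namespace TB

/-- finite rank abelian group (working form) -/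
def FRk (A : Type) [AddCommGroup A] : Prop :=
  (∃ L : AddSubgroup A, AddGroup.FG L ∧ ∀ a : A, ∃ n : ℕ, n ≠ 0 ∧ n • a ∈ L) ∧ ∀ p : ℕ, p.Prime → Finite (tor p A)

lemma max_indep {A : Type} [AddCommGroup A] (n : ℕ) (h : ∀ k : ℕ, (∃ f : (Fin k →₀ ℤ) →+ A, Function.Injective f) → k ≤ n) :
    ∃ L : AddSubgroup A, AddGroup.FG L ∧ ∀ a : A, ∃ n : ℕ, n ≠ 0 ∧ n • a ∈ L := by
  classical
  have h0 : ∃ f : (Fin 0 →₀ ℤ) →+ A, Function.Injective f := ⟨0, fun a b _ => Subsingleton.elim _ _⟩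
  obtain ⟨k, hk, hmax⟩ : ∃ k, (∃ f : (Fin k →₀ ℤ) →+ A, Function.Injective f) ∧ ¬ (∃ f : (Fin (k+1) →₀ ℤ) →+ A, Function.Injective f) := by
    by_contra hcon
    push Not at hcon
    have : ∀ k, ∃ f : (Fin k →₀ ℤ) →+ A, Function.Injective f := by
      intro k
      induction k with
      | zero => exact h0
      | succ k ih => exact hcon k ih
    have := h (n+1) (this _)
    omega
  obtain ⟨f, hf⟩ := hk
  have hfg : AddGroup.FG (Fin k →₀ ℤ) := Module.Finite.iff_addGroup_fg.mp inferInstance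
  refine ⟨f.range, ?_, ?_⟩
  · exact AddGroup.fg_of_surjective f.rangeRestrict_surjective
  · intro a
    by_contra hcon
    push Not at hcon
    apply hmax
    let tl : (Fin (k+1) →₀ ℤ) →+ (Fin k →₀ ℤ) :=
      { toFun := fun v => Finsupp.tail v, map_zero' := by ext; rfl, map_add' := fun _ _ => by ext; rfl }
    let F : (Fin (k+1) →₀ ℤ) →+ A := f.comp tl +
      ((AddMonoidHom.flip (AddMonoidHom.smul (R := ℤ) (M := A))) a).comp (Finsupp.applyAddHom 0)
    refine ⟨F, (injective_iff_map_eq_zero F).2 fun v hv => ?_⟩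
    have hv' : f (Finsupp.tail v) + v 0 • a = 0 := hv
    have h1 : v 0 = 0 := by
      by_contra hne
      refine hcon (v 0).natAbs (Int.natAbs_ne_zero.2 hne) ?_
      have h2 : v 0 • a ∈ f.range := ⟨-Finsupp.tail v, by rw [map_neg]; exact (neg_eq_of_add_eq_zero_right hv')⟩
      rw [← natCast_zsmul]
      rcases Int.natAbs_eq (v 0) with h | h
      · rw [← h]; exact h2
      · have : ((v 0).natAbs : ℤ) = - v 0 := by omega
        rw [this, neg_smul]; exact neg_mem h2
    rw [h1, zero_smul, add_zero] at hv'
    have h2 := hf (hv'.trans (map_zero f).symm)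
    ext i
    refine Fin.cases h1 (fun i => ?_) i
    have := DFunLike.congr_fun h2 i
    simpa [Finsupp.tail_apply] using this

lemma frk_of_group {A : Type} [AddCommGroup A] (h : FiniteRankGroup (Multiplicative A)) : FRk A := by
  obtain ⟨⟨n, hn⟩, h2⟩ := h
  refine ⟨max_indep n (fun k ⟨f, hf⟩ => hn k ⟨AddMonoidHom.toMultiplicative f, hf⟩), fun p hp => ?_⟩
  exact (h2 p hp).to_subtype

lemma frk_of_ab {A : Type} [AddCommGroup A] (h : FiniteRankAbelian A) : FRk A := by
  obtain ⟨⟨n, hn⟩, h2⟩ := h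
  exact ⟨max_indep n hn, fun p hp => (h2 p hp).to_subtype⟩

lemma frg_iso {A B : Type} [Group A] [Group B] (e : A ≃* B) (h : FiniteRankGroup A) : FiniteRankGroup B := by
  obtain ⟨⟨n, hn⟩, h2⟩ := h
  refine ⟨⟨n, fun k ⟨f, hf⟩ => hn k ⟨e.symm.toMonoidHom.comp f, e.symm.injective.comp hf⟩⟩, fun p hp => ?_⟩
  have := (h2 p hp).image e
  refine this.subset ?_
  intro b hb
  refine ⟨e.symm b, ?_, by simp⟩
  simp only [Set.mem_setOf_eq] at hb ⊢
  rw [← map_pow, hb, map_one]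

/-- the torsion of A/L -/
lemma quot_tor_fin {A : Type} [AddCommGroup A] (L : AddSubgroup A) (hL : AddGroup.FG L) (p : ℕ) (hp : p ≠ 0) (h : Finite (tor p A)) :
    Finite (tor p (A ⧸ L)) := by
  let W : AddSubgroup A := L.comap (nsmulAddMonoidHom p)
  have hLp : Finite (L ⧸ mul p L) := by
    haveI : AddGroup.FG (L ⧸ mul p L) := AddGroup.fg_of_surjective (QuotientAddGroup.mk'_surjective (mul p L))
    apply fg_tor_fin
    intro a
    obtain ⟨a, rfl⟩ := QuotientAddGroup.mk'_surjective _ a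
    refine ⟨p, hp, ?_⟩
    rw [← map_nsmul, QuotientAddGroup.mk'_apply, QuotientAddGroup.eq_zero_iff]
    exact ⟨a, rfl⟩
  let φ : W →+ L := ((nsmulAddMonoidHom p).comp W.subtype).codRestrict L (fun w => w.2)
  let ψ : W →+ (L ⧸ mul p L) := (QuotientAddGroup.mk' _).comp φ
  let χ : W →+ tor p (A ⧸ L) := ((QuotientAddGroup.mk' L).comp W.subtype).codRestrict _ (fun w => by
    rw [mem_tor, AddMonoidHom.comp_apply, ← map_nsmul, QuotientAddGroup.mk'_apply, QuotientAddGroup.eq_zero_iff]; exact w.2)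
  have hχ : Function.Surjective χ := by
    rintro ⟨x, hx⟩
    obtain ⟨a, rfl⟩ := QuotientAddGroup.mk'_surjective _ x
    rw [mem_tor, ← map_nsmul, QuotientAddGroup.mk'_apply, QuotientAddGroup.eq_zero_iff] at hx
    exact ⟨⟨a, hx⟩, rfl⟩
  let LW : AddSubgroup W := χ.ker
  have h1 : Finite (W ⧸ LW) := by
    refine fin_exact (A := tor p A) (C := L ⧸ mul p L)
      ((QuotientAddGroup.mk' LW).comp ((tor p A).subtype.codRestrict W (fun x => by
        change p • x.1 ∈ L; rw [tor_smul]; exact zero_mem _)))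
      (QuotientAddGroup.lift LW ψ (by
        intro w hw
        have hw' : w.1 ∈ L := (QuotientAddGroup.eq_zero_iff _).1 (congrArg Subtype.val hw)
        rw [AddMonoidHom.mem_ker]
        refine (QuotientAddGroup.eq_zero_iff _).2 ⟨⟨w.1, hw'⟩, Subtype.ext rfl⟩)) ?_ h hLp
    intro b hb
    obtain ⟨w, rfl⟩ := QuotientAddGroup.mk'_surjective _ b
    have hb' : φ w ∈ mul p L := (QuotientAddGroup.eq_zero_iff _).1 hb
    obtain ⟨l, hl⟩ := hb'
    have hl' : p • l.1 = p • w.1 := congrArg Subtype.val hl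
    refine ⟨⟨w.1 - l.1, by rw [mem_tor, smul_sub, hl', sub_self]⟩, ?_⟩
    rw [AddMonoidHom.comp_apply, ← sub_eq_zero, ← map_sub]
    refine (QuotientAddGroup.eq_zero_iff _).2 ?_
    apply Subtype.ext
    refine (QuotientAddGroup.eq_zero_iff _).2 ?_
    change w.1 - l.1 - w.1 ∈ L
    rw [sub_sub_cancel_left]; exact neg_mem l.2
  exact Finite.of_equiv _ (QuotientAddGroup.quotientKerEquivOfSurjective χ hχ).toEquiv

lemma FinCohA.frk {A : Type} [AddCommGroup A] (h : FRk A) : FinCohA A := by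
  obtain ⟨⟨L, hL, h1⟩, h2⟩ := h
  refine FinCohA.sub L (FinCohA.fg hL) (FinCohA.tor ?_ (fun p hp => quot_tor_fin L hL p hp.ne_zero (h2 p hp)))
  intro a
  obtain ⟨a, rfl⟩ := QuotientAddGroup.mk'_surjective _ a
  obtain ⟨n, hn, h⟩ := h1 a
  refine ⟨n, hn, ?_⟩
  rw [← map_nsmul]
  exact (QuotientAddGroup.eq_zero_iff _).2 h

/-- all abelian sections have finite rank -/
def FR (Γ : Type) [Group Γ] : Prop :=
  ∀ (H : Subgroup Γ) (A : Type) [AddCommGroup A] (f : H →* Multiplicative A), Function.Surjective f → FRk A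

lemma FR.of {Γ : Type} [Group Γ] (h : SolvableOfFiniteRank Γ) : FR Γ := by
  intro H A _ f hf
  have e : (H ⧸ f.ker) ≃* Multiplicative A := QuotientGroup.quotientKerEquivOfSurjective f hf
  refine frk_of_group (frg_iso e (h.2 H f.ker inferInstance ?_))
  intro x y
  apply e.injective
  rw [map_mul, map_mul, mul_comm]

lemma FR.quot {Γ Γ' : Type} [Group Γ] [Group Γ'] (h : FR Γ) (f : Γ →* Γ') (hf : Function.Surjective f) : FR Γ' := by
  intro H A _ g hg
  refine h (H.comap f) A (g.comp ((f.comp (H.comap f).subtype).codRestrict H (fun x => x.2))) ?_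
  intro a
  obtain ⟨⟨y, hy⟩, rfl⟩ := hg a
  obtain ⟨x, rfl⟩ := hf y
  exact ⟨⟨x, hy⟩, rfl⟩

lemma FR.inj {Γ Γ' : Type} [Group Γ] [Group Γ'] (h : FR Γ) (i : Γ' →* Γ) (hi : Function.Injective i) : FR Γ' := by
  intro H A _ g hg
  let e : H ≃* H.map i := H.equivMapOfInjective i hi
  refine h (H.map i) A (g.comp e.symm.toMonoidHom) (hg.comp e.symm.surjective)

lemma FR.ab {Γ : Type} [Group Γ] (h : FR Γ) {A : Type} [AddCommGroup A] (f : Γ →* Multiplicative A) (hf : Function.Surjective f) : FRk A := by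
  refine h ⊤ A (f.comp (⊤ : Subgroup Γ).subtype) ?_
  intro a
  obtain ⟨x, rfl⟩ := hf a
  exact ⟨⟨x, trivial⟩, rfl⟩

lemma FR.comm {Γ : Type} [CommGroup Γ] (h : FR Γ) : FRk (Additive Γ) :=
  h.ab (MulEquiv.multiplicativeAdditive Γ).symm.toMonoidHom (MulEquiv.surjective _)

lemma FinCoh.comm {Γ : Type} [CommGroup Γ] (h : FR Γ) : FinCoh Γ :=
  FinCoh.iso (Γ := Multiplicative (Additive Γ)) (MulEquiv.multiplicativeAdditive Γ) (FinCohA.frk h.comm)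

lemma FinCoh.solv (n : ℕ) : ∀ (Γ : Type) [Group Γ], derivedSeries Γ n = ⊥ → FR Γ → FinCoh Γ := by
  induction n with
  | zero =>
    intro Γ _ h _
    rw [derivedSeries_zero] at h
    have : Subsingleton Γ := ⟨fun a b => by
        have h1 : ∀ c : Γ, c = 1 := fun c => Subgroup.mem_bot.1 (h ▸ Subgroup.mem_top c)
        rw [h1 a, h1 b]⟩
    exact FinCoh.of_fin
  | succ n ih =>
    intro Γ _ h hFR
    let K := derivedSeries Γ n
    let q := QuotientGroup.mk' K
    have hq : Function.Surjective q := QuotientGroup.mk'_surjective _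
    refine FinCoh.ext q hq ?_ (ih _ ?_ (hFR.quot q hq))
    · have hcm : ∀ a b : q.ker, a * b = b * a := fun a b => by
        apply Subtype.ext
        have ha : a.1 ∈ K := (QuotientGroup.eq_one_iff _).1 a.2
        have hb : b.1 ∈ K := (QuotientGroup.eq_one_iff _).1 b.2
        rw [derivedSeries_succ] at h
        have := Subgroup.commutator_mem_commutator ha hb
        rw [h] at this
        exact commutatorElement_eq_one_iff_mul_comm.1 (Subgroup.mem_bot.1 this)
      letI : CommGroup q.ker := { (inferInstance : Group q.ker) with mul_comm := hcm }
      exact FinCoh.comm (hFR.inj q.ker.subtype q.ker.subtype_injective)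
    · rw [← map_derivedSeries_eq hq, Subgroup.map_eq_bot_iff, QuotientGroup.ker_mk']

lemma FinCoh.solv' {Γ : Type} [Group Γ] (hs : IsSolvable Γ) (h : FR Γ) : FinCoh Γ := by
  obtain ⟨n, hn⟩ := (isSolvable_def Γ).1 hs
  exact FinCoh.solv n Γ hn h

end TB
end

section
namespace TB

/-- V is f.g. up to d'-torsion -/
def PF (d : ℕ) (V : Type) [AddCommGroup V] : Prop :=
  ∃ L : AddSubgroup V, L.FG ∧ ∀ x : V, ∃ n : ℕ, n ≠ 0 ∧ n.Coprime d ∧ n • x ∈ L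

lemma sub_fg {V : Type} [AddCommGroup V] {L W : AddSubgroup V} (hL : L.FG) (h : W ≤ L) : W.FG := by
  have h1 : L.toIntSubmodule.FG := by
    rw [Submodule.fg_iff_addSubgroup_fg]; simpa using hL
  have h2 : IsNoetherian ℤ L.toIntSubmodule := isNoetherian_of_fg_of_noetherian _ h1
  have h3 : W.toIntSubmodule.FG := Submodule.FG.of_le h1 (by simpa using h)
  rw [Submodule.fg_iff_addSubgroup_fg] at h3; simpa using h3

lemma fg_map {V W : Type} [AddCommGroup V] [AddCommGroup W] {L : AddSubgroup V} (hL : L.FG) (f : V →+ W) : (L.map f).FG := by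
  classical
  obtain ⟨s, rfl⟩ := hL
  exact ⟨s.image f, by rw [AddMonoidHom.map_closure, Finset.coe_image]⟩

lemma fg_lift {V W : Type} [AddCommGroup V] [AddCommGroup W] {L : AddSubgroup W} (hL : L.FG) (f : V →+ W) (h : L ≤ f.range) :
    ∃ L' : AddSubgroup V, L'.FG ∧ L'.map f = L := by
  classical
  obtain ⟨s, rfl⟩ := hL
  have h1 : ∀ x : W, x ∈ s → ∃ v, f v = x := fun x hx => h (AddSubgroup.subset_closure hx)
  choose! g hg using h1
  refine ⟨AddSubgroup.closure (s.image g : Finset V), ⟨_, rfl⟩, ?_⟩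
  rw [AddMonoidHom.map_closure, Finset.coe_image]
  congr 1
  rw [← Set.image_comp]
  ext x
  constructor
  · rintro ⟨y, hy, rfl⟩
    have : f (g y) = y := hg y hy
    simpa [this] using hy
  · intro hx; exact ⟨x, hx, hg x hx⟩

/-- PF as a Serre class -/
def sPF (d : ℕ) : Serre where
  P V _ := PF d V
  zero A _ h := ⟨⊥, ⟨∅, by simp⟩, fun x => ⟨1, one_ne_zero, Nat.coprime_one_left _, by rw [h x, smul_zero]; exact zero_mem _⟩⟩
  exact A B C _ _ _ f g h := by
    rintro ⟨L, hL, h1⟩ ⟨M, hM, h2⟩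
    obtain ⟨M', hM', h3⟩ := fg_lift (sub_fg hM (inf_le_left (b := g.range))) g inf_le_right
    refine ⟨L.map f ⊔ M', (fg_map hL f).sup hM', fun b => ?_⟩
    obtain ⟨n, hn, hnd, hb⟩ := h2 (g b)
    have : g (n • b) ∈ M ⊓ g.range := ⟨by rw [map_nsmul]; exact hb, ⟨_, rfl⟩⟩
    rw [← h3] at this
    obtain ⟨m, hm, hgm⟩ := this
    obtain ⟨a, ha⟩ := h (n • b - m) (by rw [map_sub, hgm, sub_self])
    obtain ⟨k, hk, hkd, hka⟩ := h1 a
    refine ⟨k * n, mul_ne_zero hk hn, hkd.mul_left hnd, ?_⟩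
    have e : (k * n) • b = k • f a + k • m := by
      rw [← smul_add, ha, sub_add_cancel, mul_smul]
    rw [e]
    refine add_mem (AddSubgroup.mem_sup_left ⟨k • a, hka, map_nsmul _ _ _⟩) (AddSubgroup.mem_sup_right (nsmul_mem hm k))

/-- the relevant numbers d for a set of primes π -/
def Dp (π : Set ℕ) (d : ℕ) : Prop := d = 1 ∨ (d.Prime ∧ d ∉ π)

/-- PF for all relevant d -/
def sPP (π : Set ℕ) : Serre where
  P V _ := ∀ d, Dp π d → PF d V
  zero A _ h := fun d _ => (sPF d).zero A h
  exact A B C _ _ _ f g h h1 h2 := fun d hd => (sPF d).exact A B C f g h (h1 d hd) (h2 d hd)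

lemma pf_tensor {d : ℕ} {A B : Type} [AddCommGroup A] [AddCommGroup B] (hA : PF d A) (hB : PF d B) :
    PF d (TensorProduct ℤ A B) := by
  classical
  obtain ⟨L, ⟨s, hs⟩, h1⟩ := hA
  obtain ⟨M, ⟨t, ht⟩, h2⟩ := hB
  let W := AddSubgroup.closure (((s ×ˢ t).image fun x => TensorProduct.tmul ℤ x.1 x.2 : Finset (TensorProduct ℤ A B)) : Set (TensorProduct ℤ A B))
  have hW : ∀ a ∈ L, ∀ b ∈ M, TensorProduct.tmul ℤ a b ∈ W := by
    intro a ha b hb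
    rw [← hs] at ha
    rw [← ht] at hb
    induction ha using AddSubgroup.closure_induction with
    | zero => rw [TensorProduct.zero_tmul]; exact zero_mem _
    | add x y _ _ hx hy => rw [TensorProduct.add_tmul]; exact add_mem hx hy
    | neg x _ hx => rw [TensorProduct.neg_tmul]; exact neg_mem hx
    | mem x hx =>
      induction hb using AddSubgroup.closure_induction with
      | zero => rw [TensorProduct.tmul_zero]; exact zero_mem _
      | add x y _ _ hx hy => rw [TensorProduct.tmul_add]; exact add_mem hx hy
      | neg x _ hx => rw [TensorProduct.tmul_neg]; exact neg_mem hx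
      | mem y hy =>
        apply AddSubgroup.subset_closure
        exact Finset.mem_coe.2 (Finset.mem_image.2 ⟨(x, y), Finset.mem_product.2 ⟨hx, hy⟩, rfl⟩)
  refine ⟨W, ⟨_, rfl⟩, fun x => ?_⟩
  induction x using TensorProduct.induction_on with
  | zero => exact ⟨1, one_ne_zero, Nat.coprime_one_left _, by rw [smul_zero]; exact zero_mem _⟩
  | tmul a b =>
    obtain ⟨n, hn, hnd, ha⟩ := h1 a
    obtain ⟨k, hk, hkd, hb⟩ := h2 b
    refine ⟨n * k, mul_ne_zero hn hk, hnd.mul_left hkd, ?_⟩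
    have := hW _ ha _ hb
    rwa [← natCast_zsmul, ← natCast_zsmul, TensorProduct.smul_tmul_smul, ← Nat.cast_mul, natCast_zsmul] at this
  | add x y hx hy =>
    obtain ⟨n, hn, hnd, ha⟩ := hx
    obtain ⟨k, hk, hkd, hb⟩ := hy
    refine ⟨n * k, mul_ne_zero hn hk, hnd.mul_left hkd, ?_⟩
    rw [smul_add]
    refine add_mem ?_ ?_
    · rw [mul_comm, mul_smul]; exact nsmul_mem ha _
    · rw [mul_smul]; exact nsmul_mem hb _

lemma pf_fg {d : ℕ} {A : Type} [AddCommGroup A] (h : AddGroup.FG A) : PF d A :=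
  ⟨⊤, (AddGroup.fg_def.1 h), fun x => ⟨1, one_ne_zero, Nat.coprime_one_left _, trivial⟩⟩

lemma pf_fin {d : ℕ} {A : Type} [AddCommGroup A] [Finite A] : PF d A := pf_fg inferInstance

lemma pf_one_of_frk {A : Type} [AddCommGroup A] (h : FRk A) : PF 1 A := by
  obtain ⟨⟨L, hL, h1⟩, -⟩ := h
  refine ⟨L, (AddGroup.fg_iff_addSubgroup_fg L).1 hL, fun x => ?_⟩
  obtain ⟨n, hn, h⟩ := h1 x
  exact ⟨n, hn, Nat.coprime_one_right _, h⟩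

/-- no Prüfer quotient implies PF p -/
lemma pf_of_no_prufer {A : Type} [AddCommGroup A] (h : FRk A) (p : ℕ) (hp : p.Prime)
    (hno : ¬ ∃ f : A →+ pruferSubgroup p, Function.Surjective f) : PF p A := by
  obtain ⟨⟨L, hL, h1⟩, h2⟩ := h
  have hu : ∀ a : A ⧸ L, ∃ n : ℕ, n ≠ 0 ∧ n • a = 0 := by
    intro a
    obtain ⟨a, rfl⟩ := QuotientAddGroup.mk'_surjective _ a
    obtain ⟨n, hn, h⟩ := h1 a
    refine ⟨n, hn, ?_⟩
    rw [← map_nsmul]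
    exact (QuotientAddGroup.eq_zero_iff _).2 h
  have hc := copr_quot_cer hu p hp.ne_zero (quot_tor_fin L hL p hp.ne_zero (h2 p hp))
  obtain ⟨k, hf, hd⟩ := hc.dvpart hp.ne_zero
  set U := (A ⧸ L) ⧸ copr p (A ⧸ L)
  obtain ⟨r, q, hq, ⟨e⟩⟩ := dv_struct p hp.ne_zero _ _ hd (hc.inj (mul (p^k) U).subtype (mul (p^k) U).subtype_injective) le_rfl
  rcases Nat.eq_zero_or_pos r with rfl | hr
  · have h0 : Finite (mul (p^k) U) := Finite.of_injective e e.injective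
    have hU : Finite U := fin_exact (mul (p^k) U).subtype (QuotientAddGroup.mk' (mul (p^k) U)) (fun b hb =>
      ⟨⟨b, (QuotientAddGroup.eq_zero_iff _).1 hb⟩, rfl⟩) h0 hf
    let F : A →+ U := (QuotientAddGroup.mk' _).comp (QuotientAddGroup.mk' L)
    have hF : Function.Surjective F := (QuotientAddGroup.mk'_surjective _).comp (QuotientAddGroup.mk'_surjective _)
    have hUt : (⊤ : AddSubgroup U).FG := AddGroup.fg_def.1 inferInstance
    obtain ⟨L', hL', hm⟩ := fg_lift hUt F (fun x _ => hF x)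
    refine ⟨L ⊔ L', ((AddGroup.fg_iff_addSubgroup_fg L).1 hL).sup hL', fun x => ?_⟩
    have : F x ∈ L'.map F := by rw [hm]; trivial
    obtain ⟨y, hy, hxy⟩ := this
    have h3 : F (x - y) = 0 := by rw [map_sub, hxy, sub_self]
    have h4 : QuotientAddGroup.mk' L (x - y) ∈ copr p (A ⧸ L) := (QuotientAddGroup.eq_zero_iff _).1 h3
    obtain ⟨n, hn, h5⟩ := h4
    rw [← map_nsmul] at h5
    have h6 : n • (x - y) ∈ L := (QuotientAddGroup.eq_zero_iff _).1 h5
    refine ⟨n, ?_, hn, ?_⟩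
    · rintro rfl
      rw [Nat.coprime_zero_left] at hn
      exact hp.one_lt.ne' hn
    · have : n • x = n • (x - y) + n • y := by rw [← smul_add, sub_add_cancel]
      rw [this]
      exact add_mem (AddSubgroup.mem_sup_left h6) (AddSubgroup.mem_sup_right (nsmul_mem hy _))
  · exfalso
    apply hno
    have hq0 : q ⟨0, hr⟩ = p := (Nat.prime_dvd_prime_iff_eq (hq _).1 hp).1 (hq _).2
    let F : A →+ U := (QuotientAddGroup.mk' _).comp (QuotientAddGroup.mk' L)
    have hF : Function.Surjective F := (QuotientAddGroup.mk'_surjective _).comp (QuotientAddGroup.mk'_surjective _)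
    let G : A →+ pruferSubgroup (q ⟨0, hr⟩) := (Pi.evalAddMonoidHom (fun i => pruferSubgroup (q i)) ⟨0, hr⟩).comp
      (e.toAddMonoidHom.comp ((nsmulAddMonoidHom (α := U) (p^k)).rangeRestrict.comp F))
    have hG : Function.Surjective G := by
      intro x
      classical
      obtain ⟨y, hy⟩ := (e.surjective.comp ((AddMonoidHom.rangeRestrict_surjective _).comp hF))
        (Pi.single (M := fun i => pruferSubgroup (q i)) ⟨0, hr⟩ x)
      refine ⟨y, ?_⟩
      have := congrFun hy ⟨0, hr⟩
      rw [Pi.single_eq_same] at this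
      exact this
    rw [← hq0]
    exact ⟨G, hG⟩

lemma spec_of_prufer {Γ : Type} [Group Γ] (H : Subgroup Γ) (p : ℕ) (hp : p.Prime) (f : H →* Multiplicative (pruferSubgroup p))
    (hf : Function.Surjective f) : p ∈ groupSpectrum Γ :=
  ⟨hp, H, f.ker, inferInstance, ⟨QuotientGroup.quotientKerEquivOfSurjective f hf⟩⟩

/-- Γ has finite rank abelian sections and spectrum in π -/
def FRS (π : Set ℕ) (Γ : Type) [Group Γ] : Prop :=
  ∀ (H : Subgroup Γ) (A : Type) [AddCommGroup A] (f : H →* Multiplicative A), Function.Surjective f → FRk A ∧ (sPP π).P A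

lemma FRS.of {Γ : Type} [Group Γ] (h : SolvableOfFiniteRank Γ) : FRS (groupSpectrum Γ) Γ := by
  intro H A _ f hf
  have h1 := FR.of h H A f hf
  refine ⟨h1, ?_⟩
  rintro d (rfl | ⟨hd, hn⟩)
  · exact pf_one_of_frk h1
  · refine pf_of_no_prufer h1 d hd ?_
    rintro ⟨g, hg⟩
    exact hn (spec_of_prufer H d hd ((AddMonoidHom.toMultiplicative g).comp f) (Function.Surjective.comp (g := AddMonoidHom.toMultiplicative g) hg hf))

lemma FRS.fr {π : Set ℕ} {Γ : Type} [Group Γ] (h : FRS π Γ) : FR Γ := fun H A _ f hf => (h H A f hf).1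

lemma FRS.quot {π : Set ℕ} {Γ Γ' : Type} [Group Γ] [Group Γ'] (h : FRS π Γ) (f : Γ →* Γ') (hf : Function.Surjective f) : FRS π Γ' := by
  intro H A _ g hg
  refine h (H.comap f) A (g.comp ((f.comp (H.comap f).subtype).codRestrict H (fun x => x.2))) ?_
  intro a
  obtain ⟨⟨y, hy⟩, rfl⟩ := hg a
  obtain ⟨x, rfl⟩ := hf y
  exact ⟨⟨x, hy⟩, rfl⟩

lemma FRS.inj {π : Set ℕ} {Γ Γ' : Type} [Group Γ] [Group Γ'] (h : FRS π Γ) (i : Γ' →* Γ) (hi : Function.Injective i) : FRS π Γ' := by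
  intro H A _ g hg
  let e : H ≃* H.map i := H.equivMapOfInjective i hi
  refine h (H.map i) A (g.comp e.symm.toMonoidHom) (hg.comp e.symm.surjective)

lemma FRS.ab {π : Set ℕ} {Γ : Type} [Group Γ] (h : FRS π Γ) {A : Type} [AddCommGroup A] (f : Γ →* Multiplicative A) (hf : Function.Surjective f) :
    FRk A ∧ (sPP π).P A := by
  refine h ⊤ A (f.comp (⊤ : Subgroup Γ).subtype) ?_
  intro a
  obtain ⟨x, rfl⟩ := hf a
  exact ⟨⟨x, trivial⟩, rfl⟩

/-- torsion free -/
def TF (A : Type) [AddCommGroup A] : Prop := ∀ (n : ℕ) (a : A), n ≠ 0 → n • a = 0 → a = 0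

lemma tf_iff {A : Type} [AddCommGroup A] : TF A ↔ ∀ g : A, g ≠ 0 → ¬IsOfFinAddOrder g := by
  constructor
  · intro h g hg hf
    obtain ⟨n, hn, h0⟩ := isOfFinAddOrder_iff_nsmul_eq_zero.1 hf
    exact hg (h n g hn.ne' h0)
  · intro h n a hn ha
    by_contra hne
    exact h a hne (isOfFinAddOrder_iff_nsmul_eq_zero.2 ⟨n, Nat.pos_of_ne_zero hn, ha⟩)

lemma nice_pp {π : Set ℕ} {A : Type} [AddCommGroup A] (h1 : FiniteRankAbelian A) (h2 : addSpectrum A ⊆ π) : (sPP π).P A := by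
  have hf := frk_of_ab h1
  rintro d (rfl | ⟨hd, hn⟩)
  · exact pf_one_of_frk hf
  · refine pf_of_no_prufer hf d hd ?_
    rintro ⟨g, hg⟩
    refine hn (h2 (spec_of_prufer ⊤ d hd ((AddMonoidHom.toMultiplicative g).comp (⊤ : Subgroup (Multiplicative A)).subtype) ?_))
    intro x
    obtain ⟨y, hy⟩ := hg x
    exact ⟨⟨y, trivial⟩, hy⟩

lemma prufer_inf (p : ℕ) (hp : p.Prime) (h : Finite (pruferSubgroup p)) : False := by
  obtain ⟨b, hb⟩ := prufer_dv hp (Nat.card (pruferSubgroup p)) Nat.card_pos.ne' (pu p hp)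
  rw [card_nsmul_eq_zero'] at hb
  exact pu_ne p hp hb.symm

lemma prufer_not_pf (p : ℕ) (hp : p.Prime) : ¬ PF p (pruferSubgroup p) := by
  rintro ⟨L, hL, h⟩
  have hLf : Finite L := by
    haveI := (AddGroup.fg_iff_addSubgroup_fg L).2 hL
    apply fg_tor_fin
    intro a
    obtain ⟨k, hk⟩ := prufer_tors p a.1
    exact ⟨p^k, pow_ne_zero _ hp.ne_zero, Subtype.ext hk⟩
  apply prufer_inf p hp
  refine Finite.of_surjective (fun x : L => x.1) ?_
  intro x
  obtain ⟨n, hn, hnd, hx⟩ := h x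
  obtain ⟨k, hk⟩ := prufer_tors p x
  obtain ⟨z, hz⟩ := cop_surj (Nat.Coprime.pow_right k hnd) x hk
  refine ⟨⟨x, ?_⟩, rfl⟩
  rw [← hz, smul_comm]
  exact zsmul_mem hx z

lemma nice_of_pp {π : Set ℕ} {A : Type} [AddCommGroup A] (ht : TF A) (h : (sPP π).P A) :
    FiniteRankAbelian A ∧ addSpectrum A ⊆ π := by
  refine ⟨⟨?_, ?_⟩, ?_⟩
  · obtain ⟨L, hL, h1⟩ := h 1 (Or.inl rfl)
    haveI : AddGroup.FG L := (AddGroup.fg_iff_addSubgroup_fg L).2 hL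
    haveI : Module.Finite ℤ L := Module.Finite.iff_addGroup_fg.mpr inferInstance
    refine ⟨Module.finrank ℤ L, fun k ⟨f, hf⟩ => ?_⟩
    choose N hN _ hNL using h1
    let n := ∏ i : Fin k, N (f (Finsupp.single i 1))
    have hn : n ≠ 0 := Finset.prod_ne_zero_iff.2 fun i _ => hN _
    have hL : ∀ v, n • f v ∈ L := by
      intro v
      induction v using Finsupp.induction_linear with
      | zero => rw [map_zero, smul_zero]; exact zero_mem _
      | add v w hv hw => rw [map_add, smul_add]; exact add_mem hv hw
      | single i c =>
        obtain ⟨e, he⟩ := Finset.dvd_prod_of_mem (fun i : Fin k => N (f (Finsupp.single i 1))) (Finset.mem_univ i)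
        have h3 : n • f (Finsupp.single i 1) ∈ L := by
          change (∏ i : Fin k, N (f (Finsupp.single i 1))) • _ ∈ L
          rw [he, mul_comm, mul_smul]; exact nsmul_mem (hNL _) _
        have : Finsupp.single i c = c • Finsupp.single i (1:ℤ) := by simp
        rw [this, map_zsmul, smul_comm]
        exact zsmul_mem h3 c
    let F : (Fin k →₀ ℤ) →+ L := ((nsmulAddMonoidHom n).comp f).codRestrict L hL
    have hF : Function.Injective F := by
      rw [injective_iff_map_eq_zero]
      intro v hv
      have : n • f v = 0 := congrArg Subtype.val hv
      exact hf ((ht n _ hn this).trans (map_zero f).symm)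
    have := LinearMap.finrank_le_finrank_of_injective (f := F.toIntLinearMap) hF
    simpa using this
  · intro p hp
    refine (Set.finite_singleton (0:A)).subset ?_
    intro a ha
    exact ht p a hp.ne_zero ha
  · rintro p ⟨hp, H, K, hK, ⟨e⟩⟩
    by_contra hn
    apply prufer_not_pf p hp
    have hA := h p (Or.inr ⟨hp, hn⟩)
    let H' : AddSubgroup A := Subgroup.toAddSubgroup' H
    have hH : PF p H' := (sPF p).of_inj H'.subtype (fun b hb => Subtype.ext hb) hA
    let g : H →* Multiplicative (pruferSubgroup p) := e.toMonoidHom.comp (QuotientGroup.mk' K)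
    have hg : Function.Surjective g := e.surjective.comp (QuotientGroup.mk'_surjective K)
    let g' : H' →+ pruferSubgroup p := 
      { toFun := fun x => Multiplicative.toAdd (g ⟨Multiplicative.ofAdd x.1, x.2⟩)
        map_zero' := map_one g
        map_add' := fun x y => map_mul g ⟨Multiplicative.ofAdd x.1, x.2⟩ ⟨Multiplicative.ofAdd y.1, y.2⟩ }
    refine (sPF p).of_surj g' ?_ hH
    intro x
    obtain ⟨y, hy⟩ := hg (Multiplicative.ofAdd x)
    exact ⟨⟨Multiplicative.toAdd y.1, y.2⟩, hy⟩

end TB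
end

section
namespace TB

lemma ideal_mul (P : Serre) {R : Type} [CommRing R] (I J : Ideal R) (hf : I.FG) (hI : P.P (R ⧸ I)) (hJ : P.P (R ⧸ J)) : P.P (R ⧸ (I * J)) := by
  obtain ⟨s, hs⟩ := hf
  have hsI : ∀ a : s, (a : R) ∈ I := fun a => by rw [← hs]; exact Ideal.subset_span a.2
  have hex : ∀ a : s, ∃ g : R ⧸ J →+ R ⧸ (I * J), ∀ r, g (Ideal.Quotient.mk J r) = Ideal.Quotient.mk (I * J) (r * a) := by
    intro a
    refine ⟨QuotientAddGroup.lift _ ((Ideal.Quotient.mk (I * J)).toAddMonoidHom.comp (AddMonoidHom.mulRight (a : R))) ?_, fun r => rfl⟩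
    intro r hr
    refine Ideal.Quotient.eq_zero_iff_mem.2 ?_
    show r * (a : R) ∈ I * J
    rw [mul_comm r]
    exact Ideal.mul_mem_mul (hsI a) hr
  choose g hg using hex
  have hP : P.P (s → R ⧸ J) := Serre.piFin P hJ
  let f : (s → R ⧸ J) →+ (R ⧸ (I * J)) := ∑ a : s, (g a).comp (Pi.evalAddMonoidHom _ a)
  have hf : ∀ c, f c = ∑ a : s, g a (c a) := fun c => by simp [f]
  have hle : I * J ≤ I := Ideal.mul_le_left
  refine P.exact (s → R ⧸ J) _ (R ⧸ I) f (Ideal.Quotient.factor hle).toAddMonoidHom ?_ hP hI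
  intro b hb
  obtain ⟨r, rfl⟩ := Ideal.Quotient.mk_surjective b
  have hr : r ∈ I := Ideal.Quotient.eq_zero_iff_mem.1 hb
  rw [← hs, Submodule.mem_span_finset'] at hr
  obtain ⟨c, hc⟩ := hr
  refine ⟨fun a => Ideal.Quotient.mk J (c a), ?_⟩
  rw [hf, ← hc, map_sum]
  exact Finset.sum_congr rfl fun a _ => hg a _

/-- integral group ring -/
abbrev GR (Q : Type) := MonoidAlgebra ℤ Q

/-- basis element -/
abbrev bs {Q : Type} (q : Q) : GR Q := MonoidAlgebra.single q 1

section
variable {Q : Type} [Group Q] {V W : Type} [AddCommGroup V] [AddCommGroup W]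

lemma gr_ind {p : GR Q → Prop} (r : GR Q) (h1 : ∀ q, p (bs q)) (hadd : ∀ a b, p a → p b → p (a + b))
    (hneg : ∀ a, p a → p (-a)) (h0 : p 0) : p r := by
  induction r using MonoidAlgebra.induction_linear with
  | zero => exact h0
  | add f g hf hg => exact hadd _ _ hf hg
  | single q n =>
    have hn : ∀ n : ℤ, MonoidAlgebra.single q n = n • (bs q : GR Q) := by
      intro n
      simp [bs, MonoidAlgebra.smul_single]
    rw [hn]
    induction n using Int.induction_on with
    | zero => simpa using h0
    | succ n ih => rw [add_smul, one_smul]; exact hadd _ _ ih (h1 q)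
    | pred n ih => rw [sub_smul, one_smul, sub_eq_add_neg]; exact hadd _ _ ih (hneg _ (h1 q))

lemma gr_ext {D D' : GR Q →+ V} (h : ∀ q, D (bs q) = D' (bs q)) : D = D' := by
  refine DFunLike.ext _ _ fun r => ?_
  induction r using gr_ind with
  | h1 q => exact h q
  | hadd a b ha hb => rw [map_add, map_add, ha, hb]
  | hneg a ha => rw [map_neg, map_neg, ha]
  | h0 => simp

/-- ring hom from an action -/
def Act.Rh (α : Act Q V) : GR Q →+* AddMonoid.End V :=
  ((MonoidAlgebra.lift ℤ (AddMonoid.End V) Q)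
    { toFun := fun q => (α q : AddMonoid.End V)
      map_one' := by ext x; exact α.one x
      map_mul' := fun a b => by ext x; exact α.mul a b x }).toRingHom

lemma Act.Rh_bs (α : Act Q V) (q : Q) (v : V) : α.Rh (bs q) v = α q v := by
  have : α.Rh (bs q) = (α q : AddMonoid.End V) := by
    simp [Act.Rh, bs]
    rfl
  rw [this]; rfl

/-- action of group ring elements -/
def Act.R (α : Act Q V) (r : GR Q) : V →+ V := α.Rh r

/-- evaluation at v -/
def Act.Rv (α : Act Q V) (v : V) : GR Q →+ V where
  toFun r := α.R r v
  map_zero' := by simp only [Act.R, map_zero]; rfl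
  map_add' a b := by simp only [Act.R, map_add]; rfl

lemma Act.Rv_apply (α : Act Q V) (v : V) (r) : α.Rv v r = α.R r v := rfl
@[simp] lemma Act.R_bs (α : Act Q V) (q : Q) (v : V) : α.R (bs q) v = α q v := α.Rh_bs q v
@[simp] lemma Act.R_zero (α : Act Q V) (v : V) : α.R 0 v = 0 := map_zero (α.Rv v)
@[simp] lemma Act.R_one (α : Act Q V) (v : V) : α.R 1 v = v := by simp only [Act.R, map_one]; rfl
lemma Act.R_add (α : Act Q V) (a b : GR Q) (v : V) : α.R (a + b) v = α.R a v + α.R b v := map_add (α.Rv v) a b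
lemma Act.R_sub (α : Act Q V) (a b : GR Q) (v : V) : α.R (a - b) v = α.R a v - α.R b v := map_sub (α.Rv v) a b
lemma Act.R_neg (α : Act Q V) (a : GR Q) (v : V) : α.R (-a) v = -α.R a v := map_neg (α.Rv v) a
lemma Act.R_nsmul (α : Act Q V) (n : ℕ) (a : GR Q) (v : V) : α.R (n • a) v = n • α.R a v := map_nsmul (α.Rv v) n a
lemma Act.R_mul (α : Act Q V) (a b : GR Q) (v : V) : α.R (a * b) v = α.R a (α.R b v) := by
  simp only [Act.R, map_mul]; rfl

lemma Act.R_equi (α : Act Q V) (β : Act Q W) (φ : V →+ W) (h : ∀ q v, φ (α q v) = β q (φ v)) (r : GR Q) (v : V) :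
    φ (α.R r v) = β.R r (φ v) := by
  have : φ.comp (α.Rv v) = β.Rv (φ v) := gr_ext fun q => by
    simp [Act.Rv_apply, h]
  exact DFunLike.congr_fun this r

lemma Act.R_eq (α : Act Q V) (v : V) (D : GR Q →+ V) (h : ∀ q, D (bs q) = α q v) (r : GR Q) : D r = α.R r v := by
  have : D = α.Rv v := gr_ext fun q => by simp [Act.Rv_apply, h]
  rw [this]; rfl

/-- if R-actions agree -/
lemma Act.R_inv (α : Act Q V) (S : AddSubgroup V) (h : ∀ q, ∀ v ∈ S, α q v ∈ S) (r : GR Q) (v : V) (hv : v ∈ S) : α.R r v ∈ S := by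
  induction r using gr_ind with
  | h1 q => rw [Act.R_bs]; exact h q v hv
  | hadd a b ha hb => rw [Act.R_add]; exact add_mem ha hb
  | hneg a ha => rw [Act.R_neg]; exact neg_mem ha
  | h0 => simp
end

section
variable {Q : Type} [CommGroup Q] {V W : Type} [AddCommGroup V] [AddCommGroup W] {π : Set ℕ}

/-- nice ideals -/
def NI (π : Set ℕ) (I : Ideal (GR Q)) : Prop := (sPP π).P (GR Q ⧸ I)

lemma NI.of_map {I : Ideal (GR Q)} (f : GR Q →+ V) (hV : (sPP π).P V) (h : ∀ r, f r = 0 → r ∈ I) : NI π I := by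
  have h1 : (sPP π).P (GR Q ⧸ f.ker) := (sPP π).of_inj (QuotientAddGroup.kerLift f)
    (fun b hb => (injective_iff_map_eq_zero _).1 (QuotientAddGroup.kerLift_injective f) b hb) hV
  let g : (GR Q ⧸ f.ker) →+ GR Q ⧸ I := QuotientAddGroup.lift f.ker (Submodule.mkQ I).toAddMonoidHom
    (fun r hr => (Submodule.Quotient.mk_eq_zero I).2 (h r hr))
  refine (sPP π).of_surj g (fun b => ?_) h1
  obtain ⟨r, rfl⟩ := Submodule.mkQ_surjective I b
  exact ⟨QuotientAddGroup.mk' _ r, rfl⟩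

lemma NI.mono {I J : Ideal (GR Q)} (hI : NI π I) (h : I ≤ J) : NI π J :=
  NI.of_map (Submodule.mkQ I).toAddMonoidHom hI (fun r hr => h ((Submodule.Quotient.mk_eq_zero I).1 hr))

lemma gr_noeth [Group.FG Q] : IsNoetherianRing (GR Q) := by
  haveI : Monoid.FG Q := Group.fg_iff_monoid_fg.1 inferInstance
  haveI : Algebra.FiniteType ℤ (GR Q) := MonoidAlgebra.finiteType_of_fg
  exact Algebra.FiniteType.isNoetherianRing ℤ _

lemma NI.mul [Group.FG Q] {I J : Ideal (GR Q)} (hI : NI π I) (hJ : NI π J) : NI π (I * J) :=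
  ideal_mul (sPP π) I J ((isNoetherianRing_iff_ideal_fg _).1 gr_noeth I) hI hJ

/-- diagonal -/
def Dg (I J : Ideal (GR Q)) : GR Q →+* TensorProduct ℤ (GR Q ⧸ I) (GR Q ⧸ J) :=
  ((MonoidAlgebra.lift ℤ (TensorProduct ℤ (GR Q ⧸ I) (GR Q ⧸ J)) Q)
    { toFun := fun q => TensorProduct.tmul ℤ (Ideal.Quotient.mk I (bs q)) (Ideal.Quotient.mk J (bs q))
      map_one' := rfl
      map_mul' := fun a b => by
        rw [Algebra.TensorProduct.tmul_mul_tmul, ← map_mul, ← map_mul]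
        simp [bs, MonoidAlgebra.single_mul_single] }).toRingHom

lemma Dg_bs (I J : Ideal (GR Q)) (q : Q) : Dg I J (bs q) = TensorProduct.tmul ℤ (Ideal.Quotient.mk I (bs q)) (Ideal.Quotient.mk J (bs q)) := by
  simp [Dg, bs]
  rfl

/-- I * J -/
def star (I J : Ideal (GR Q)) : Ideal (GR Q) := RingHom.ker (Dg I J)

lemma NI.star {I J : Ideal (GR Q)} (hI : NI π I) (hJ : NI π J) : NI π (star I J) :=
  NI.of_map (Dg I J).toAddMonoidHom (fun d hd => pf_tensor (hI d hd) (hJ d hd)) (fun r hr => hr)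

lemma star_kill {I J : Ideal (GR Q)} (F : GR Q →+ GR Q →+ V) (hI : ∀ a ∈ I, ∀ b, F a b = 0) (hJ : ∀ b ∈ J, ∀ a, F a b = 0)
    (D : GR Q →+ V) (hD : ∀ q, D (bs q) = F (bs q) (bs q)) (r : GR Q) (hr : r ∈ star I J) : D r = 0 := by
  let F1 : GR Q →+ (GR Q ⧸ J →+ V) :=
    { toFun := fun a => QuotientAddGroup.lift J.toAddSubgroup (F a) (fun b hb => hJ b hb a)
      map_zero' := by
        refine DFunLike.ext _ _ fun b => ?_
        obtain ⟨b, rfl⟩ := QuotientAddGroup.mk'_surjective _ b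
        show F 0 b = 0
        simp
      map_add' := fun a a' => by
        refine DFunLike.ext _ _ fun b => ?_
        obtain ⟨b, rfl⟩ := QuotientAddGroup.mk'_surjective _ b
        show F (a + a') b = F a b + F a' b
        simp }
  let F2 : GR Q ⧸ I →+ (GR Q ⧸ J →+ V) := QuotientAddGroup.lift I.toAddSubgroup F1 (fun a ha => by
    refine DFunLike.ext _ _ fun b => ?_
    obtain ⟨b, rfl⟩ := QuotientAddGroup.mk'_surjective _ b
    exact hI a ha b)
  let L : TensorProduct ℤ (GR Q ⧸ I) (GR Q ⧸ J) →+ V := TensorProduct.liftAddHom F2 (fun n a b => by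
    rw [map_zsmul, map_zsmul]; rfl)
  have : D = L.comp (Dg I J).toAddMonoidHom := gr_ext fun q => by
    rw [hD]
    show _ = L (Dg I J (bs q))
    rw [Dg_bs]
    rfl
  rw [this]
  show L (Dg I J r) = 0
  rw [show Dg I J r = 0 from hr, map_zero]

/-- augmentation -/
def augH (Q : Type) [CommGroup Q] : GR Q →+* ℤ := ((MonoidAlgebra.lift ℤ ℤ Q) (1 : Q →* ℤ)).toRingHom

lemma augH_bs (q : Q) : augH Q (bs q) = 1 := by
  show ((MonoidAlgebra.lift ℤ ℤ Q) (1 : Q →* ℤ)) (bs q) = 1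
  rw [MonoidAlgebra.lift_single]; simp

/-- augmentation ideal -/
def augI (Q : Type) [CommGroup Q] : Ideal (GR Q) := RingHom.ker (augH Q)

lemma bs_augI (q : Q) : bs q - 1 ∈ augI Q := by
  rw [augI, RingHom.mem_ker, map_sub, map_one, augH_bs, sub_self]

lemma augI_map (D : GR Q →+ V) (v : V) (h : ∀ q, D (bs q) = v) (r : GR Q) (hr : r ∈ augI Q) : D r = 0 := by
  have : D = ((zmultiplesHom V) v).comp (augH Q).toAddMonoidHom := gr_ext fun q => by
    rw [h]
    show v = (zmultiplesHom V) v (augH Q (bs q))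
    rw [augH_bs]; simp
  rw [this]
  show (zmultiplesHom V) v ((augH Q) r) = 0
  rw [show (augH Q) r = 0 from hr, map_zero]

lemma NI.aug : NI π (augI Q) :=
  NI.of_map (augH Q).toAddMonoidHom (fun d _ => pf_fg (Module.Finite.iff_addGroup_fg.1 inferInstance)) (fun r hr => hr)

/-- V is killed by a nice ideal -/
def Kil (π : Set ℕ) (α : Act Q V) : Prop := ∃ I : Ideal (GR Q), NI π I ∧ ∀ r ∈ I, ∀ v, α.R r v = 0

lemma Kil.of_fin (α : Act Q V) {ι : Type} [Finite ι] (m : ι → V) (hV : (sPP π).P V)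
    (h : ∀ r, (∀ i, α.R r (m i) = 0) → ∀ v, α.R r v = 0) : Kil π α := by
  let f : GR Q →+ (ι → V) := Pi.addMonoidHom fun i => α.Rv (m i)
  let I : Ideal (GR Q) :=
    { carrier := {r | ∀ i, α.R r (m i) = 0}
      zero_mem' := fun i => by simp
      add_mem' := fun ha hb i => by rw [Act.R_add, ha i, hb i, add_zero]
      smul_mem' := fun c r hr i => by rw [smul_eq_mul, Act.R_mul, hr i, map_zero] }
  exact ⟨I, NI.of_map f (Serre.piFin (sPP π) hV) (fun r hr i => congrFun hr i), fun r hr v => h r hr v⟩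

lemma Kil.finite [Finite V] (α : Act Q V) : Kil π α :=
  Kil.of_fin α (fun v : V => v) (fun _ _ => pf_fin) (fun _ h => h)

lemma Kil.tf (α : Act Q V) (ht : ∀ (n : ℕ) (v : V), n ≠ 0 → n • v = 0 → v = 0) (hV : (sPP π).P V) : Kil π α := by
  obtain ⟨L, ⟨s, hs⟩, hL⟩ := hV 1 (Or.inl rfl)
  refine Kil.of_fin α (fun v : s => (v : V)) hV fun r hr v => ?_
  have h1 : L ≤ (α.R r).ker := by
    rw [← hs, AddSubgroup.closure_le]
    intro x hx
    exact hr ⟨x, hx⟩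
  obtain ⟨n, hn, -, hv⟩ := hL v
  refine ht n _ hn ?_
  rw [← map_nsmul]
  exact h1 hv

lemma Kil.quot (α : Act Q V) (β : Act Q W) (φ : V →+ W) (hs : Function.Surjective φ) (h : ∀ q v, φ (α q v) = β q (φ v))
    (hk : Kil π α) : Kil π β := by
  obtain ⟨I, hI, h1⟩ := hk
  refine ⟨I, hI, fun r hr w => ?_⟩
  obtain ⟨v, rfl⟩ := hs w
  rw [← Act.R_equi α β φ h, h1 r hr, map_zero]
end
end TB
end

section
namespace TB

open Classical in
/-- pullback along an endomorphism -/
def pb {Γ X : Type} [Group Γ] [AddCommGroup X] (ρ : Act Γ X) (f : Γ →* Γ) (n : ℕ) : Hn ρ n →+ Hn ρ n :=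
  if h : Compat ρ ρ f (AddMonoidHom.id X) then Hmap f (AddMonoidHom.id X) h n else 0

lemma pb_eq {Γ X : Type} [Group Γ] [AddCommGroup X] (ρ : Act Γ X) (f : Γ →* Γ) (n : ℕ)
    (h : Compat ρ ρ f (AddMonoidHom.id X)) : pb ρ f n = Hmap f (AddMonoidHom.id X) h n := by
  rw [pb, dif_pos h]

/-- iterated cross effects -/
def EE {Γ X : Type} [Group Γ] [AddCommGroup X] (ρ : Act Γ X) (n : ℕ) : List (Γ →* Γ) → (Hn ρ n →+ Hn ρ n)
  | [] => AddMonoidHom.id _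
  | f :: l => (EE ρ n l).comp (AddMonoidHom.id _ - pb ρ f n)

lemma EE_δ {Γ X Y Z : Type} [Group Γ] [AddCommGroup X] [AddCommGroup Y] [AddCommGroup Z] {ρ : Act Γ X} {σ : Act Γ Y} {τ : Act Γ Z}
    (S : SES ρ σ τ) (n : ℕ) (l : List (Γ →* Γ)) (h : ∀ f ∈ l, Compat ρ ρ f (AddMonoidHom.id X) ∧ Compat σ σ f (AddMonoidHom.id Y) ∧
      Compat τ τ f (AddMonoidHom.id Z)) (z : Hn τ n) : EE ρ (n+1) l (S.δ n z) = S.δ n (EE τ n l z) := by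
  induction l generalizing z with
  | nil => rfl
  | cons f l ih =>
    obtain ⟨h1, h2, h3⟩ := h f (by simp)
    simp only [EE, AddMonoidHom.comp_apply, AddMonoidHom.sub_apply, AddMonoidHom.id_apply]
    rw [pb_eq ρ f _ h1, pb_eq τ f _ h3, ← ih (fun f hf => h f (by simp [hf])), map_sub, map_sub, map_sub,
      δ_nat S S f _ _ _ h1 h2 h3 (fun _ => rfl) (fun _ => rfl) n z]

lemma poly_van {Γ : Type} [Group Γ] (l : List (Γ →* Γ)) : ∀ {X : Type} [AddCommGroup X] (ρ : Act Γ X)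
    (_ : ∀ f ∈ l, Compat ρ ρ f (AddMonoidHom.id X)) (_ : ∀ f ∈ l, ∀ g, f (f g) = f g)
    (_ : l.Pairwise (fun f f' => ∀ g, f' g = 1 → f g = g)) (b : ℕ) (_ : b < l.length) (x : Hn ρ b), EE ρ b l x = 0 := by
  induction l with
  | nil => intro X _ ρ _ _ _ b hb; simp at hb
  | cons f l ih =>
    intro X _ ρ hc hi hp b hb x
    rw [List.pairwise_cons] at hp
    have hcf := hc f (by simp)
    simp only [EE, AddMonoidHom.comp_apply, AddMonoidHom.sub_apply, AddMonoidHom.id_apply]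
    let H : Subgroup Γ := MonoidHom.eqLocus f (MonoidHom.id Γ)
    have hH : ∀ h : H, f h = h := fun h => h.2
    have hcoe : ∀ y, ρ.comp H.subtype = ρ.comp H.subtype → (fun g => ρ g y) ∈ coindS H (ρ.comp H.subtype) := by
      intro y _ h g
      exact ρ.mul _ _ _
    let i : X →+ coindS H (ρ.comp H.subtype) :=
      { toFun := fun y => ⟨fun g => ρ g y, hcoe y rfl⟩
        map_zero' := by ext g; simp
        map_add' := fun a b => by ext g; simp }
    have hie : Equi ρ (coind H (ρ.comp H.subtype)) i := by
      intro g y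
      ext k
      exact (ρ.mul _ _ _).symm
    have hii : Function.Injective i := by
      intro a b h
      have := congrFun (congrArg Subtype.val h) 1
      have h' : ρ 1 a = ρ 1 b := this
      rwa [ρ.one, ρ.one] at h'
    let S := SES.ofInj _ _ i hie hii
    set x' := x - pb ρ f b x with hx'
    have h0 : S.Hi b x' = 0 := by
      apply shapiro
      show Hmap _ _ _ _ (Hmap _ _ _ _ x') = 0
      rw [Hmap_comp, hx', pb_eq ρ f b hcf, map_sub]
      refine sub_eq_zero.2 (Eq.trans ?_ (Hmap_comp _ _ _ _ _ _ b x).symm)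
      refine Hmap_congr _ _ ?_ ?_ b x
      · ext h
        simpa using congrArg Subtype.val (rfl : h = h) |>.trans (hH h).symm
      · ext y; rfl
    cases b with
    | zero => rw [S.Hi_inj0 x' h0, map_zero]
    | succ n =>
      obtain ⟨z, hz⟩ := S.ex_i n x' h0
      have hcc : ∀ f' ∈ l, Compat (coind H (ρ.comp H.subtype)) (coind H (ρ.comp H.subtype)) f' (AddMonoidHom.id _) := by
        intro f' hf' g φ
        ext k
        show φ.1 (k * f' g) = φ.1 (k * g)
        have hk : f' (k * f' g * (k * g)⁻¹) = 1 := by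
          simp [hi f' (by simp [hf'])]
        have hk2 := hp.1 f' hf' _ hk
        have h3 := coindS_mem H φ ⟨k * f' g * (k * g)⁻¹, hk2⟩ (k * g)
        simp only [inv_mul_cancel_right] at h3
        rw [h3]
        show ρ _ _ = _
        have h4 := hc f' (by simp [hf']) (k * f' g * (k * g)⁻¹) (φ.1 (k * g))
        rw [hk] at h4
        simp only [AddMonoidHom.id_apply, ρ.one] at h4
        exact h4.symm
      have hcq : ∀ f' ∈ l, Compat (qAct (coind H (ρ.comp H.subtype)) i.range (range_inv ρ _ i hie)) (qAct (coind H (ρ.comp H.subtype)) i.range (range_inv ρ _ i hie)) f' (AddMonoidHom.id _) := by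
        intro f' hf' g φ
        obtain ⟨φ, rfl⟩ := QuotientAddGroup.mk'_surjective _ φ
        exact congrArg (QuotientAddGroup.mk' i.range) (hcc f' hf' g φ)
      rw [← hz, EE_δ S n l (fun f' hf' => ⟨hc f' (by simp [hf']), hcc f' hf', hcq f' hf'⟩)]
      rw [ih _ hcq (fun f' hf' => hi f' (by simp [hf'])) hp.2 n (by simpa using hb), map_zero]
end TB
end

section
namespace TB

/-- additive lift -/
def grLift {Q A : Type} [AddCommGroup A] (F : Q → A) : GR Q →+ A :=
  (Finsupp.liftAddHom (fun q => zmultiplesHom A (F q))).comp (MonoidAlgebra.coeffAddEquiv (R := ℤ) (M := Q)).toAddMonoidHom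

lemma grLift_bs {Q A : Type} [AddCommGroup A] (F : Q → A) (q : Q) : grLift F (bs q) = F q := by
  show (Finsupp.liftAddHom (fun q => zmultiplesHom A (F q))) (Finsupp.single q 1) = F q
  simp

/-- trivial action -/
def trivA (Γ X : Type) [Group Γ] [AddCommGroup X] : Act Γ X := ⟨fun _ => AddMonoidHom.id X, fun _ => rfl, fun _ _ _ => rfl⟩

lemma triv_compat {Γ Δ X : Type} [Group Γ] [Group Δ] [AddCommGroup X] (f : Δ →* Γ) :
    Compat (trivA Γ X) (trivA Δ X) f (AddMonoidHom.id X) := fun _ _ => rfl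

/-- pullback with trivial action -/
def tb {Γ Δ : Type} [Group Γ] [Group Δ] (X : Type) [AddCommGroup X] (f : Δ →* Γ) (n : ℕ) : Hn (trivA Γ X) n →+ Hn (trivA Δ X) n :=
  Hmap f (AddMonoidHom.id X) (triv_compat f) n

lemma tb_comp {Γ Δ Ε : Type} [Group Γ] [Group Δ] [Group Ε] {X : Type} [AddCommGroup X] (f : Δ →* Γ) (g : Ε →* Δ) (n : ℕ) (x) :
    tb X g n (tb X f n x) = tb X (f.comp g) n x := by
  rw [tb, tb, Hmap_comp]; rfl

lemma tb_id {Γ : Type} [Group Γ] {X : Type} [AddCommGroup X] (n : ℕ) (x) :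
    tb X (MonoidHom.id Γ) n x = x := Hmap_id _ _ _

lemma pb_triv {Γ X : Type} [Group Γ] [AddCommGroup X] (f : Γ →* Γ) (n : ℕ) : pb (trivA Γ X) f n = tb X f n :=
  pb_eq _ _ _ (triv_compat f)

section poly
variable {V X : Type} [AddCommGroup V] [AddCommGroup X]

/-- endomorphism as a group hom -/
abbrev tm {V W : Type} [AddCommGroup V] [AddCommGroup W] (u : V →+ W) : Multiplicative V →* Multiplicative W := AddMonoidHom.toMultiplicative u

/-- group ring of additive group of endomorphisms -/
abbrev ER (V : Type) [AddCommGroup V] := GR (Multiplicative (V →+ V))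

/-- basis elements -/
abbrev be (u : V →+ V) : ER V := bs (Multiplicative.ofAdd u)

lemma be_add (u v : V →+ V) : be (u + v) = be u * be v := by
  simp [be, bs, MonoidAlgebra.single_mul_single]

lemma be_zero : be (0 : V →+ V) = 1 := rfl

/-- polynomial extension -/
def TH (V X : Type) [AddCommGroup V] [AddCommGroup X] (b : ℕ) : ER V →+ (Hn (trivA (Multiplicative V) X) b →+ Hn (trivA (Multiplicative V) X) b) :=
  grLift fun u => tb X (tm u.toAdd) b

lemma TH_be (b : ℕ) (u : V →+ V) : TH V X b (be u) = tb X (tm u) b := grLift_bs _ _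

/-- kill a coordinate -/
def kc (m : ℕ) (V : Type) [AddCommGroup V] (i : Fin m) : (Fin m → V) →+ (Fin m → V) where
  toFun v := Function.update v i 0
  map_zero' := by simp
  map_add' a b := by
    ext j
    by_cases h : j = i
    · subst h; simp
    · simp [h]

/-- sum map -/
def fw {m : ℕ} (w : Fin m → (V →+ V)) : (Fin m → V) →+ V := ∑ i, (w i).comp (Pi.evalAddMonoidHom _ i)

lemma fw_apply {m : ℕ} (w : Fin m → (V →+ V)) (v) : fw w v = ∑ i, w i (v i) := by simp [fw]

lemma fw_kc {m : ℕ} (w : Fin m → (V →+ V)) (i) : (fw w).comp (kc m V i) = fw (Function.update w i 0) := by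
  ext v
  simp only [AddMonoidHom.comp_apply, fw_apply]
  refine Finset.sum_congr rfl fun j _ => ?_
  by_cases h : j = i
  · subst h; simp [kc]
  · simp [kc, h]

/-- diagonal -/
def dgn (m : ℕ) (V : Type) [AddCommGroup V] : V →+ (Fin m → V) := Pi.addMonoidHom fun _ => AddMonoidHom.id V

lemma cross {m : ℕ} (b : ℕ) (x : Hn (trivA (Multiplicative V) X) b) (l : List (Fin m)) (hl : l.Nodup) : ∀ (w : Fin m → (V →+ V)),
    tb X (tm (dgn m V)) b (EE (trivA (Multiplicative (Fin m → V)) X) b (l.map fun i => tm (kc m V i)) (tb X (tm (fw w)) b x)) =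
      TH V X b (be (∑ j, if j ∈ l then 0 else w j) * (l.map fun i => be (w i) - 1).prod) x := by
  induction l with
  | nil =>
    intro w
    simp only [List.map_nil, EE, AddMonoidHom.id_apply, List.prod_nil, mul_one, TH_be, List.not_mem_nil, if_false]
    rw [tb_comp]
    congr 2
    ext v
    simp [fw_apply, dgn]
    rfl
  | cons i l ih =>
    intro w
    rw [List.nodup_cons] at hl
    simp only [List.map_cons, EE, AddMonoidHom.comp_apply, AddMonoidHom.sub_apply, AddMonoidHom.id_apply]
    rw [pb_triv, tb_comp, map_sub, map_sub, ih hl.2 w]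
    have h1 : (tm (fw w)).comp (tm (kc m V i)) = tm (fw (Function.update w i 0)) := by
      rw [← fw_kc]; rfl
    rw [h1, ih hl.2, ← AddMonoidHom.sub_apply, ← map_sub]
    congr 2
    have h2 : (l.map fun j => be (Function.update w i 0 j) - 1) = l.map fun j => be (w j) - 1 := by
      refine List.map_congr_left fun j hj => ?_
      rw [Function.update_of_ne]
      rintro rfl
      exact hl.1 hj
    have h3 : (∑ j, if j ∈ l then 0 else w j) = w i + ∑ j, if j ∈ i :: l then 0 else w j := by
      rw [← Finset.add_sum_erase _ _ (Finset.mem_univ i), ← Finset.add_sum_erase (Finset.univ) (fun j => if j ∈ i :: l then 0 else w j) (Finset.mem_univ i)]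
      simp only [hl.1, if_false, List.mem_cons, true_or, if_true, zero_add]
      congr 1
      refine Finset.sum_congr rfl fun j hj => ?_
      simp [Finset.ne_of_mem_erase hj]
    have h4 : (∑ j, if j ∈ l then 0 else Function.update w i 0 j) = ∑ j, if j ∈ i :: l then 0 else w j := by
      refine Finset.sum_congr rfl fun j hj => ?_
      by_cases h : j = i
      · subst h; simp
      · simp [h]
    rw [h2, h3, h4, be_add, List.prod_cons]
    ring

lemma TH_van (b : ℕ) (us : List (V →+ V)) (h : b < us.length) (x : Hn (trivA (Multiplicative V) X) b) :
    TH V X b (us.map fun u => be u - 1).prod x = 0 := by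
  have h1 := cross b x (List.finRange us.length) (List.nodup_finRange _) us.get
  rw [poly_van] at h1
  · simp only [List.mem_finRange, if_true, Finset.sum_const_zero, be_zero, one_mul, map_zero] at h1
    rw [h1]
    congr 3
    conv_lhs => rw [← List.map_get_finRange us]
    rw [List.map_map]; rfl
  · intro f hf
    exact triv_compat f
  · intro f hf g
    obtain ⟨i, -, rfl⟩ := List.mem_map.1 hf
    show Multiplicative.ofAdd (Function.update (Function.update g.toAdd i 0) i 0) = Multiplicative.ofAdd (Function.update g.toAdd i 0)
    simp
  · rw [List.pairwise_map]
    refine (List.nodup_finRange us.length).imp ?_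
    intro i j hij g hg
    have hg' : Function.update g.toAdd j 0 = 0 := hg
    show Function.update g.toAdd i 0 = g.toAdd
    have := congrFun hg' i
    rw [Function.update_of_ne hij] at this
    rw [Function.update_eq_self_iff, this]; rfl
  · simpa using h

lemma aug_cl (G : Type) [CommGroup G] (r : GR G) (hr : r ∈ augI G) : r ∈ AddSubgroup.closure (Set.range fun g : G => bs g - 1) := by
  have : ∀ r : GR G, r - (augH G r) • 1 ∈ AddSubgroup.closure (Set.range fun g : G => (bs g - 1 : GR G)) := by
    intro r
    induction r using gr_ind with
    | h1 q => rw [augH_bs, one_smul]; exact AddSubgroup.subset_closure ⟨q, rfl⟩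
    | hadd a b ha hb =>
      have := add_mem ha hb
      rw [map_add, add_smul]
      convert this using 1
      abel
    | hneg a ha =>
      have := neg_mem ha
      rw [map_neg, neg_smul]
      convert this using 1
      abel
    | h0 => simp
  have h1 := this r
  rwa [show augH G r = 0 from hr, zero_smul, sub_zero] at h1

lemma TH_aug (b m : ℕ) (hb : b < m) (s : ER V) (hs : s ∈ augI (Multiplicative (V →+ V)) ^ m) (x) : TH V X b s x = 0 := by
  have key : ∀ m, ∀ s ∈ augI (Multiplicative (V →+ V)) ^ m, ∀ vs : List (V →+ V), b < m + vs.length →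
      TH V X b (s * (vs.map fun u => be u - 1).prod) x = 0 := by
    intro m
    induction m with
    | zero =>
      intro s hs vs hv
      induction s using gr_ind with
      | h1 q =>
        have h1 : (bs q : ER V) = (be q.toAdd - 1) + 1 := (sub_add_cancel _ _).symm
        rw [h1, add_mul, one_mul, map_add, AddMonoidHom.add_apply]
        have h2 := TH_van b (q.toAdd :: vs) (by simp; omega) x
        rw [List.map_cons, List.prod_cons] at h2
        rw [h2, TH_van b vs (by omega), add_zero]
      | hadd a b ha hb => rw [add_mul, map_add, AddMonoidHom.add_apply, ha (by simp), hb (by simp), add_zero]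
      | hneg a ha => rw [neg_mul, map_neg, AddMonoidHom.neg_apply, ha (by simp), neg_zero]
      | h0 => simp
    | succ m ih =>
      intro s hs vs hv
      rw [pow_succ] at hs
      refine Submodule.mul_induction_on hs ?_ ?_
      · intro a ha c hc
        have hk := aug_cl _ c hc
        clear hc
        induction hk using AddSubgroup.closure_induction with
        | mem c hk =>
          obtain ⟨q, rfl⟩ := hk
          have h2 := ih a ha (q.toAdd :: vs) (by simp; omega)
          rw [List.map_cons, List.prod_cons, ← mul_assoc] at h2
          exact h2
        | zero => simp
        | add c d _ _ ih1 ih2 => rw [mul_add, add_mul, map_add, AddMonoidHom.add_apply, ih1, ih2, add_zero]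
        | neg c _ ih1 => rw [mul_neg, neg_mul, map_neg, AddMonoidHom.neg_apply, ih1, neg_zero]
      · intro c d hc hd
        rw [add_mul, map_add, AddMonoidHom.add_apply, hc, hd, add_zero]
  have := key m s hs [] (by simpa using hb)
  simpa using this
end poly
end TB
end

section
namespace TB
section p2a
variable {Q : Type} [CommGroup Q] {V X : Type} [AddCommGroup V] [AddCommGroup X] {π : Set ℕ}

/-- left multiplication on endomorphisms -/
def lcm (α : Act Q V) (q : Q) : Multiplicative (V →+ V) →* Multiplicative (V →+ V) where
  toFun u := Multiplicative.ofAdd ((α q).comp u.toAdd)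
  map_one' := by
    apply Multiplicative.toAdd.injective
    ext v
    exact map_zero (α q)
  map_mul' a b := by
    apply Multiplicative.toAdd.injective
    ext v
    exact map_add (α q) (a.toAdd v) (b.toAdd v)

/-- ring hom -/
def La (α : Act Q V) (q : Q) : ER V →+* ER V := MonoidAlgebra.mapDomainRingHom ℤ (lcm α q)

lemma La_be (α : Act Q V) (q : Q) (u : V →+ V) : La α q (be u) = be ((α q).comp u) := by
  simp [La, be, bs, lcm]

/-- action on the group ring -/
def sg (α : Act Q V) : Act Q (ER V) where
  f q := (La α q).toAddMonoidHom
  one' s := by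
    show La α 1 s = s
    induction s using gr_ind with
    | h1 u =>
      refine (La_be α 1 u.toAdd).trans ?_
      congr 1
      apply Multiplicative.toAdd.injective
      ext v
      exact α.one (u.toAdd v)
    | hadd a b ha hb => rw [map_add, ha, hb]
    | hneg a ha => rw [map_neg, ha]
    | h0 => rw [map_zero]
  mul' g h s := by
    show La α (g * h) s = La α g (La α h s)
    induction s using gr_ind with
    | h1 u =>
      refine (La_be α _ u.toAdd).trans ?_
      refine Eq.trans ?_ ((congrArg (La α g) (La_be α h u.toAdd)).trans (La_be α g _)).symm
      congr 1
      apply Multiplicative.toAdd.injective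
      ext v
      exact α.mul _ _ _
    | hadd a b ha hb => simp only [map_add, ha, hb]
    | hneg a ha => simp only [map_neg, ha]
    | h0 => simp only [map_zero]

lemma sg_apply (α : Act Q V) (q : Q) (s) : sg α q s = La α q s := rfl

lemma aug_La (α : Act Q V) (q : Q) (s) : augH _ (La α q s) = augH _ s := by
  induction s using gr_ind with
  | h1 u =>
    refine (congrArg _ (La_be α q u.toAdd)).trans ?_
    rw [augH_bs, augH_bs]
  | hadd a b ha hb => simp only [map_add, ha, hb]
  | hneg a ha => simp only [map_neg, ha]
  | h0 => simp only [map_zero]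

/-- augmentation ideal -/
abbrev Del (V : Type) [AddCommGroup V] : Ideal (ER V) := augI (Multiplicative (V →+ V))

lemma mem_Del (s : ER V) : s ∈ Del V ↔ augH _ s = 0 := Iff.rfl

lemma La_pow (α : Act Q V) (q : Q) (i : ℕ) (s) (hs : s ∈ Del V ^ i) : La α q s ∈ Del V ^ i := by
  have h1 : Del V ≤ (Del V).comap (La α q) := by
    intro s hs
    rw [Ideal.mem_comap, mem_Del, aug_La]
    exact hs
  exact Ideal.le_comap_pow (La α q) i (Ideal.pow_right_mono h1 i hs)

lemma sgR_pow (α : Act Q V) (r : GR Q) (i : ℕ) (s) (hs : s ∈ Del V ^ i) : (sg α).R r s ∈ Del V ^ i :=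
  (sg α).R_inv (Submodule.toAddSubgroup (Del V ^ i)) (fun q v hv => La_pow α q i v hv) r s hs

/-- the sequence of ideals -/
def Is (I : Ideal (GR Q)) : ℕ → Ideal (GR Q)
  | 0 => augI Q
  | i+1 => star (Is I i) I

/-- killing ideals -/
def PP (I : Ideal (GR Q)) : ℕ → Ideal (GR Q)
  | 0 => augI Q
  | b+1 => Is I (b+1) * PP I b

lemma NI.Is {I : Ideal (GR Q)} (hI : NI π I) : ∀ i, NI π (Is I i)
  | 0 => NI.aug
  | i+1 => (NI.Is hI i).star hI

lemma NI.PP [Group.FG Q] {I : Ideal (GR Q)} (hI : NI π I) : ∀ i, NI π (PP I i)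
  | 0 => NI.aug
  | i+1 => (NI.Is hI (i+1)).mul (NI.PP hI i)

lemma be_comp_add (u v : V →+ V) : be (u + v) - 1 - ((be u - 1) + (be v - 1)) ∈ Del V ^ 2 := by
  rw [be_add, show be u * be v - 1 - ((be u - 1) + (be v - 1)) = (be u - 1) * (be v - 1) by ring, pow_two]
  exact Ideal.mul_mem_mul (bs_augI _) (bs_augI _)

/-- linearisation -/
def bl (V : Type) [AddCommGroup V] : (V →+ V) →+ (ER V ⧸ (Del V ^ 2)) where
  toFun u := Ideal.Quotient.mk _ (be u - 1)
  map_zero' := by rw [be_zero, sub_self, map_zero]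
  map_add' u v := by
    rw [← map_add, Ideal.Quotient.eq]
    exact be_comp_add u v

/-- the R operation as additive function of the ring element -/
def Rc (α : Act Q V) (u : V →+ V) : GR Q →+ (V →+ V) where
  toFun r := (α.R r).comp u
  map_zero' := by ext v; exact map_zero (α.Rv (u v))
  map_add' a b := by ext v; exact α.R_add _ _ _

lemma kill_one (α : Act Q V) (I : Ideal (GR Q)) (hk : ∀ r ∈ I, ∀ v, α.R r v = 0) (u : V →+ V) (r) (hr : r ∈ I) :
    (sg α).R r (be u - 1) ∈ Del V ^ 2 := by
  have h1 : ((Ideal.Quotient.mk (Del V ^ 2)).toAddMonoidHom.comp ((sg α).Rv (be u - 1))) = (bl V).comp (Rc α u) := by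
    refine gr_ext fun q => ?_
    show Ideal.Quotient.mk (Del V ^ 2) ((sg α).R (bs q) (be u - 1)) = Ideal.Quotient.mk _ (be ((α.R (bs q)).comp u) - 1)
    rw [(sg α).R_bs, sg_apply, map_sub, La_be, map_one]
    congr 4
    ext v
    exact (α.R_bs q _).symm
  have h2 := DFunLike.congr_fun h1 r
  rw [← Ideal.Quotient.eq_zero_iff_mem]
  refine h2.trans ?_
  have : Rc α u r = 0 := by
    ext v
    exact hk r hr _
  rw [AddMonoidHom.comp_apply, this, map_zero]

lemma Is_step (α : Act Q V) (I : Ideal (GR Q)) (hk : ∀ r ∈ I, ∀ v, α.R r v = 0) (i : ℕ) :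
    ∀ r ∈ Is I i, ∀ s ∈ Del V ^ i, (sg α).R r s ∈ Del V ^ (i+1) := by
  induction i with
  | zero =>
    intro r hr s _
    rw [zero_add, pow_one, mem_Del]
    exact augI_map ((augH _).toAddMonoidHom.comp ((sg α).Rv s)) (augH _ s) (fun q => by
      show augH _ ((sg α).R (bs q) s) = _
      rw [(sg α).R_bs, sg_apply, aug_La]) r hr
  | succ i ih =>
    intro r hr s hs
    rw [pow_succ] at hs
    refine Submodule.mul_induction_on hs ?_ ?_
    · intro a ha c hc
      have hk2 := aug_cl _ c hc
      clear hc
      induction hk2 using AddSubgroup.closure_induction with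
      | mem c h =>
        obtain ⟨u, rfl⟩ := h
        set b : ER V := bs u - 1
        let F : GR Q →+ GR Q →+ (ER V ⧸ (Del V ^ (i+2))) :=
          AddMonoidHom.mk' (fun x => (Ideal.Quotient.mk (Del V ^ (i+2))).toAddMonoidHom.comp ((AddMonoidHom.mulLeft ((sg α).R x a)).comp ((sg α).Rv b)))
            (by
              intro x y
              ext z
              show Ideal.Quotient.mk _ ((sg α).R (x + y) a * (sg α).R _ b) = Ideal.Quotient.mk _ ((sg α).R x a * (sg α).R _ b) + Ideal.Quotient.mk _ ((sg α).R y a * (sg α).R _ b)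
              rw [(sg α).R_add, add_mul, map_add])
        have hb : b ∈ Del V ^ 1 := by rw [pow_one]; exact bs_augI _
        have := star_kill F (I := Is I i) (J := I) ?_ ?_ ((Ideal.Quotient.mk (Del V ^ (i+2))).toAddMonoidHom.comp ((sg α).Rv (a * b))) ?_ r hr
        · exact Ideal.Quotient.eq_zero_iff_mem.1 this
        · intro x hx y
          refine Ideal.Quotient.eq_zero_iff_mem.2 ?_
          rw [show i + 2 = (i + 1) + 1 from rfl, pow_add]
          exact Ideal.mul_mem_mul (ih x hx a ha) (sgR_pow α y 1 b hb)
        · intro y hy x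
          refine Ideal.Quotient.eq_zero_iff_mem.2 ?_
          rw [pow_add]
          exact Ideal.mul_mem_mul (sgR_pow α x i a ha) (kill_one α I hk u.toAdd y hy)
        · intro q
          show Ideal.Quotient.mk _ ((sg α).R (bs q) (a * b)) = Ideal.Quotient.mk _ ((sg α).R (bs q) a * (sg α).R (bs q) b)
          rw [(sg α).R_bs, (sg α).R_bs, (sg α).R_bs, sg_apply, sg_apply, sg_apply, map_mul]
      | zero => rw [mul_zero, map_zero]; exact zero_mem _
      | add c d _ _ h1 h2 => rw [mul_add, map_add]; exact add_mem h1 h2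
      | neg c _ h1 => rw [mul_neg, map_neg]; exact neg_mem h1
    · intro c d h1 h2
      rw [map_add]; exact add_mem h1 h2

lemma PP_step (α : Act Q V) (I : Ideal (GR Q)) (hk : ∀ r ∈ I, ∀ v, α.R r v = 0) (b : ℕ) :
    ∀ r ∈ PP I b, ∀ s, (sg α).R r s ∈ Del V ^ (b+1) := by
  induction b with
  | zero =>
    intro r hr s
    exact Is_step α I hk 0 r hr s (by simp)
  | succ b ih =>
    intro r hr s
    refine Submodule.mul_induction_on (show r ∈ Is I (b+1) * PP I b from hr) ?_ ?_
    · intro x hx y hy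
      rw [(sg α).R_mul]
      exact Is_step α I hk (b+1) x hx _ (ih y hy s)
    · intro x y h1 h2
      rw [(sg α).R_add]
      exact add_mem h1 h2

/-- pullback action on cohomology -/
def gam (α : Act Q V) (X : Type) [AddCommGroup X] (b : ℕ) : Act Q (Hn (trivA (Multiplicative V) X) b) where
  f q := tb X (tm (α q)) b
  one' x := by
    have : tm (α 1) = MonoidHom.id (Multiplicative V) := by
      ext v
      exact congrArg Multiplicative.ofAdd (α.one v)
    rw [this, tb_id]
  mul' g h x := by
    rw [tb_comp]
    have : tm (α (g * h)) = (tm (α h)).comp (tm (α g)) := by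
      ext v
      rw [mul_comm g h]
      exact congrArg Multiplicative.ofAdd (α.mul h g v)
    rw [this]

lemma gam_apply (α : Act Q V) (b : ℕ) (q) (x : Hn (trivA (Multiplicative V) X) b) : gam α X b q x = tb X (tm (α q)) b x := rfl

lemma gam_kill (α : Act Q V) (I : Ideal (GR Q)) (hk : ∀ r ∈ I, ∀ v, α.R r v = 0) (b : ℕ) (r) (hr : r ∈ PP I b)
    (x : Hn (trivA (Multiplicative V) X) b) : (gam α X b).R r x = 0 := by
  have h1 := (gam α X b).R_eq x (((AddMonoidHom.eval x).comp (TH V X b)).comp ((sg α).Rv (be (AddMonoidHom.id V)))) ?_ r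
  · rw [← h1]
    exact TH_aug b (b+1) (Nat.lt_succ_self b) _ (PP_step α I hk b r hr _) x
  · intro q
    show TH V X b ((sg α).R (bs q) (be (AddMonoidHom.id V))) x = _
    rw [(sg α).R_bs, sg_apply, La_be, TH_be]
    rfl
end p2a
end TB
end

section
namespace TB
section ops
variable {Q : Type} [CommGroup Q] {V X : Type} [AddCommGroup V] [AddCommGroup X] {π : Set ℕ}

/-- commuting actions -/
def Comm (a b : Act Q X) : Prop := ∀ q r x, a q (b r x) = b r (a q x)

/-- product of commuting actions -/
def mulC (a b : Act Q X) (h : Comm a b) : Act Q X where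
  f q := (a q).comp (b q)
  one' x := by simp
  mul' q r x := by
    simp only [AddMonoidHom.comp_apply]
    rw [a.mul, b.mul, h r q]

lemma mulC_apply (a b : Act Q X) (h : Comm a b) (q x) : mulC a b h q x = a q (b q x) := rfl

/-- inverse action -/
def invC (a : Act Q X) : Act Q X where
  f q := a q⁻¹
  one' x := by simp
  mul' q r x := by rw [mul_inv, a.mul]

lemma invC_apply (a : Act Q X) (q x) : invC a q x = a q⁻¹ x := rfl

lemma mulC_kill (a b : Act Q X) (h : Comm a b) (I J : Ideal (GR Q)) (hI : ∀ r ∈ I, ∀ x, a.R r x = 0) (hJ : ∀ r ∈ J, ∀ x, b.R r x = 0)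
    (r) (hr : r ∈ star I J) (x) : (mulC a b h).R r x = 0 := by
  let F : GR Q →+ GR Q →+ X := AddMonoidHom.mk' (fun s => (a.R s).comp (b.Rv x)) (by
    intro s t
    ext y
    exact a.R_add s t _)
  exact star_kill F (fun s hs t => hI s hs _) (fun t ht s => (congrArg (a.R s) (hJ t ht x)).trans (map_zero _)) ((mulC a b h).Rv x) (fun q => by
    show (mulC a b h).R (bs q) x = a.R (bs q) (b.R (bs q) x)
    rw [Act.R_bs, Act.R_bs, Act.R_bs]; rfl) r hr

lemma ch_compat (Γ : Type) [Group Γ] {X Y : Type} [AddCommGroup X] [AddCommGroup Y] (φ : X →+ Y) :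
    Compat (trivA Γ X) (trivA Γ Y) (MonoidHom.id Γ) φ := fun _ _ => rfl

/-- coefficient maps with trivial action -/
def ch (Γ : Type) [Group Γ] {X Y : Type} [AddCommGroup X] [AddCommGroup Y] (φ : X →+ Y) (b : ℕ) : Hn (trivA Γ X) b →+ Hn (trivA Γ Y) b :=
  Hmap (MonoidHom.id Γ) φ (ch_compat Γ φ) b

lemma ch_comp {Γ : Type} [Group Γ] {X Y Z : Type} [AddCommGroup X] [AddCommGroup Y] [AddCommGroup Z] (φ : X →+ Y) (ψ : Y →+ Z) (b : ℕ) (x) :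
    ch Γ ψ b (ch Γ φ b x) = ch Γ (ψ.comp φ) b x := by
  rw [ch, ch, Hmap_comp]; rfl

lemma ch_id {Γ : Type} [Group Γ] {X : Type} [AddCommGroup X] (b : ℕ) (x) :
    ch Γ (AddMonoidHom.id X) b x = x := Hmap_id _ _ _

lemma ch_zero {Γ : Type} [Group Γ] {X Y : Type} [AddCommGroup X] [AddCommGroup Y] (b : ℕ) (x) :
    ch Γ (0 : X →+ Y) b x = 0 := Hmap_zero _ _ _

lemma ch_add {Γ : Type} [Group Γ] {X Y : Type} [AddCommGroup X] [AddCommGroup Y] (φ ψ : X →+ Y) (b : ℕ) (x) :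
    ch Γ (φ + ψ) b x = ch Γ φ b x + ch Γ ψ b x := Hmap_add (φ := φ) (φ' := ψ) (ch_compat Γ φ) (ch_compat Γ ψ) b x

lemma ch_nsmul {Γ : Type} [Group Γ] {X : Type} [AddCommGroup X] (m : ℕ) (b : ℕ) (x) :
    ch Γ (m • AddMonoidHom.id X) b x = m • x := by
  induction m with
  | zero => rw [zero_smul, zero_smul, ch_zero]
  | succ m ih => rw [succ_nsmul, succ_nsmul, ch_add, ih, ch_id]

lemma tb_ch {Γ Δ : Type} [Group Γ] [Group Δ] {X Y : Type} [AddCommGroup X] [AddCommGroup Y] (f : Δ →* Γ) (φ : X →+ Y) (b : ℕ) (x) :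
    tb Y f b (ch Γ φ b x) = ch Δ φ b (tb X f b x) := by
  rw [tb, ch, ch, tb, Hmap_comp, Hmap_comp]
  rfl

/-- coefficient action -/
def cof (Γ : Type) [Group Γ] (δ : Act Q X) (b : ℕ) : Act Q (Hn (trivA Γ X) b) where
  f q := ch Γ (δ q) b
  one' x := by rw [δ.one_eq, ch_id]
  mul' q r x := by rw [ch_comp, δ.mul_eq]

lemma cof_apply {Γ : Type} [Group Γ] (δ : Act Q X) (b : ℕ) (q x) : cof Γ δ b q x = ch Γ (δ q) b x := rfl

lemma cof_R {Γ : Type} [Group Γ] (δ : Act Q X) (b : ℕ) (r x) : (cof Γ δ b).R r x = ch Γ (δ.R r) b x := by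
  let D : GR Q →+ Hn (trivA Γ X) b := AddMonoidHom.mk' (fun s => ch Γ (δ.R s) b x) (by
    intro s t
    rw [← ch_add]
    congr 2
    ext y
    exact δ.R_add s t y)
  refine ((cof Γ δ b).R_eq x D (fun q => ?_) r).symm
  show ch Γ (δ.R (bs q)) b x = ch Γ (δ q) b x
  congr 2
  ext y
  exact δ.R_bs q y

lemma gam_cof (α : Act Q V) (δ : Act Q X) (b : ℕ) : Comm (gam α X b) (cof (Multiplicative V) δ b) := by
  intro q r x
  rw [gam_apply, gam_apply, cof_apply, cof_apply, tb_ch]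

lemma cof_gam (α : Act Q V) (δ : Act Q X) (b : ℕ) : Comm (cof (Multiplicative V) δ b) (invC (gam α X b)) := by
  intro q r x
  rw [invC_apply, invC_apply, gam_cof]

/-- the next module -/
def nxt (α : Act Q V) (δ : Act Q X) (b : ℕ) : Act Q (Hn (trivA (Multiplicative V) X) b) := mulC (cof _ δ b) (invC (gam α X b)) (cof_gam α δ b)

lemma nxt_apply (α : Act Q V) (δ : Act Q X) (b : ℕ) (q x) : nxt α δ b q x = ch _ (δ q) b (tb X (tm (α q⁻¹)) b x) := rfl
end ops

lemma cstep_compat {Q : Type} [CommGroup Q] {Γ Γ' V X : Type} [Group Γ] [Group Γ'] [AddCommGroup V] [AddCommGroup X] (τ' : Γ' →* Q) (f : Γ →* Γ')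
    (e : Multiplicative V ≃* f.ker) (δ : Act Q X) :
    Compat ((δ.comp (τ'.comp f)).comp f.ker.subtype) (trivA (Multiplicative V) X) e.toMonoidHom (AddMonoidHom.id X) := by
  intro v x
  show δ (τ' (f (e v))) x = x
  rw [(f.mem_ker).1 (e v).2, map_one, δ.one]

lemma Hmap_bij {Γ Δ X Y : Type} [Group Γ] [Group Δ] [AddCommGroup X] [AddCommGroup Y] {ρ : Act Γ X} {σ : Act Δ Y} (f : Δ ≃* Γ) (φ : X ≃+ Y)
    (h : Compat ρ σ f.toMonoidHom φ.toAddMonoidHom) (n : ℕ) : Function.Bijective (Hmap f.toMonoidHom φ.toAddMonoidHom h n) := by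
  have h' : Compat σ ρ f.symm.toMonoidHom φ.symm.toAddMonoidHom := by
    intro g y
    apply φ.injective
    have := h (f.symm g) (φ.symm y)
    simp only [MulEquiv.toMonoidHom_eq_coe, MonoidHom.coe_coe, MulEquiv.apply_symm_apply, AddEquiv.toAddMonoidHom_eq_coe, AddMonoidHom.coe_coe,
      AddEquiv.apply_symm_apply] at this ⊢
    exact this.symm
  refine Function.bijective_iff_has_inverse.2 ⟨Hmap f.symm.toMonoidHom φ.symm.toAddMonoidHom h' n, fun x => ?_, fun x => ?_⟩
  · rw [Hmap_comp]
    refine (Hmap_congr _ Compat.id ?_ ?_ n x).trans (Hmap_id _ _ _)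
    · ext; simp
    · ext; simp
  · rw [Hmap_comp]
    refine (Hmap_congr _ Compat.id ?_ ?_ n x).trans (Hmap_id _ _ _)
    · ext; simp
    · ext; simp

lemma cstep {Q : Type} [CommGroup Q] {Γ Γ' V X : Type} [Group Γ] [Group Γ'] [AddCommGroup V] [AddCommGroup X] (τ' : Γ' →* Q) (f : Γ →* Γ')
    (hf : Function.Surjective f) (α : Act Q V) (e : Multiplicative V ≃* f.ker)
    (he : ∀ g v, (e (Multiplicative.ofAdd (α (τ' (f g)) v)) : Γ) = g * e (Multiplicative.ofAdd v) * g⁻¹) (δ : Act Q X)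
    (P : Serre) (n : ℕ) (h : ∀ a b, a + b = n → P.P (Hn ((nxt α δ b).comp τ') a)) : P.P (Hn (δ.comp (τ'.comp f)) n) := by
  refine lhs _ f hf P n fun a b hab => ?_
  refine P_of_bij P (MulEquiv.refl Γ') (Hmap e.toMonoidHom (AddMonoidHom.id X) (cstep_compat τ' f e δ) b)
    (Hmap_bij e (AddEquiv.refl X) (cstep_compat τ' f e δ) b) ?_ a (h a b hab)
  intro g' x
  obtain ⟨g, rfl⟩ := hf g'
  show Hmap _ _ _ _ (actQ _ f hf b (f g) x) = nxt α δ b (τ' (f g)) _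
  rw [actQ_apply, nxt_apply, Hmap_comp, tb, ch, Hmap_comp]
  refine Eq.trans ?_ (Hmap_comp _ _ _ _ _ _ _ _).symm
  refine Hmap_congr _ _ ?_ ?_ _ _
  · ext v
    show ((cj f.ker g (e (Multiplicative.ofAdd v)) : f.ker) : Γ) = e (Multiplicative.ofAdd (α (τ' (f g))⁻¹ v))
    rw [cj_coe, ← map_inv, ← map_inv, he, inv_inv]
  · rfl

/-- chains of extensions -/
inductive Chain (π : Set ℕ) (Q : Type) [CommGroup Q] : ∀ (Γ : Type) [Group Γ], (Γ →* Q) → Prop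
  | base (Γ : Type) [Group Γ] (τ : Γ →* Q) (h : Function.Bijective τ) : Chain π Q Γ τ
  | step (Γ Γ' : Type) [Group Γ] [Group Γ'] (τ' : Γ' →* Q) (f : Γ →* Γ') (hf : Function.Surjective f) (V : Type) [AddCommGroup V] (α : Act Q V)
      (e : Multiplicative V ≃* f.ker) (he : ∀ g v, (e (Multiplicative.ofAdd (α (τ' (f g)) v)) : Γ) = g * e (Multiplicative.ofAdd v) * g⁻¹)
      (h1 : FRk V) (h2 : (sPP π).P V) (h3 : Kil π α) (ih : Chain π Q Γ' τ') : Chain π Q Γ (τ'.comp f)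

lemma chain_ind {π : Set ℕ} {Q : Type} [CommGroup Q] (C : ∀ (X : Type) [AddCommGroup X], Act Q X → Prop) (P : Serre)
    (hbase : ∀ (X : Type) [AddCommGroup X] (δ : Act Q X) (n : ℕ), C X δ → P.P (Hn δ n))
    (hstep : ∀ (V X : Type) [AddCommGroup V] [AddCommGroup X] (α : Act Q V) (δ : Act Q X) (b : ℕ), FRk V → (sPP π).P V → Kil π α → C X δ →
      C (Hn (trivA (Multiplicative V) X) b) (nxt α δ b)) {Γ : Type} [Group Γ] {τ : Γ →* Q} (h : Chain π Q Γ τ) :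
    ∀ (X : Type) [AddCommGroup X] (δ : Act Q X) (n : ℕ), C X δ → P.P (Hn (δ.comp τ) n) := by
  induction h with
  | base Γ τ h =>
    intro X _ δ n hC
    let e : Γ ≃* Q := MulEquiv.ofBijective τ h
    refine P_of_bij P e.symm (AddMonoidHom.id X) Function.bijective_id ?_ n (hbase X δ n hC)
    intro q x
    show δ (e (e.symm q)) x = δ q x
    rw [e.apply_symm_apply]
  | step Γ Γ' τ' f hf V α e he h1 h2 h3 _ ih =>
    intro X _ δ n hC
    exact cstep τ' f hf α e he δ P n fun a b _ => ih _ _ a (hstep V X α δ b h1 h2 h3 hC)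

/-- the Sigma condition -/
def Sig (π : Set ℕ) {Q : Type} [CommGroup Q] (X : Type) [AddCommGroup X] (δ : Act Q X) : Prop :=
  ∃ a b : Act Q X, Comm a b ∧ (∀ q x, δ q x = b q (a q⁻¹ x)) ∧ Kil π a ∧
    ∀ J : Ideal (GR Q), NI π J → ∃ r ∈ J, ∃ m : ℕ, m ≠ 0 ∧ ∃ ψ : X →+ X, (∀ q x, ψ (a q x) = a q (ψ x)) ∧ (∀ q x, ψ (b q x) = b q (ψ x)) ∧
      ∀ x, ψ (b.R r x) = m • x

lemma Sig.base {π : Set ℕ} {Q : Type} [CommGroup Q] (X : Type) [AddCommGroup X] (δ : Act Q X) (n : ℕ) (h : Sig π X δ) : sBd.P (Hn δ n) := by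
  obtain ⟨a, b, hab, hδ, ⟨I, hI, hk⟩, hJ⟩ := h
  obtain ⟨r, hr, m, hm, ψ, h1, h2, h3⟩ := hJ I hI
  have ea : ∀ q, Equi δ δ (a q) := by
    intro q g x
    rw [MonoidHom.id_apply, hδ, hδ, hab, ← a.mul, ← a.mul, mul_comm]
  have eb : ∀ q, Equi δ δ (b q) := by
    intro q g x
    rw [MonoidHom.id_apply, hδ, hδ, hab, ← b.mul, ← b.mul, mul_comm]
  have eψ : Equi δ δ ψ := by
    intro g x
    rw [MonoidHom.id_apply, hδ, hδ, h2, h1]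
  let A : Act Q (Hn δ n) := ⟨fun q => Hmap (MonoidHom.id Q) (a q) (ea q) n, fun x => (Hmap_congr _ Compat.id rfl a.one_eq n x).trans (Hmap_id _ _ _),
    fun q r x => by rw [Hmap_comp]; exact Hmap_congr _ _ rfl (a.mul_eq q r) n x⟩
  have hA : ∀ (c : Act Q X) (ec : ∀ q, Equi δ δ (c q)) (s : GR Q) (es : Equi δ δ (c.R s)) (x), (∀ q, Hmap (MonoidHom.id Q) (c q) (ec q) n x = A q x) → Hmap (MonoidHom.id Q) (c.R s) es n x = A.R s x := by
    intro c ec s es x hc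
    have eR : ∀ s, Equi δ δ (c.R s) := by
      intro s g y
      rw [MonoidHom.id_apply]
      exact (c.R_equi c (δ g) (fun q z => (ec q g z).symm) s y).symm
    let D : GR Q →+ Hn δ n := AddMonoidHom.mk' (fun s => Hmap (MonoidHom.id Q) (c.R s) (eR s) n x) (by
      intro s t
      rw [← Hmap_add]
      exact Hmap_congr _ _ rfl (by ext y; exact c.R_add s t y) n x)
    refine A.R_eq x D (fun q => ?_) s
    rw [← hc]
    exact Hmap_congr (eR (bs q)) _ rfl (by ext y; exact c.R_bs q y) n x
  have eaR : Equi δ δ (a.R r) := fun g y => (a.R_equi a (δ g) (fun q z => (ea q g z).symm) r y).symm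
  have ebR : Equi δ δ (b.R r) := fun g y => (b.R_equi b (δ g) (fun q z => (eb q g z).symm) r y).symm
  refine ⟨m, hm, fun x => ?_⟩
  have k1 : Hmap (MonoidHom.id Q) (a.R r) eaR n x = 0 :=
    (Hmap_congr _ Compat.zero rfl (by ext y; exact hk r hr y) n x).trans (Hmap_zero _ _ _)
  have k2 : Hmap (MonoidHom.id Q) (b.R r) ebR n x = 0 := by
    rw [hA b eb r ebR x, ← hA a ea r eaR x (fun q => rfl), k1]
    intro q
    have hcq : Compat δ δ (MulAut.conj q⁻¹).toMonoidHom (δ q) := by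
      intro g y
      simp only [MulEquiv.toMonoidHom_eq_coe, MonoidHom.coe_coe, MulAut.conj_apply, inv_inv]
      rw [← δ.mul, ← δ.mul]
      congr 2
      group
    have := conj_id δ q hcq n (A q x)
    rw [← this]
    show _ = Hmap _ _ _ n (Hmap (MonoidHom.id Q) (a q) (ea q) n x)
    rw [Hmap_comp]
    refine Hmap_congr _ _ ?_ ?_ n x
    · ext g
      simp [MulAut.conj_apply]
    · ext y
      simp only [AddMonoidHom.comp_apply]
      rw [hδ, a.inv_self]
  have k3 := congrArg (Hmap (MonoidHom.id Q) ψ eψ n) k2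
  rw [Hmap_comp, map_zero] at k3
  rw [← k3, ← natCast_zsmul, ← Hmap_zsmul (ρ := δ) (m : ℤ) (Compat.zsmul _) n x]
  refine Hmap_congr _ _ rfl ?_ n x
  ext y
  show (m : ℤ) • y = ψ (b.R r y)
  rw [h3, natCast_zsmul]

lemma Sig.step {π : Set ℕ} {Q : Type} [CommGroup Q] [Group.FG Q] (V X : Type) [AddCommGroup V] [AddCommGroup X] (α : Act Q V) (δ : Act Q X) (n : ℕ)
    (hα : Kil π α) (h : Sig π X δ) : Sig π (Hn (trivA (Multiplicative V) X) n) (nxt α δ n) := by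
  obtain ⟨I, hI, hIk⟩ := hα
  obtain ⟨a, b, hab, hδ, ⟨J, hJ, hk⟩, hψ⟩ := h
  refine ⟨mulC (gam α X n) (cof _ a n) (gam_cof α a n), cof _ b n, ?_, ?_, ⟨star (PP I n) J, (NI.PP hI n).star hJ, ?_⟩, ?_⟩
  · intro q r x
    rw [mulC_apply, mulC_apply, ← gam_cof]
    congr 1
    rw [cof_apply, cof_apply, cof_apply, cof_apply, ch_comp, ch_comp]
    congr 2
    ext y
    exact hab _ _ _
  · intro q x
    rw [nxt_apply, mulC_apply, cof_apply, cof_apply, gam_apply, tb_ch, ch_comp]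
    congr 2
    ext y
    exact hδ q y
  · exact mulC_kill _ _ _ _ _ (gam_kill α I hIk n) (fun r hr x => by
      rw [cof_R, ← ch_zero (X := X) (Y := X) n x]
      congr 2
      ext y
      exact hk r hr y)
  · intro K hK
    obtain ⟨r, hr, m, hm, ψ, h1, h2, h3⟩ := hψ K hK
    refine ⟨r, hr, m, hm, ch _ ψ n, ?_, ?_, ?_⟩
    · intro q x
      rw [mulC_apply, mulC_apply, gam_apply, gam_apply, ← tb_ch, cof_apply, cof_apply, ch_comp, ch_comp]
      congr 3
      ext y
      exact h1 q y
    · intro q x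
      rw [cof_apply, cof_apply, ch_comp, ch_comp]
      congr 2
      ext y
      exact h2 q y
    · intro x
      rw [cof_R, ch_comp, ← ch_nsmul]
      congr 2
      ext y
      exact h3 y

theorem Sig.chain {π : Set ℕ} {Q : Type} [CommGroup Q] [Group.FG Q] {Γ : Type} [Group Γ] {τ : Γ →* Q} (h : Chain π Q Γ τ)
    (X : Type) [AddCommGroup X] (δ : Act Q X) (n : ℕ) (hS : Sig π X δ) : sBd.P (Hn (δ.comp τ) n) :=
  chain_ind (fun X _ δ => Sig π X δ) sBd (fun X _ δ n h => Sig.base X δ n h) (fun V X _ _ α δ b _ _ hk hS => Sig.step V X α δ b hk hS) h X δ n hS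
end TB
end

section
namespace TB

lemma fact_cop (m n : ℕ) (hn : n ≠ 0) : ∃ (k c : ℕ), n ∣ m ^ k * c ∧ c.Coprime m := by
  induction n using Nat.recOnMul with
  | zero => exact absurd rfl hn
  | one => exact ⟨0, 1, one_dvd _, Nat.coprime_one_left _⟩
  | prime p hp =>
    rcases Nat.coprime_or_dvd_of_prime hp m with h | h
    · exact ⟨0, p, by simp, h⟩
    · exact ⟨1, 1, by simpa using h, Nat.coprime_one_left _⟩
  | mul a b ha hb =>
    obtain ⟨k, c, h1, h2⟩ := ha (left_ne_zero_of_mul hn)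
    obtain ⟨k', c', h1', h2'⟩ := hb (right_ne_zero_of_mul hn)
    exact ⟨k + k', c * c', by rw [pow_add, mul_mul_mul_comm]; exact mul_dvd_mul h1 h1', h2.mul_left h2'⟩

lemma cop_zero {A : Type} [AddCommGroup A] {m c : ℕ} (h : c.Coprime m) (x : A) (h1 : c • x = 0) (h2 : m • x = 0) : x = 0 := by
  obtain ⟨u, v, huv⟩ := Nat.isCoprime_iff_coprime.2 h
  rw [← one_smul ℤ x, ← huv, add_smul, mul_smul, mul_smul, natCast_zsmul, natCast_zsmul, h1, h2, smul_zero, smul_zero, add_zero]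

lemma equi_nsmul {Γ X : Type} [Group Γ] [AddCommGroup X] (ρ : Act Γ X) (m : ℕ) : Equi ρ ρ (m • AddMonoidHom.id X) := by
  intro g x
  simp

lemma Hmap_nsmul {Γ X : Type} [Group Γ] [AddCommGroup X] (ρ : Act Γ X) (m : ℕ) (h : Equi ρ ρ (m • AddMonoidHom.id X)) (n : ℕ) (x) :
    Hmap (MonoidHom.id Γ) (m • AddMonoidHom.id X) h n x = m • x := by
  refine (Hmap_congr h (Compat.zsmul (m:ℤ)) rfl ?_ n x).trans ((Hmap_zsmul (m:ℤ) _ n x).trans (natCast_zsmul _ _))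
  ext y
  simp

lemma mtors {Γ X : Type} [Group Γ] [AddCommGroup X] (ρ : Act Γ X) {m : ℕ} (hX : ∀ x : X, ∃ k : ℕ, m ^ k • x = 0) (n : ℕ) (y : Hn ρ n)
    (c : ℕ) (hc : c ≠ 0) (h : c • y = 0) : ∃ k : ℕ, m ^ k • y = 0 := by
  obtain ⟨k, c', h1, h2⟩ := fact_cop m c hc
  refine ⟨k, ?_⟩
  have hb : Function.Bijective (c' • AddMonoidHom.id X) := by
    constructor
    · rw [injective_iff_map_eq_zero]
      intro x hx
      obtain ⟨j, hj⟩ := hX x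
      exact cop_zero (h2.pow_right j) x hx hj
    · intro x
      obtain ⟨j, hj⟩ := hX x
      obtain ⟨z, hz⟩ := cop_surj (h2.pow_right j) x hj
      exact ⟨z • x, hz⟩
  refine Hmap_inj_of_bij (MulEquiv.refl Γ) (c' • AddMonoidHom.id X) hb (equi_nsmul ρ c') n _ ?_
  refine (Hmap_nsmul ρ c' (equi_nsmul ρ c') n _).trans ?_
  obtain ⟨d, hd⟩ := h1
  rw [← mul_smul, mul_comm, hd, mul_comm, mul_smul, h, smul_zero]

lemma fin_tor {Γ X : Type} [Group Γ] [AddCommGroup X] (hΓ : FinCoh Γ) (ρ : Act Γ X) (m : ℕ) (hm : m ≠ 0) (hD : Dv X) (hf : Finite (tor m X)) (n : ℕ) :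
    Finite (tor m (Hn ρ n)) := by
  let S := SES.ofSurj ρ ρ (m • AddMonoidHom.id X) (equi_nsmul ρ m) (fun x => hD m hm x)
  haveI : Finite (m • AddMonoidHom.id X).ker := by
    refine Finite.of_injective (β := tor m X) (fun x => ⟨x.1, mem_tor.2 x.2⟩) ?_
    intro a b h
    exact Subtype.ext (congrArg (fun z : tor m X => z.1) h)
  have hk : ∀ g, ∀ x ∈ (m • AddMonoidHom.id X).ker, ρ g x ∈ (m • AddMonoidHom.id X).ker := by
    intro g x hx
    have hx' : m • x = 0 := hx
    show m • ρ g x = 0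
    rw [← map_nsmul, hx', map_zero]
  have hfin := hΓ n _ (sAct ρ (m • AddMonoidHom.id X).ker hk) this
  have hr : Finite (S.Hi n).range := Finite.of_surjective (S.Hi n).rangeRestrict (S.Hi n).rangeRestrict_surjective
  refine Finite.of_injective (β := (S.Hi n).range) (fun y => ⟨y.1, ?_⟩) ?_
  · refine S.ex_mid n y.1 ?_
    exact (Hmap_nsmul ρ m (equi_nsmul ρ m) n _).trans (tor_smul y)
  · intro a b h
    exact Subtype.ext (congrArg (fun z : (S.Hi n).range => z.1) h)

lemma mul_inv' {Γ X : Type} [Group Γ] [AddCommGroup X] (ρ : Act Γ X) (m : ℕ) : ∀ g, ∀ x ∈ mul m X, ρ g x ∈ mul m X := by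
  intro g x hx
  obtain ⟨y, rfl⟩ := mem_mul.1 hx
  exact mem_mul.2 ⟨ρ g y, (map_nsmul _ _ _).symm⟩

lemma cer_red {Γ X : Type} [Group Γ] [AddCommGroup X] (hΓ : FinCoh Γ) (ρ : Act Γ X) {m : ℕ} (hm : m ≠ 0) (hX : Cer m X) (n : ℕ)
    (h : ∀ (S : AddSubgroup X) (hS : ∀ g, ∀ x ∈ S, ρ g x ∈ S), Dv S → Cer m S → ∀ y : Hn (sAct ρ S hS) n, ∃ k : ℕ, k ≠ 0 ∧ k • y = 0) :
    Cer m (Hn ρ n) := by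
  obtain ⟨k, h1, h2⟩ := hX.dvpart hm
  have hS := mul_inv' ρ (m^k)
  have hC : Cer m (mul (m^k) X) := hX.inj (mul (m^k) X).subtype (AddSubgroup.subtype_injective _)
  refine (SES.sub ρ (mul (m^k) X) hS).P_mid (sCer m hm) n ?_ ?_
  · refine ⟨fun y => ?_, fin_tor hΓ _ m hm h2 hC.2 n⟩
    obtain ⟨c, hc, hy⟩ := h _ hS h2 hC y
    exact mtors _ hC.1 n y c hc hy
  · refine ⟨fun y => ⟨k, Hn_kill _ (m^k) ?_ n y⟩, ?_⟩
    · intro x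
      obtain ⟨x, rfl⟩ := QuotientAddGroup.mk'_surjective _ x
      rw [← map_nsmul, QuotientAddGroup.mk'_apply, QuotientAddGroup.eq_zero_iff]
      exact mem_mul.2 ⟨x, rfl⟩
    · haveI := hΓ n _ (qAct ρ (mul (m^k) X) hS) h1
      exact Subtype.finite

lemma tool {Γ X : Type} [CommGroup Γ] [AddCommGroup X] (ρ : Act Γ X) (ht : ∀ g x, ρ g x = x) {p : ℕ} (hp : p ≠ 0) (hD : Dv X) (hC : Cer p X)
    (L : Subgroup Γ) (hL : L.FG) (hc : ∀ g : Γ, ∃ n : ℕ, n ≠ 0 ∧ n.Coprime p ∧ g ^ n ∈ L) (b : ℕ) (y : Hn ρ b)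
    (hy : Hmap L.subtype (AddMonoidHom.id X) Compat.res b y = 0) : y = 0 := by
  refine compact_div hD ρ ht b y ?_
  intro s
  let H : Subgroup Γ := Subgroup.closure s ⊔ L
  have hHfg : H.FG := Subgroup.FG.sup ⟨s, rfl⟩ hL
  refine ⟨H, fun g hg => (le_sup_left : _ ≤ H) (Subgroup.subset_closure hg), ?_⟩
  set z := Hmap H.subtype (AddMonoidHom.id X) Compat.res b y with hz
  have hF : Group.FG H := (Group.fg_iff_subgroup_fg H).2 hHfg
  have hz1 : Cer p (Hn (ρ.comp H.subtype) b) := fg_comm (sCer p hp) (fun a b => Subtype.ext (mul_comm a.1 b.1)) hF _ hC b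
  obtain ⟨k, hk⟩ := hz1.1 z
  let L' : Subgroup H := L.subgroupOf H
  have hind : L'.index • z = 0 := by
    refine transfer _ L' b z ?_
    rw [hz, Hmap_comp]
    have hLH : ∀ l : L', (l.1 : Γ) ∈ L := fun l => Subgroup.mem_subgroupOf.1 l.2
    let j : L' →* L := (H.subtype.comp L'.subtype).codRestrict L hLH
    have e1 : Compat (ρ.comp L.subtype) ((ρ.comp H.subtype).comp L'.subtype) j (AddMonoidHom.id X) := fun _ _ => rfl
    have := congrArg (Hmap j (AddMonoidHom.id X) e1 b) hy
    rw [Hmap_comp, map_zero] at this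
    exact this
  have hcop : L'.index.Coprime (p^k) := by
    have hF' : Group.FG (H ⧸ L') := QuotientGroup.fg L'
    have hcm : ∀ a b : H ⧸ L', a * b = b * a := by
      intro a b
      obtain ⟨a, rfl⟩ := QuotientGroup.mk_surjective a
      obtain ⟨b, rfl⟩ := QuotientGroup.mk_surjective b
      exact congrArg (QuotientGroup.mk (s := L')) (Subtype.ext (mul_comm a.1 b.1))
    letI : CommGroup (H ⧸ L') := { (inferInstance : Group (H ⧸ L')) with mul_comm := hcm }
    have ho : ∀ x : H ⧸ L', ∃ n : ℕ, n ≠ 0 ∧ n.Coprime p ∧ x ^ n = 1 := by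
      intro x
      obtain ⟨x, rfl⟩ := QuotientGroup.mk_surjective x
      obtain ⟨n, h1, h2, h3⟩ := hc x.1
      refine ⟨n, h1, h2, ?_⟩
      exact (QuotientGroup.eq_one_iff (N := L') (x ^ n)).2 (Subgroup.mem_subgroupOf.2 h3)
    have hH : Finite (H ⧸ L') := CommGroup.finite_of_fg_torsion (H ⧸ L') (by
        intro x
        obtain ⟨n, hn, _, hx⟩ := ho x
        rw [isOfFinOrder_iff_pow_eq_one]
        exact ⟨n, Nat.pos_of_ne_zero hn, hx⟩)
    refine Nat.Coprime.pow_right k ?_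
    rw [Subgroup.index_eq_card, Nat.coprime_iff_gcd_eq_one]
    by_contra hne
    obtain ⟨q, hq, hqd⟩ := Nat.exists_prime_and_dvd hne
    haveI : Fact q.Prime := ⟨hq⟩
    obtain ⟨y, hy⟩ := exists_prime_orderOf_dvd_card' q (hqd.trans (Nat.gcd_dvd_left _ _))
    obtain ⟨n, _, hn, hyn⟩ := ho y
    have h1 : q ∣ n := by
      rw [← hy]; exact orderOf_dvd_of_pow_eq_one hyn
    have := Nat.Coprime.eq_one_of_dvd (Nat.Coprime.coprime_dvd_left h1 hn) (hqd.trans (Nat.gcd_dvd_right _ _))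
    exact hq.one_lt.ne' this
  exact cop_zero hcop z hind hk

lemma tool2 {V X : Type} [AddCommGroup V] [AddCommGroup X] (ρ : Act (Multiplicative V) X) (ht : ∀ g x, ρ g x = x) {p : ℕ} (hp : p ≠ 0) (hV : PF p V)
    (hF : FRk V) (hC : Cer p X) (b : ℕ) : Cer p (Hn ρ b) := by
  refine cer_red (FinCohA.frk hF) ρ hp hC b ?_
  intro S hS hD hSC y
  obtain ⟨L, hL, hc⟩ := hV
  have hL' : (AddSubgroup.toSubgroup L).FG := (AddSubgroup.fg_iff_mul_fg L).1 hL
  have hcer : Cer p (Hn ((sAct ρ S hS).comp (AddSubgroup.toSubgroup L).subtype) b) :=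
    fg_comm (sCer p hp) (fun a b => Subtype.ext (mul_comm a.1 b.1)) ((Group.fg_iff_subgroup_fg _).2 hL') _ hSC b
  obtain ⟨k, hk⟩ := hcer.1 (Hmap (AddSubgroup.toSubgroup L).subtype (AddMonoidHom.id S) Compat.res b y)
  refine ⟨p^k, pow_ne_zero _ hp, ?_⟩
  refine tool (sAct ρ S hS) (fun g x => Subtype.ext (ht g x.1)) hp hD hSC (AddSubgroup.toSubgroup L) hL' (fun g => hc g.toAdd) b _ ?_
  rw [map_nsmul, hk]

theorem chain_cer {π : Set ℕ} {Q : Type} [CommGroup Q] (hQ : Group.FG Q) {p : ℕ} (hp : p.Prime) (hpπ : p ∉ π) {Γ : Type} [Group Γ] {τ : Γ →* Q}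
    (h : Chain π Q Γ τ) (X : Type) [AddCommGroup X] (δ : Act Q X) (n : ℕ) (hX : Cer p X) : Cer p (Hn (δ.comp τ) n) :=
  chain_ind (fun X _ _ => Cer p X) (sCer p hp.ne_zero) (fun X _ δ n h => fg_comm (sCer p hp.ne_zero) mul_comm hQ δ h n)
    (fun V X _ _ α δ b h1 h2 _ hC => tool2 _ (fun _ _ => rfl) hp.ne_zero (h2 p (Or.inr ⟨hp, hpπ⟩)) h1 hC b) h X δ n hX
end TB
end

section
namespace TB

/-- irreducible up to isogeny -/
structure Irr (p : ℕ) {Γ C : Type} [Group Γ] [AddCommGroup C] (ρ : Act Γ C) : Prop where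
  dv : Dv C
  cer : Cer p C
  ne : ∃ c : C, c ≠ 0
  irr : ∀ S : AddSubgroup C, (∀ g, ∀ x ∈ S, ρ g x ∈ S) → Dv S → S = ⊥ ∨ S = ⊤

lemma dv_tor_ne {C : Type} [AddCommGroup C] {p : ℕ} (hC : Cer p C) (c : C) (hc : c ≠ 0) : ∃ t : C, t ≠ 0 ∧ p • t = 0 := by
  obtain ⟨k, hk⟩ := hC.1 c
  induction k generalizing c with
  | zero => exact absurd (by simpa using hk) hc
  | succ k ih =>
    by_cases h : p ^ k • c = 0
    · exact ih c hc h
    · refine ⟨p ^ k • c, h, ?_⟩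
      rw [← mul_smul, ← pow_succ', hk]

lemma dv_sub_eq {C : Type} [AddCommGroup C] {p : ℕ} (hp : p ≠ 0) (hC : Cer p C) (S : AddSubgroup C) (hS : Dv S) (h : ∀ t : C, p • t = 0 → t ∈ S) (c : C) : c ∈ S := by
  obtain ⟨k, hk⟩ := hC.1 c
  induction k generalizing c with
  | zero =>
    have : c = 0 := by simpa using hk
    rw [this]; exact S.zero_mem
  | succ k ih =>
    have h1 : p • c ∈ S := ih (p • c) (by rw [← mul_smul, ← pow_succ, hk])
    obtain ⟨s, hs⟩ := hS p hp ⟨p • c, h1⟩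
    have h2 : p • (s : C) = p • c := congrArg Subtype.val hs
    have h3 : c - s ∈ S := h _ (by rw [smul_sub, h2, sub_self])
    have := S.add_mem h3 s.2
    simpa using this

lemma exists_irred {p : ℕ} (hp : p ≠ 0) {Γ B : Type} [Group Γ] [AddCommGroup B] (ρ : Act Γ B) (hD : Dv B) (hC : Cer p B) (hne : ∃ b : B, b ≠ 0) :
    ∃ (C : AddSubgroup B) (hC : ∀ g, ∀ x ∈ C, ρ g x ∈ C), Irr p (sAct ρ C hC) := by
  let good : ℕ → Prop := fun n => ∃ (C : AddSubgroup B), (∀ g, ∀ x ∈ C, ρ g x ∈ C) ∧ Dv C ∧ (∃ c ∈ C, c ≠ 0) ∧ Nat.card (tor p C) = n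
  have hex : ∃ n, good n := by
    refine ⟨_, ⊤, fun g x _ => AddSubgroup.mem_top _, ?_, ?_, rfl⟩
    · intro n hn a
      obtain ⟨b, hb⟩ := hD n hn a.1
      exact ⟨⟨b, AddSubgroup.mem_top _⟩, Subtype.ext hb⟩
    · obtain ⟨b, hb⟩ := hne
      exact ⟨b, AddSubgroup.mem_top _, hb⟩
  classical
  obtain ⟨C, h1, h2, h3, h4⟩ := Nat.find_spec hex
  have hCC : Cer p C := hC.inj C.subtype (AddSubgroup.subtype_injective _)
  refine ⟨C, h1, h2, hCC, ?_, ?_⟩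
  · obtain ⟨c, hc, hc0⟩ := h3
    exact ⟨⟨c, hc⟩, fun h => hc0 (congrArg Subtype.val h)⟩
  · intro S hS hSd
    by_cases hb : S = ⊥
    · exact Or.inl hb
    right
    obtain ⟨s, hs0⟩ : ∃ s : S, s ≠ 0 := AddSubgroup.ne_bot_iff_exists_ne_zero.1 hb
    let S' : AddSubgroup B := S.map C.subtype
    let e : S ≃+ S' := S.equivMapOfInjective C.subtype (AddSubgroup.subtype_injective _)
    have hg : good (Nat.card (tor p S')) := by
      refine ⟨S', ?_, hSd.surj e.toAddMonoidHom e.surjective, ?_, rfl⟩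
      · rintro g _ ⟨x, hx, rfl⟩
        exact ⟨_, hS g x hx, rfl⟩
      · exact ⟨s.1.1, ⟨s.1, s.2, rfl⟩, fun h => hs0 (Subtype.ext (Subtype.ext h))⟩
    have hle := Nat.find_min' hex hg
    rw [← h4] at hle
    have hfin : Finite (tor p C) := hCC.2
    have hmem : ∀ x : tor p S', (x.1 : B) ∈ C := by
      intro x
      obtain ⟨y, hy, hyx⟩ := x.1.2
      rw [← hyx]; exact y.2
    let j : tor p S' → tor p C := fun x => ⟨⟨x.1.1, hmem x⟩, mem_tor.2 (Subtype.ext (congrArg (fun y : S' => y.1) (tor_smul x)))⟩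
    have hj : Function.Injective j := by
      intro a b hab
      have h5 : (j a).1.1 = (j b).1.1 := by rw [hab]
      exact Subtype.ext (Subtype.ext h5)
    have hjs : Function.Surjective j := by
      haveI : Finite (tor p S') := Finite.of_injective j hj
      have hc : Nat.card (tor p S') = Nat.card (tor p C) := le_antisymm (Nat.card_le_card_of_injective j hj) hle
      exact ((Nat.bijective_iff_injective_and_card j).2 ⟨hj, hc⟩).2
    rw [eq_top_iff]
    intro c _
    refine dv_sub_eq hp hCC S hSd ?_ c
    intro t ht
    obtain ⟨x, hx⟩ := hjs ⟨t, mem_tor.2 ht⟩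
    obtain ⟨y, hy, hyx⟩ := x.1.2
    have h6 : (j x).1.1 = t.1 := by rw [hx]
    have : y = t := Subtype.ext (hyx.trans h6)
    rw [← this]; exact hy

lemma card_quot_lt {p : ℕ} (hp : p ≠ 0) {B : Type} [AddCommGroup B] (hB : Cer p B) (C : AddSubgroup B) (hD : Dv C) (hne : ∃ c : C, c ≠ 0) :
    Nat.card (tor p (B ⧸ C)) < Nat.card (tor p B) := by
  haveI : Finite (tor p B) := hB.2
  let j : tor p B → tor p (B ⧸ C) := fun x => ⟨QuotientAddGroup.mk' C x.1, mem_tor.2 (by rw [← map_nsmul, tor_smul, map_zero])⟩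
  have hs : Function.Surjective j := by
    rintro ⟨y, hy⟩
    obtain ⟨b, rfl⟩ := QuotientAddGroup.mk'_surjective C y
    rw [mem_tor, ← map_nsmul, QuotientAddGroup.mk'_apply, QuotientAddGroup.eq_zero_iff] at hy
    obtain ⟨c, hc⟩ := hD p hp ⟨_, hy⟩
    have hc' : p • (c : B) = p • b := congrArg Subtype.val hc
    refine ⟨⟨b - c, mem_tor.2 (by rw [smul_sub, hc', sub_self])⟩, Subtype.ext ?_⟩
    show QuotientAddGroup.mk' C (b - c) = QuotientAddGroup.mk' C b
    rw [map_sub, sub_eq_self, QuotientAddGroup.mk'_apply, QuotientAddGroup.eq_zero_iff]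
    exact c.2
  refine lt_of_le_of_ne (Nat.card_le_card_of_surjective j hs) ?_
  intro hc
  have hi := ((Nat.bijective_iff_surjective_and_card j).2 ⟨hs, hc.symm⟩).1
  obtain ⟨c, hc⟩ := hne
  obtain ⟨t, ht, htp⟩ := dv_tor_ne (hB.inj C.subtype (AddSubgroup.subtype_injective _)) c hc
  have h1 : j ⟨t.1, mem_tor.2 (congrArg Subtype.val htp)⟩ = j 0 := by
    refine Subtype.ext ?_
    show QuotientAddGroup.mk' C t.1 = QuotientAddGroup.mk' C 0
    rw [map_zero, QuotientAddGroup.mk'_apply, QuotientAddGroup.eq_zero_iff]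
    exact t.2
  exact ht (Subtype.ext (congrArg (fun x : tor p B => x.1) (hi h1)))

/-- devissage -/
theorem devis {p : ℕ} (hp : p ≠ 0) {Γ : Type} [Group Γ] (P : ∀ (B : Type) [AddCommGroup B], Act Γ B → Prop)
    (h0 : ∀ (B : Type) [AddCommGroup B] (ρ : Act Γ B), (∀ b : B, b = 0) → P B ρ)
    (hs : ∀ (B : Type) [AddCommGroup B] (ρ : Act Γ B) (C : AddSubgroup B) (hC : ∀ g, ∀ x ∈ C, ρ g x ∈ C), Dv B → Cer p B →
      Irr p (sAct ρ C hC) → P (B ⧸ C) (qAct ρ C hC) → P B ρ)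
    (B : Type) [AddCommGroup B] (ρ : Act Γ B) (hD : Dv B) (hC : Cer p B) : P B ρ := by
  induction hn : Nat.card (tor p B) using Nat.strong_induction_on generalizing B with
  | _ n ih =>
    by_cases hne : ∃ b : B, b ≠ 0
    · obtain ⟨C, hCi, hI⟩ := exists_irred hp ρ hD hC hne
      refine hs B ρ C hCi hD hC hI ?_
      exact ih _ (hn ▸ card_quot_lt hp hC C hI.dv hI.ne) (B ⧸ C) _ (hD.surj _ (QuotientAddGroup.mk'_surjective C))
        (hC.surj hp _ (QuotientAddGroup.mk'_surjective C)) rfl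
    · push Not at hne
      exact h0 B ρ hne

lemma Irr.sub {p : ℕ} (hp : p ≠ 0) {Γ C : Type} [Group Γ] [AddCommGroup C] {ρ : Act Γ C} (h : Irr p ρ) (S : AddSubgroup C) (hS : ∀ g, ∀ x ∈ S, ρ g x ∈ S) :
    S = ⊤ ∨ ∃ k : ℕ, ∀ x ∈ S, p ^ k • x = 0 := by
  have hc : Cer p S := h.cer.inj S.subtype (AddSubgroup.subtype_injective _)
  obtain ⟨k, _, h2⟩ := hc.dvpart hp
  let S' : AddSubgroup C := (mul (p^k) S).map S.subtype
  let e : mul (p^k) S ≃+ S' := (mul (p^k) S).equivMapOfInjective S.subtype (AddSubgroup.subtype_injective _)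
  have hinv : ∀ g, ∀ x ∈ S', ρ g x ∈ S' := by
    rintro g _ ⟨x, hx, rfl⟩
    obtain ⟨y, rfl⟩ := mem_mul.1 hx
    exact ⟨p^k • sAct ρ S hS g y, mem_mul.2 ⟨_, rfl⟩, by
      simp only [map_nsmul]; rfl⟩
  rcases h.irr S' hinv (h2.surj e.toAddMonoidHom e.surjective) with h3 | h3
  · right
    refine ⟨k, fun x hx => ?_⟩
    have : p ^ k • x ∈ S' := ⟨p^k • ⟨x, hx⟩, mem_mul.2 ⟨_, rfl⟩, rfl⟩
    rw [h3] at this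
    exact this
  · left
    rw [eq_top_iff, ← h3]
    rintro _ ⟨x, _, rfl⟩
    exact x.2

/-- quasi-inverse of an isogeny -/
lemma quasi_inv {C : Type} [AddCommGroup C] (r : C →+ C) (hs : Function.Surjective r) (m : ℕ) (hk : ∀ x, r x = 0 → m • x = 0) :
    ∃ ψ : C →+ C, (∀ x, ψ (r x) = m • x) ∧ (∀ x, r (ψ x) = m • x) ∧ ∀ g : C →+ C, (∀ x, g (r x) = r (g x)) → ∀ x, ψ (g x) = g (ψ x) := by
  choose s hs' using hs
  have key : ∀ x y, r x = y → m • s y = m • x := by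
    intro x y h
    have : r (s y - x) = 0 := by rw [map_sub, hs', h, sub_self]
    have := hk _ this
    rw [smul_sub, sub_eq_zero] at this
    exact this
  let ψ : C →+ C := AddMonoidHom.mk' (fun y => m • s y) (by
    intro a b
    rw [← smul_add]
    exact key _ _ (by rw [map_add, hs', hs']))
  have h1 : ∀ x, ψ (r x) = m • x := fun x => key x _ rfl
  refine ⟨ψ, h1, fun x => ?_, ?_⟩
  · show r (m • s x) = _
    rw [map_nsmul, hs']
  · intro g hg x
    obtain ⟨y, rfl⟩ : ∃ y, r y = x := ⟨s x, hs' x⟩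
    rw [hg, h1, h1, map_nsmul]

lemma Irr.endo {p : ℕ} (hp : p ≠ 0) {Γ C : Type} [Group Γ] [AddCommGroup C] {ρ : Act Γ C} (h : Irr p ρ) (r : C →+ C) (hr : ∀ g x, r (ρ g x) = ρ g (r x))
    (hne : ∃ x, r x ≠ 0) : ∃ (m : ℕ) (_ : m ≠ 0) (ψ : C →+ C), (∀ x, ψ (r x) = m • x) ∧ (∀ x, r (ψ x) = m • x) ∧
      ∀ g : C →+ C, (∀ x, g (r x) = r (g x)) → ∀ x, ψ (g x) = g (ψ x) := by
  have hs : r.range = ⊤ := by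
    refine (h.irr r.range ?_ (h.dv.surj r.rangeRestrict r.rangeRestrict_surjective)).resolve_left ?_
    · rintro g _ ⟨x, rfl⟩
      exact ⟨ρ g x, hr g x⟩
    · intro hb
      obtain ⟨x, hx⟩ := hne
      have : r x ∈ r.range := ⟨x, rfl⟩
      rw [hb] at this
      exact hx this
  have hk : ∃ k : ℕ, ∀ x ∈ r.ker, p ^ k • x = 0 := by
    refine (h.sub hp r.ker ?_).resolve_left ?_
    · intro g x hx
      rw [AddMonoidHom.mem_ker] at hx ⊢
      rw [hr, hx, map_zero]
    · intro ht
      obtain ⟨x, hx⟩ := hne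
      have : x ∈ r.ker := by rw [ht]; exact AddSubgroup.mem_top _
      exact hx this
  obtain ⟨k, hk⟩ := hk
  obtain ⟨ψ, h1⟩ := quasi_inv r (AddMonoidHom.range_eq_top.1 hs) (p^k) (fun x hx => hk x hx)
  exact ⟨p^k, pow_ne_zero _ hp, ψ, h1⟩

/-- action on Hom -/
def homAct {Γ M C : Type} [Group Γ] [AddCommGroup M] [AddCommGroup C] (μ : Act Γ M) (ρ : Act Γ C) : Act Γ (M →+ C) where
  f g := AddMonoidHom.mk' (fun φ => ((ρ g : C →+ C).comp φ).comp (μ g⁻¹ : M →+ M)) (by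
    intro a b
    ext x
    simp)
  one' φ := by
    ext x
    simp [Act.one_eq]
  mul' g h φ := by
    ext x
    simp [Act.mul_eq, mul_inv_rev]

lemma homAct_apply {Γ M C : Type} [Group Γ] [AddCommGroup M] [AddCommGroup C] (μ : Act Γ M) (ρ : Act Γ C) (g : Γ) (φ : M →+ C) (x : M) :
    homAct μ ρ g φ x = ρ g (φ (μ g⁻¹ x)) := rfl

end TB
end

section
namespace TB

lemma SES.split {Γ X Y Z : Type} [Group Γ] [AddCommGroup X] [AddCommGroup Y] [AddCommGroup Z] {ρX : Act Γ X} {ρY : Act Γ Y} {ρZ : Act Γ Z}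
    (S : SES ρX ρY ρZ) (hD : Dv X) : ∃ s : Z →+ Y, ∀ z, S.q (s z) = z := by
  obtain ⟨h, hh⟩ := hD.ext S.i S.inj (AddMonoidHom.id X)
  choose t ht using S.surj
  have key : ∀ y z, S.q y = z → t z - S.i (h (t z)) = y - S.i (h y) := by
    intro y z hyz
    obtain ⟨x, hx⟩ := S.ex (t z - y) (by rw [map_sub, ht, hyz, sub_self])
    have h1 : h (t z - y) = x := by rw [← hx, hh]; rfl
    have h2 : t z = y + S.i x := by rw [hx]; abel
    have h3 : h (t z) = h y + x := by rw [← h1, map_sub]; abel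
    rw [h3, map_add, h2]; abel
  refine ⟨AddMonoidHom.mk' (fun z => t z - S.i (h (t z))) ?_, ?_⟩
  · intro a b
    rw [key (t a + t b) (a + b) (by rw [map_add, ht, ht]), map_add, map_add]
    abel
  · intro z
    show S.q (t z - S.i (h (t z))) = z
    rw [map_sub, ht, S.qi, sub_zero]

/-- composition -/
def pst {M X Y : Type} [AddCommGroup M] [AddCommGroup X] [AddCommGroup Y] (φ : X →+ Y) : (M →+ X) →+ (M →+ Y) :=
  AddMonoidHom.mk' (fun f => φ.comp f) (by intro a b; ext x; simp)

lemma pst_apply {M X Y : Type} [AddCommGroup M] [AddCommGroup X] [AddCommGroup Y] (φ : X →+ Y) (f : M →+ X) (x) : pst φ f x = φ (f x) := rfl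

lemma pst_equi {Γ M X Y : Type} [Group Γ] [AddCommGroup M] [AddCommGroup X] [AddCommGroup Y] (μ : Act Γ M) {ρX : Act Γ X} {ρY : Act Γ Y} (φ : X →+ Y)
    (h : Equi ρX ρY φ) : Equi (homAct μ ρX) (homAct μ ρY) (pst φ) := by
  intro g f
  ext x
  exact h g _

/-- Hom of an exact sequence -/
def homSES {Γ M X Y Z : Type} [Group Γ] [AddCommGroup M] [AddCommGroup X] [AddCommGroup Y] [AddCommGroup Z] (μ : Act Γ M) {ρX : Act Γ X} {ρY : Act Γ Y} {ρZ : Act Γ Z}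
    (S : SES ρX ρY ρZ) (hD : Dv X) : SES (homAct μ ρX) (homAct μ ρY) (homAct μ ρZ) where
  i := pst S.i
  q := pst S.q
  hi := pst_equi μ S.i S.hi
  hq := pst_equi μ S.q S.hq
  inj := by
    intro a b h
    ext x
    exact S.inj (DFunLike.congr_fun h x)
  surj := by
    intro φ
    obtain ⟨s, hs⟩ := S.split hD
    refine ⟨s.comp φ, ?_⟩
    ext x
    exact hs _
  qi := by
    intro φ
    ext x
    exact S.qi _
  ex := by
    intro φ h
    have hx : ∀ x, ∃ y, S.i y = φ x := fun x => S.ex _ (DFunLike.congr_fun h x)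
    choose t ht using hx
    refine ⟨AddMonoidHom.mk' t ?_, ?_⟩
    · intro a b
      refine S.inj ?_
      rw [map_add, ht, ht, ht, map_add]
    · ext x
      exact ht x

lemma kill_base {Γ X : Type} [Group Γ] [AddCommGroup X] (ρ : Act Γ X) (z : Γ) (hz : ∀ g, z * g = g * z) (ψ : X →+ X) (hψ : ∀ g x, ψ (ρ g x) = ρ g (ψ x)) (m : ℕ)
    (hm : ∀ x, ψ (ρ z x - x) = m • x) (n : ℕ) (y : Hn ρ n) : m • y = 0 := by
  have h1 : Equi ρ ρ (ρ z) := by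
    intro g x
    rw [MonoidHom.id_apply, ← ρ.mul, ← ρ.mul, hz]
  have h2 : Compat ρ ρ (MulAut.conj z⁻¹).toMonoidHom (ρ z) := by
    intro g x
    have : (MulAut.conj z⁻¹).toMonoidHom g = g := by
      show z⁻¹ * g * z⁻¹⁻¹ = g
      rw [inv_inv, mul_assoc, ← hz, inv_mul_cancel_left]
    rw [this]
    exact h1 g x
  have h3 : Hmap (MonoidHom.id Γ) (ρ z) h1 n y = y := by
    refine (Hmap_congr h1 h2 ?_ rfl n y).trans (conj_id ρ z h2 n y)
    refine DFunLike.ext _ _ fun g => ?_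
    show g = z⁻¹ * g * z⁻¹⁻¹
    rw [inv_inv, mul_assoc, ← hz, inv_mul_cancel_left]
  have h4 : Equi ρ ρ (ρ z - AddMonoidHom.id X) := h1.sub Compat.id
  have h5 : Hmap (MonoidHom.id Γ) (ρ z - AddMonoidHom.id X) h4 n y = 0 := by
    rw [Hmap_sub h1 Compat.id, h3, Hmap_id, sub_self]
  have h6 : Equi ρ ρ ψ := fun g x => hψ g x
  rw [← Hmap_nsmul ρ m (equi_nsmul ρ m) n y]
  have h7 := Hmap_comp _ _ h4 _ _ h6 n y
  rw [h5, map_zero] at h7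
  refine (Hmap_congr _ _ rfl ?_ n y).trans h7.symm
  ext x
  exact (hm x).symm

theorem LN (i : ℕ) : ∀ (Γ X : Type) [Group Γ] [AddCommGroup X] (ρ : Act Γ X) (z : Γ), z ∈ Subgroup.upperCentralSeries Γ (i+1) →
    (∀ g ∈ Subgroup.upperCentralSeries Γ i, ∀ x, ρ g x = x) → ∀ ψ : X →+ X, (∀ g x, ψ (ρ g x) = ρ g (ψ x)) → ∀ m : ℕ, m ≠ 0 → 
    (∀ x, ψ (ρ z x - x) = m • x) → ∀ n, sBd.P (Hn ρ n) := by
  induction i with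
  | zero =>
    intro Γ X _ _ ρ z hz _ ψ hψ m hm0 hm n
    refine ⟨m, hm0, kill_base ρ z ?_ ψ hψ m hm n⟩
    rw [zero_add, Subgroup.upperCentralSeries_one] at hz
    exact fun g => (Subgroup.mem_center_iff.1 hz g).symm
  | succ i ih =>
    intro Γ X _ _ ρ z hz ht ψ hψ m hm0 hm n
    let f := QuotientGroup.mk' (Subgroup.center Γ)
    have hf : Function.Surjective f := QuotientGroup.mk'_surjective _
    have hc : ∀ g : Γ, ∀ k : f.ker, cj f.ker g k = k := by
      intro g k
      refine Subtype.ext ?_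
      have hk : (k : Γ) ∈ Subgroup.center Γ := (QuotientGroup.eq_one_iff _).1 k.2
      rw [cj_coe, mul_assoc, ← Subgroup.mem_center_iff.1 hk g, inv_mul_cancel_left]
    refine lhs ρ f hf sBd n ?_
    intro a b _
    have hco : ∀ φ : X →+ X, (∀ g x, φ (ρ g x) = ρ g (φ x)) → Equi (ρ.comp f.ker.subtype) (ρ.comp f.ker.subtype) φ := fun φ h g x => h _ x
    refine ih (Γ ⧸ Subgroup.center Γ) _ (actQ ρ f hf b) (f z) ?_ ?_ (Hmap (MonoidHom.id _) ψ (hco ψ hψ) b) ?_ m hm0 ?_ a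
    · have := hz
      rw [← Subgroup.comap_upperCentralSeries_quotient_center] at this
      exact this
    · intro g hg x
      obtain ⟨g, rfl⟩ := hf g
      have hg' : g ∈ Subgroup.upperCentralSeries Γ (i+1) := by
        rw [← Subgroup.comap_upperCentralSeries_quotient_center]
        exact hg
      rw [actQ_apply]
      refine (Hmap_congr _ Compat.id (DFunLike.ext _ _ (hc g)) ?_ b x).trans (Hmap_id _ b x)
      ext x
      exact ht g hg' x
    · intro g x
      obtain ⟨g, rfl⟩ := hf g
      rw [actQ_f]
      exact Hmap_conj f.ker ψ (fun g x => hψ g x) (hco ψ hψ) b g x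
    · intro x
      have hcm : Compat (ρ.comp f.ker.subtype) (ρ.comp f.ker.subtype) (MonoidHom.id _) (ρ z) := by
        intro k x
        have hk : (k : Γ) ∈ Subgroup.center Γ := (QuotientGroup.eq_one_iff _).1 k.2
        show ρ z (ρ k x) = ρ k (ρ z x)
        rw [← ρ.mul, ← ρ.mul, Subgroup.mem_center_iff.1 hk z]
      have e1 : actQ ρ f hf b (f z) x = Hmap (MonoidHom.id _) (ρ z) hcm b x := by
        rw [actQ_apply]
        exact Hmap_congr _ _ (DFunLike.ext _ _ (hc z)) rfl b x
      have e2 : actQ ρ f hf b (f z) x - x = Hmap (MonoidHom.id _) (ρ z - AddMonoidHom.id X) (hcm.sub Compat.id) b x := by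
        rw [e1, Hmap_sub hcm Compat.id, Hmap_id]
      rw [e2]
      refine (Hmap_comp _ _ _ _ _ _ b x).trans ?_
      rw [← Hmap_nsmul (ρ.comp f.ker.subtype) m (equi_nsmul _ m) b x]
      refine Hmap_congr _ _ rfl ?_ b x
      ext x
      exact hm x

lemma bd_of_zero {Γ X : Type} [Group Γ] [AddCommGroup X] (ρ : Act Γ X) (m : ℕ) (hm : m ≠ 0) (h : ∀ x : X, m • x = 0) (n : ℕ) : sBd.P (Hn ρ n) :=
  ⟨m, hm, Hn_kill ρ m h n⟩

lemma Irr.nilp {p : ℕ} (hp : p ≠ 0) {N : Type} [Group N] (hN : Group.IsNilpotent N) {C : Type} [AddCommGroup C] {ρ : Act N C} (h : Irr p ρ)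
    (ht : ∃ g x, ρ g x ≠ x) : (∀ n, sBd.P (Hn ρ n)) ∧ ∀ (M : Type) [AddCommGroup M] (n : ℕ), sBd.P (Hn (homAct (trivA N M) ρ) n) := by
  obtain ⟨i, h1, h2⟩ : ∃ i, (∀ g ∈ Subgroup.upperCentralSeries N i, ∀ x, ρ g x = x) ∧ ¬ (∀ g ∈ Subgroup.upperCentralSeries N (i+1), ∀ x, ρ g x = x) := by
    by_contra hcon
    push Not at hcon
    have hall : ∀ i, ∀ g ∈ Subgroup.upperCentralSeries N i, ∀ x, ρ g x = x := by
      intro i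
      induction i with
      | zero =>
        intro g hg x
        rw [Subgroup.upperCentralSeries_zero, Subgroup.mem_bot] at hg
        rw [hg, ρ.one]
      | succ i ih => exact hcon i ih
    obtain ⟨k, hk⟩ := hN.nilpotent'
    obtain ⟨g, x, hgx⟩ := ht
    exact hgx (hall k g (by rw [hk]; trivial) x)
  push Not at h2
  obtain ⟨z, hz, x0, hx0⟩ := h2
  have hcomm : ∀ g x, ρ z (ρ g x) = ρ g (ρ z x) := by
    intro g x
    have h3 : ∀ x, ρ (z * g * z⁻¹ * g⁻¹) x = x := h1 _ (Subgroup.mem_upperCentralSeries_succ_iff.1 hz g)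
    rw [← ρ.mul, ← ρ.mul]
    have e : z * g = z * g * z⁻¹ * g⁻¹ * (g * z) := by group
    rw [e, ρ.mul, h3]
  obtain ⟨m, hm, ψ, p1, p2, p3⟩ := h.endo hp (ρ z - AddMonoidHom.id C) (by
    intro g x
    simp [hcomm]) ⟨x0, by simpa [sub_eq_zero] using hx0⟩
  have hψ : ∀ g x, ψ (ρ g x) = ρ g (ψ x) := by
    intro g x
    refine p3 (ρ g) (fun x => ?_) x
    simp [hcomm]
  constructor
  · exact LN i N C ρ z hz h1 ψ hψ m hm p1
  · intro M _
    refine LN i N (M →+ C) (homAct (trivA N M) ρ) z hz ?_ (pst ψ) ?_ m hm ?_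
    · intro g hg φ
      ext x
      exact h1 g hg _
    · intro g φ
      ext x
      exact hψ g _
    · intro φ
      ext x
      exact p1 (φ x)

lemma dv_not_bd {C : Type} [AddCommGroup C] (hD : Dv C) (hne : ∃ c : C, c ≠ 0) (h : ∃ m : ℕ, m ≠ 0 ∧ ∀ c : C, m • c = 0) : False := by
  obtain ⟨m, hm, h⟩ := h
  obtain ⟨c, hc⟩ := hne
  obtain ⟨d, rfl⟩ := hD m hm c
  exact hc (h d)

theorem lemN {p : ℕ} (hp : p ≠ 0) {N : Type} [Group N] (hN : Group.IsNilpotent N) (M : Type) [AddCommGroup M] (B : Type) [AddCommGroup B] (ρ : Act N B) (hD : Dv B) (hC : Cer p B) :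
    sBd.P (Hn ρ 0) → ∀ n, sBd.P (Hn (homAct (trivA N M) ρ) n) := by
  refine devis hp (fun B _ ρ => sBd.P (Hn ρ 0) → ∀ n, sBd.P (Hn (homAct (trivA N M) ρ) n)) ?_ ?_ B ρ hD hC
  · intro B _ ρ h _ n
    refine bd_of_zero _ 1 one_ne_zero (fun φ => ?_) n
    ext x
    exact h _
  · intro B _ ρ C hCi hD hC hI ih h0 n
    have hC0 : sBd.P (Hn (sAct ρ C hCi) 0) := sBd.of_inj ((SES.sub ρ C hCi).Hi 0) (SES.Hi_inj0 _) h0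
    have hnt : ∃ g x, sAct ρ C hCi g x ≠ x := by
      by_contra hcon
      push Not at hcon
      obtain ⟨m, hm, h⟩ := hC0
      refine dv_not_bd hI.dv hI.ne ⟨m, hm, fun c => ?_⟩
      have := congrArg (val0 _) (h (cl0 c (fun g => hcon g c)))
      rw [map_nsmul, map_zero, val0_cl0] at this
      exact this
    obtain ⟨k1, k2⟩ := hI.nilp hp hN hnt
    refine (homSES (trivA N M) (SES.sub ρ C hCi) hI.dv).P_mid sBd n (k2 M n) (ih ?_ n)
    exact (SES.sub ρ C hCi).P_right sBd 0 h0 (k1 1)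

/-- irreducible with nontrivial action of the nilpotent kernel -/
theorem Irr.bd {p : ℕ} (hp : p ≠ 0) {Γ Q : Type} [Group Γ] [Group Q] (τ : Γ →* Q) (hτ : Function.Surjective τ) (hN : Group.IsNilpotent τ.ker) {C : Type} [AddCommGroup C] {ρ : Act Γ C} (h : Irr p ρ)
    (ht : ∃ g ∈ τ.ker, ∃ x, ρ g x ≠ x) (M : Type) [AddCommGroup M] (μ : Act Q M) (n : ℕ) : sBd.P (Hn (homAct (μ.comp τ) ρ) n) := by
  refine lhs _ τ hτ sBd n ?_
  intro a b _
  have e : (homAct (μ.comp τ) ρ).comp τ.ker.subtype = homAct (trivA τ.ker M) (ρ.comp τ.ker.subtype) := by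
    refine Act.ext fun g φ => ?_
    ext x
    show ρ g (φ (μ (τ (g:Γ)⁻¹) x)) = ρ g (φ x)
    have : τ (g:Γ)⁻¹ = 1 := by rw [map_inv, g.2, inv_one]
    rw [this, μ.one]
  have hb : sBd.P (Hn ((homAct (μ.comp τ) ρ).comp τ.ker.subtype) b) := by
    rw [e]
    refine lemN hp hN M C _ h.dv h.cer ?_ b
    let F : AddSubgroup C := (val0 (ρ.comp τ.ker.subtype)).range
    have hF : ∀ g, ∀ x ∈ F, ρ g x ∈ F := by
      rintro g _ ⟨y, rfl⟩
      refine ⟨cl0 (ρ g (val0 _ y)) ?_, rfl⟩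
      intro k
      have hk : g⁻¹ * k * g ∈ τ.ker := by
        have := (inferInstance : τ.ker.Normal).conj_mem k.1 k.2 g⁻¹
        simpa using this
      have := val0_fix (ρ.comp τ.ker.subtype) y ⟨_, hk⟩
      have this' : ρ (g⁻¹ * k * g) (val0 _ y) = val0 _ y := this
      show ρ k (ρ g (val0 _ y)) = ρ g (val0 _ y)
      conv_rhs => rw [← this']
      rw [← ρ.mul, ← ρ.mul]
      congr 2
      group
    rcases h.sub hp F hF with h1 | ⟨k, hk⟩
    · exfalso
      obtain ⟨g, hg, x, hx⟩ := ht
      have : x ∈ F := by rw [h1]; trivial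
      obtain ⟨y, rfl⟩ := this
      exact hx (val0_fix (ρ.comp τ.ker.subtype) y ⟨g, hg⟩)
    · refine ⟨p^k, pow_ne_zero _ hp, fun y => ?_⟩
      refine val0_inj _ ?_
      rw [map_nsmul, map_zero]
      exact hk _ ⟨y, rfl⟩
  obtain ⟨m, hm, hm'⟩ := hb
  exact bd_of_zero _ m hm hm' a
end TB
end

section
namespace TB

/-- homomorphisms from nice modules are bounded -/
def Hyp (π : Set ℕ) {Γ Q B : Type} [Group Γ] [Group Q] [AddCommGroup B] (τ : Γ →* Q) (ρ : Act Γ B) : Prop :=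
  ∀ (M : Type) [AddCommGroup M] (μ : Act Q M), TF M → (sPP π).P M → ∀ φ : M →+ B, (∀ g x, φ (μ (τ g) x) = ρ g (φ x)) →
    ∃ m : ℕ, m ≠ 0 ∧ ∀ x, m • φ x = 0

/-- the ring of p-fractions -/
def Zp (p : ℕ) : AddSubgroup ℚ where
  carrier := {q | ∃ (k : ℕ) (n : ℤ), (p^k : ℕ) • q = n}
  zero_mem' := ⟨0, 0, by simp⟩
  add_mem' := by
    rintro a b ⟨k, n, h⟩ ⟨l, m, h'⟩
    refine ⟨k + l, p^l * n + p^k * m, ?_⟩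
    push_cast
    rw [← h, ← h']
    simp only [nsmul_eq_mul]
    push_cast
    ring
  neg_mem' := by
    rintro a ⟨k, n, h⟩
    exact ⟨k, -n, by rw [smul_neg, h]; push_cast; rfl⟩

lemma zp_tf (p : ℕ) : TF (Zp p) := by
  intro n a hn h
  have : n • (a : ℚ) = 0 := congrArg Subtype.val h
  rw [nsmul_eq_mul, mul_eq_zero] at this
  refine Subtype.ext (this.resolve_left (by exact_mod_cast hn))

def zpOne (p : ℕ) : Zp p := ⟨1, 0, 1, by simp⟩

lemma zp_pp {π : Set ℕ} {p : ℕ} (hp : p.Prime) (hpπ : p ∈ π) : (sPP π).P (Zp p) := by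
  intro d hd
  refine ⟨AddSubgroup.zmultiples (zpOne p), ⟨{zpOne p}, by simp [AddSubgroup.zmultiples_eq_closure]⟩, ?_⟩
  rintro ⟨x, k, n, h⟩
  refine ⟨p^k, pow_ne_zero _ hp.ne_zero, Nat.Coprime.pow_left k ?_, ?_⟩
  · rcases hd with rfl | ⟨h1, h2⟩
    · exact Nat.coprime_one_right _
    · refine (Nat.coprime_primes hp h1).2 ?_
      rintro rfl
      exact h2 hpπ
  · rw [AddSubgroup.mem_zmultiples_iff]
    refine ⟨n, Subtype.ext ?_⟩
    show (n : ℤ) • (1 : ℚ) = (p^k : ℕ) • x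
    rw [h]; simp

def zpInv (p : ℕ) (hp : p ≠ 0) (k : ℕ) : Zp p := ⟨((p:ℚ)^k)⁻¹, k, 1, by
  have : (p:ℚ) ≠ 0 := by exact_mod_cast hp
  rw [nsmul_eq_mul]; push_cast
  exact mul_inv_cancel₀ (pow_ne_zero _ this)⟩

lemma zpInv_smul (p : ℕ) (hp : p ≠ 0) (k : ℕ) : p^k • zpInv p hp k = zpOne p := by
  refine Subtype.ext ?_
  have : (p:ℚ) ≠ 0 := by exact_mod_cast hp
  show (p^k : ℕ) • ((p:ℚ)^k)⁻¹ = (1:ℚ)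
  rw [nsmul_eq_mul]; push_cast
  exact mul_inv_cancel₀ (pow_ne_zero _ this)

lemma tf_tensor {A B : Type} [AddCommGroup A] [AddCommGroup B] (hA : TF A) (hB : TF B) : TF (TensorProduct ℤ A B) := by
  have key : ∀ (A : Type) [AddCommGroup A], TF A → Module.IsTorsionFree ℤ A := by
    intro A _ h
    refine Module.IsTorsionFree.of_smul_eq_zero ?_
    intro r m hrm
    by_cases hr : r = 0
    · exact Or.inl hr
    · right
      refine h r.natAbs m (by simpa using hr) ?_
      rcases Int.natAbs_eq r with h1 | h1
      · rw [← natCast_zsmul, ← h1, hrm]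
      · have : (r.natAbs : ℤ) = -r := by omega
        rw [← natCast_zsmul, this, neg_smul, hrm, neg_zero]
  haveI := key A hA
  haveI := key B hB
  haveI : Module.Flat ℤ A := inferInstance
  haveI : Module.Flat ℤ B := inferInstance
  haveI : Module.Flat ℤ (TensorProduct ℤ A B) := Module.Flat.instTensorProduct
  intro n x hn h
  have h1 : (n : ℤ) • x = 0 := by rw [natCast_zsmul]; exact h
  exact (smul_eq_zero.1 h1).resolve_left (by exact_mod_cast hn)

/-- bilinear maps as homs from tensors -/
def tens {A B C : Type} [AddCommGroup A] [AddCommGroup B] [AddCommGroup C] (F : A →+ B →+ C) : TensorProduct ℤ A B →+ C :=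
  TensorProduct.liftAddHom F (fun r a b => by rw [map_zsmul, map_zsmul]; rfl)

lemma tens_tmul {A B C : Type} [AddCommGroup A] [AddCommGroup B] [AddCommGroup C] (F : A →+ B →+ C) (a b) : tens F (TensorProduct.tmul ℤ a b) = F a b := rfl

/-- action on the tensor product -/
def tAct {Q A : Type} [Group Q] [AddCommGroup A] (α : Act Q A) (B : Type) [AddCommGroup B] : Act Q (TensorProduct ℤ A B) where
  f q := ((α q).toIntLinearMap.rTensor B).toAddMonoidHom
  one' x := by
    rw [α.one_eq]
    show LinearMap.rTensor B LinearMap.id x = x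
    rw [LinearMap.rTensor_id]; rfl
  mul' a b x := by
    rw [α.mul_eq]
    exact LinearMap.rTensor_comp_apply B (α a).toIntLinearMap (α b).toIntLinearMap x

lemma tAct_tmul {Q A : Type} [Group Q] [AddCommGroup A] (α : Act Q A) (B : Type) [AddCommGroup B] (q a) (b : B) :
    tAct α B q (TensorProduct.tmul ℤ a b) = TensorProduct.tmul ℤ (α q a) b := rfl

lemma hyp_bil {π : Set ℕ} {Q C : Type} [Group Q] [AddCommGroup C] {Γ : Type} [Group Γ] {τ : Γ →* Q} {δ : Act Q C} (h : Hyp π τ (δ.comp τ)) {O : Type} [AddCommGroup O] (α : Act Q O) 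
    (h1 : TF O) (h2 : (sPP π).P O) {p : ℕ} (hp : p.Prime) (hpπ : p ∈ π) (F : O →+ Zp p →+ C) (hF : ∀ q o z, F (α q o) z = δ q (F o z)) :
    ∃ m : ℕ, m ≠ 0 ∧ ∀ o z, m • F o z = 0 := by
  obtain ⟨m, hm, h3⟩ := h _ (tAct α (Zp p)) (tf_tensor h1 (zp_tf p)) (fun d hd => pf_tensor (h2 d hd) (zp_pp hp hpπ d hd)) (tens F) (by
    intro g x
    induction x using TensorProduct.induction_on with
    | zero => simp
    | tmul o z => exact hF _ o z
    | add a b ha hb => rw [map_add, map_add, map_add, map_add, ha, hb])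
  exact ⟨m, hm, fun o z => h3 (TensorProduct.tmul ℤ o z)⟩

lemma sig_ne {π : Set ℕ} {Q C : Type} [CommGroup Q] [AddCommGroup C] {Γ : Type} [Group Γ] {τ : Γ →* Q} {δ : Act Q C} (h : Hyp π τ (δ.comp τ))
    {p : ℕ} (hp : p.Prime) (hpπ : p ∈ π) (hD : Dv C) (hC : Cer p C) (hne : ∃ c : C, c ≠ 0) (J : Ideal (GR Q)) (hJ : NI π J) :
    ∃ r ∈ J, ∃ x, δ.R r x ≠ 0 := by
  by_contra hcon
  push Not at hcon
  let D : GR Q →+ (C →+ C) := AddMonoidHom.mk' (fun r => δ.R r) (by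
    intro a b
    ext x
    exact δ.R_add a b x)
  let β : Act Q (C →+ C) := homAct (trivA Q C) δ
  have hinv : ∀ q, ∀ x ∈ D.range, β q x ∈ D.range := by
    rintro q _ ⟨r, rfl⟩
    refine ⟨bs q * r, ?_⟩
    ext x
    show δ.R (bs q * r) x = δ q (δ.R r x)
    rw [δ.R_mul, δ.R_bs]
  have h1 : TF D.range := by
    intro n a hn h0
    refine Subtype.ext ?_
    ext x
    obtain ⟨y, rfl⟩ := hD n hn x
    have h0' : n • a.1 = 0 := congrArg Subtype.val h0
    have := DFunLike.congr_fun h0' y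
    rw [map_nsmul]
    exact this
  have h2 : (sPP π).P D.range := by
    let g : GR Q ⧸ J →+ D.range := QuotientAddGroup.lift J.toAddSubgroup D.rangeRestrict (fun r hr => by
      refine Subtype.ext ?_
      ext x
      exact hcon r hr x)
    refine (sPP π).of_surj g ?_ hJ
    rintro ⟨_, r, rfl⟩
    exact ⟨Submodule.Quotient.mk r, rfl⟩
  obtain ⟨c, hc⟩ := hne
  obtain ⟨hh, hh'⟩ := hD.ext (zmultiplesHom (Zp p) (zpOne p)) (by
    rw [injective_iff_map_eq_zero]
    intro n hn
    have : n • (1:ℚ) = 0 := congrArg Subtype.val hn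
    simpa using this) (zmultiplesHom C c)
  have hh1 : hh (zpOne p) = c := by
    have := hh' 1
    simpa using this
  let F : D.range →+ Zp p →+ C := AddMonoidHom.mk' (fun o => o.1.comp hh) (by
    intro a b
    ext z
    rfl)
  obtain ⟨m, hm, h3⟩ := hyp_bil h (sAct β D.range hinv) h1 h2 hp hpπ F (fun q o z => rfl)
  have hid : (AddMonoidHom.id C) ∈ D.range := ⟨1, by ext x; exact δ.R_one x⟩
  obtain ⟨k, c', e1, e2⟩ := fact_cop p m hm
  obtain ⟨d, hd⟩ := e1
  have h4 : m • hh (zpInv p hp.ne_zero k) = 0 := h3 ⟨_, hid⟩ _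
  have h5 : c' • c = 0 := by
    rw [← hh1, ← zpInv_smul p hp.ne_zero k, map_nsmul, ← mul_smul, mul_comm, hd, mul_comm, mul_smul, h4, smul_zero]
  obtain ⟨j, hj⟩ := hC.1 c
  exact hc (cop_zero (e2.pow_right j) c h5 hj)

/-- precomposition action -/
def preAct {Q M : Type} [CommGroup Q] [AddCommGroup M] (μ : Act Q M) (C : Type) [AddCommGroup C] : Act Q (M →+ C) where
  f q := AddMonoidHom.mk' (fun φ => φ.comp (μ q : M →+ M)) (by intro a b; ext x; rfl)
  one' φ := by ext x; simp
  mul' a b φ := by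
    ext x
    show φ (μ (a * b) x) = φ (μ b (μ a x))
    rw [mul_comm, μ.mul]

lemma sig_hom {π : Set ℕ} {Q C M : Type} [CommGroup Q] [AddCommGroup C] [AddCommGroup M] {Γ : Type} [Group Γ] {τ : Γ →* Q} {δ : Act Q C} (h : Hyp π τ (δ.comp τ))
    {p : ℕ} (hp : p.Prime) (hpπ : p ∈ π) (hI : Irr p (δ.comp τ)) (μ : Act Q M) (hk : Kil π μ) : Sig π (M →+ C) (homAct μ δ) := by
  have hpre : ∀ r φ x, (preAct μ C).R r φ x = φ (μ.R r x) := by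
    intro r φ x
    let D : GR Q →+ (M →+ C) := AddMonoidHom.mk' (fun r => φ.comp (μ.R r)) (by
      intro a b
      ext x
      show φ (μ.R (a + b) x) = φ (μ.R a x) + φ (μ.R b x)
      rw [μ.R_add, map_add])
    have := (preAct μ C).R_eq φ D (fun q => by
      ext x
      show φ (μ.R (bs q) x) = φ (μ q x)
      rw [μ.R_bs]) r
    exact (DFunLike.congr_fun this x).symm
  have hpost : ∀ r φ x, (homAct (trivA Q M) δ).R r φ x = δ.R r (φ x) := by
    intro r φ x
    let D : GR Q →+ (M →+ C) := AddMonoidHom.mk' (fun r => (δ.R r).comp φ) (by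
      intro a b
      ext x
      exact δ.R_add a b _)
    have := (homAct (trivA Q M) δ).R_eq φ D (fun q => by
      ext x
      exact δ.R_bs q _) r
    exact (DFunLike.congr_fun this x).symm
  refine ⟨preAct μ C, homAct (trivA Q M) δ, fun _ _ _ => rfl, fun q φ => ?_, ?_, ?_⟩
  · ext x; rfl
  · obtain ⟨I, hI, hkk⟩ := hk
    refine ⟨I, hI, fun r hr φ => ?_⟩
    ext x
    rw [hpre, hkk r hr, map_zero]; rfl
  · intro J hJ
    obtain ⟨r, hr, hne⟩ := sig_ne h hp hpπ hI.dv hI.cer hI.ne J hJ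
    have hcomm : ∀ q x, δ.R r (δ q x) = δ q (δ.R r x) := by
      intro q x
      rw [← δ.R_bs, ← δ.R_bs, ← δ.R_mul, ← δ.R_mul, mul_comm]
    obtain ⟨m, hm, ψ, p1, p2, p3⟩ := hI.endo hp.ne_zero (δ.R r) (fun g x => hcomm (τ g) x) hne
    refine ⟨r, hr, m, hm, pst ψ, ?_, ?_, ?_⟩
    · intro q φ
      rfl
    · intro q φ
      ext x
      exact p3 (δ q) (fun x => (hcomm q x).symm) _
    · intro φ
      ext x
      rw [pst_apply, hpost, p1]; rfl

lemma fac {Γ Q C : Type} [Group Γ] [Group Q] [AddCommGroup C] (τ : Γ →* Q) (hτ : Function.Surjective τ) (ρ : Act Γ C) (ht : ∀ g ∈ τ.ker, ∀ x, ρ g x = x) :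
    ∃ δ : Act Q C, ρ = δ.comp τ := by
  choose s hs using hτ
  have key : ∀ g h, τ g = τ h → ρ g = ρ h := by
    intro g h e
    ext x
    have : ρ (h⁻¹ * g) x = x := ht _ (by rw [MonoidHom.mem_ker, map_mul, map_inv, e, inv_mul_cancel]) x
    rw [ρ.mul] at this
    conv_rhs => rw [← this]
    rw [ρ.self_inv]
  refine ⟨⟨fun q => ρ (s q), fun x => ?_, fun a b x => ?_⟩, Act.ext fun g x => ?_⟩
  · rw [key (s 1) 1 (by rw [hs, map_one]), ρ.one]
  · rw [← ρ.mul, key (s (a * b)) (s a * s b) (by rw [hs, map_mul, hs, hs])]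
  · show ρ g x = ρ (s (τ g)) x
    rw [key g (s (τ g)) (hs _).symm]

lemma homZ {P : Serre} {Γ C : Type} [Group Γ] [AddCommGroup C] (ρ : Act Γ C) (n : ℕ) (h : P.P (Hn (homAct (trivA Γ ℤ) ρ) n)) : P.P (Hn ρ n) := by
  let φ : C →+ (ℤ →+ C) := AddMonoidHom.mk' (fun c => zmultiplesHom C c) (by
    intro a b
    ext
    simp)
  refine P_of_bij P (MulEquiv.refl Γ) φ ⟨fun a b h => (zmultiplesHom C).injective h, (zmultiplesHom C).surjective⟩ ?_ n h
  intro g x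
  refine DFunLike.ext _ _ fun k => ?_
  show k • ρ g x = ρ g (k • x)
  rw [map_zsmul]

theorem caseIn {π : Set ℕ} {Q : Type} [CommGroup Q] [Group.FG Q] {Γ : Type} [Group Γ] {τ : Γ →* Q} (hτ : Function.Surjective τ) (hN : Group.IsNilpotent τ.ker) (hc : Chain π Q Γ τ)
    {p : ℕ} (hp : p.Prime) (hpπ : p ∈ π) (B : Type) [AddCommGroup B] (ρ : Act Γ B) (hD : Dv B) (hC : Cer p B) :
    Hyp π τ ρ → ∀ (M : Type) [AddCommGroup M] (μ : Act Q M), Kil π μ → ∀ n, sBd.P (Hn (homAct (μ.comp τ) ρ) n) := by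
  refine devis hp.ne_zero (fun B _ ρ => Hyp π τ ρ → ∀ (M : Type) [AddCommGroup M] (μ : Act Q M), Kil π μ → ∀ n, sBd.P (Hn (homAct (μ.comp τ) ρ) n)) ?_ ?_ B ρ hD hC
  · intro B _ ρ h _ M _ μ hk n
    refine bd_of_zero _ 1 one_ne_zero (fun φ => ?_) n
    ext x
    exact h _
  · intro B _ ρ C hCi hD hC hI ih hH
    have hHC : Hyp π τ (sAct ρ C hCi) := by
      intro M _ μ h1 h2 φ hφ
      obtain ⟨m, hm, h3⟩ := hH M μ h1 h2 (C.subtype.comp φ) (fun g x => by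
        show (φ (μ (τ g) x)).1 = _
        rw [hφ]; rfl)
      exact ⟨m, hm, fun x => Subtype.ext (h3 x)⟩
    have hE : ∀ (M : Type) [AddCommGroup M] (μ : Act Q M), Kil π μ → ∀ n, sBd.P (Hn (homAct (μ.comp τ) (sAct ρ C hCi)) n) := by
      intro M _ μ hk n
      by_cases ht : ∃ g ∈ τ.ker, ∃ x, sAct ρ C hCi g x ≠ x
      · exact hI.bd hp.ne_zero τ hτ hN ht M μ n
      · push Not at ht
        obtain ⟨δ, hδ⟩ := fac τ hτ _ ht
        rw [hδ] at hI hHC ⊢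
        have e : homAct (μ.comp τ) (δ.comp τ) = (homAct μ δ).comp τ := Act.ext fun g φ => by
          ext x
          show (δ (τ g) (φ (μ (τ g⁻¹) x))).1 = (δ (τ g) (φ (μ (τ g)⁻¹ x))).1
          rw [map_inv]
        rw [e]
        exact (sig_hom hHC hp hpπ hI μ hk).chain hc _ _ n
    have S := fun (M : Type) [AddCommGroup M] (μ : Act Q M) => homSES (μ.comp τ) (SES.sub ρ C hCi) hI.dv
    intro M _ μ hk n
    refine (homSES (μ.comp τ) (SES.sub ρ C hCi) hI.dv).P_mid sBd n (hE M μ hk n) (ih ?_ M μ hk n)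
    intro M _ μ h1 h2 φ hφ
    let S := homSES (μ.comp τ) (SES.sub ρ C hCi) hI.dv
    obtain ⟨k, hk0, hkk⟩ := hE M μ (Kil.tf μ h1 h2) 1
    have hfix : ∀ g, homAct (μ.comp τ) (qAct ρ C hCi) g (k • φ) = k • φ := by
      intro g
      rw [map_nsmul]
      congr 1
      ext x
      rw [homAct_apply, ← hφ]
      congr 1
      exact μ.comp τ |>.self_inv g x
    have hfix1 : ∀ g, homAct (μ.comp τ) (qAct ρ C hCi) g φ = φ := by
      intro g
      ext x
      rw [homAct_apply, ← hφ]
      congr 1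
      exact μ.comp τ |>.self_inv g x
    have e1 : cl0 (k • φ) hfix = k • cl0 φ hfix1 := by
      refine val0_inj _ ?_
      rw [map_nsmul, val0_cl0, val0_cl0]
    have e2 : S.δ 0 (cl0 (k • φ) hfix) = 0 := by
      rw [e1, map_nsmul, hkk]
    obtain ⟨y, hy⟩ := S.ex_δ 0 _ e2
    obtain ⟨φ', hφ', rfl⟩ := cl0_surj y
    have e3 : S.q φ' = k • φ := by
      have := congrArg (val0 _) hy
      rw [val0_cl0] at this
      exact this
    obtain ⟨m, hm, h3⟩ := hH M μ h1 h2 φ' (fun g x => by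
      have := DFunLike.congr_fun (hφ' g) (μ (τ g) x)
      rw [homAct_apply] at this
      rw [← this]
      congr 2
      exact (μ.comp τ).inv_self g x)
    refine ⟨m * k, mul_ne_zero hm hk0, fun x => ?_⟩
    have e4 := DFunLike.congr_fun e3 x
    have e5 : k • φ x = QuotientAddGroup.mk' C (φ' x) := e4.symm
    rw [mul_smul, e5, ← map_nsmul, h3, map_zero]

theorem caseOut {π : Set ℕ} {Q : Type} [CommGroup Q] [Group.FG Q] {Γ : Type} [Group Γ] {τ : Γ →* Q} (hτ : Function.Surjective τ) (hN : Group.IsNilpotent τ.ker) (hc : Chain π Q Γ τ)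
    {p : ℕ} (hp : p.Prime) (hpπ : p ∉ π) (B : Type) [AddCommGroup B] (ρ : Act Γ B) (hD : Dv B) (hC : Cer p B) :
    ∀ n, sTor.P (Hn ρ n) := by
  refine devis hp.ne_zero (fun B _ ρ => ∀ n, sTor.P (Hn ρ n)) ?_ ?_ B ρ hD hC
  · intro B _ ρ h n y
    exact ⟨1, one_ne_zero, Hn_kill _ 1 (fun x => h _) n y⟩
  · intro B _ ρ C hCi hD hC hI ih n
    refine (SES.sub ρ C hCi).P_mid sTor n ?_ (ih n)
    by_cases ht : ∃ g ∈ τ.ker, ∃ x, sAct ρ C hCi g x ≠ x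
    · have h1 : sBd.P (Hn (sAct ρ C hCi) n) := homZ _ n (hI.bd hp.ne_zero τ hτ hN ht ℤ (trivA Q ℤ) n)
      obtain ⟨m, hm, h1⟩ := h1
      exact fun y => ⟨m, hm, h1 y⟩
    · push Not at ht
      obtain ⟨δ, hδ⟩ := fac τ hτ _ ht
      rw [hδ] at hI ⊢
      exact (chain_cer inferInstance hp hpπ hc C δ n hI.cer).tors hp.ne_zero

theorem caseAll {π : Set ℕ} {Q : Type} [CommGroup Q] [Group.FG Q] {Γ : Type} [Group Γ] {τ : Γ →* Q} (hτ : Function.Surjective τ) (hN : Group.IsNilpotent τ.ker) (hc : Chain π Q Γ τ)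
    {p : ℕ} (hp : p.Prime) (B : Type) [AddCommGroup B] (ρ : Act Γ B) (hD : Dv B) (hC : Cer p B) (hH : Hyp π τ ρ) :
    ∀ n, sTor.P (Hn ρ n) := by
  intro n
  by_cases hpπ : p ∈ π
  · have h1 : sBd.P (Hn ρ n) := homZ ρ n (caseIn hτ hN hc hp hpπ B ρ hD hC hH ℤ (trivA Q ℤ) (Kil.tf _ (by
      intro n v hn h
      simpa [hn] using h) (fun d _ => pf_fg inferInstance)) n)
    obtain ⟨m, hm, h1⟩ := h1
    exact fun y => ⟨m, hm, h1 y⟩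
  · exact caseOut hτ hN hc hp hpπ B ρ hD hC n
end TB
end

section
namespace TB

/-- sufficient conditions for a kernel to be a good factor -/
def Good (π : Set ℕ) {Γ Γ' Q : Type} [Group Γ] [Group Γ'] [CommGroup Q] (f : Γ →* Γ') (τ' : Γ' →* Q) : Prop :=
  Finite f.ker ∨ (∀ t : Γ, f t = 1 → ∀ n : ℕ, n ≠ 0 → t^n = 1 → t = 1) ∨
    ∃ (M : Type) (_ : AddCommGroup M) (μ : Act Q M), TF M ∧ (sPP π).P M ∧ ∃ φ : M → Γ, (∀ m, f (φ m) = 1) ∧ (∀ m m', φ (m + m') = φ m * φ m') ∧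
      (∀ t, f t = 1 → ∃ m, φ m = t) ∧ ∀ g m, φ (μ (τ' (f g)) m) = g * φ m * g⁻¹

theorem step1 {π : Set ℕ} {Γ Γ' Q : Type} [Group Γ] [Group Γ'] [CommGroup Q] (τ' : Γ' →* Q) (f : Γ →* Γ') (hf : Function.Surjective f)
    (hτ : Function.Surjective τ') (hc : ∀ n t : Γ, τ' (f n) = 1 → f t = 1 → n * t = t * n) (hab : ∀ t, f t = 1 → τ' (f t) = 1) (hF : FRS π Γ) (hG : Good π f τ')
    (ih : Chain π Q Γ' τ') : Chain π Q Γ (τ'.comp f) := by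
  letI : CommGroup f.ker := { (inferInstance : Group f.ker) with
    mul_comm := fun a b => Subtype.ext (hc a.1 b.1 (hab _ a.2) b.2) }
  have hs : ∀ q, ∃ g, τ' (f g) = q := fun q => by
    obtain ⟨x, rfl⟩ := hτ q
    obtain ⟨y, rfl⟩ := hf x
    exact ⟨y, rfl⟩
  choose s hs using hs
  have key : ∀ g g' t : Γ, τ' (f g) = τ' (f g') → f t = 1 → g * t * g⁻¹ = g' * t * g'⁻¹ := by
    intro g g' t h ht
    have h1 := hc (g'⁻¹ * g) t (by rw [map_mul, map_mul, map_inv, map_inv, h, inv_mul_cancel]) ht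
    calc g * t * g⁻¹ = g' * ((g'⁻¹ * g) * t) * g⁻¹ := by group
      _ = g' * t * g'⁻¹ := by rw [h1]; group
  have hk : ∀ (g : Γ) (t : f.ker), f (g * t.1 * g⁻¹) = 1 := fun g t => by
    rw [map_mul, map_mul, f.mem_ker.1 t.2, map_inv, mul_one, mul_inv_cancel]
  let α : Act Q (Additive f.ker) :=
    { f := fun q =>
        { toFun := fun v => Additive.ofMul ⟨s q * (Additive.toMul v).1 * (s q)⁻¹, hk _ _⟩
          map_zero' := by
            refine congrArg Additive.ofMul (Subtype.ext ?_)
            show s q * 1 * (s q)⁻¹ = 1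
            group
          map_add' := fun v w => by
            refine congrArg Additive.ofMul (Subtype.ext ?_)
            show s q * ((Additive.toMul v).1 * (Additive.toMul w).1) * (s q)⁻¹ = (s q * (Additive.toMul v).1 * (s q)⁻¹) * (s q * (Additive.toMul w).1 * (s q)⁻¹)
            group }
      one' := fun v => by
        refine congrArg Additive.ofMul (Subtype.ext ?_)
        show s 1 * (Additive.toMul v).1 * (s 1)⁻¹ = (Additive.toMul v).1
        rw [key _ 1 _ (by rw [hs, map_one, map_one]) (Additive.toMul v).2]; group
      mul' := fun a b v => by
        refine congrArg Additive.ofMul (Subtype.ext ?_)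
        show s (a * b) * (Additive.toMul v).1 * (s (a * b))⁻¹ = s a * (s b * (Additive.toMul v).1 * (s b)⁻¹) * (s a)⁻¹
        rw [key _ (s a * s b) _ (by rw [hs, map_mul, map_mul, hs, hs]) (Additive.toMul v).2]; group }
  have hα : ∀ g (v : Additive f.ker), ((Additive.toMul (α (τ' (f g)) v)).1 : Γ) = g * (Additive.toMul v).1 * g⁻¹ := by
    intro g v
    exact key _ _ _ (hs _) (Additive.toMul v).2
  let e : Multiplicative (Additive f.ker) ≃* f.ker :=
    { toFun := fun x => Additive.toMul (Multiplicative.toAdd x)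
      invFun := fun x => Multiplicative.ofAdd (Additive.ofMul x)
      left_inv := fun _ => rfl
      right_inv := fun _ => rfl
      map_mul' := fun _ _ => rfl }
  have hV := (hF.inj f.ker.subtype (Subtype.val_injective)).ab (A := Additive f.ker) e.symm.toMonoidHom e.symm.surjective
  refine Chain.step Γ Γ' τ' f hf (Additive f.ker) α e (fun g v => hα g v) hV.1 hV.2 ?_ ih
  rcases hG with h | h | ⟨M, _, μ, hM, hM', φ, h1, h2, h3, h4⟩
  · haveI : Finite (Additive f.ker) := h
    exact Kil.finite α
  · refine Kil.tf α (fun n v hn hv => ?_) hV.2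
    refine congrArg Additive.ofMul (Subtype.ext (h (Additive.toMul v).1 (Additive.toMul v).2 n hn ?_))
    exact congrArg (fun x : Additive f.ker => (Additive.toMul x).1) hv
  · let ψ : M →+ Additive f.ker := AddMonoidHom.mk' (fun m => Additive.ofMul ⟨φ m, h1 m⟩) (fun a b => congrArg Additive.ofMul (Subtype.ext (h2 a b)))
    refine Kil.quot μ α ψ (fun v => ?_) (fun q m => ?_) (Kil.tf μ hM hM')
    · obtain ⟨m, hm⟩ := h3 _ (Additive.toMul v).2
      exact ⟨m, congrArg Additive.ofMul (Subtype.ext hm)⟩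
    · refine congrArg Additive.ofMul (Subtype.ext ?_)
      show φ (μ q m) = s q * φ m * (s q)⁻¹
      rw [← h4, hs]

/-- chain for the quotient by `L` -/
def Ch (π : Set ℕ) {Γ Q : Type} [Group Γ] [CommGroup Q] (τ : Γ →* Q) (L : Subgroup Γ) : Prop :=
  ∀ (_ : L.Normal) (h : L ≤ τ.ker), Chain π Q (Γ ⧸ L) (QuotientGroup.lift L τ h)

lemma Ch.base (π : Set ℕ) {Γ Q : Type} [Group Γ] [CommGroup Q] (τ : Γ →* Q) (hτ : Function.Surjective τ) (L : Subgroup Γ) (hL : τ.ker ≤ L) : Ch π τ L := by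
  intro _ h
  refine Chain.base _ _ ⟨?_, ?_⟩
  · rw [← MonoidHom.ker_eq_bot_iff, eq_bot_iff]
    intro x
    induction x using QuotientGroup.induction_on with
    | H x => 
      intro hx
      exact (QuotientGroup.eq_one_iff _).2 (hL hx)
  · intro q
    obtain ⟨g, rfl⟩ := hτ q
    exact ⟨QuotientGroup.mk g, rfl⟩

/-- condition on a factor -/
def GoodF (π : Set ℕ) {Γ Q : Type} [Group Γ] [CommGroup Q] (τ : Γ →* Q) (L L' : Subgroup Γ) : Prop :=
  L.relIndex L' ≠ 0 ∨ (∀ t ∈ L', ∀ n : ℕ, n ≠ 0 → t^n ∈ L → t ∈ L) ∨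
    ∃ (M : Type) (_ : AddCommGroup M) (μ : Act Q M), TF M ∧ (sPP π).P M ∧ ∃ φ : M → Γ, (∀ m, φ m ∈ L') ∧ (∀ m m', (φ (m + m'))⁻¹ * (φ m * φ m') ∈ L) ∧
      (∀ t ∈ L', ∃ m, (φ m)⁻¹ * t ∈ L) ∧ ∀ g m, (φ (μ (τ g) m))⁻¹ * (g * φ m * g⁻¹) ∈ L

theorem Ch.step {π : Set ℕ} {Γ Q : Type} [Group Γ] [CommGroup Q] {τ : Γ →* Q} (hτ : Function.Surjective τ) {L L' : Subgroup Γ} (hN : L'.Normal) (hLL : L ≤ L') (hL' : L' ≤ τ.ker)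
    (hc : ∀ n ∈ τ.ker, ∀ t ∈ L', n * t * n⁻¹ * t⁻¹ ∈ L) (hF : FRS π Γ) (hG : GoodF π τ L L') (ih : Ch π τ L') : Ch π τ L := by
  intro _ h
  let f : Γ ⧸ L →* Γ ⧸ L' := QuotientGroup.map L L' (MonoidHom.id Γ) hLL
  have hf : Function.Surjective f := by
    intro x
    induction x using QuotientGroup.induction_on with
    | H x => exact ⟨QuotientGroup.mk x, rfl⟩
  have hfk : ∀ t : Γ, f (QuotientGroup.mk t) = 1 ↔ t ∈ L' := fun t => QuotientGroup.eq_one_iff t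
  have e : QuotientGroup.lift L τ h = (QuotientGroup.lift L' τ hL').comp f := by
    refine MonoidHom.ext fun x => ?_
    induction x using QuotientGroup.induction_on with
    | H x => rfl
  rw [e]
  refine step1 _ f hf ?_ ?_ ?_ (hF.quot (QuotientGroup.mk' L) (QuotientGroup.mk'_surjective L)) ?_ (ih _ hL')
  · intro q
    obtain ⟨g, rfl⟩ := hτ q
    exact ⟨QuotientGroup.mk g, rfl⟩
  · intro n t
    induction n using QuotientGroup.induction_on with
    | H n => 
    induction t using QuotientGroup.induction_on with
    | H t => 
      intro hn ht
      have h1 := hc n hn t ((hfk t).1 ht)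
      have h2 : ((n * t * n⁻¹ * t⁻¹ : Γ) : Γ ⧸ L) = 1 := (QuotientGroup.eq_one_iff _).2 h1
      have h3 : (n : Γ ⧸ L) * t * (n : Γ ⧸ L)⁻¹ * (t : Γ ⧸ L)⁻¹ = 1 := h2
      rw [mul_inv_eq_one, mul_inv_eq_iff_eq_mul] at h3
      exact h3
  · intro t ht
    rw [ht, map_one]
  · rcases hG with h | h | ⟨M, _, μ, hM, hM', φ, h1, h2, h3, h4⟩
    · left
      haveI : L.IsFiniteRelIndex L' := ⟨h⟩
      haveI : Finite (L' ⧸ L.subgroupOf L') := by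
        haveI : (L.subgroupOf L').FiniteIndex := ⟨h⟩
        infer_instance
      let g : L' ⧸ L.subgroupOf L' → f.ker := fun x => Quotient.liftOn' x (fun y => ⟨QuotientGroup.mk y.1, (hfk _).2 y.2⟩) (by
        intro a b hab
        refine Subtype.ext (QuotientGroup.eq.2 ?_)
        exact (QuotientGroup.leftRel_apply (s := L.subgroupOf L').1 hab))
      refine Finite.of_surjective g ?_
      rintro ⟨x, hx⟩
      induction x using QuotientGroup.induction_on with
      | H x => exact ⟨QuotientGroup.mk ⟨x, (hfk _).1 hx⟩, rfl⟩
    · right; left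
      intro t
      induction t using QuotientGroup.induction_on with
      | H t => 
        intro ht n hn htn
        exact (QuotientGroup.eq_one_iff _).2 (h t ((hfk t).1 ht) n hn ((QuotientGroup.eq_one_iff _).1 htn))
    · right; right
      refine ⟨M, _, μ, hM, hM', fun m => QuotientGroup.mk (φ m), fun m => (hfk _).2 (h1 m), fun a b => QuotientGroup.eq.2 (h2 a b), ?_, ?_⟩
      · intro t
        induction t using QuotientGroup.induction_on with
        | H t =>
          intro ht
          obtain ⟨m, hm⟩ := h3 t ((hfk t).1 ht)
          exact ⟨m, QuotientGroup.eq.2 hm⟩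
      · intro g m
        induction g using QuotientGroup.induction_on with
        | H g => exact QuotientGroup.eq.2 (h4 g m)

lemma Ch.fin {π : Set ℕ} {Γ Q : Type} [Group Γ] [CommGroup Q] {τ : Γ →* Q} (hτ : Function.Surjective τ) (hF : FRS π Γ) (h : Ch π τ ⊥) : Chain π Q Γ τ := by
  have hb : (⊥ : Subgroup Γ) ≤ τ.ker := bot_le
  have e : τ = (QuotientGroup.lift ⊥ τ hb).comp (QuotientGroup.mk' ⊥) := by
    refine MonoidHom.ext fun x => rfl
  have hk : ∀ t : Γ, QuotientGroup.mk' (⊥ : Subgroup Γ) t = 1 → t = 1 := fun t ht => (QuotientGroup.eq_one_iff t).1 ht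
  rw [e]
  refine step1 _ (QuotientGroup.mk' ⊥) (QuotientGroup.mk'_surjective _) ?_ ?_ ?_ hF ?_ (h inferInstance hb)
  · intro q
    obtain ⟨g, rfl⟩ := hτ q
    exact ⟨QuotientGroup.mk g, rfl⟩
  · intro n t _ ht
    rw [hk t ht, one_mul, mul_one]
  · intro t ht
    rw [ht, map_one]
  · right; left
    intro t ht _ _ _
    exact hk t ht

/-- next term of the upper central series of `K` relative to `L` -/
def nx {Γ : Type} [Group Γ] (K L : Subgroup Γ) [L.Normal] : Subgroup Γ :=
  (Subgroup.centralizer ((K.map (QuotientGroup.mk' L) : Subgroup (Γ ⧸ L)) : Set (Γ ⧸ L))).comap (QuotientGroup.mk' L) ⊓ K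

lemma mem_nx {Γ : Type} [Group Γ] (K L : Subgroup Γ) [L.Normal] (x : Γ) : x ∈ nx K L ↔ (∀ n ∈ K, (n : Γ ⧸ L) * x = x * n) ∧ x ∈ K := by
  unfold nx
  rw [Subgroup.mem_inf, Subgroup.mem_comap, Subgroup.mem_centralizer_iff]
  refine and_congr_left fun _ => ⟨fun h n hn => h _ ⟨n, hn, rfl⟩, ?_⟩
  rintro h _ ⟨n, hn, rfl⟩
  exact h n hn

lemma nx_normal {Γ : Type} [Group Γ] (K L : Subgroup Γ) [K.Normal] [L.Normal] : (nx K L).Normal := by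
  haveI : (K.map (QuotientGroup.mk' L)).Normal := Subgroup.Normal.map inferInstance _ (QuotientGroup.mk'_surjective L)
  haveI := Subgroup.normal_centralizer (H := K.map (QuotientGroup.mk' L))
  unfold nx
  infer_instance

lemma comm_q {Γ : Type} [Group Γ] (L : Subgroup Γ) [L.Normal] (n x : Γ) : n * x * n⁻¹ * x⁻¹ ∈ L ↔ (n : Γ ⧸ L) * x = x * n := by
  rw [← QuotientGroup.eq_one_iff]
  show (n : Γ ⧸ L) * x * (n : Γ ⧸ L)⁻¹ * (x : Γ ⧸ L)⁻¹ = 1 ↔ _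
  rw [mul_inv_eq_one, mul_inv_eq_iff_eq_mul]

lemma nx_tf {Γ : Type} [Group Γ] (K L L' : Subgroup Γ) [K.Normal] [L.Normal] [L'.Normal] (hL' : L' = nx K L)
    (h : ∀ t ∈ nx K L, ∀ n : ℕ, n ≠ 0 → t^n ∈ L → t ∈ L) :
    ∀ t ∈ nx K L', ∀ n : ℕ, n ≠ 0 → t^n ∈ L' → t ∈ L' := by
  intro x hx k hk hxk
  rw [mem_nx] at hx
  rw [hL', mem_nx] at hxk ⊢
  refine ⟨fun n hn => ?_, hx.2⟩
  have h1 := (comm_q L' n x).2 (hx.1 n hn)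
  rw [← comm_q]
  rw [hL'] at h1
  refine h _ h1 k hk ?_
  rw [mem_nx] at h1
  set c : Γ := n * x * n⁻¹ * x⁻¹ with hc
  have h2 : Commute (c : Γ ⧸ L) x := (h1.1 x hx.2).symm
  have h3 : ((c : Γ ⧸ L) * x)^k = n * (x : Γ ⧸ L)^k * (n : Γ ⧸ L)⁻¹ := by
    rw [← conj_pow]
    congr 1
    rw [hc]
    show (n : Γ ⧸ L) * x * (n : Γ ⧸ L)⁻¹ * (x : Γ ⧸ L)⁻¹ * x = _
    rw [inv_mul_cancel_right]
  have h4 : (n : Γ ⧸ L) * (x : Γ ⧸ L)^k = (x : Γ ⧸ L)^k * n := hxk.1 n hn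
  rw [h2.mul_pow, h4, mul_inv_cancel_right] at h3
  have h5 : (c : Γ ⧸ L)^k = 1 := by
    exact mul_eq_right.1 h3
  exact (QuotientGroup.eq_one_iff _).1 h5

theorem Ch.nilp {π : Set ℕ} {Γ Q : Type} [Group Γ] [CommGroup Q] {τ : Γ →* Q} (hτ : Function.Surjective τ) (hF : FRS π Γ) :
    ∀ (j : ℕ) (L : Subgroup Γ) [L.Normal], L ≤ τ.ker → (∀ t ∈ nx τ.ker L, ∀ n : ℕ, n ≠ 0 → t^n ∈ L → t ∈ L) →
      (∀ x ∈ Subgroup.lowerCentralSeries τ.ker j, x ∈ L) → Ch π τ L := by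
  intro j
  induction j with
  | zero =>
    intro L _ _ _ h
    exact Ch.base π τ hτ L (fun x hx => h x hx)
  | succ j ih =>
    intro L _ hL ht h
    haveI := nx_normal τ.ker L
    refine Ch.step hτ (L' := nx τ.ker L) inferInstance ?_ (fun x hx => ((mem_nx _ _ _).1 hx).2) ?_ hF (Or.inr (Or.inl ht)) (ih _ (fun x hx => ((mem_nx _ _ _).1 hx).2) (nx_tf _ _ _ rfl ht) ?_)
    · intro x hx
      rw [mem_nx]
      refine ⟨fun n hn => ?_, hL hx⟩
      rw [(QuotientGroup.eq_one_iff x).2 hx, one_mul, mul_one]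
    · intro n hn t hT
      rw [comm_q]
      exact ((mem_nx _ _ _).1 hT).1 n hn
    · intro x hx
      rw [mem_nx]
      refine ⟨fun n hn => ?_, ?_⟩
      · have h1 := h (x * n * x⁻¹ * n⁻¹) (by
          exact Subgroup.commutator_mem_commutator hx hn)
        exact ((comm_q L x n).1 h1).symm
      · exact Subgroup.lowerCentralSeries_antitone τ.ker (Nat.zero_le j) hx

theorem mkChain {G : Type} [Group G] (hF : FRS (groupSpectrum G) G) {N : Subgroup G} [N.Normal] {r : ℕ} {T : Fin (r + 1) → Subgroup G}
    (hT : Monotone T) (hT0 : T 0 = ⊥) (hTl : (T (Fin.last r) : Set G) = {g : G | g ∈ N ∧ IsOfFinOrder g})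
    (hTn : ∀ (i : Fin (r + 1)) (g t : G), t ∈ T i → g * t * g⁻¹ ∈ T i)
    (hTc : ∀ (i : Fin r) (n t : G), n ∈ N → t ∈ T i.succ → n * t * n⁻¹ * t⁻¹ ∈ T i.castSucc)
    (hTm : ∀ i : Fin r, (T i.castSucc).relIndex (T i.succ) = 0 →
        ∃ M : Rep ℤ (G ⧸ N), NiceRep (groupSpectrum G) M ∧
          ∃ φ : M → G,
            (∀ m : M, φ m ∈ T i.succ) ∧
            (∀ m m' : M, (φ (m + m'))⁻¹ * (φ m * φ m') ∈ T i.castSucc) ∧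
            (∀ t : G, t ∈ T i.succ → ∃ m : M, (φ m)⁻¹ * t ∈ T i.castSucc) ∧
            (∀ (g : G) (m : M),
              (φ (M.ρ (QuotientGroup.mk g) m))⁻¹ * (g * φ m * g⁻¹) ∈ T i.castSucc))
    {Γ Q : Type} [Group Γ] [CommGroup Q] (τ : Γ →* Q) (hτ : Function.Surjective τ) (ι : Γ →* G) (hι : Function.Injective ι) (hιN : ∀ n ∈ N, ∃ g, ι g = n)
    (hk : ∀ g, τ g = 1 ↔ ι g ∈ N) (jj : Q →* G ⧸ N) (hj : ∀ g, jj (τ g) = QuotientGroup.mk (ι g)) (hnil : Group.IsNilpotent τ.ker) :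
    Chain (groupSpectrum G) Q Γ τ := by
  have hFΓ : FRS (groupSpectrum G) Γ := hF.inj ι hι
  have hTN : ∀ i, T i ≤ N := fun i x hx => by
    have h1 : x ∈ (T (Fin.last r) : Set G) := hT (Fin.le_last i) hx
    rw [hTl] at h1
    exact h1.1
  have hnorm : ∀ i, ((T i).comap ι).Normal := fun i => ⟨fun n hn g => by
    rw [Subgroup.mem_comap, map_mul, map_mul, map_inv]
    exact hTn i _ _ hn⟩
  have hle : ∀ i, (T i).comap ι ≤ τ.ker := fun i x hx => (hk x).2 (hTN i hx)
  have main : ∀ i : Fin (r+1), Ch (groupSpectrum G) τ ((T i).comap ι) := by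
    intro i
    induction i using Fin.reverseInduction with
    | last =>
      obtain ⟨j, hj⟩ := (Subgroup.isNilpotent_iff_lowerCentralSeries _).1 hnil
      haveI := hnorm (Fin.last r)
      refine Ch.nilp hτ hFΓ j _ (hle _) ?_ ?_
      · intro t ht n hn htn
        have h1 : ι (t^n) ∈ (T (Fin.last r) : Set G) := htn
        show ι t ∈ (T (Fin.last r) : Set G)
        rw [hTl] at h1 ⊢
        refine ⟨(hk t).1 ((mem_nx _ _ _).1 ht).2, ?_⟩
        rw [map_pow] at h1
        exact (isOfFinOrder_pow.1 h1.2).resolve_right hn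
      · intro x hx
        rw [hj, Subgroup.mem_bot] at hx
        rw [hx]; exact Subgroup.one_mem _
    | cast i ih =>
      refine Ch.step hτ (hnorm i.succ) (Subgroup.comap_mono (hT (Fin.castSucc_lt_succ).le)) (hle _) ?_ hFΓ ?_ ih
      · intro n hn t ht
        rw [Subgroup.mem_comap]
        simp only [map_mul, map_inv]
        exact hTc i _ _ ((hk n).1 hn) ht
      · by_cases h0 : (T i.castSucc).relIndex (T i.succ) = 0
        · right; right
          obtain ⟨M, ⟨hM1, hM2, hM3⟩, φ, h1, h2, h3, h4⟩ := hTm i h0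
          have hφ : ∀ m, ∃ g, ι g = φ m := fun m => hιN _ (hTN _ (h1 m))
          choose ψ hψ using hφ
          let μ : Act Q M :=
            { f := fun q => (M.ρ (jj q)).toAddMonoidHom
              one' := fun x => by
                show M.ρ (jj 1) x = x
                rw [map_one, map_one]; rfl
              mul' := fun a b x => by
                show M.ρ (jj (a * b)) x = M.ρ (jj a) (M.ρ (jj b) x)
                rw [map_mul, map_mul]; rfl }
          refine ⟨M, _, μ, tf_iff.2 hM1, nice_pp hM2 hM3, ψ, fun m => ?_, fun m m' => ?_, fun t ht => ?_, fun g m => ?_⟩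
          · rw [Subgroup.mem_comap, hψ]; exact h1 m
          · rw [Subgroup.mem_comap]
            simp only [map_mul, map_inv, hψ]
            exact h2 m m'
          · obtain ⟨m, hm⟩ := h3 _ ht
            refine ⟨m, ?_⟩
            rw [Subgroup.mem_comap]
            simp only [map_mul, map_inv, hψ]
            exact hm
          · rw [Subgroup.mem_comap]
            simp only [map_mul, map_inv, hψ]
            have : μ (τ g) m = M.ρ (QuotientGroup.mk (ι g)) m := by
              rw [← hj]; rfl
            rw [this]
            exact h4 _ _
        · left
          intro h
          apply h0
          rw [Subgroup.relIndex_comap] at h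
          have e : ((T i.succ).comap ι).map ι = T i.succ := by
            refine Subgroup.map_comap_eq_self fun x hx => ?_
            obtain ⟨g, hg⟩ := hιN x (hTN _ hx)
            exact ⟨g, hg⟩
          rwa [e] at h
  have := main 0
  have e : (T 0).comap ι = ⊥ := by
    rw [hT0]; exact (MonoidHom.ker_eq_bot_iff ι).2 hι
  rw [e] at this
  exact Ch.fin hτ hFΓ this

end TB
end

section
namespace TB

lemma hyp_sub {π : Set ℕ} {Γ Q B : Type} [Group Γ] [Group Q] [AddCommGroup B] {τ : Γ →* Q} {ρ : Act Γ B} (h : Hyp π τ ρ) (C : AddSubgroup B) (hC) :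
    Hyp π τ (sAct ρ C hC) := by
  intro M _ μ h1 h2 φ hφ
  obtain ⟨m, hm, h3⟩ := h M μ h1 h2 (C.subtype.comp φ) (fun g x => by
    show (φ (μ (τ g) x)).1 = _
    rw [hφ]; rfl)
  exact ⟨m, hm, fun x => Subtype.ext (h3 x)⟩

section coi
variable {G : Type} [Group G] (H : Subgroup G) {M D : Type} [AddCommGroup M] [AddCommGroup D] (μ : Act H M) (ρ : Act G D) (ψ : M →+ D)

lemma coind_pp {π : Set ℕ} [H.FiniteIndex] (h : (sPP π).P M) : (sPP π).P (coindS H μ) := by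
  let F : coindS H μ →+ ((G ⧸ H) → M) :=
    { toFun := fun φ q => φ.1 (q.out)⁻¹
      map_zero' := rfl
      map_add' := fun _ _ => rfl }
  refine (sPP π).of_inj F (fun φ hφ => ?_) (Serre.piFin (sPP π) h)
  ext g
  have h1 : ∃ k : H, (QuotientGroup.mk g⁻¹ : G ⧸ H).out = g⁻¹ * k := QuotientGroup.mk_out_eq_mul H g⁻¹
  obtain ⟨k, hk⟩ := h1
  have h2 : φ.1 ((QuotientGroup.mk g⁻¹ : G ⧸ H).out)⁻¹ = 0 := congrFun hφ (QuotientGroup.mk g⁻¹)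
  have h3 : g = (k : G) * ((QuotientGroup.mk g⁻¹ : G ⧸ H).out)⁻¹ := by rw [hk]; group
  rw [h3, coindS_mem, h2, map_zero]; rfl

lemma coind_tf (h : TF M) : TF (coindS H μ) := by
  intro n φ hn hφ
  ext g
  exact h n _ hn (congrArg (fun u : coindS H μ => u.1 g) hφ)

/-- summand of the trace map -/
def trF : coindS H μ →+ (G → D) where
  toFun φ g := ρ g (ψ (φ.1 g⁻¹))
  map_zero' := by
    funext g
    show ρ g (ψ 0) = 0
    rw [map_zero, map_zero]
  map_add' a b := by
    funext g
    show ρ g (ψ (a.1 g⁻¹ + b.1 g⁻¹)) = ρ g (ψ (a.1 g⁻¹)) + ρ g (ψ (b.1 g⁻¹))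
    rw [map_add, map_add]

lemma trF_mul (hψ : ∀ (h : H) x, ψ (μ h x) = ρ h (ψ x)) (φ) (g : G) (h : H) : trF H μ ρ ψ φ (g * h) = trF H μ ρ ψ φ g := by
  show ρ (g * h) (ψ (φ.1 (g * h)⁻¹)) = ρ g (ψ (φ.1 g⁻¹))
  have e : (g * (h : G))⁻¹ = ((h⁻¹ : H) : G) * g⁻¹ := by rw [mul_inv_rev]; rfl
  rw [e, coindS_mem, hψ, Act.mul]
  congr 1
  show ρ h (ρ (h : G)⁻¹ _) = _
  rw [ρ.self_inv]

lemma trF_out (hψ : ∀ (h : H) x, ψ (μ h x) = ρ h (ψ x)) (φ) (g : G) : trF H μ ρ ψ φ (QuotientGroup.mk g : G ⧸ H).out = trF H μ ρ ψ φ g := by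
  obtain ⟨k, hk⟩ := QuotientGroup.mk_out_eq_mul H g
  rw [hk, trF_mul _ _ _ _ hψ]

lemma trF_act (φ) (x g : G) : trF H μ ρ ψ (coind H μ x φ) g = ρ x (trF H μ ρ ψ φ (x⁻¹ * g)) := by
  show ρ g (ψ (φ.1 (g⁻¹ * x))) = ρ x (ρ (x⁻¹ * g) (ψ (φ.1 (x⁻¹ * g)⁻¹)))
  rw [← Act.mul, mul_inv_cancel_left, mul_inv_rev, inv_inv]

theorem hyp_coind {π : Set ℕ} [H.FiniteIndex] (hH : Hyp π (MonoidHom.id G) ρ) (hM : TF M) (hM' : (sPP π).P M) 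
    (hψ : ∀ (h : H) x, ψ (μ h x) = ρ h (ψ x)) : ∃ m : ℕ, m ≠ 0 ∧ ∀ x, m • ψ x = 0 := by
  classical
  haveI : Fintype (G ⧸ H) := Fintype.ofFinite _
  let Ψ : coindS H μ →+ D := 
    { toFun := fun φ => ∑ q : G ⧸ H, trF H μ ρ ψ φ q.out
      map_zero' := by simp
      map_add' := fun a b => by simp [Finset.sum_add_distrib] }
  obtain ⟨m, hm, h⟩ := hH (coindS H μ) (coind H μ) (coind_tf H μ hM) (coind_pp H μ hM') Ψ (by
    intro x φ
    show ∑ q : G ⧸ H, trF H μ ρ ψ (coind H μ x φ) q.out = ρ x (∑ q : G ⧸ H, trF H μ ρ ψ φ q.out)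
    rw [map_sum]
    refine Fintype.sum_equiv (MulAction.toPerm x⁻¹) _ _ (fun q => ?_)
    rw [trF_act]
    congr 1
    show _ = trF H μ ρ ψ φ (x⁻¹ • q).out
    induction q using QuotientGroup.induction_on with
    | H g => 
      rw [show x⁻¹ • (QuotientGroup.mk g : G ⧸ H) = QuotientGroup.mk (x⁻¹ * g) from rfl, trF_out _ _ _ _ hψ]
      obtain ⟨k, hk⟩ := QuotientGroup.mk_out_eq_mul H g
      rw [hk, ← mul_assoc, trF_mul _ _ _ _ hψ])
  refine ⟨m, hm, fun x => ?_⟩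
  let φ : coindS H μ := ⟨fun g => if hg : g ∈ H then μ ⟨g, hg⟩ x else 0, by
    intro h g
    show (if hg : (h : G) * g ∈ H then μ ⟨h * g, hg⟩ x else 0) = μ h (if hg : g ∈ H then μ ⟨g, hg⟩ x else 0)
    by_cases hg : g ∈ H
    · have h2 : (h : G) * g ∈ H := H.mul_mem h.2 hg
      rw [dif_pos hg, dif_pos h2, ← Act.mul]; rfl
    · have h2 : (h : G) * g ∉ H := fun h3 => hg ((H.mul_mem_cancel_left h.2).1 h3)
      rw [dif_neg hg, dif_neg h2, map_zero]⟩
  have e : Ψ φ = ψ x := by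
    show ∑ q : G ⧸ H, trF H μ ρ ψ φ q.out = ψ x
    rw [Finset.sum_eq_single (QuotientGroup.mk 1 : G ⧸ H)]
    · rw [trF_out _ _ _ _ hψ]
      show ρ 1 (ψ (if hg : (1 : G)⁻¹ ∈ H then μ ⟨(1 : G)⁻¹, hg⟩ x else 0)) = _
      have h1 : (1 : G)⁻¹ ∈ H := by rw [inv_one]; exact H.one_mem
      rw [dif_pos h1, Act.one]
      have : (⟨(1 : G)⁻¹, h1⟩ : H) = 1 := Subtype.ext inv_one
      rw [this, Act.one]
    · intro q _ hq
      show ρ _ (ψ (if hg : (q.out)⁻¹ ∈ H then μ ⟨(q.out)⁻¹, hg⟩ x else 0)) = _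
      rw [dif_neg, map_zero, map_zero]
      intro h1
      apply hq
      rw [← QuotientGroup.out_eq' q]
      refine QuotientGroup.eq.2 ?_
      rw [mul_one]; exact h1
    · intro h; exact absurd (Finset.mem_univ _) h
  rw [← e]; exact h φ

end coi

/-- the p-primary case for groups in the class -/
theorem corep {G : Type} [Group G] (hG : MemClassU G) {p : ℕ} (hp : p.Prime) (B : Type) [AddCommGroup B] (ρ : Act G B) (hD : Dv B) (hC : Cer p B)
    (hH : Hyp (groupSpectrum G) (MonoidHom.id G) ρ) (n : ℕ) : sTor.P (Hn ρ n) := by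
  obtain ⟨hS, N, hN, hnil, hfg, ⟨H, hH0, hHc⟩, r, T, h1, h2, h3, h4, h5, h6⟩ := hG
  have hF := FRS.of hS
  let Γ : Subgroup G := H.comap (QuotientGroup.mk' N)
  letI : CommGroup H := { (inferInstance : Group H) with mul_comm := hHc }
  let τ : Γ →* H := (QuotientGroup.mk' N).subgroupComap H
  have hτ : Function.Surjective τ := MonoidHom.subgroupComap_surjective_of_surjective _ _ (QuotientGroup.mk'_surjective N)
  have hk : ∀ g : Γ, τ g = 1 ↔ (g : G) ∈ N := by
    intro g
    rw [← QuotientGroup.eq_one_iff]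
    exact ⟨fun h => congrArg Subtype.val h, fun h => Subtype.ext h⟩
  have hιN : ∀ n ∈ N, ∃ g : Γ, Γ.subtype g = n := by
    intro n hn
    refine ⟨⟨n, ?_⟩, rfl⟩
    show (QuotientGroup.mk n : G ⧸ N) ∈ H
    rw [(QuotientGroup.eq_one_iff n).2 hn]; exact H.one_mem
  haveI : H.FiniteIndex := ⟨hH0⟩
  haveI : Γ.FiniteIndex := ⟨by
    show (H.comap (QuotientGroup.mk' N)).index ≠ 0
    rw [Subgroup.index_comap_of_surjective _ (QuotientGroup.mk'_surjective N)]; exact hH0⟩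
  haveI : Group.FG (G ⧸ N) := hfg
  haveI : Group.FG H := Subgroup.fg_of_index_ne_zero H
  have hnil' : Group.IsNilpotent τ.ker := by
    let j : τ.ker →* N := 
      { toFun := fun x => ⟨x.1.1, (hk x.1).1 x.2⟩
        map_one' := rfl
        map_mul' := fun _ _ => rfl }
    have hj : Function.Bijective j := by
      refine ⟨fun a b hab => ?_, fun x => ?_⟩
      · exact Subtype.ext (Subtype.ext (congrArg (fun y : N => (y : G)) hab))
      · obtain ⟨g, hg⟩ := hιN x.1 x.2
        exact ⟨⟨g, (hk g).2 (by rw [show (g : G) = x.1 from hg]; exact x.2)⟩, Subtype.ext hg⟩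
    haveI := hnil
    exact Group.nilpotent_of_mulEquiv (MulEquiv.ofBijective j hj).symm
  have hch := mkChain hF h1 h2 h3 h4 h5 h6 τ hτ Γ.subtype Subtype.val_injective hιN hk H.subtype (fun g => rfl) hnil'
  have hHyp : Hyp (groupSpectrum G) τ (ρ.comp Γ.subtype) := by
    intro M _ μ hM hM' φ hφ
    exact hyp_coind Γ (μ.comp τ) ρ φ hH hM hM' (fun h x => hφ h x)
  have key := caseAll hτ hnil' hch hp B (ρ.comp Γ.subtype) hD hC hHyp n
  intro y
  obtain ⟨k, hk0, hk1⟩ := key (Hmap Γ.subtype (AddMonoidHom.id B) Compat.res n y)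
  refine ⟨Γ.index * k, mul_ne_zero Subgroup.FiniteIndex.index_ne_zero hk0, ?_⟩
  rw [mul_smul]
  refine transfer ρ Γ n (k • y) ?_
  rw [map_nsmul]; exact hk1

/-- primary component -/
def prim (d : ℕ) (D : Type) [AddCommGroup D] : AddSubgroup D where
  carrier := {a | ∃ k : ℕ, d^k • a = 0}
  zero_mem' := ⟨0, smul_zero _⟩
  add_mem' := by
    rintro a b ⟨m, hm⟩ ⟨n, hn⟩
    refine ⟨m + n, ?_⟩
    rw [smul_add, pow_add, mul_comm, mul_smul, hm, mul_comm, mul_smul, hn, smul_zero, smul_zero, add_zero]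
  neg_mem' := by
    rintro a ⟨m, hm⟩
    exact ⟨m, by rw [smul_neg, hm, neg_zero]⟩

lemma prim_inv {G D : Type} [Group G] [AddCommGroup D] (ρ : Act G D) (d : ℕ) : ∀ g, ∀ x ∈ prim d D, ρ g x ∈ prim d D := by
  rintro g x ⟨k, hk⟩
  exact ⟨k, by rw [← map_nsmul, hk, map_zero]⟩

lemma prim_dv {D : Type} [AddCommGroup D] (hD : Dv D) {d : ℕ} (hd : d ≠ 0) : Dv (prim d D) := by
  refine dv_of (m := d) ?_ ?_
  · rintro ⟨a, k, hk⟩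
    exact ⟨k, Subtype.ext hk⟩
  · rintro ⟨a, k, hk⟩
    obtain ⟨b, hb⟩ := hD d hd a
    exact ⟨⟨b, k+1, by rw [pow_succ, mul_smul, hb, hk]⟩, Subtype.ext hb⟩

lemma prim_cer {D : Type} [AddCommGroup D] {m d : ℕ} (hC : Cer m D) (hd : d ∣ m) : Cer d (prim d D) := by
  refine ⟨?_, ?_⟩
  · rintro ⟨a, k, hk⟩
    exact ⟨k, Subtype.ext hk⟩
  · haveI := hC.2
    obtain ⟨c, rfl⟩ := hd
    let F : tor d (prim d D) → tor (d * c) D := fun x => ⟨x.1.1, by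
      have h1 : d • x.1.1 = 0 := congrArg (fun y : prim d D => y.1) (tor_smul x)
      rw [mem_tor, mul_comm, mul_smul, h1]
      exact smul_zero _⟩
    refine Finite.of_injective F fun a b h => ?_
    exact Subtype.ext (Subtype.ext (congrArg (fun y : tor (d * c) D => y.1) h))

theorem corem {G : Type} [Group G] (hG : MemClassU G) (n : ℕ) : ∀ (m : ℕ) (_ : m ≠ 0) (B : Type) [AddCommGroup B] (ρ : Act G B) (_ : Dv B) (_ : Cer m B)
    (_ : Hyp (groupSpectrum G) (MonoidHom.id G) ρ), sTor.P (Hn ρ n) := by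
  intro m
  induction m using Nat.strong_induction_on with
  | _ m ih =>
    intro hm B _ ρ hD hC hH
    by_cases h1 : m = 1
    · subst h1
      have hz : ∀ x : B, 1 • x = 0 := fun x => by
        obtain ⟨k, hk⟩ := hC.1 x
        rwa [one_pow] at hk
      intro y
      exact ⟨1, one_ne_zero, Hn_kill ρ 1 hz n y⟩
    · obtain ⟨p, hp, hpm⟩ := Nat.exists_prime_and_dvd h1
      obtain ⟨v, c, hc, hmc⟩ := Nat.exists_eq_pow_mul_and_not_dvd hm p hp.ne_one
      have hcop : p.Coprime c := (Nat.Prime.coprime_iff_not_dvd hp).2 hc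
      have hv : v ≠ 0 := by
        rintro rfl
        rw [pow_zero, one_mul] at hmc
        exact hc (hmc ▸ hpm)
      have hc0 : c ≠ 0 := by
        rintro rfl
        exact hc (dvd_zero _)
      have hlt : c < m := by
        rw [hmc]
        exact lt_mul_of_one_lt_left (Nat.pos_of_ne_zero hc0) (Nat.one_lt_pow hv hp.one_lt)
      have hcm : c ∣ m := ⟨p^v, by rw [hmc, mul_comm]⟩
      have i1 := prim_inv ρ p
      have i2 := prim_inv ρ c
      refine (SES.sub ρ (prim p B) i1).P_mid sTor n (corep hG hp _ _ (prim_dv hD hp.ne_zero) (prim_cer hC hpm) (hyp_sub hH _ _) n) ?_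
      have hc' := ih c hlt hc0 (prim c B) (sAct ρ _ i2) (prim_dv hD hc0) (prim_cer hC hcm) (hyp_sub hH _ _)
      have hb : Function.Bijective ((QuotientAddGroup.mk' (prim p B)).comp (prim c B).subtype) := ?_
      · let e := AddEquiv.ofBijective _ hb
        refine P_of_bij sTor (MulEquiv.refl G) e.symm.toAddMonoidHom e.symm.bijective ?_ n hc'
        intro g x
        refine e.injective ?_
        obtain ⟨y, rfl⟩ := e.surjective x
        show e (e.symm _) = e (sAct ρ _ i2 g (e.symm (e y)))
        rw [e.apply_symm_apply, e.symm_apply_apply]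
        rfl
      refine ⟨?_, ?_⟩
      · rw [injective_iff_map_eq_zero]
        rintro ⟨a, k, hk⟩ ha
        obtain ⟨l, hl⟩ := (QuotientAddGroup.eq_zero_iff a).1 ha
        refine Subtype.ext ?_
        exact cop_zero (Nat.Coprime.pow l k hcop) a hl hk
      · intro x
        obtain ⟨a, rfl⟩ := QuotientAddGroup.mk'_surjective _ x
        obtain ⟨k, hk⟩ := hC.1 a
        have h2 : ((p^v)^k).Coprime (c^k) := (Nat.Coprime.pow_left v hcop).pow k k
        obtain ⟨s, t, hst⟩ := Nat.isCoprime_iff_coprime.2 h2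
        have h3 : (c^k) • ((p^v)^k) • a = 0 := by
          rw [← mul_smul, ← mul_pow, mul_comm, ← hmc, hk]
        refine ⟨⟨s • ((p^v)^k) • a, k, by rw [smul_comm, h3, smul_zero]⟩, ?_⟩
        show (QuotientAddGroup.mk (s • ((p^v)^k) • a) : B ⧸ prim p B) = QuotientAddGroup.mk a
        rw [QuotientAddGroup.eq]
        refine ⟨v * k, ?_⟩
        have h4 : -(s • ((p^v)^k) • a) + a = t • (c^k) • a := by
          have h5 : a = s • ((p^v)^k) • a + t • (c^k) • a := by
            conv_lhs => rw [← one_smul ℤ a, ← hst, add_smul, mul_smul, mul_smul, natCast_zsmul, natCast_zsmul]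
          rw [neg_add_eq_iff_eq_add]; exact h5
        rw [h4, smul_comm, pow_mul, smul_comm ((p^v)^k), h3, smul_zero]

end TB
end

section
namespace TB

/-- the action underlying a representation -/
def ofRep {G : Type} [Group G] (A : Rep.{0} ℤ G) : Act G A where
  f g := (A.ρ g).toAddMonoidHom
  one' x := by
    show A.ρ 1 x = x
    rw [map_one]; rfl
  mul' a b x := by
    show A.ρ (a * b) x = A.ρ a (A.ρ b x)
    rw [map_mul]; rfl

lemma dd_rep {G : Type} [Group G] (A : Rep.{0} ℤ G) (n : ℕ) (f) :
    dd (ofRep A) n f = (inhomogeneousCochains.d A n).hom f := by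
  ext g
  rw [inhomogeneousCochains.d_hom_apply, dd_apply]
  refine congrArg₂ (· + ·) rfl (Finset.sum_congr rfl fun j _ => ?_)
  exact (int_smul_eq_zsmul _ _ _).symm

lemma icoc_inj {G : Type} [Group G] (A : Rep.{0} ℤ G) (n : ℕ) : Function.Injective (groupCohomology.iCocycles A n) :=
  (ModuleCat.mono_iff_injective (groupCohomology.iCocycles A n)).1 inferInstance

lemma rep_d {G : Type} [Group G] (A : Rep.{0} ℤ G) (n : ℕ) (z : Zn (ofRep A) n) : inhomogeneousCochains.d A n z.1 = 0 := by
  have := z.2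
  exact (dd_rep A n z.1).symm.trans this

/-- cocycles -/
def zMap {G : Type} [Group G] (A : Rep.{0} ℤ G) (n : ℕ) : Zn (ofRep A) n →+ groupCohomology.cocycles A n :=
  AddMonoidHom.mk' (fun z => groupCohomology.cocyclesMk z.1 (rep_d A n z)) (by
    intro a b
    apply icoc_inj
    rw [map_add, groupCohomology.iCocycles_mk, groupCohomology.iCocycles_mk, groupCohomology.iCocycles_mk]
    rfl)

lemma zMap_i {G : Type} [Group G] (A : Rep.{0} ℤ G) (n : ℕ) (z) : groupCohomology.iCocycles A n (zMap A n z) = z.1 :=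
  groupCohomology.iCocycles_mk _ (rep_d A n z)

lemma zMap_surj {G : Type} [Group G] (A : Rep.{0} ℤ G) (n : ℕ) : Function.Surjective (zMap A n) := by
  intro x
  refine ⟨⟨groupCohomology.iCocycles A n x, ?_⟩, ?_⟩
  · show dd (ofRep A) n _ = 0
    rw [dd_rep, ← groupCohomology.inhomogeneousCochains.d_def]
    have h := (groupCohomology.inhomogeneousCochains A).iCycles_d n (n+1)
    exact congrArg (fun f => f.hom x) h
  · apply icoc_inj
    rw [zMap_i]

lemma zMap_bd {G : Type} [Group G] (A : Rep.{0} ℤ G) (n : ℕ) (z : Zn (ofRep A) n) (hz : z.1 ∈ Bn (ofRep A) n) :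
    groupCohomology.π A n (zMap A n z) = 0 := by
  cases n with
  | zero =>
    have h : z = 0 := Subtype.ext hz
    rw [h, map_zero, map_zero]
  | succ n =>
    obtain ⟨u, hu⟩ := hz
    have h : zMap A (n+1) z = groupCohomology.toCocycles A n (n+1) u := by
      apply icoc_inj
      rw [zMap_i, ← hu, dd_rep, ← groupCohomology.inhomogeneousCochains.d_def]
      have h := (groupCohomology.inhomogeneousCochains A).toCycles_i n (n+1)
      exact (congrArg (fun f => f.hom u) h).symm
    rw [h]
    have h2 := (groupCohomology.inhomogeneousCochains A).toCycles_comp_homologyπ n (n+1)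
    exact congrArg (fun f => f.hom u) h2

/-- comparison with group cohomology -/
def cmpH {G : Type} [Group G] (A : Rep.{0} ℤ G) (n : ℕ) : Hn (ofRep A) n →+ groupCohomology A n :=
  QuotientAddGroup.lift _ ((groupCohomology.π A n).hom.toAddMonoidHom.comp (zMap A n)) (fun z hz => zMap_bd A n z hz)

lemma cmpH_surj {G : Type} [Group G] (A : Rep.{0} ℤ G) (n : ℕ) : Function.Surjective (cmpH A n) := by
  intro x
  induction x using groupCohomology_induction_on with
  | h x =>
    obtain ⟨z, rfl⟩ := zMap_surj A n x
    exact ⟨mkH (ofRep A) n z, rfl⟩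

theorem final (G : Type) [Group G] (hG : MemClassU G) (ω : Set ℕ)
    (A : Rep.{0} ℤ G) (hA : IsCernikovOmega ω A)
    (hsub : ∀ S : AddSubgroup A, (∀ (g : G), ∀ a ∈ S, A.ρ g a ∈ S) →
      (S : Set A).Infinite → ¬ IsQuotientOfNiceRep (groupSpectrum G) A S) (n : ℕ) :
    IsCernikovOmega ω (groupCohomology A n) := by
  obtain ⟨m, hm, hω, hC⟩ := cer_of_omega ω hA
  have hF := FRS.of hG.1
  have hHyp : Hyp (groupSpectrum G) (MonoidHom.id G) (ofRep A) := by
    intro M _ μ hM hM' φ hφ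
    have hfin : Finite φ.range := by
      by_contra hinf
      refine hsub φ.range ?_ (fun h => hinf h.to_subtype) ?_
      · rintro g _ ⟨x, rfl⟩
        exact ⟨μ g x, hφ g x⟩
      · obtain ⟨h1, h2⟩ := nice_of_pp hM hM'
        refine ⟨Rep.of (toRepr μ), ⟨tf_iff.1 hM, h1, h2⟩, φ, fun x => ⟨x, rfl⟩, ?_, fun g x => hφ g x⟩
        rintro _ ⟨x, rfl⟩
        exact ⟨x, rfl⟩
    haveI := hfin
    refine ⟨Nat.card φ.range, Nat.card_pos.ne', fun x => ?_⟩
    have h1 : Nat.card φ.range • (⟨φ x, x, rfl⟩ : φ.range) = 0 := card_nsmul_eq_zero'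
    exact congrArg (fun y : φ.range => y.1) h1
  have key : Cer m (Hn (ofRep A) n) := by
    refine cer_red (FinCoh.solv' hG.1.1 hF.fr) (ofRep A) hm hC n ?_
    intro S hS hD hSC
    exact corem hG n m hm S (sAct (ofRep A) S hS) hD hSC (hyp_sub hHyp S hS)
  exact (key.surj hm (cmpH A n) (cmpH_surj A n)).omega ω hm hω

end TB
end

/-- **Theorem B.** Let `G` be a group in the class `𝒰` with spectrum `π`, and let
`ω` be a set of primes.  Let `A` be a `ℤG`-module whose underlying abelian group is
a Černikov `ω`-group, and suppose that `A` has no infinite `ℤG`-submodule that is a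
`ℤG`-module quotient of some `ℤG`-module whose underlying abelian group is
torsion-free of finite rank and `π`-spectral.  Then `H^n(G, A)` is a Černikov
`ω`-group for all `n ≥ 0`. -/
theorem theoremB (G : Type) [Group G] (hG : MemClassU G) (ω : Set ℕ)
    (A : Rep ℤ G) (hA : IsCernikovOmega ω A)
    (hsub : ∀ S : AddSubgroup A, (∀ (g : G), ∀ a ∈ S, A.ρ g a ∈ S) →
      (S : Set A).Infinite → ¬ IsQuotientOfNiceRep (groupSpectrum G) A S) (n : ℕ) :
    IsCernikovOmega ω (groupCohomology A n) := by
  exact TB.final G hG ω A hA hsub n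

end
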